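/- For each integer n ≥ 3 and any non-empty perfect compact metric space X that admits a topological embedding into ℝ^{n−1}, there exists a topological embedding 𝔸 : X × 𝒞 → ℝⁿ such that: (1) for every s ∈ 𝒞 the image 𝔸(X × {s}) fails to be locally hyperplanar at at least one of its points; and (2) for every pair s ≠ t in 𝒞 the images 𝔸(X × {s}) and 𝔸(X × {t}) are ambiently incomparable in ℝⁿ (in particular the images are pairwise disjoint). -/

import Mathlib

open Set Topology Metric

noncomputable section

/-- The coordinate line `ℝ × {0}^{n-1}` in `ℝⁿ`. -/
def coordLine (n : ℕ) : Set (EuclideanSpace ℝ (Fin n)) :=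
  {x | ∀ i : Fin n, (i : ℕ) ≠ 0 → x i = 0}

/-- The coordinate hyperplane `ℝ^{n-1} × {0}` in `ℝⁿ`. -/
def coordHyperplane (n : ℕ) : Set (EuclideanSpace ℝ (Fin n)) :=
  {x | ∀ i : Fin n, (i : ℕ) = n - 1 → x i = 0}

/-- `X` can be ambiently embedded in `Y`: some self-homeomorphism of `ℝⁿ` takes `X` into `Y`. -/
def AmbientlyEmbeds {n : ℕ} (X Y : Set (EuclideanSpace ℝ (Fin n))) : Prop :=
  ∃ h : EuclideanSpace ℝ (Fin n) ≃ₜ EuclideanSpace ℝ (Fin n), h '' X ⊆ Y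

/-- `X` and `Y` are ambiently incomparable. -/
def AmbientlyIncomparable {n : ℕ} (X Y : Set (EuclideanSpace ℝ (Fin n))) : Prop :=
  ¬ AmbientlyEmbeds X Y ∧ ¬ AmbientlyEmbeds Y X

/-- `X ⊆ ℝⁿ` is locally hyperplanar at `x ∈ X`. -/
def LocallyHyperplanarAt {n : ℕ} (X : Set (EuclideanSpace ℝ (Fin n)))
    (x : EuclideanSpace ℝ (Fin n)) : Prop :=
  ∃ U ∈ 𝓝 x, ∃ h : U → EuclideanSpace ℝ (Fin n), Topology.IsEmbedding h ∧
    ∀ y : U, (y : EuclideanSpace ℝ (Fin n)) ∈ X → h y ∈ coordHyperplane n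

/-- A compact zero-dimensional set `K ⊆ ℝⁿ` is tame if a self-homeomorphism of `ℝⁿ`
moves it into the coordinate line. -/
def TameSet {n : ℕ} (K : Set (EuclideanSpace ℝ (Fin n))) : Prop :=
  ∃ h : EuclideanSpace ℝ (Fin n) ≃ₜ EuclideanSpace ℝ (Fin n), h '' K ⊆ coordLine n

/-- `K` is locally tame at `x`. -/
def LocallyTameAt {n : ℕ} (K : Set (EuclideanSpace ℝ (Fin n)))
    (x : EuclideanSpace ℝ (Fin n)) : Prop :=
  ∃ U ∈ 𝓝 x, TameSet (K ∩ closure U)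

/-- `K` is everywhere wild: locally wild at each of its points. -/
def EverywhereWild {n : ℕ} (K : Set (EuclideanSpace ℝ (Fin n))) : Prop :=
  ∀ x ∈ K, ¬ LocallyTameAt K x

/-- `K` is a Cantor set: homeomorphic to the middle-thirds Cantor set. -/
def IsCantorSet {X : Type*} [TopologicalSpace X] (K : Set X) : Prop :=
  Nonempty (↥K ≃ₜ ↥cantorSet)

/-- The unit cube `Iⁿ = [0,1]ⁿ` in `ℝⁿ`. -/
def unitCube (n : ℕ) : Set (EuclideanSpace ℝ (Fin n)) :=
  {x | ∀ i, x i ∈ Set.Icc (0 : ℝ) 1}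

/-- The open face `(0,1)^{n-1} × {0}` of the unit cube. -/
def openFace (n : ℕ) : Set (EuclideanSpace ℝ (Fin n)) :=
  {x | (∀ i : Fin n, (i : ℕ) < n - 1 → x i ∈ Set.Ioo (0 : ℝ) 1) ∧
    ∀ i : Fin n, (i : ℕ) = n - 1 → x i = 0}

section Cocycles

variable {X Y : Type*} [TopologicalSpace X] [TopologicalSpace Y] {G : Type*} [Group G]

/-- `P a b` holds for all nearby pairs of points of `s`. -/
def Loc (s : Set X) (P : X → X → Prop) : Prop :=
  ∀ p ∈ s, ∃ O ∈ 𝓝[s] p, ∀ a ∈ O, ∀ b ∈ O, P a b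

/-- `f` is a potential of `τ` on `s`. -/
def IsPot (s : Set X) (τ : X → X → G) (f : X → G) : Prop :=
  Loc s fun a b => τ a b = (f a)⁻¹ * f b

/-- `f` is an isomorphism between the cocycles `τ` and `τ'` on `s`. -/
def IsIso (s : Set X) (τ τ' : X → X → G) (f : X → G) : Prop :=
  Loc s fun a b => τ a b = (f a)⁻¹ * τ' a b * f b

/-- `τ` is locally a coboundary on `s`. -/
def IsCoc (s : Set X) (τ : X → X → G) : Prop :=
  ∀ p ∈ s, ∃ f : X → G, ∃ O ∈ 𝓝[s] p, ∀ a ∈ O, ∀ b ∈ O, τ a b = (f a)⁻¹ * f b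

/-- `f` is locally constant on `s`. -/
def LocConst (s : Set X) (f : X → G) : Prop := Loc s fun a b => f a = f b

theorem Loc.mono {s t : Set X} {P : X → X → Prop} (h : Loc s P) (hts : t ⊆ s) : Loc t P := by
  intro p hp
  obtain ⟨O, hO, h1⟩ := h p (hts hp)
  exact ⟨O, nhdsWithin_mono _ hts hO, h1⟩

theorem Loc.imp {s : Set X} {P Q : X → X → Prop} (h : Loc s P)
    (hPQ : ∀ a ∈ s, ∀ b ∈ s, P a b → Q a b) : Loc s Q := by
  intro p hp
  obtain ⟨O, hO, h1⟩ := h p hp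
  exact ⟨O ∩ s, Filter.inter_mem hO self_mem_nhdsWithin,
    fun a ha b hb => hPQ a ha.2 b hb.2 (h1 a ha.1 b hb.1)⟩

theorem Loc.and {s : Set X} {P Q : X → X → Prop} (h : Loc s P) (h' : Loc s Q) :
    Loc s fun a b => P a b ∧ Q a b := by
  intro p hp
  obtain ⟨O, hO, h1⟩ := h p hp
  obtain ⟨O', hO', h2⟩ := h' p hp
  exact ⟨O ∩ O', Filter.inter_mem hO hO',
    fun a ha b hb => ⟨h1 a ha.1 b hb.1, h2 a ha.2 b hb.2⟩⟩

theorem Loc.comp {s : Set X} {t : Set Y} {P : Y → Y → Prop} {φ : X → Y} (h : Loc t P)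
    (hc : ContinuousOn φ s) (hm : MapsTo φ s t) : Loc s fun a b => P (φ a) (φ b) := by
  intro p hp
  obtain ⟨O, hO, h1⟩ := h _ (hm hp)
  exact ⟨φ ⁻¹' O, ((hc p hp).tendsto_nhdsWithin hm) hO, fun a ha b hb => h1 _ ha _ hb⟩

theorem Loc.of_cover {s : Set X} {P : X → X → Prop}
    (h : ∀ p ∈ s, ∃ O, IsOpen O ∧ p ∈ O ∧ Loc (s ∩ O) P) : Loc s P := by
  intro p hp
  obtain ⟨O, hO, hpO, h1⟩ := h p hp
  obtain ⟨O', hO', h2⟩ := h1 p ⟨hp, hpO⟩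
  refine ⟨O', ?_, h2⟩
  rwa [nhdsWithin_inter_of_mem' (mem_nhdsWithin_of_mem_nhds (hO.mem_nhds hpO))] at hO'

theorem Loc.transport {s : Set X} {P : X → Prop} (hs : IsPreconnected s)
    (h : Loc s fun a b => P a → P b) {x y : X} (hx : x ∈ s) (hy : y ∈ s) (hP : P x) : P y := by
  have := hs.induction₂ (fun a b => (P a ↔ P b)) (fun x hx => ?_)
    (fun x y z _ _ _ => Iff.trans) (fun x y _ _ => Iff.symm) hx hy
  · exact this.1 hP
  · obtain ⟨O, hO, h1⟩ := h x hx
    filter_upwards [hO] with y hy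
    exact ⟨h1 _ (mem_of_mem_nhdsWithin hx hO) _ hy, h1 _ hy _ (mem_of_mem_nhdsWithin hx hO)⟩

theorem IsPot.mono {s t : Set X} {τ : X → X → G} {f : X → G} (h : IsPot s τ f) (hts : t ⊆ s) :
    IsPot t τ f := Loc.mono h hts

theorem IsIso.mono {s t : Set X} {τ τ' : X → X → G} {f : X → G} (h : IsIso s τ τ' f)
    (hts : t ⊆ s) : IsIso t τ τ' f := Loc.mono h hts

omit [Group G] in
theorem LocConst.eq {s : Set X} {f : X → G} (h : LocConst s f) (hs : IsPreconnected s)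
    {x y : X} (hx : x ∈ s) (hy : y ∈ s) : f x = f y :=
  Loc.transport (P := fun z => f x = f z) hs (h.imp fun _ _ _ _ h1 h2 => h2.trans h1) hx hy rfl

theorem IsCoc.mono {s t : Set X} {τ : X → X → G} (h : IsCoc s τ) (hts : t ⊆ s) : IsCoc t τ := by
  intro p hp
  obtain ⟨f, O, hO, h1⟩ := h p (hts hp)
  exact ⟨f, O, nhdsWithin_mono _ hts hO, h1⟩

theorem IsCoc.comp {s : Set X} {t : Set Y} {τ : Y → Y → G} {φ : X → Y} (h : IsCoc t τ)
    (hc : ContinuousOn φ s) (hm : MapsTo φ s t) : IsCoc s fun a b => τ (φ a) (φ b) := by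
  intro p hp
  obtain ⟨f, O, hO, h1⟩ := h _ (hm hp)
  exact ⟨f ∘ φ, φ ⁻¹' O, ((hc p hp).tendsto_nhdsWithin hm) hO, fun a ha b hb => h1 _ ha _ hb⟩

theorem IsCoc.mul {s : Set X} {τ : X → X → G} (h : IsCoc s τ) :
    ∀ p ∈ s, ∃ O ∈ 𝓝[s] p, ∀ a ∈ O, ∀ b ∈ O, ∀ c ∈ O, τ a b * τ b c = τ a c := by
  intro p hp
  obtain ⟨f, O, hO, h1⟩ := h p hp
  exact ⟨O, hO, fun a ha b hb c hc => by rw [h1 a ha b hb, h1 b hb c hc, h1 a ha c hc]; group⟩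

theorem IsCoc.self {s : Set X} {τ : X → X → G} (h : IsCoc s τ) {p : X} (hp : p ∈ s) :
    τ p p = 1 := by
  obtain ⟨f, O, hO, h1⟩ := h p hp
  have := mem_of_mem_nhdsWithin hp hO
  simp [h1 p this p this]

theorem IsCoc.of_loc_eq {s : Set X} {τ τ' : X → X → G} (h : IsCoc s τ)
    (he : Loc s fun a b => τ a b = τ' a b) : IsCoc s τ' := by
  intro p hp
  obtain ⟨f, O, hO, h1⟩ := h p hp
  obtain ⟨O', hO', h2⟩ := he p hp
  exact ⟨f, O ∩ O', Filter.inter_mem hO hO',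
    fun a ha b hb => by rw [← h2 a ha.2 b hb.2, h1 a ha.1 b hb.1]⟩

theorem IsCoc.of_cover {s : Set X} {τ : X → X → G}
    (h : ∀ p ∈ s, ∃ O, IsOpen O ∧ p ∈ O ∧ IsCoc (s ∩ O) τ) : IsCoc s τ := by
  intro p hp
  obtain ⟨O, hO, hpO, h1⟩ := h p hp
  obtain ⟨f, O', hO', h2⟩ := h1 p ⟨hp, hpO⟩
  refine ⟨f, O', ?_, h2⟩
  rwa [nhdsWithin_inter_of_mem' (mem_nhdsWithin_of_mem_nhds (hO.mem_nhds hpO))] at hO'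

theorem IsIso.isCoc {s : Set X} {τ τ' : X → X → G} {f : X → G} (hf : IsIso s τ τ' f)
    (h : IsCoc s τ') : IsCoc s τ := by
  intro p hp
  obtain ⟨g, O, hO, h1⟩ := h p hp
  obtain ⟨O', hO', h2⟩ := hf p hp
  exact ⟨fun a => g a * f a, O ∩ O', Filter.inter_mem hO hO',
    fun a ha b hb => by rw [h2 a ha.2 b hb.2, h1 a ha.1 b hb.1]; group⟩

theorem IsPot.div_locConst {s : Set X} {τ : X → X → G} {f g : X → G} (hf : IsPot s τ f)
    (hg : IsPot s τ g) : LocConst s fun a => f a * (g a)⁻¹ := by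
  refine (Loc.and hf hg).imp ?_
  intro a _ b _ h
  have := h.1.symm.trans h.2
  rw [inv_mul_eq_iff_eq_mul] at this
  simp only [this]; group

theorem LocConst.mul_isPot {s : Set X} {τ : X → X → G} {k f : X → G} (hk : LocConst s k)
    (hf : IsPot s τ f) : IsPot s τ fun a => k a * f a :=
  (Loc.and hk hf).imp fun a _ b _ h => by simp only [h.2, h.1]; group

theorem IsPot.const_mul {s : Set X} {τ : X → X → G} {f : X → G} (k : G)
    (hf : IsPot s τ f) : IsPot s τ fun a => k * f a :=
  hf.imp fun a _ b _ h => by rw [h]; group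

theorem IsPot.eq {s : Set X} {τ : X → X → G} {f g : X → G} (hf : IsPot s τ f)
    (hg : IsPot s τ g) (hs : IsPreconnected s) {x y : X} (hx : x ∈ s) (hy : y ∈ s)
    (hxy : f x = g x) : f y = g y := by
  have := (hf.div_locConst hg).eq hs hx hy
  simp only [hxy, mul_inv_cancel] at this
  exact (mul_inv_eq_one.mp this.symm)

theorem IsPot.congr {s : Set X} {τ : X → X → G} {f g : X → G} (hf : IsPot s τ f)
    (hfg : EqOn f g s) : IsPot s τ g :=
  hf.imp fun a ha b hb h => by rw [h, hfg ha, hfg hb]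

/-- Gluing potentials over two relatively closed pieces. -/
theorem IsPot.glue_closed {s A B : Set X} {τ : X → X → G} {f : X → G} (hτ : IsCoc s τ)
    (hs : s = A ∪ B) (hA : ∃ F, IsClosed F ∧ A = s ∩ F) (hB : ∃ F, IsClosed F ∧ B = s ∩ F)
    (hfA : IsPot A τ f) (hfB : IsPot B τ f) : IsPot s τ f := by
  obtain ⟨FA, hFA, rfl⟩ := hA
  obtain ⟨FB, hFB, rfl⟩ := hB
  have key : ∀ F F' : Set X, IsClosed F → IsClosed F' → s = s ∩ F ∪ s ∩ F' →
      IsPot (s ∩ F) τ f → ∀ p ∈ s, p ∉ F' →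
      ∃ O ∈ 𝓝[s] p, ∀ a ∈ O, ∀ b ∈ O, τ a b = (f a)⁻¹ * f b := by
    intro F F' hF hF' hss hf p hp hpF'
    have hpF : p ∈ F := by
      rw [hss] at hp; exact hp.elim (fun h => h.2) fun h => absurd h.2 hpF'
    obtain ⟨O, hO, h1⟩ := hf p ⟨hp, hpF⟩
    refine ⟨O, ?_, h1⟩
    have : s ∩ F'ᶜ ⊆ s ∩ F := by
      rintro x ⟨hx, hx'⟩
      refine ⟨hx, ?_⟩
      rw [hss] at hx; exact hx.elim (fun h => h.2) fun h => absurd h.2 hx'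
    have h2 := nhdsWithin_mono p this hO
    rwa [nhdsWithin_inter_of_mem' (mem_nhdsWithin_of_mem_nhds (hF'.isOpen_compl.mem_nhds hpF'))]
      at h2
  intro p hp
  by_cases hpA : p ∈ FA
  · by_cases hpB : p ∈ FB
    · obtain ⟨O1, hO1, h1⟩ := hfA p ⟨hp, hpA⟩
      obtain ⟨O2, hO2, h2⟩ := hfB p ⟨hp, hpB⟩
      obtain ⟨O3, hO3, h3⟩ := hτ.mul p hp
      have p1 := mem_of_mem_nhdsWithin (show p ∈ s ∩ FA from ⟨hp, hpA⟩) hO1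
      have p2 := mem_of_mem_nhdsWithin (show p ∈ s ∩ FB from ⟨hp, hpB⟩) hO2
      have p3 := mem_of_mem_nhdsWithin hp hO3
      refine ⟨(O1 ∪ O2) ∩ O3, Filter.inter_mem ?_ hO3, ?_⟩
      · rw [hs, nhdsWithin_union]
        exact ⟨Filter.mem_of_superset hO1 subset_union_left,
          Filter.mem_of_superset hO2 subset_union_right⟩
      · rintro a ⟨ha, ha3⟩ b ⟨hb, hb3⟩
        have e1 : ∀ a ∈ O1 ∪ O2, τ a p = (f a)⁻¹ * f p := by
          rintro a (ha | ha)
          · exact h1 a ha p p1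
          · exact h2 a ha p p2
        have e2 : ∀ a ∈ O1 ∪ O2, τ p a = (f p)⁻¹ * f a := by
          rintro a (ha | ha)
          · exact h1 p p1 a ha
          · exact h2 p p2 a ha
        rw [← h3 a ha3 p p3 b hb3, e1 a ha, e2 b hb]; group
    · exact key FA FB hFA hFB hs hfA p hp hpB
  · exact key FB FA hFB hFA (by rwa [union_comm]) hfB p hp hpA

theorem IsCoc.exists_tube {s : Set Y} {τ : ℝ × Y → ℝ × Y → G}
    (h : IsCoc (Icc (0 : ℝ) 1 ×ˢ s) τ) {y : Y} (hy : y ∈ s) :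
    ∃ O, IsOpen O ∧ y ∈ O ∧ ∃ F, IsPot (Icc (0 : ℝ) 1 ×ˢ (s ∩ O)) τ F := by
  have box : ∀ t : Icc (0 : ℝ) 1, ∃ U : Set ℝ, ∃ O : Set Y, ∃ f : ℝ × Y → G, IsOpen U ∧ IsOpen O ∧
      t.1 ∈ U ∧ y ∈ O ∧ ∀ a ∈ (U ∩ Icc 0 1) ×ˢ (s ∩ O), ∀ b ∈ (U ∩ Icc 0 1) ×ˢ (s ∩ O),
        τ a b = (f a)⁻¹ * f b := by
    intro t
    obtain ⟨f, W, hW, h1⟩ := h (t.1, y) ⟨t.2, hy⟩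
    obtain ⟨V, hV, hVW⟩ := mem_nhdsWithin_iff_exists_mem_nhds_inter.mp hW
    obtain ⟨U, O, hU, hU', hO, hO', hUO⟩ := mem_nhds_prod_iff'.mp hV
    refine ⟨U, O, f, hU, hO, hU', hO', fun a ha b hb => h1 a (hVW ?_) b (hVW ?_)⟩
    · exact ⟨hUO ⟨ha.1.1, ha.2.2⟩, ha.1.2, ha.2.1⟩
    · exact ⟨hUO ⟨hb.1.1, hb.2.2⟩, hb.1.2, hb.2.1⟩
  choose U O f hU hO htU hyO hf using box
  obtain ⟨t, ht0, htm, ⟨m, hm⟩, ht⟩ := exists_monotone_Icc_subset_open_cover_Icc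
    (zero_le_one' ℝ) (c := fun i => Subtype.val ⁻¹' U i)
    (fun i => (hU i).preimage continuous_subtype_val)
    (fun x _ => mem_iUnion.mpr ⟨x, htU x⟩)
  have ind : ∀ n, ∃ W, IsOpen W ∧ y ∈ W ∧ ∃ F, IsPot (Icc (0 : ℝ) (t n) ×ˢ (s ∩ W)) τ F := by
    intro n
    induction n with
    | zero =>
      rw [ht0]
      refine ⟨O 0, hO _, hyO _, f 0, ?_⟩
      intro p hp
      refine ⟨_, self_mem_nhdsWithin, fun a ha b hb => hf 0 a ?_ b ?_⟩
      all_goals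
        simp only [Icc_self, mem_prod, mem_singleton_iff, mem_inter_iff] at ha hb ⊢
        simp only [ha, hb, and_true, mem_Icc, le_refl, zero_le_one]
        exact htU 0
    | succ n ih =>
      obtain ⟨W, hW, hyW, F, hF⟩ := ih
      obtain ⟨i, hi⟩ := ht n
      have hle : (t n : ℝ) ≤ t (n + 1) := htm n.le_succ
      have hsub : Icc (t n : ℝ) (t (n + 1)) ×ˢ (s ∩ (W ∩ O i)) ⊆ (U i ∩ Icc 0 1) ×ˢ (s ∩ O i) := by
        rintro ⟨r, z⟩ ⟨hr, hz⟩
        have h01 : r ∈ Icc (0 : ℝ) 1 := ⟨(t n).2.1.trans hr.1, hr.2.trans (t (n + 1)).2.2⟩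
        have : (⟨r, h01⟩ : Icc (0 : ℝ) 1) ∈ Icc (t n) (t (n + 1)) := ⟨hr.1, hr.2⟩
        exact ⟨⟨hi this, h01⟩, hz.1, hz.2.2⟩
      have hfi : IsPot (Icc (t n : ℝ) (t (n + 1)) ×ˢ (s ∩ (W ∩ O i))) τ (f i) := fun p hp =>
        ⟨_, self_mem_nhdsWithin, fun a ha b hb => hf i a (hsub ha) b (hsub hb)⟩
      have hF' : IsPot (Icc (0 : ℝ) (t n) ×ˢ (s ∩ (W ∩ O i))) τ F :=
        hF.mono (prod_mono_right (by intro x hx; exact ⟨hx.1, hx.2.1⟩))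
      have hk : LocConst (s ∩ (W ∩ O i)) fun z => F (t n, z) * (f i (t n, z))⁻¹ := by
        have h1 : LocConst ({(t n : ℝ)} ×ˢ (s ∩ (W ∩ O i))) fun z => F z * (f i z)⁻¹ :=
          IsPot.div_locConst (τ := τ)
            (hF'.mono (prod_mono_left (singleton_subset_iff.mpr ⟨(t n).2.1, le_rfl⟩)))
            (hfi.mono (prod_mono_left (singleton_subset_iff.mpr ⟨le_rfl, hle⟩)))
        exact h1.comp (φ := fun z => ((t n : ℝ), z)) (by fun_prop) fun z hz => ⟨rfl, hz⟩
      have hk' : LocConst (Icc (t n : ℝ) (t (n + 1)) ×ˢ (s ∩ (W ∩ O i)))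
          fun p => F (t n, p.2) * (f i (t n, p.2))⁻¹ :=
        hk.comp (φ := Prod.snd) (by fun_prop) fun z hz => hz.2
      refine ⟨W ∩ O i, hW.inter (hO i), ⟨hyW, hyO i⟩,
        fun p => if p.1 ≤ t n then F p else F (t n, p.2) * (f i (t n, p.2))⁻¹ * f i p, ?_⟩
      refine IsPot.glue_closed (A := Icc (0 : ℝ) (t n) ×ˢ (s ∩ (W ∩ O i)))
        (B := Icc (t n : ℝ) (t (n + 1)) ×ˢ (s ∩ (W ∩ O i))) ?_ ?_
        ⟨Prod.fst ⁻¹' Iic (t n : ℝ), isClosed_Iic.preimage continuous_fst, ?_⟩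
        ⟨Prod.fst ⁻¹' Ici (t n : ℝ), isClosed_Ici.preimage continuous_fst, ?_⟩ ?_ ?_
      · exact h.mono (prod_mono (Icc_subset_Icc_right (t (n + 1)).2.2) inter_subset_left)
      · rw [← union_prod, Icc_union_Icc_eq_Icc (t n).2.1 hle]
      · ext ⟨r, z⟩
        simp only [mem_prod, mem_Icc, mem_inter_iff, mem_preimage, mem_Iic]
        constructor
        · rintro ⟨h1, h2⟩; exact ⟨⟨⟨h1.1, h1.2.trans hle⟩, h2⟩, h1.2⟩
        · rintro ⟨⟨h1, h2⟩, h3⟩; exact ⟨⟨h1.1, h3⟩, h2⟩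
      · ext ⟨r, z⟩
        simp only [mem_prod, mem_Icc, mem_inter_iff, mem_preimage, mem_Ici]
        constructor
        · rintro ⟨h1, h2⟩; exact ⟨⟨⟨(t n).2.1.trans h1.1, h1.2⟩, h2⟩, h1.1⟩
        · rintro ⟨⟨h1, h2⟩, h3⟩; exact ⟨⟨h3, h1.2⟩, h2⟩
      · exact hF'.congr fun p hp => by simp [hp.1.2]
      · refine (hk'.mul_isPot hfi).congr fun p hp => ?_
        by_cases hp1 : p.1 ≤ t n
        · have : p = ((t n : ℝ), p.2) := Prod.ext (le_antisymm hp1 hp.1.1) rfl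
          simp only [hp1, if_true]
          conv_rhs => rw [this]
          conv_lhs => rw [this]
          simp
        · simp [hp1]
  obtain ⟨W, hW, hyW, F, hF⟩ := ind m
  rw [hm m le_rfl] at hF
  exact ⟨W, hW, hyW, F, hF⟩

/-- The two ends of a cocycle over `[0,1] × s` are isomorphic. -/
theorem IsCoc.homotopy {s : Set Y} {τ : ℝ × Y → ℝ × Y → G}
    (h : IsCoc (Icc (0 : ℝ) 1 ×ˢ s) τ) :
    ∃ f, IsIso s (fun a b => τ (1, a) (1, b)) (fun a b => τ (0, a) (0, b)) f := by
  choose! O hO hyO F hF using fun y (hy : y ∈ s) => h.exists_tube hy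
  refine ⟨fun y => (F y (0, y))⁻¹ * F y (1, y), Loc.of_cover fun y hy =>
    ⟨O y, hO y hy, hyO y hy, ?_⟩⟩
  have e0 : Loc (s ∩ O y) fun a b => τ (0, a) (0, b) = (F y (0, a))⁻¹ * F y (0, b) :=
    (hF y hy).comp (φ := fun z => ((0 : ℝ), z)) (by fun_prop) fun z hz => ⟨by simp, hz⟩
  have e1 : Loc (s ∩ O y) fun a b => τ (1, a) (1, b) = (F y (1, a))⁻¹ * F y (1, b) :=
    (hF y hy).comp (φ := fun z => ((1 : ℝ), z)) (by fun_prop) fun z hz => ⟨by simp, hz⟩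
  refine (e0.and e1).imp ?_
  rintro a ha b hb ⟨h0, h1⟩
  have key : ∀ a ∈ s ∩ O y,
      (F a (0, a))⁻¹ * F a (1, a) = (F y (0, a))⁻¹ * F y (1, a) := by
    intro a ha
    have g1 : IsPot (Icc (0 : ℝ) 1 ×ˢ {a}) τ (F a) :=
      (hF a ha.1).mono (prod_mono_right (by rintro _ rfl; exact ⟨ha.1, hyO _ ha.1⟩))
    have g2 : IsPot (Icc (0 : ℝ) 1 ×ˢ {a}) τ (F y) :=
      (hF y hy).mono (prod_mono_right (by rintro _ rfl; exact ha))
    have := (g1.div_locConst g2).eq (isPreconnected_Icc.prod isPreconnected_singleton)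
      (x := (0, a)) (y := (1, a)) (by simp) (by simp)
    rw [mul_inv_eq_iff_eq_mul] at this
    simp only [this]; group
  simp only [key a ha, key b hb, h0, h1]
  group

theorem IsCoc.trivial_of_starConvex {E : Type*} [AddCommGroup E] [Module ℝ E] [TopologicalSpace E]
    [ContinuousSMul ℝ E] [IsTopologicalAddGroup E] {s : Set E} {x : E} (hs : StarConvex ℝ x s)
    (hx : x ∈ s) {τ : E → E → G} (h : IsCoc s τ) : ∃ f, IsPot s τ f := by
  have := (h.comp (s := Icc (0 : ℝ) 1 ×ˢ s) (φ := fun p => x + p.1 • (p.2 - x)) (by fun_prop)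
    (fun p hp => hs.add_smul_sub_mem hp.2 hp.1.1 hp.1.2)).homotopy
  obtain ⟨f, hf⟩ := this
  refine ⟨f, hf.imp ?_⟩
  intro a _ b _ h1
  simpa [h.self hx] using h1

theorem IsCoc.trivial_of_convex {E : Type*} [AddCommGroup E] [Module ℝ E] [TopologicalSpace E]
    [ContinuousSMul ℝ E] [IsTopologicalAddGroup E] {s : Set E} (hs : Convex ℝ s)
    {τ : E → E → G} (h : IsCoc s τ) : ∃ f, IsPot s τ f := by
  rcases s.eq_empty_or_nonempty with rfl | ⟨x, hx⟩
  · exact ⟨1, fun p hp => hp.elim⟩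
  · exact h.trivial_of_starConvex (hs.starConvex hx) hx

end Cocycles

section Standard

variable {G : Type*} [Group G]

open Classical in
/-- The cut function of the standard cocycle. -/
noncomputable def cutFun (g : G) (z : ℂ) : G := if 0 ≤ z.im then 1 else g

open Classical in
/-- The standard cocycle on `ℂ \ {0}` with monodromy `g`, cut along the negative real axis. -/
noncomputable def st (g : G) (a b : ℂ) : G :=
  if a.re < 0 ∧ b.re < 0 then (cutFun g a)⁻¹ * cutFun g b else 1

theorem st_pos_mul (g : G) {r : ℝ} (hr : 0 < r) (a b : ℂ) : st g (r * a) (r * b) = st g a b := by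
  simp [st, cutFun, mul_neg_iff, hr, hr.not_gt, mul_nonneg_iff_of_pos_left]

theorem st_pos_mul' (g : G) {r r' : ℝ} (hr : 0 < r) (hr' : 0 < r') (a b : ℂ) :
    st g (r * a) (r' * b) = st g a b := by
  simp [st, cutFun, mul_neg_iff, hr, hr.not_gt, hr', hr'.not_gt, mul_nonneg_iff_of_pos_left]

theorem st_eq_one_of_re_nonneg {g : G} {a b : ℂ} (h : 0 ≤ a.re) : st g a b = 1 := by
  simp [st, h.not_gt]

theorem st_eq_one_of_im_nonneg {g : G} {a b : ℂ} (ha : 0 ≤ a.im) (hb : 0 ≤ b.im) :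
    st g a b = 1 := by
  simp [st, cutFun, ha, hb]

theorem st_eq_one_of_im_neg {g : G} {a b : ℂ} (ha : a.im < 0) (hb : b.im < 0) :
    st g a b = 1 := by
  simp [st, cutFun, ha.not_ge, hb.not_ge]

theorem st_of_re_neg {g : G} {a b : ℂ} (ha : a.re < 0) (hb : b.re < 0) :
    st g a b = (cutFun g a)⁻¹ * cutFun g b := by
  simp [st, ha, hb]

theorem isCoc_st (g : G) : IsCoc {0}ᶜ (st g) := by
  intro p hp
  rcases lt_or_ge p.re 0 with h | h
  · refine ⟨cutFun g, {z | z.re < 0}, mem_nhdsWithin_of_mem_nhds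
      ((isOpen_lt Complex.continuous_re continuous_const).mem_nhds h),
      fun a ha b hb => st_of_re_neg ha hb⟩
  rcases h.lt_or_eq with h | h
  · exact ⟨1, {z | 0 < z.re}, mem_nhdsWithin_of_mem_nhds
      ((isOpen_lt continuous_const Complex.continuous_re).mem_nhds h),
      fun a ha b hb => by simp [st_eq_one_of_re_nonneg (le_of_lt ha)]⟩
  rcases lt_trichotomy p.im 0 with h' | h' | h'
  · exact ⟨1, {z | z.im < 0}, mem_nhdsWithin_of_mem_nhds
      ((isOpen_lt Complex.continuous_im continuous_const).mem_nhds h'),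
      fun a ha b hb => by simp [st_eq_one_of_im_neg (g := g) ha hb]⟩
  · exact absurd (Complex.ext h.symm h') hp
  · exact ⟨1, {z | 0 < z.im}, mem_nhdsWithin_of_mem_nhds
      ((isOpen_lt continuous_const Complex.continuous_im).mem_nhds h'),
      fun a ha b hb => by simp [st_eq_one_of_im_nonneg (g := g) (le_of_lt ha) (le_of_lt hb)]⟩

/-- The potential of `st g` on the universal cover. -/
noncomputable def stLift (g : G) (θ : ℝ) : G := g ^ ⌈(θ - Real.pi) / (2 * Real.pi)⌉

theorem stLift_add (g : G) (θ : ℝ) (k : ℤ) :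
    stLift g (θ + k * (2 * Real.pi)) = g ^ k * stLift g θ := by
  have : (θ + k * (2 * Real.pi) - Real.pi) / (2 * Real.pi) = (θ - Real.pi) / (2 * Real.pi) + k := by
    field_simp [Real.pi_ne_zero]; ring
  rw [stLift, this, Int.ceil_add_intCast, stLift, ← zpow_add, add_comm]

theorem stLift_eq_one (g : G) {θ : ℝ} (h1 : -Real.pi < θ) (h2 : θ ≤ Real.pi) :
    stLift g θ = 1 := by
  have : ⌈(θ - Real.pi) / (2 * Real.pi)⌉ = 0 := by
    rw [Int.ceil_eq_zero_iff]
    constructor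
    · rw [lt_div_iff₀ (by positivity)]; linarith
    · exact div_nonpos_of_nonpos_of_nonneg (by linarith) (by positivity)
  rw [stLift, this, zpow_zero]

theorem IsPot.isIso {X : Type*} [TopologicalSpace X] {s : Set X} {τ τ' : X → X → G} {f g : X → G}
    (hf : IsPot s τ f) (hg : IsPot s τ' g) : IsIso s τ τ' fun a => (g a)⁻¹ * f a :=
  (Loc.and hf hg).imp fun a _ b _ h => by simp only [h.1, h.2]; group

open Complex in
theorem isPot_stLift (g : G) :
    IsPot univ (fun s t : ℝ => st g (exp (s * I)) (exp (t * I))) (stLift g) := by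
  have hre : ∀ s : ℝ, (exp (s * I)).re = Real.cos s := exp_ofReal_mul_I_re
  have him : ∀ s : ℝ, (exp (s * I)).im = Real.sin s := exp_ofReal_mul_I_im
  have base : ∀ p : ℝ, -Real.pi < p → p ≤ Real.pi → ∃ O ∈ 𝓝 p, ∀ a ∈ O, ∀ b ∈ O,
      st g (exp (a * I)) (exp (b * I)) = (stLift g a)⁻¹ * stLift g b := by
    intro p hp1 hp2
    rcases hp2.lt_or_eq with hp2 | rfl
    · have hO : Ioo (-Real.pi) Real.pi ∈ 𝓝 p := isOpen_Ioo.mem_nhds ⟨hp1, hp2⟩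
      have h1 : ∀ a ∈ Ioo (-Real.pi) Real.pi, stLift g a = 1 :=
        fun a ha => stLift_eq_one g ha.1 ha.2.le
      rcases lt_trichotomy p 0 with h | rfl | h
      · refine ⟨_, Filter.inter_mem hO (isOpen_Iio.mem_nhds h), fun a ha b hb => ?_⟩
        rw [h1 a ha.1, h1 b hb.1, st_eq_one_of_im_neg]; · simp
        · rw [him]; exact Real.sin_neg_of_neg_of_neg_pi_lt ha.2 ha.1.1
        · rw [him]; exact Real.sin_neg_of_neg_of_neg_pi_lt hb.2 hb.1.1
      · refine ⟨_, Filter.inter_mem hO (isOpen_Ioo.mem_nhds (show (0 : ℝ) ∈ Ioo (-(Real.pi / 2))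
          (Real.pi / 2) from ⟨by linarith [Real.pi_pos], by linarith [Real.pi_pos]⟩)),
          fun a ha b hb => ?_⟩
        rw [h1 a ha.1, h1 b hb.1, st_eq_one_of_re_nonneg]; · simp
        · rw [hre]; exact (Real.cos_pos_of_mem_Ioo ha.2).le
      · refine ⟨_, Filter.inter_mem hO (isOpen_Ioi.mem_nhds h), fun a ha b hb => ?_⟩
        rw [h1 a ha.1, h1 b hb.1, st_eq_one_of_im_nonneg]; · simp
        · rw [him]; exact (Real.sin_pos_of_pos_of_lt_pi ha.2 ha.1.2).le
        · rw [him]; exact (Real.sin_pos_of_pos_of_lt_pi hb.2 hb.1.2).le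
    · refine ⟨Ioo (Real.pi / 2) (Real.pi + Real.pi / 2), isOpen_Ioo.mem_nhds
        ⟨by linarith, by linarith⟩, fun a ha b hb => ?_⟩
      have key : ∀ a ∈ Ioo (Real.pi / 2) (Real.pi + Real.pi / 2),
          cutFun g (exp (a * I)) = stLift g a := by
        intro a ha
        by_cases h : a ≤ Real.pi
        · rw [stLift_eq_one g (by linarith [ha.1]) h, cutFun, if_pos]
          rw [him]; exact Real.sin_nonneg_of_nonneg_of_le_pi (by linarith [ha.1]) h
        · push Not at h
          have e : stLift g a = g := by
            have := stLift_add g (a - 2 * Real.pi) 1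
            rw [stLift_eq_one g (θ := a - 2 * Real.pi) (by linarith) (by linarith [ha.2])] at this
            simpa using this
          rw [e, cutFun, if_neg]
          rw [him, not_le, ← Real.sin_sub_two_pi]
          exact Real.sin_neg_of_neg_of_neg_pi_lt (by linarith [ha.2]) (by linarith)
      rw [st_of_re_neg, key a ha, key b hb]
      · rw [hre]; exact Real.cos_neg_of_pi_div_two_lt_of_lt ha.1 ha.2
      · rw [hre]; exact Real.cos_neg_of_pi_div_two_lt_of_lt hb.1 hb.2
  intro p _
  obtain ⟨k, hk, -⟩ := existsUnique_sub_zsmul_mem_Ioc Real.two_pi_pos p (-Real.pi)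
  obtain ⟨O, hO, h⟩ := base (p - k • (2 * Real.pi)) hk.1 (by have := hk.2; linarith)
  refine ⟨(fun x => x - k • (2 * Real.pi)) ⁻¹' O, ?_, fun a ha b hb => ?_⟩
  · rw [nhdsWithin_univ]
    exact (by fun_prop : Continuous fun x : ℝ => x - k • (2 * Real.pi)).continuousAt.preimage_mem_nhds hO
  · have e1 : ∀ a : ℝ, exp (((a - k • (2 * Real.pi) : ℝ) : ℂ) * I) = exp (a * I) := by
      intro a
      have := exp_int_mul_two_pi_mul_I k
      push_cast [zsmul_eq_mul]
      rw [sub_mul, exp_sub, mul_assoc (k : ℂ), this, div_one]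
    have e2 : ∀ a : ℝ, stLift g a = g ^ k * stLift g (a - k • (2 * Real.pi)) := by
      intro a
      rw [← stLift_add]; congr 1; simp
    have := h _ ha _ hb
    simp only [e1] at this
    change st g (exp (a * I)) (exp (b * I)) = _
    rw [this, e2 a, e2 b]; group

open Complex in
/-- Periodic isomorphisms in polar coordinates descend. -/
theorem IsIso.of_polar {Y : Type*} [TopologicalSpace Y] {R : Set ℝ} (hR : R ⊆ Ioi 0) {W : Set Y}
    {τ τ' : ℂ × Y → ℂ × Y → G} {f : ℝ × ℝ × Y → G}
    (hf : IsIso (R ×ˢ univ ×ˢ W) (fun a b : ℝ × ℝ × Y => τ (a.1 * exp (a.2.1 * I), a.2.2) (b.1 * exp (b.2.1 * I), b.2.2))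
      (fun a b : ℝ × ℝ × Y => τ' (a.1 * exp (a.2.1 * I), a.2.2) (b.1 * exp (b.2.1 * I), b.2.2)) f)
    (hper : ∀ r ∈ R, ∀ s, ∀ y ∈ W, f (r, s + 2 * Real.pi, y) = f (r, s, y)) :
    IsIso {p : ℂ × Y | ‖p.1‖ ∈ R ∧ p.2 ∈ W} τ τ' fun p => f (‖p.1‖, arg p.1, p.2) := by
  have hper' : ∀ r ∈ R, ∀ s, ∀ y ∈ W, ∀ k : ℤ, f (r, s + k * (2 * Real.pi), y) = f (r, s, y) := by
    intro r hr s y hy k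
    have : Function.Periodic (fun s => f (r, s, y)) (2 * Real.pi) := fun s => hper r hr s y hy
    exact this.int_mul k s
  refine Loc.of_cover fun p hp => ?_
  have hp0 : p.1 ≠ 0 := norm_pos_iff.mp (hR hp.1)
  set c : ℂ := exp (-(arg p.1 * I)) with hc
  have hpc : p.1 * c = ‖p.1‖ := by
    conv_lhs => rw [← norm_mul_exp_arg_mul_I p.1]
    rw [hc, mul_assoc, ← exp_add]; simp
  refine ⟨{q | q.1 * c ∈ slitPlane}, isOpen_slitPlane.preimage (by fun_prop), ?_, ?_⟩
  · show p.1 * c ∈ slitPlane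
    rw [hpc]
    exact ofReal_mem_slitPlane.mpr (norm_pos_iff.mpr hp0)
  set β : ℂ → ℝ := fun z => arg (z * c) + arg p.1 with hβ
  have hβe : ∀ z : ℂ, ‖z‖ * exp (β z * I) = z := by
    intro z
    have h1 := norm_mul_exp_arg_mul_I (z * c)
    have hn : ‖z * c‖ = ‖z‖ := by
      rw [norm_mul, hc, ← neg_mul, ← ofReal_neg, norm_exp_ofReal_mul_I, mul_one]
    rw [hn] at h1
    rw [hβ]; push_cast
    rw [add_mul, exp_add, ← mul_assoc, h1, mul_assoc, hc, ← exp_add]; simp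
  have hcont : ContinuousOn (fun q : ℂ × Y => (‖q.1‖, β q.1, q.2))
      ({p : ℂ × Y | ‖p.1‖ ∈ R ∧ p.2 ∈ W} ∩ {q | q.1 * c ∈ slitPlane}) := by
    refine ContinuousOn.prodMk (by fun_prop) (ContinuousOn.prodMk ?_ (by fun_prop))
    refine ContinuousOn.add (fun q hq => ?_) continuousOn_const
    exact ContinuousAt.continuousWithinAt (ContinuousAt.comp (f := fun q : ℂ × Y => q.1 * c)
      (continuousAt_arg hq.2) (by fun_prop))
  have := Loc.comp (Y := ℝ × ℝ × Y) hf hcont (fun q hq => ⟨hq.1.1, mem_univ _, hq.1.2⟩)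
  refine this.imp ?_
  intro a ha b hb h
  simp only [hβe] at h
  rw [h]
  have key : ∀ a : ℂ × Y, ‖a.1‖ ∈ R → a.2 ∈ W →
      f (‖a.1‖, β a.1, a.2) = f (‖a.1‖, arg a.1, a.2) := by
    intro a ha hW
    have h1 : exp (β a.1 * I) = exp (arg a.1 * I) := by
      have hn : (‖a.1‖ : ℂ) ≠ 0 := ofReal_ne_zero.mpr (ne_of_gt (hR ha))
      exact mul_left_cancel₀ hn ((hβe a.1).trans (norm_mul_exp_arg_mul_I a.1).symm)
    obtain ⟨k, hk⟩ := exp_eq_exp_iff_exists_int.mp h1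
    have h2 : β a.1 = arg a.1 + k * (2 * Real.pi) := by
      have : (β a.1 : ℂ) * I = ((arg a.1 + k * (2 * Real.pi) : ℝ) : ℂ) * I := by
        rw [hk]; push_cast; ring
      exact_mod_cast mul_right_cancel₀ I_ne_zero this
    rw [h2, hper' _ ha _ _ hW]
  rw [key a ha.1.1 ha.1.2, key b hb.1.1 hb.1.2]

open Complex in
theorem st_nontrivial {g : G} {f : ℂ → G} (hf : IsPot (sphere 0 1) (st g) f) : g = 1 := by
  have h1 : IsPot univ (fun s t : ℝ => st g (exp (s * I)) (exp (t * I))) fun s : ℝ => f (exp (s * I)) :=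
    Loc.comp (φ := fun s : ℝ => exp (s * I)) hf (by fun_prop) fun s _ => by simp
  have h2 := (h1.div_locConst (isPot_stLift g)).eq isPreconnected_univ (mem_univ 0)
    (mem_univ (0 + (1 : ℤ) * (2 * Real.pi)))
  rw [stLift_add, stLift_eq_one g (by linarith [Real.pi_pos]) Real.pi_pos.le] at h2
  have h3 : exp (((0 + (1 : ℤ) * (2 * Real.pi) : ℝ) : ℂ) * I) = exp (((0 : ℝ) : ℂ) * I) := by
    simp
  rw [h3] at h2
  simpa using h2

open Complex in
theorem st_pow_iso (x : G) (N : ℕ) :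
    ∃ f, IsIso {0}ᶜ (fun a b => st x (a ^ N) (b ^ N)) (st (x ^ N)) f := by
  have h1 : IsPot univ (fun s t : ℝ => st x (exp (s * I) ^ N) (exp (t * I) ^ N))
      fun s => stLift x (N * s) := by
    refine Loc.imp (Loc.comp (φ := fun s : ℝ => (N : ℝ) * s) (isPot_stLift x) (s := univ)
      (by fun_prop) fun s _ => mem_univ _) ?_
    intro a _ b _ h
    rw [← h]
    simp only [← exp_nat_mul]
    push_cast
    simp only [mul_assoc]
  have h2 := h1.isIso (isPot_stLift (x ^ N))
  have h3 := IsIso.of_polar (R := Ioi 0) (W := (univ : Set Unit)) (τ := fun a b => st x (a.1 ^ N) (b.1 ^ N))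
    (τ' := fun a b => st (x ^ N) a.1 b.1) (f := fun p => (stLift (x ^ N) p.2.1)⁻¹ * stLift x (N * p.2.1))
    subset_rfl ?_ ?_
  · refine ⟨_, Loc.imp (Loc.comp (φ := fun z : ℂ => (z, ())) h3 (s := {0}ᶜ) (by fun_prop)
      fun z hz => ⟨by simpa using hz, mem_univ _⟩) fun a _ b _ h => h⟩
  · refine Loc.imp (Loc.comp (φ := fun p : ℝ × ℝ × Unit => p.2.1) h2 (by fun_prop)
      fun _ _ => mem_univ _) ?_
    rintro ⟨r, s, _⟩ ⟨hr, -⟩ ⟨r', s', _⟩ ⟨hr', -⟩ h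
    simp only [mul_pow, ← ofReal_pow]
    rw [st_pos_mul' _ (pow_pos hr _) (pow_pos hr' _), st_pos_mul' _ hr hr']; exact h
  · intro r _ s y _
    have e1 := stLift_add (x ^ N) s 1
    have e2 := stLift_add x (N * s) N
    have e3 : (N : ℝ) * s + (N : ℤ) * (2 * Real.pi) = N * (s + 2 * Real.pi) := by push_cast; ring
    rw [e3] at e2
    simp only [Int.cast_one, one_mul, zpow_one] at e1
    simp only [e1, e2, zpow_natCast]; group

end Standard

section Replace

variable {X : Type*} [TopologicalSpace X] {G : Type*} [Group G]

open Classical in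
/-- Replace a cocycle by another one inside `T`. -/
noncomputable def replaceCoc (T : Set X) (π τ : X → X → G) (a b : X) : G :=
  if a ∈ T ∧ b ∈ T then π a b else τ a b

theorem IsCoc.replace {s T T' C C' : Set X} {τ π : X → X → G} (hT : IsClosed T) (hT' : IsOpen T')
    (hTT : T' ⊆ T) (hC : C ⊆ T') (hτ : IsCoc (s \ C) τ)
    (hCc : IsClosed C) (hCc' : IsClosed C')
    (hπ : IsCoc ((T ∩ s) \ C') π)
    (h : ∀ p ∈ (T ∩ s) \ T', ∃ O ∈ 𝓝[T ∩ s] p, ∀ a ∈ O, ∀ b ∈ O, τ a b = π a b) :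
    IsCoc (s \ C') (replaceCoc T π τ) := by
  intro p hp
  by_cases hpT : p ∈ T
  · by_cases hpT' : p ∈ T'
    · obtain ⟨f, O, hO, hf⟩ := hπ p ⟨⟨hpT, hp.1⟩, hp.2⟩
      have e1 : 𝓝[(T ∩ s) \ C'] p = 𝓝[s \ C'] p := by
        have : (T ∩ s) \ C' = T ∩ (s \ C') := by rw [inter_sdiff_assoc]
        rw [this, nhdsWithin_inter_of_mem
          (mem_nhdsWithin_of_mem_nhds (Filter.mem_of_superset (hT'.mem_nhds hpT') hTT))]
      rw [e1] at hO
      refine ⟨f, O ∩ T', Filter.inter_mem hO (mem_nhdsWithin_of_mem_nhds (hT'.mem_nhds hpT')),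
        fun a ha b hb => ?_⟩
      rw [replaceCoc, if_pos ⟨hTT ha.2, hTT hb.2⟩, hf a ha.1 b hb.1]
    · obtain ⟨f, O, hO, hf⟩ := hτ p ⟨hp.1, fun h => hpT' (hC h)⟩
      obtain ⟨O', hO', h'⟩ := h p ⟨⟨hpT, hp.1⟩, hpT'⟩
      have e1 : 𝓝[s \ C] p = 𝓝[s] p := nhdsWithin_inter_of_mem'
        (mem_nhdsWithin_of_mem_nhds (hCc.isOpen_compl.mem_nhds fun h => hpT' (hC h)))
      have e2 : 𝓝[s \ C'] p = 𝓝[s] p := nhdsWithin_inter_of_mem'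
        (mem_nhdsWithin_of_mem_nhds (hCc'.isOpen_compl.mem_nhds hp.2))
      rw [e1] at hO
      obtain ⟨V, hV, hVO⟩ := mem_nhdsWithin_iff_exists_mem_nhds_inter.mp hO'
      refine ⟨f, O ∩ (V ∩ s), ?_, fun a ha b hb => ?_⟩
      · rw [e2]
        exact Filter.inter_mem hO (Filter.inter_mem (mem_nhdsWithin_of_mem_nhds hV)
          self_mem_nhdsWithin)
      · rw [← hf a ha.1 b hb.1, replaceCoc]
        split_ifs with hab
        · exact (h' a (hVO ⟨ha.2.1, hab.1, ha.2.2⟩) b (hVO ⟨hb.2.1, hab.2, hb.2.2⟩)).symm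
        · rfl
  · obtain ⟨f, O, hO, hf⟩ := hτ p ⟨hp.1, fun h => hpT (hTT (hC h))⟩
    have e1 : 𝓝[s \ C] p = 𝓝[s] p := nhdsWithin_inter_of_mem'
      (mem_nhdsWithin_of_mem_nhds (hCc.isOpen_compl.mem_nhds fun h => hpT (hTT (hC h))))
    have e2 : 𝓝[s \ C'] p = 𝓝[s] p := nhdsWithin_inter_of_mem'
      (mem_nhdsWithin_of_mem_nhds (hCc'.isOpen_compl.mem_nhds hp.2))
    refine ⟨f, O ∩ Tᶜ, ?_, fun a ha b hb => ?_⟩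
    · rw [e2]; rw [e1] at hO
      exact Filter.inter_mem hO (mem_nhdsWithin_of_mem_nhds (hT.isOpen_compl.mem_nhds hpT))
    · rw [replaceCoc, if_neg (fun h => ha.2 h.1), hf a ha.1 b hb.1]

/-- Adding preconnected pieces touching the closure. -/
theorem IsPreconnected.union_touching {Q : Set X} (hQ : IsPreconnected Q) {ι : Sort*} {A : ι → Set X}
    (hA : ∀ i, IsPreconnected (A i)) (h : ∀ i, (A i ∩ closure Q).Nonempty) :
    IsPreconnected (Q ∪ ⋃ i, A i) := by
  rcases Q.eq_empty_or_nonempty with rfl | ⟨x, hx⟩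
  · have : IsEmpty ι := ⟨fun i => by simpa using h i⟩
    simp [isPreconnected_empty]
  have h1 : ∀ i, IsPreconnected (Q ∪ A i) := by
    intro i
    obtain ⟨y, hyA, hyQ⟩ := h i
    have hQy : IsPreconnected (Q ∪ {y}) := hQ.subset_closure subset_union_left
      (union_subset subset_closure (singleton_subset_iff.mpr hyQ))
    have := hQy.union y (Or.inr rfl) hyA (hA i)
    convert this using 1
    rw [union_assoc, singleton_union, insert_eq_of_mem hyA]
  refine isPreconnected_of_forall x ?_
  rintro y (hy | hy)
  · exact ⟨Q, subset_union_left, hx, hy, hQ⟩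
  · obtain ⟨i, hi⟩ := mem_iUnion.mp hy
    exact ⟨Q ∪ A i, union_subset_union_right _ (subset_iUnion A i), Or.inl hx, Or.inr hi, h1 i⟩

theorem IsPreconnected.of_reach {C A : Set X} (hC : IsPreconnected C) (hCA : C ⊆ A)
    (h : ∀ x ∈ A, ∃ t ⊆ A, IsPreconnected t ∧ x ∈ t ∧ (t ∩ C).Nonempty) : IsPreconnected A := by
  have := hC.union_touching (A := fun x : A => (h x.1 x.2).choose)
    (fun x => (h x.1 x.2).choose_spec.2.1)
    (fun x => (h x.1 x.2).choose_spec.2.2.2.mono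
      (inter_subset_inter_right _ subset_closure))
  convert this using 1
  refine subset_antisymm (fun x hx => Or.inr ?_) (union_subset hCA ?_)
  · exact mem_iUnion.mpr ⟨⟨x, hx⟩, (h x hx).choose_spec.2.2.1⟩
  · exact iUnion_subset fun x => (h x.1 x.2).choose_spec.1

end Replace

/-- The solid torus `{‖z‖ ≤ 1} × S¹`. -/
def soTorus : Set (ℂ × Circle) := {p | ‖p.1‖ ≤ 1}

section Cable

open Complex

/-- The defining function of the cable of radius `r` winding once along `z` per `N` turns. -/
noncomputable def cableFun (N : ℕ) (r : ℝ) (p : ℂ × Circle) : ℂ := p.1 ^ N - r ^ N * p.2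

/-- The cable embedding of the solid torus. -/
noncomputable def cable (N : ℕ) (r η : ℝ) (p : ℂ × Circle) : ℂ × Circle :=
  (r * p.2 * (1 + η * p.1 * (starRingEnd ℂ (p.2 : ℂ)) ^ N) ^ (1 / N : ℂ), p.2 ^ N)

variable {N : ℕ} {r η : ℝ}

theorem continuous_cableFun : Continuous (cableFun N r) := by
  unfold cableFun; fun_prop

theorem circle_mul_conj (u : Circle) : (u : ℂ) * starRingEnd ℂ (u : ℂ) = 1 := by
  rw [mul_conj, normSq_eq_norm_sq, Circle.norm_coe]; simp

theorem cable_arg_norm {p : ℂ × Circle} (hη : 0 < η) (hp : p ∈ soTorus) :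
    ‖(η * p.1 * (starRingEnd ℂ (p.2 : ℂ)) ^ N : ℂ)‖ ≤ η := by
  rw [norm_mul, norm_mul, norm_pow, norm_conj, Circle.norm_coe, one_pow, mul_one, norm_real,
    Real.norm_of_nonneg hη.le]
  exact mul_le_of_le_one_right hη.le hp

theorem cable_fst_pow (hN : N ≠ 0) (p : ℂ × Circle) :
    (cable N r η p).1 ^ N = r ^ N * ((p.2 : ℂ) ^ N + η * p.1) := by
  have h1 := cpow_nat_inv_pow (1 + η * p.1 * (starRingEnd ℂ (p.2 : ℂ)) ^ N) hN
  have h2 : (p.2 : ℂ) ^ N * (starRingEnd ℂ (p.2 : ℂ)) ^ N = 1 := by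
    rw [← mul_pow, circle_mul_conj, one_pow]
  simp only [cable, mul_pow, one_div, h1]
  linear_combination (r : ℂ) ^ N * η * p.1 * h2

theorem cableFun_cable (hN : N ≠ 0) (p : ℂ × Circle) :
    cableFun N r (cable N r η p) = ((r ^ N * η : ℝ) : ℂ) * p.1 := by
  rw [cableFun, cable_fst_pow hN]
  simp only [cable, Circle.coe_pow]; push_cast; ring

theorem cable_norm_pow (hN : N ≠ 0) (hr : 0 < r) (hη : 0 < η) {p : ℂ × Circle}
    (hp : p ∈ soTorus) : r ^ N * (1 - η) ≤ ‖(cable N r η p).1‖ ^ N ∧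
      ‖(cable N r η p).1‖ ^ N ≤ r ^ N * (1 + η) := by
  rw [← norm_pow, cable_fst_pow hN, norm_mul, norm_pow, norm_real, Real.norm_of_nonneg hr.le]
  have h1 : ‖(η * p.1 : ℂ)‖ ≤ η := by
    rw [norm_mul, norm_real, Real.norm_of_nonneg hη.le]
    exact mul_le_of_le_one_right hη.le hp
  have h2 : ‖(p.2 : ℂ) ^ N‖ = 1 := by rw [norm_pow, Circle.norm_coe, one_pow]
  have h3 := norm_add_le ((p.2 : ℂ) ^ N) (η * p.1)
  have h4 := norm_sub_norm_le ((p.2 : ℂ) ^ N) (-(η * p.1))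
  rw [sub_neg_eq_add, norm_neg] at h4
  constructor <;> gcongr <;> linarith

theorem cable_norm (hN : N ≠ 0) (hr : 0 < r) (hη : 0 < η) (hη' : η < 1) {p : ℂ × Circle}
    (hp : p ∈ soTorus) : r * (1 - η) ≤ ‖(cable N r η p).1‖ ∧
      ‖(cable N r η p).1‖ ≤ r * (1 + η) := by
  obtain ⟨h1, h2⟩ := cable_norm_pow hN hr hη hp
  constructor
  · refine le_of_pow_le_pow_left₀ hN (norm_nonneg _) (le_trans ?_ h1)
    rw [mul_pow]; gcongr
    exact pow_le_of_le_one (by linarith) (by linarith) hN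
  · refine le_of_pow_le_pow_left₀ hN (by positivity) (h2.trans ?_)
    rw [mul_pow]; gcongr
    exact le_self_pow₀ (by linarith) hN

theorem cable_injOn (hN : N ≠ 0) (hr : 0 < r) (hη : 0 < η) (hη' : η < 1) :
    InjOn (cable N r η) soTorus := by
  intro p hp q hq h
  have h1 : p.1 = q.1 := by
    have := cableFun_cable (r := r) (η := η) hN p
    rw [h, cableFun_cable hN] at this
    have h0 : ((r ^ N * η : ℝ) : ℂ) ≠ 0 := by
      rw [ofReal_ne_zero]; positivity
    exact (mul_left_cancel₀ h0 this).symm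
  have h2 : p.2 ^ N = q.2 ^ N := congrArg Prod.snd h
  have h3 : starRingEnd ℂ (p.2 : ℂ) ^ N = starRingEnd ℂ (q.2 : ℂ) ^ N := by
    rw [← map_pow, ← map_pow, ← Circle.coe_pow, ← Circle.coe_pow, h2]
  have h4 : (cable N r η p).1 = (cable N r η q).1 := congrArg Prod.fst h
  have hne : (cable N r η q).1 ≠ 0 := by
    rw [← norm_pos_iff]
    exact lt_of_lt_of_le (mul_pos hr (by linarith)) (cable_norm hN hr hη hη' hq).1
  simp only [cable, h1, h3] at h4 hne
  have h5 := mul_right_cancel₀ (right_ne_zero_of_mul hne) h4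
  have h6 := mul_left_cancel₀ (ofReal_ne_zero.mpr hr.ne') h5
  exact Prod.ext h1 (Circle.ext h6)

theorem cable_mem_of_cableFun (hN : N ≠ 0) (hr : 0 < r) (hη : 0 < η) (hη' : η < 1)
    {q : ℂ × Circle} {ρ : ℝ} (hρ : ρ ≤ 1) (hq : ‖cableFun N r q‖ ≤ r ^ N * η * ρ) :
    ∃ p : ℂ × Circle, ‖p.1‖ ≤ ρ ∧ ‖p.1‖ = ‖cableFun N r q‖ / (r ^ N * η) ∧ cable N r η p = q := by
  have hpos : 0 < r ^ N * η := by positivity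
  set ζ : ℂ := cableFun N r q / ((r ^ N * η : ℝ) : ℂ) with hζ
  have hζn : ‖ζ‖ = ‖cableFun N r q‖ / (r ^ N * η) := by
    rw [hζ, norm_div, norm_real, Real.norm_of_nonneg hpos.le]
  have hζ1 : ‖ζ‖ ≤ ρ := by
    rw [hζn, div_le_iff₀ hpos]; linarith
  set w : ℂ := 1 + η * ζ * starRingEnd ℂ (q.2 : ℂ) with hw
  have hw0 : w ≠ 0 := by
    intro h0
    have : ‖(η * ζ * starRingEnd ℂ (q.2 : ℂ) : ℂ)‖ = 1 := by
      rw [show (η * ζ * starRingEnd ℂ (q.2 : ℂ) : ℂ) = -1 by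
        rw [hw] at h0; linear_combination h0]
      simp
    rw [norm_mul, norm_mul, norm_conj, Circle.norm_coe, norm_real, Real.norm_of_nonneg hη.le] at this
    nlinarith [norm_nonneg ζ]
  have hz : q.1 ^ N = r ^ N * q.2 * w := by
    have h1 : cableFun N r q = ((r ^ N * η : ℝ) : ℂ) * ζ := by
      rw [hζ, mul_div_cancel₀]; exact ofReal_ne_zero.mpr hpos.ne'
    rw [cableFun, sub_eq_iff_eq_add] at h1
    rw [h1, hw]; push_cast
    linear_combination -(r : ℂ) ^ N * η * ζ * circle_mul_conj q.2
  set s : ℂ := w ^ (1 / N : ℂ) with hs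
  have hsN : s ^ N = w := by rw [hs, one_div]; exact cpow_nat_inv_pow w hN
  have hs0 : s ≠ 0 := by
    intro h0; rw [h0, zero_pow hN] at hsN; exact hw0 hsN.symm
  have hr0 : (r : ℂ) ≠ 0 := ofReal_ne_zero.mpr hr.ne'
  have huN : (q.1 / (r * s)) ^ N = q.2 := by
    rw [div_pow, mul_pow, hsN, hz]; field_simp
  have hu1 : ‖q.1 / (r * s)‖ = 1 := by
    refine (pow_eq_one_iff_of_nonneg (norm_nonneg _) hN).mp ?_
    rw [← norm_pow, huN, Circle.norm_coe]
  obtain ⟨u, hu⟩ : ∃ u : Circle, (u : ℂ) = q.1 / (r * s) :=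
    ⟨⟨q.1 / (r * s), mem_sphere_zero_iff_norm.mpr hu1⟩, rfl⟩
  rw [← hu] at huN
  refine ⟨(ζ, u), hζ1, hζn, Prod.ext ?_ (Circle.ext (by rw [← huN]; simp [cable]))⟩
  have e : starRingEnd ℂ (u : ℂ) ^ N = starRingEnd ℂ (q.2 : ℂ) := by
    rw [← map_pow, huN]
  simp only [cable]
  rw [e, ← hw, ← hs, hu]
  field_simp

theorem cable_image (hN : N ≠ 0) (hr : 0 < r) (hη : 0 < η) (hη' : η < 1) :
    cable N r η '' soTorus = {q | ‖cableFun N r q‖ ≤ r ^ N * η} := by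
  ext q
  constructor
  · rintro ⟨p, hp, rfl⟩
    have : ‖p.1‖ ≤ 1 := hp
    change ‖_‖ ≤ _
    rw [cableFun_cable hN, norm_mul, norm_real, Real.norm_of_nonneg (by positivity)]
    exact mul_le_of_le_one_right (by positivity) this
  · intro hq
    obtain ⟨p, hp, -, h⟩ := cable_mem_of_cableFun hN hr hη hη' le_rfl (q := q) (by simpa using hq)
    exact ⟨p, hp, h⟩

end Cable

section CableLip

open Complex

theorem norm_pow_sub_pow_le {x y : ℂ} (hx : ‖x‖ ≤ 1) (hy : ‖y‖ ≤ 1) (N : ℕ) :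
    ‖x ^ N - y ^ N‖ ≤ N * ‖x - y‖ := by
  induction N with
  | zero => simp
  | succ n ih =>
    have : x ^ (n + 1) - y ^ (n + 1) = x ^ n * (x - y) + (x ^ n - y ^ n) * y := by ring
    rw [this]
    refine (norm_add_le _ _).trans ?_
    rw [norm_mul, norm_mul, norm_pow]
    have h1 : ‖x‖ ^ n ≤ 1 := pow_le_one₀ (norm_nonneg _) hx
    push_cast
    nlinarith [norm_nonneg (x - y), norm_nonneg (x ^ n - y ^ n), norm_nonneg y]

theorem exists_lipschitz_root (N : ℕ) : ∃ L : ℝ, 0 ≤ L ∧ ∀ w ∈ closedBall (0 : ℂ) (1 / 8),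
    ∀ w' ∈ closedBall (0 : ℂ) (1 / 8),
      ‖(1 + w) ^ (1 / N : ℂ) - (1 + w') ^ (1 / N : ℂ)‖ ≤ L * ‖w - w'‖ := by
  have h : ContDiffOn ℝ 1 (fun w : ℂ => (1 + w) ^ (1 / N : ℂ)) (closedBall 0 (1 / 8)) := by
    have : ContDiffOn ℂ 1 (fun w : ℂ => (1 + w) ^ (1 / N : ℂ)) (closedBall 0 (1 / 8)) := by
      have h2 : DifferentiableOn ℂ (fun w : ℂ => (1 + w) ^ (1 / N : ℂ)) (ball 0 1) := by
        intro w hw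
        refine DifferentiableAt.differentiableWithinAt ?_
        refine DifferentiableAt.cpow_const (by fun_prop) ?_
        refine mem_slitPlane_of_norm_lt_one ?_
        simpa using hw
      exact (h2.contDiffOn isOpen_ball).mono (closedBall_subset_ball (by norm_num))
    exact this.restrict_scalars ℝ
  obtain ⟨K, hK⟩ := h.exists_lipschitzOnWith one_ne_zero (convex_closedBall _ _) (isCompact_closedBall _ _)
  exact ⟨K, K.2, fun w hw w' hw' => by simpa [dist_eq_norm] using hK.dist_le_mul w hw w' hw'⟩

theorem Circle.dist_eq' (u v : Circle) : dist u v = ‖(u : ℂ) - v‖ := by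
  rw [← dist_eq_norm]; rfl

theorem cable_lipschitz (N : ℕ) : ∃ C : ℝ, 0 ≤ C ∧ ∀ r η : ℝ, 0 < r → r ≤ 1 → 0 < η → η ≤ 1 / 8 →
    ∀ p ∈ soTorus, ∀ q ∈ soTorus,
      dist (cable N r η p).1 (cable N r η q).1 ≤ C * (η * dist p.1 q.1 + dist p.2 q.2) ∧
      dist (cable N r η p).2 (cable N r η q).2 ≤ C * dist p.2 q.2 := by
  obtain ⟨L, hL0, hL⟩ := exists_lipschitz_root N
  refine ⟨1 + L + L * N + N, by positivity, fun r η hr hr1 hη hη8 p hp q hq => ⟨?_, ?_⟩⟩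
  · have hb : ∀ p ∈ soTorus, (η * p.1 * (starRingEnd ℂ (p.2 : ℂ)) ^ N : ℂ) ∈ closedBall (0 : ℂ) (1/8) :=
      fun p hp => by simpa using (cable_arg_norm hη hp).trans hη8
    have h1 := hL _ (hb p hp) _ (hb q hq)
    have h2 := hL _ (hb p hp) 0 (by simp)
    have h3 : ‖(η * p.1 * (starRingEnd ℂ (p.2 : ℂ)) ^ N : ℂ)‖ ≤ 1 := (cable_arg_norm hη hp).trans (by linarith)
    set P := (η * p.1 * (starRingEnd ℂ (p.2 : ℂ)) ^ N : ℂ) with hP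
    set Q := (η * q.1 * (starRingEnd ℂ (q.2 : ℂ)) ^ N : ℂ) with hQ
    simp only [add_zero, one_cpow, sub_zero] at h2
    have h4 : ‖(1 + P) ^ (1 / N : ℂ)‖ ≤ 1 + L := by
      calc _ = ‖(1 + P) ^ (1 / N : ℂ) - 1 + 1‖ := by ring_nf
        _ ≤ _ := norm_add_le _ _
        _ ≤ 1 + L := by rw [norm_one]; nlinarith
    have h5 : ‖P - Q‖ ≤ η * ‖p.1 - q.1‖ + N * ‖(p.2 : ℂ) - q.2‖ := by
      have : P - Q = η * (p.1 - q.1) * starRingEnd ℂ (p.2 : ℂ) ^ N + η * q.1 * (starRingEnd ℂ (p.2 : ℂ) ^ N - starRingEnd ℂ (q.2 : ℂ) ^ N) := by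
        rw [hP, hQ]; ring
      rw [this]
      refine (norm_add_le _ _).trans (add_le_add ?_ ?_)
      · simp [abs_of_pos hη, Circle.norm_coe]
      · rw [norm_mul, norm_mul, norm_real, Real.norm_of_nonneg hη.le]
        have e1 := norm_pow_sub_pow_le (x := starRingEnd ℂ (p.2 : ℂ)) (y := starRingEnd ℂ (q.2 : ℂ)) (by simp [Circle.norm_coe]) (by simp [Circle.norm_coe]) N
        rw [← map_sub, norm_conj] at e1
        have : η * ‖q.1‖ ≤ 1 := by
          have : ‖q.1‖ ≤ 1 := hq
          nlinarith [norm_nonneg q.1]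
        calc _ ≤ 1 * ‖starRingEnd ℂ (p.2 : ℂ) ^ N - starRingEnd ℂ (q.2 : ℂ) ^ N‖ := by gcongr
          _ ≤ _ := by rw [one_mul]; exact e1
    rw [dist_eq_norm, dist_eq_norm, Circle.dist_eq']
    have e : (cable N r η p).1 - (cable N r η q).1 =
        r * (((p.2 : ℂ) - q.2) * (1 + P) ^ (1 / N : ℂ) + q.2 * ((1 + P) ^ (1 / N : ℂ) - (1 + Q) ^ (1 / N : ℂ))) := by
      simp only [cable, ← hP, ← hQ]; ring
    rw [e, norm_mul, norm_real, Real.norm_of_nonneg hr.le]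
    have h6 := norm_add_le (((p.2 : ℂ) - q.2) * (1 + P) ^ (1 / N : ℂ)) (q.2 * ((1 + P) ^ (1 / N : ℂ) - (1 + Q) ^ (1 / N : ℂ)))
    rw [norm_mul, norm_mul _ (_ - _), Circle.norm_coe, one_mul] at h6
    have h7 : ‖(p.2 : ℂ) - q.2‖ * ‖(1 + P) ^ (1 / N : ℂ)‖ ≤ ‖(p.2 : ℂ) - q.2‖ * (1 + L) := by gcongr
    have h8 := mul_le_mul_of_nonneg_left h5 hL0
    have h9 := h6.trans (add_le_add h7 (h1.trans h8))
    refine (mul_le_of_le_one_left (norm_nonneg _) hr1).trans (h9.trans ?_)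
    have a1 : 0 ≤ η * ‖p.1 - q.1‖ := by positivity
    have a2 : 0 ≤ ‖(p.2 : ℂ) - q.2‖ := norm_nonneg _
    have a3 : (0 : ℝ) ≤ N := by positivity
    have a4 := mul_nonneg a3 a1
    nlinarith
  · have := norm_pow_sub_pow_le (x := (p.2 : ℂ)) (y := (q.2 : ℂ)) (by simp [Circle.norm_coe]) (by simp [Circle.norm_coe]) N
    simp only [cable, Circle.dist_eq', Circle.coe_pow]
    refine this.trans ?_
    have : 0 ≤ L * N := by positivity
    gcongr; linarith

theorem cable_norm_lt {N : ℕ} (hN : N ≠ 0) {r η : ℝ} (hr : 0 < r) (hr2 : r ≤ 1 / 2) (hη : 0 < η)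
    (hη' : η ≤ 1 / 8) {p : ℂ × Circle} (hp : p ∈ soTorus) : ‖(cable N r η p).1‖ < 3 / 4 := by
  have := (cable_norm hN hr hη (by linarith) hp).2
  nlinarith

theorem cable_ne {N : ℕ} (hN : N ≠ 0) {η : ℝ} (hη : 0 < η) (hη' : η ≤ 1 / 8)
    {p q : ℂ × Circle} (hp : p ∈ soTorus) (hq : q ∈ soTorus) :
    cable N (1 / 4) η p ≠ cable N (1 / 2) η q := by
  intro h
  have h1 := (cable_norm hN (r := 1/4) (by norm_num) hη (by linarith) hp).2
  have h2 := (cable_norm hN (r := 1/2) (by norm_num) hη (by linarith) hq).1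
  rw [h] at h1
  linarith

theorem continuousOn_cable {N : ℕ} {r η : ℝ} (hr : 0 < r) (hr1 : r ≤ 1) (hη : 0 < η) (hη' : η ≤ 1 / 8) :
    ContinuousOn (cable N r η) soTorus := by
  obtain ⟨C, hC0, hC⟩ := cable_lipschitz N
  have : LipschitzOnWith (Real.toNNReal (2 * C)) (cable N r η) soTorus := by
    refine LipschitzOnWith.of_dist_le_mul fun p hp q hq => ?_
    obtain ⟨h1, h2⟩ := hC r η hr hr1 hη hη' p hp q hq
    have e1 : dist p.1 q.1 ≤ dist p q := le_max_left _ _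
    have e2 : dist p.2 q.2 ≤ dist p q := le_max_right _ _
    rw [Real.coe_toNNReal _ (by linarith)]
    refine max_le (h1.trans ?_) (h2.trans ?_)
    · have : η * dist p.1 q.1 + dist p.2 q.2 ≤ 2 * dist p q := by
        have := dist_nonneg (x := p.1) (y := q.1); nlinarith
      nlinarith
    · nlinarith [dist_nonneg (x := p) (y := q)]
  exact this.continuousOn

end CableLip

section Conn

open Complex

theorem IsPreconnected.closure_sdiff_inter_nonempty {X : Type*} [TopologicalSpace X] {S T : Set X} (hS : IsPreconnected S)
    (hT : IsClosed T) (h1 : (S \ T).Nonempty) (h2 : (S ∩ T).Nonempty) :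
    (S ∩ T ∩ closure (S \ T)).Nonempty := by
  by_contra h
  rw [not_nonempty_iff_eq_empty] at h
  obtain ⟨x, hxS, hx1, hx2⟩ := hS Tᶜ (closure (S \ T))ᶜ hT.isOpen_compl isClosed_closure.isOpen_compl
    (fun x hx => by
      by_cases hxT : x ∈ T
      · exact Or.inr fun hc => (h ▸ (⟨⟨hx, hxT⟩, hc⟩ : x ∈ S ∩ T ∩ closure (S \ T)) : x ∈ (∅ : Set X))
      · exact Or.inl hxT) (by obtain ⟨x, hx⟩ := h1; exact ⟨x, hx.1, hx.2⟩)
    (by obtain ⟨x, hx⟩ := h2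
        exact ⟨x, hx.1, fun hc => (h ▸ (⟨hx, hc⟩ : x ∈ S ∩ T ∩ closure (S \ T)) : x ∈ (∅ : Set X))⟩)
  exact hx2 (subset_closure ⟨hxS, hx1⟩)

theorem isPreconnected_circle : IsPreconnected (univ : Set Circle) := by
  have := (isPreconnected_univ (α := ℝ)).image Circle.exp (Circle.exp.continuous.continuousOn)
  rwa [image_univ, Circle.exp_surjective.range_eq] at this

theorem isPreconnected_torus_sphere (r : ℝ) : IsPreconnected {p : ℂ × Circle | ‖p.1‖ = r} := by
  have h1 : IsPreconnected (sphere (0 : ℂ) r) :=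
    isPreconnected_sphere (by rw [rank_real_complex]; norm_num) 0 r
  have := h1.prod isPreconnected_circle
  convert this using 1
  ext p; simp

theorem isPreconnected_solid {S : Set (ℂ × Circle)} (hS : {p : ℂ × Circle | ‖p.1‖ < 1} ⊆ S) (hS' : S ⊆ soTorus)
    {A : Set (ℂ × Circle)}
    (h : ∀ p ∈ S, p ∉ A → ‖p.1‖ < 3 / 4 → ∃ t ⊆ S \ A, IsPreconnected t ∧ p ∈ t ∧ ∃ q ∈ t, ‖q.1‖ = 3 / 4)
    (hA : ∀ p ∈ A, ‖p.1‖ < 3 / 4) : IsPreconnected (S \ A) := by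
  refine (isPreconnected_torus_sphere (3 / 4)).of_reach (fun p hp => ⟨hS ?_, fun h => ?_⟩) ?_
  · show ‖p.1‖ < 1
    rw [show ‖p.1‖ = 3 / 4 from hp]; norm_num
  · exact (hA p h).ne hp
  · rintro p ⟨hpS, hpA⟩
    rcases lt_or_ge ‖p.1‖ (3 / 4) with hlt | hge
    · obtain ⟨t, h1, h2, h3, q, h4, h5⟩ := h p hpS hpA hlt
      exact ⟨t, h1, h2, h3, q, h4, h5⟩
    · have hp1 : ‖p.1‖ ≤ 1 := hS' hpS
      have hp0 : 0 < ‖p.1‖ := by linarith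
      refine ⟨(fun s : ℝ => ((s : ℂ) * p.1, p.2)) '' Icc (3 / 4 / ‖p.1‖) 1, ?_, ?_, ?_, ?_⟩
      · rintro _ ⟨s, hs, rfl⟩
        have hs0 : 0 < s := lt_of_lt_of_le (by positivity) hs.1
        have e : ‖(s : ℂ) * p.1‖ = s * ‖p.1‖ := by
          rw [norm_mul, norm_real, Real.norm_of_nonneg hs0.le]
        constructor
        · rcases hs.2.lt_or_eq with h1 | h1
          · refine hS ?_
            show ‖(s : ℂ) * p.1‖ < 1
            rw [e]; nlinarith
          · rw [h1]; simpa using hpS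
        · intro hc
          have := hA _ hc
          simp only [e] at this
          have h2 := hs.1
          rw [div_le_iff₀ hp0] at h2
          linarith
      · exact isPreconnected_Icc.image _ (by fun_prop)
      · refine ⟨1, ⟨?_, le_rfl⟩, by simp⟩
        rw [div_le_one hp0]; exact hge
      · refine ⟨_, ⟨3 / 4 / ‖p.1‖, ⟨le_rfl, by rw [div_le_one hp0]; exact hge⟩, rfl⟩, ?_⟩
        show ‖((3 / 4 / ‖p.1‖ : ℝ) : ℂ) * p.1‖ = 3 / 4
        rw [norm_mul, norm_real, Real.norm_of_nonneg (by positivity)]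
        field_simp

theorem norm_sub_le_of_cos {s R a b : ℝ} (hs : 0 ≤ s) (hR : 0 ≤ R) (h : Real.cos b ≤ Real.cos a) :
    ‖(s : ℂ) * exp (a * I) - R‖ ≤ ‖(s : ℂ) * exp (b * I) - R‖ := by
  have key : ∀ x : ℝ, ‖(s : ℂ) * exp (x * I) - R‖ ^ 2 = s ^ 2 + R ^ 2 - 2 * s * R * Real.cos x := by
    intro x
    rw [← normSq_eq_norm_sq, normSq_apply]
    simp only [sub_re, sub_im, re_ofReal_mul, im_ofReal_mul, exp_ofReal_mul_I_re, exp_ofReal_mul_I_im,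
      ofReal_re, ofReal_im]
    nlinarith [Real.sin_sq_add_cos_sq x]
  refine le_of_sq_le_sq ?_ (norm_nonneg _) |> id
  rw [key, key]
  nlinarith [mul_nonneg hs hR]

/-- The part of the solid torus outside two parallel cables is connected. -/
theorem isPreconnected_compl_cables {N : ℕ} (hN : N ≠ 0) {η : ℝ} (hη : 0 < η) (hη' : η ≤ 1 / 8)
    {S : Set (ℂ × Circle)} (hS : {p : ℂ × Circle | ‖p.1‖ < 1} ⊆ S) (hS' : S ⊆ soTorus) :
    IsPreconnected (S \ (cable N (1 / 4) η '' soTorus ∪ cable N (1 / 2) η '' soTorus)) := by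
  refine isPreconnected_solid hS hS' ?_ ?_
  · intro p hpS hpA hlt
    rw [cable_image hN (by norm_num) hη (by linarith), cable_image hN (by norm_num) hη (by linarith)] at hpA ⊢
    set e : ℂ := exp (arg p.1 * I) with he
    have hpe : p.1 = ‖p.1‖ * e := (norm_mul_exp_arg_mul_I _).symm
    set α : ℝ := arg (e ^ N * starRingEnd ℂ (p.2 : ℂ)) with hα
    have hen : ‖e‖ = 1 := norm_exp_ofReal_mul_I _
    have heα : e ^ N = p.2 * exp (α * I) := by
      have := norm_mul_exp_arg_mul_I (e ^ N * starRingEnd ℂ (p.2 : ℂ))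
      rw [norm_mul, norm_pow, hen, norm_conj, Circle.norm_coe, ← hα] at this
      simp only [one_pow, mul_one, ofReal_one, one_mul] at this
      rw [this]
      linear_combination -e ^ N * circle_mul_conj p.2
    obtain ⟨ε, hε, hεα⟩ : ∃ ε : ℝ, (ε = 1 ∨ ε = -1) ∧ α = ε * |α| := by
      rcases abs_choice α with h | h
      · exact ⟨1, Or.inl rfl, by rw [h, one_mul]⟩
      · exact ⟨-1, Or.inr rfl, by rw [h]; ring⟩
    have hcos : ∀ τ, Real.cos (ε * τ) = Real.cos τ := by
      intro τ; rcases hε with h | h <;> simp [h]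
    set g : ℝ × ℝ → ℂ × Circle := fun q => (q.2 * (e * exp ((ε * (q.1 - |α|) / N : ℝ) * I)), p.2) with hg
    have hgc : Continuous g := by rw [hg]; fun_prop
    have hgN : ∀ q : ℝ × ℝ, 0 ≤ q.2 → ‖(g q).1‖ = q.2 := by
      intro q hq
      simp only [hg, norm_mul, norm_real, Real.norm_of_nonneg hq, hen, norm_exp_ofReal_mul_I, mul_one]
    have hgP : ∀ (r : ℝ) (q : ℝ × ℝ), ‖cableFun N r (g q)‖ = ‖((q.2 ^ N : ℝ) : ℂ) * exp ((ε * q.1 : ℝ) * I) - ((r ^ N : ℝ) : ℂ)‖ := by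
      intro r q
      have : cableFun N r (g q) = p.2 * (((q.2 ^ N : ℝ) : ℂ) * exp ((ε * q.1 : ℝ) * I) - ((r ^ N : ℝ) : ℂ)) := by
        simp only [cableFun, hg, mul_pow, heα, ← exp_nat_mul]
        have : exp (α * I) * exp (N * ((ε * (q.1 - |α|) / N : ℝ) * I)) = exp ((ε * q.1 : ℝ) * I) := by
          have e1 : (α : ℂ) = ε * (|α| : ℝ) := by exact_mod_cast hεα
          have e2 : (N : ℂ) * ((ε * (q.1 - |α|) / N : ℝ) * I) = (ε * (q.1 - |α|) : ℝ) * I := by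
            push_cast; field_simp
          rw [← exp_add, e2]; congr 1
          push_cast
          linear_combination I * e1
        rw [← this]; push_cast; ring
      rw [this, norm_mul, Circle.norm_coe, one_mul]
    have hα0 := abs_nonneg α
    have hαπ : |α| ≤ Real.pi := abs_arg_le_pi _
    have hgp : g (|α|, ‖p.1‖) = p := by
      simp only [hg, sub_self, mul_zero, zero_div, ofReal_zero, zero_mul, exp_zero, mul_one]
      rw [← hpe]
    have hs1 : IsPreconnected (Icc |α| Real.pi ×ˢ {‖p.1‖} : Set (ℝ × ℝ)) :=
      isPreconnected_Icc.prod isPreconnected_singleton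
    have hs2 : IsPreconnected ({Real.pi} ×ˢ Icc ‖p.1‖ (3 / 4) : Set (ℝ × ℝ)) :=
      isPreconnected_singleton.prod isPreconnected_Icc
    have hs := hs1.union (Real.pi, ‖p.1‖) (by simp [hαπ]) (by simp [hlt.le]) hs2
    have hsN : ∀ q ∈ (Icc |α| Real.pi ×ˢ {‖p.1‖} ∪ {Real.pi} ×ˢ Icc ‖p.1‖ (3 / 4) : Set (ℝ × ℝ)), 0 ≤ q.2 ∧ q.2 ≤ 3 / 4 := by
      rintro ⟨a, b⟩ (⟨-, hb⟩ | ⟨-, hb⟩)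
      · rw [show b = ‖p.1‖ from hb]; exact ⟨norm_nonneg _, hlt.le⟩
      · exact ⟨(norm_nonneg _).trans hb.1, hb.2⟩
    have hmono : ∀ r : ℝ, 0 ≤ r → ∀ q ∈ (Icc |α| Real.pi ×ˢ {‖p.1‖} ∪ {Real.pi} ×ˢ Icc ‖p.1‖ (3 / 4) : Set (ℝ × ℝ)),
        ‖cableFun N r p‖ ≤ ‖cableFun N r (g q)‖ := by
      intro r hr q hq
      have h1 : ∀ τ ∈ Icc |α| Real.pi, ‖cableFun N r p‖ ≤ ‖cableFun N r (g (τ, ‖p.1‖))‖ := by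
        intro τ hτ
        conv_lhs => rw [← hgp]
        rw [hgP, hgP]
        refine norm_sub_le_of_cos (by positivity) (by positivity) ?_
        rw [hcos, hcos]
        exact Real.cos_le_cos_of_nonneg_of_le_pi hα0 hτ.2 hτ.1
      obtain ⟨a, b⟩ := q
      rcases hq with ⟨ha, hb⟩ | ⟨ha, hb⟩
      · rw [show b = ‖p.1‖ from hb]; exact h1 a ha
      · rw [show a = Real.pi from ha]
        refine (h1 _ ⟨hαπ, le_rfl⟩).trans ?_
        have h2 : ∀ s : ℝ, 0 ≤ s → ‖cableFun N r (g (Real.pi, s))‖ = s ^ N + r ^ N := by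
          intro s hs
          rw [hgP]
          have : exp ((ε * Real.pi : ℝ) * I) = -1 := by
            rcases hε with h | h
            · simp [h, exp_pi_mul_I]
            · simp [h, exp_neg, exp_pi_mul_I]
          simp only [this]
          rw [show ((s ^ N : ℝ) : ℂ) * -1 - ((r ^ N : ℝ) : ℂ) = -((s ^ N + r ^ N : ℝ) : ℂ) by push_cast; ring,
            norm_neg, norm_real, Real.norm_of_nonneg (by positivity)]
        rw [h2 _ (norm_nonneg _), h2 _ ((norm_nonneg _).trans hb.1)]
        have := pow_le_pow_left₀ (norm_nonneg p.1) hb.1 N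
        linarith
    refine ⟨_, ?_, hs.image g hgc.continuousOn, ⟨(|α|, ‖p.1‖), Or.inl ⟨⟨le_rfl, hαπ⟩, rfl⟩, hgp⟩,
      g (Real.pi, 3 / 4), ⟨(Real.pi, 3 / 4), Or.inr ⟨mem_singleton _, hlt.le, le_rfl⟩, rfl⟩, hgN _ (by norm_num)⟩
    rintro _ ⟨q, hq, rfl⟩
    refine ⟨hS ?_, ?_⟩
    · show ‖(g q).1‖ < 1
      rw [hgN q (hsN q hq).1]; linarith [(hsN q hq).2]
    · rintro (hc | hc)
      · exact hpA (Or.inl ((hmono _ (by norm_num) q hq).trans hc))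
      · exact hpA (Or.inr ((hmono _ (by norm_num) q hq).trans hc))
  · rintro _ (⟨p, hp, rfl⟩ | ⟨p, hp, rfl⟩)
    · exact cable_norm_lt hN (by norm_num) (by norm_num) hη hη' hp
    · exact cable_norm_lt hN (by norm_num) (by norm_num) hη hη' hp

end Conn

section CableLower

open Complex

variable {G : Type*} [Group G]

theorem pow_half_lt {N : ℕ} (hN : N ≠ 0) {r : ℝ} (hr : 0 < r) (hr2 : r ≤ 1 / 2) : r ^ N < (3 / 4 : ℝ) ^ N :=
  pow_lt_pow_left₀ (by linarith) hr.le hN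

theorem cable_lower {N : ℕ} (hN : N ≠ 0) {r η : ℝ} (hr : 0 < r) (hr2 : r ≤ 1 / 2) (hη : 0 < η)
    (hη' : η ≤ 1 / 8) (x : G) : ∃ τ : ℂ × Circle → ℂ × Circle → G,
      IsCoc {p | cableFun N r p ≠ 0} τ ∧
      Loc {p : ℂ × Circle | 3 / 4 ≤ ‖p.1‖} (fun a b => τ a b = st (x ^ N) a.1 b.1) ∧
      ∀ a ∈ cable N r η '' soTorus, ∀ b ∈ cable N r η '' soTorus,
        τ a b = st x (cableFun N r a) (cableFun N r b) := by
  have h0 : IsCoc {p | cableFun N r p ≠ 0} (fun a b => st x (cableFun N r a) (cableFun N r b)) :=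
    (isCoc_st x).comp continuous_cableFun.continuousOn fun p hp => hp
  have hb := pow_half_lt hN hr hr2
  have h1 : IsCoc (Icc (0 : ℝ) 1 ×ˢ {p : ℂ × Circle | 3 / 4 ≤ ‖p.1‖})
      (fun a b => st x (a.2.1 ^ N - a.1 * r ^ N * a.2.2) (b.2.1 ^ N - b.1 * r ^ N * b.2.2)) := by
    refine (isCoc_st x).comp (φ := fun a : ℝ × (ℂ × Circle) => a.2.1 ^ N - a.1 * r ^ N * a.2.2) (by fun_prop) ?_
    rintro ⟨t, z, v⟩ ⟨ht, hz⟩ hc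
    have e1 : z ^ N = t * r ^ N * v := by
      have : z ^ N - t * r ^ N * v = 0 := hc
      linear_combination this
    have e2 := congrArg norm e1
    rw [norm_pow, norm_mul, norm_mul, norm_pow, norm_real, norm_real, Circle.norm_coe,
      Real.norm_of_nonneg hr.le, Real.norm_of_nonneg ht.1] at e2
    have e3 : (3 / 4 : ℝ) ^ N ≤ ‖z‖ ^ N := pow_le_pow_left₀ (by norm_num) hz N
    have e4 : t * r ^ N ≤ r ^ N := mul_le_of_le_one_left (by positivity) ht.2
    linarith
  obtain ⟨f1, hf1⟩ := h1.homotopy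
  obtain ⟨f2, hf2⟩ := st_pow_iso x N
  have h2 : IsIso {p : ℂ × Circle | 3 / 4 ≤ ‖p.1‖} (fun a b => st x (a.1 ^ N) (b.1 ^ N))
      (fun a b => st (x ^ N) a.1 b.1) fun a => f2 a.1 :=
    Loc.comp (φ := fun a : ℂ × Circle => a.1) hf2 (by fun_prop) fun a (ha : 3 / 4 ≤ ‖a.1‖) h => by
      rw [show a.1 = 0 from h, norm_zero] at ha; norm_num at ha
  classical
  let f : ℂ × Circle → G := fun a => if 3 / 4 ≤ ‖a.1‖ then f2 a.1 * f1 a else 1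
  refine ⟨fun a b => f a * st x (cableFun N r a) (cableFun N r b) * (f b)⁻¹, ?_, ?_, ?_⟩
  · refine IsIso.isCoc (f := fun a => (f a)⁻¹) ?_ h0
    refine fun p hp => ⟨univ, Filter.univ_mem, fun a _ b _ => ?_⟩
    simp
  · refine (hf1.and h2).imp ?_
    rintro a (ha : 3 / 4 ≤ ‖a.1‖) b (hb : 3 / 4 ≤ ‖b.1‖) ⟨e1, e2⟩
    simp only [ofReal_one, one_mul, ofReal_zero, zero_mul, sub_zero] at e1
    beta_reduce at e2
    rw [e2] at e1
    simp only [f, ha, hb, if_true, cableFun, e1]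
    group
  · rintro _ ⟨a, ha, rfl⟩ _ ⟨b, hb, rfl⟩
    have e1 := (cable_norm_lt hN hr hr2 hη hη' ha).not_ge
    have e2 := (cable_norm_lt hN hr hr2 hη hη' hb).not_ge
    simp [f, e1, e2]

end CableLower

section CableUpper

open Complex

variable {G : Type*} [Group G]

theorem IsPot.monodromy {E : Type*} [TopologicalSpace E] {s : Set E} (hs : IsPreconnected s) {σ : E → E → G} {F : E → G}
    (h : IsPot s σ F) {T : E → E} (hT : ContinuousOn T s) (hTs : MapsTo T s s)
    (hσ : ∀ a ∈ s, ∀ b ∈ s, σ (T a) (T b) = σ a b) {a b : E} (ha : a ∈ s) (hb : b ∈ s) :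
    F (T a) * (F a)⁻¹ = F (T b) * (F b)⁻¹ := by
  have h1 : IsPot s σ (F ∘ T) := by
    refine Loc.imp (Loc.comp (φ := T) h hT hTs) ?_
    intro a ha b hb h
    rw [← hσ a ha b hb, h]; rfl
  exact (h1.div_locConst h).eq hs ha hb

theorem exp_add_two_pi (s : ℝ) : exp (((s + 2 * Real.pi : ℝ) : ℂ) * I) = exp (s * I) := by
  push_cast; rw [add_mul]; exact exp_periodic _

theorem cable_meridian {N : ℕ} (hN : N ≠ 0) {r η : ℝ} (hr : 0 < r) (hr2 : r ≤ 1 / 2) (hη : 0 < η)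
    (hη' : η ≤ 1 / 8) (hG : ∀ g : G, g ^ N = 1) {τ : ℂ × Circle → ℂ × Circle → G}
    (hτ : IsCoc (soTorus \ cable N r η '' soTorus) τ) {ρ : ℝ} (hρ : ρ ∈ Icc (3 / 4 : ℝ) 1) (v : Circle)
    {h : ℝ → G} (hh : IsPot univ (fun s t : ℝ => τ (ρ * exp (s * I), v) (ρ * exp (t * I), v)) h) (s : ℝ) :
    h (s + 2 * Real.pi) = h s := by
  rw [cable_image hN hr hη (by linarith)] at hτ
  have hρ0 : 0 < ρ := by linarith [hρ.1]
  have hrN : r ^ N * η < r ^ N := by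
    have : 0 < r ^ N := by positivity
    nlinarith
  -- potential on the torus of radius `ρ`
  obtain ⟨F, hF⟩ : ∃ F : ℝ × ℝ → G, IsPot univ (fun a b : ℝ × ℝ =>
      τ (ρ * exp (a.1 * I), Circle.exp a.2) (ρ * exp (b.1 * I), Circle.exp b.2)) F := by
    refine IsCoc.trivial_of_convex convex_univ (hτ.comp (φ := fun a : ℝ × ℝ => ((ρ : ℂ) * exp (a.1 * I), Circle.exp a.2))
      (by fun_prop) ?_)
    rintro ⟨a, b⟩ -
    have e0 : ‖(ρ : ℂ) * exp (a * I)‖ = ρ := by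
      rw [norm_mul, norm_exp_ofReal_mul_I, norm_real, Real.norm_of_nonneg hρ0.le, mul_one]
    refine ⟨e0.trans_le hρ.2, fun (hle : ‖cableFun N r ((ρ : ℂ) * exp (a * I), Circle.exp b)‖ ≤ r ^ N * η) => hle.not_gt ?_⟩
    have e1 := norm_sub_norm_le (((ρ : ℂ) * exp (a * I)) ^ N) ((r : ℂ) ^ N * Circle.exp b)
    rw [norm_pow, e0, norm_mul, Circle.norm_coe, norm_pow, norm_real, Real.norm_of_nonneg hr.le, mul_one] at e1
    refine lt_of_lt_of_le ?_ e1
    have e2 : (3 / 4 : ℝ) ^ N ≤ ρ ^ N := pow_le_pow_left₀ (by norm_num) hρ.1 N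
    have e3 : (3 / 2 : ℝ) * (1/2) ^ N ≤ (3 / 4) ^ N := by
      have : (1/2 : ℝ) ^ N * (3/2) ^ N = (3/4)^N := by rw [← mul_pow]; norm_num
      rw [← this]
      have : (3/2 : ℝ) ≤ (3/2)^N := le_self_pow₀ (by norm_num) hN
      nlinarith [pow_pos (show (0:ℝ) < 1/2 by norm_num) N]
    have e4 : r ^ N ≤ (1/2) ^ N := pow_le_pow_left₀ hr.le hr2 N
    nlinarith [pow_pos (show (0:ℝ) < 1/2 by norm_num) N]
  -- potential along the curve parallel to the cable
  set c : ℝ × ℝ → ℂ × Circle := fun a => ((a.1 : ℂ) * exp ((a.2 + Real.pi / N : ℝ) * I), Circle.exp (N * a.2)) with hc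
  have hcc : Continuous c := by rw [hc]; fun_prop
  obtain ⟨E, hE⟩ : ∃ E : ℝ × ℝ → G, IsPot (Icc 0 ρ ×ˢ univ) (fun a b : ℝ × ℝ => τ (c a) (c b)) E := by
    refine IsCoc.trivial_of_convex ((convex_Icc _ _).prod convex_univ) (hτ.comp (φ := c) hcc.continuousOn ?_)
    rintro ⟨a, b⟩ ⟨ha, -⟩
    have e0 : ‖(c (a, b)).1‖ = a := by
      simp only [hc]
      rw [norm_mul, norm_exp_ofReal_mul_I, norm_real, Real.norm_of_nonneg ha.1, mul_one]
    refine ⟨e0.trans_le (ha.2.trans hρ.2), fun (hle : ‖cableFun N r (c (a, b))‖ ≤ r ^ N * η) => hle.not_gt ?_⟩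
    have e1 : cableFun N r (c (a, b)) = -((a ^ N + r ^ N : ℝ) * exp ((N * b : ℝ) * I)) := by
      simp only [cableFun, hc, mul_pow, ← exp_nat_mul, Circle.coe_exp]
      have : exp (N * (((b + Real.pi / N : ℝ) : ℂ) * I)) = - exp ((N * b : ℝ) * I) := by
        rw [show (N : ℂ) * (((b + Real.pi / N : ℝ) : ℂ) * I) = (N * b : ℝ) * I + Real.pi * I by
          push_cast; field_simp, exp_add, exp_pi_mul_I]; ring
      rw [this]; push_cast; ring
    rw [e1, norm_neg, norm_mul, norm_exp_ofReal_mul_I, norm_real, mul_one]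
    have := pow_nonneg ha.1 N
    rw [Real.norm_of_nonneg (by positivity)]
    linarith
  -- potential along the core
  obtain ⟨D, hD⟩ : ∃ D : ℝ → G, IsPot univ (fun a b : ℝ => τ (0, Circle.exp a) (0, Circle.exp b)) D := by
    refine IsCoc.trivial_of_convex convex_univ (hτ.comp (φ := fun a : ℝ => ((0 : ℂ), Circle.exp a)) (by fun_prop) ?_)
    rintro a -
    refine ⟨by simp [soTorus], fun (hle : ‖cableFun N r (0, Circle.exp a)‖ ≤ r ^ N * η) => hle.not_gt ?_⟩
    rw [cableFun, zero_pow hN, zero_sub, norm_neg, norm_mul, Circle.norm_coe, norm_pow, norm_real,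
      Real.norm_of_nonneg hr.le, mul_one]
    exact hrN
  have key1 : E (0, 2 * Real.pi) = E (0, 0) := by
    have h1 : IsPot univ (fun a b : ℝ => τ (0, Circle.exp (N * a)) (0, Circle.exp (N * b))) fun x => E (0, x) := by
      refine Loc.imp (Loc.comp (φ := fun x : ℝ => ((0 : ℝ), x)) hE (s := univ) (by fun_prop)
        fun x _ => ⟨⟨le_rfl, hρ0.le⟩, mem_univ _⟩) ?_
      intro a _ b _ h
      simpa [hc] using h
    have h2 : IsPot univ (fun a b : ℝ => τ (0, Circle.exp (N * a)) (0, Circle.exp (N * b))) fun x => D (N * x) :=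
      Loc.comp (φ := fun x : ℝ => (N : ℝ) * x) hD (s := univ) (by fun_prop) fun _ _ => mem_univ _
    have h3 := (h1.div_locConst h2).eq isPreconnected_univ (mem_univ (2 * Real.pi)) (mem_univ 0)
    have h4 : ∀ k : ℕ, D (k * (2 * Real.pi)) = (D (2 * Real.pi) * (D 0)⁻¹) ^ k * D 0 := by
      intro k
      induction k with
      | zero => simp
      | succ k ih =>
        have := hD.monodromy isPreconnected_univ (T := fun x => x + 2 * Real.pi) (by fun_prop)
          (mapsTo_univ _ _) (fun a _ b _ => by simp only [Circle.exp_add_two_pi])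
          (mem_univ (k * (2 * Real.pi))) (mem_univ 0)
        rw [zero_add, mul_inv_eq_iff_eq_mul, ih] at this
        rw [pow_succ', mul_assoc, ← this]
        congr 1; push_cast; ring
    simp only [h4, hG, mul_zero, one_mul] at h3
    exact mul_right_cancel h3
  have key2 : E (ρ, 2 * Real.pi) = E (ρ, 0) := by
    have := hE.monodromy ((isPreconnected_Icc).prod isPreconnected_univ) (T := fun x => (x.1, x.2 + 2 * Real.pi)) (by fun_prop)
      (fun x hx => ⟨hx.1, mem_univ _⟩) (fun a _ b _ => by
        have : ∀ a : ℝ × ℝ, c (a.1, a.2 + 2 * Real.pi) = c a := by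
          intro a
          simp only [hc]
          congr 1
          · rw [add_right_comm, _root_.exp_add_two_pi]
          · have := (Circle.periodic_exp.nat_mul N) (N * a.2)
            rw [← this]; congr 1; ring
        simp only [this]) (a := (ρ, 0)) (b := (0, 0)) ⟨⟨hρ0.le, le_rfl⟩, mem_univ _⟩ ⟨⟨le_rfl, hρ0.le⟩, mem_univ _⟩
    simp only [zero_add, key1] at this
    rw [mul_inv_cancel, mul_inv_eq_one] at this
    exact this
  have key3 : F (Real.pi / N + 2 * Real.pi, N * (2 * Real.pi)) = F (Real.pi / N, 0) := by
    have h1 : IsPot univ (fun a b : ℝ => τ (c (ρ, a)) (c (ρ, b))) fun x => E (ρ, x) :=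
      Loc.comp (φ := fun x : ℝ => ((ρ : ℝ), x)) hE (s := univ) (by fun_prop)
        fun x _ => ⟨⟨hρ0.le, le_rfl⟩, mem_univ _⟩
    have h2 : IsPot univ (fun a b : ℝ => τ (c (ρ, a)) (c (ρ, b))) fun x => F (x + Real.pi / N, N * x) :=
      Loc.comp (φ := fun x : ℝ => (x + Real.pi / N, (N : ℝ) * x)) hF (s := univ) (by fun_prop) fun _ _ => mem_univ _
    have h3 := (h1.div_locConst h2).eq isPreconnected_univ (mem_univ (2 * Real.pi)) (mem_univ 0)
    simp only [key2, mul_zero, zero_add] at h3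
    rw [add_comm]
    exact inv_injective (mul_left_cancel h3)
  have hFθ : ∀ (k : ℕ) (s : ℝ), F (s, k * (2 * Real.pi)) = (F (0, 2 * Real.pi) * (F (0, 0))⁻¹) ^ k * F (s, 0) := by
    intro k s
    induction k with
    | zero => simp
    | succ k ih =>
      have := hF.monodromy isPreconnected_univ (T := fun x => (x.1, x.2 + 2 * Real.pi)) (by fun_prop)
        (mapsTo_univ _ _) (fun a _ b _ => by simp only [Circle.exp_add_two_pi])
        (mem_univ (s, (k * (2 * Real.pi)))) (mem_univ (0, 0))
      rw [zero_add, mul_inv_eq_iff_eq_mul, ih] at this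
      rw [pow_succ', mul_assoc, ← this]
      congr 2; push_cast; ring
  rw [hFθ, hG, one_mul] at key3
  obtain ⟨θ, rfl⟩ := Circle.exp_surjective v
  have h1 : IsPot univ (fun s t : ℝ => τ (ρ * exp (s * I), Circle.exp θ) (ρ * exp (t * I), Circle.exp θ)) fun s => F (s, θ) :=
    Loc.comp (φ := fun x : ℝ => (x, θ)) hF (s := univ) (by fun_prop) fun _ _ => mem_univ _
  have h2 := (hh.div_locConst h1).eq isPreconnected_univ (mem_univ (s + 2 * Real.pi)) (mem_univ s)
  have h3 := hF.monodromy isPreconnected_univ (T := fun x => (x.1 + 2 * Real.pi, x.2)) (by fun_prop)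
        (mapsTo_univ _ _) (fun a _ b _ => by simp only [_root_.exp_add_two_pi])
        (mem_univ (s, θ)) (mem_univ (Real.pi / N, 0))
  simp only [key3] at h3
  rw [mul_inv_cancel, mul_inv_eq_one] at h3
  simp only [h3] at h2
  exact mul_right_cancel h2

theorem cable_upper {N : ℕ} (hN : N ≠ 0) {r η : ℝ} (hr : 0 < r) (hr2 : r ≤ 1 / 2) (hη : 0 < η)
    (hη' : η ≤ 1 / 8) (hG : ∀ g : G, g ^ N = 1) {Y : Type*} [TopologicalSpace Y]
    {τ : ℂ × (Circle × Y) → ℂ × (Circle × Y) → G}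
    (hτ : IsCoc {p | (p.1, p.2.1) ∈ soTorus \ cable N r η '' soTorus} τ) :
    ∃ f, IsIso {p : ℂ × (Circle × Y) | ‖p.1‖ ∈ Icc (3 / 4 : ℝ) 1} τ (fun a b => τ (1, a.2) (1, b.2)) f := by
  have hT : ∀ p : ℂ × (Circle × Y), ‖p.1‖ ∈ Icc (3 / 4 : ℝ) 1 → (p.1, p.2.1) ∈ soTorus \ cable N r η '' soTorus := by
    intro p hp
    refine ⟨hp.2, ?_⟩
    rintro ⟨q, hq, hqp⟩
    have := cable_norm_lt hN hr hr2 hη hη' hq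
    rw [hqp] at this
    exact this.not_ge hp.1
  have h1 : IsCoc (Icc (0 : ℝ) 1 ×ˢ (Icc (3 / 4 : ℝ) 1 ×ˢ univ ×ˢ univ : Set (ℝ × ℝ × (Circle × Y))))
      (fun a b => τ ((1 + a.1 * (a.2.1 - 1) : ℝ) * exp ((a.1 * a.2.2.1 : ℝ) * I), a.2.2.2)
        ((1 + b.1 * (b.2.1 - 1) : ℝ) * exp ((b.1 * b.2.2.1 : ℝ) * I), b.2.2.2)) := by
    refine hτ.comp (φ := fun a : ℝ × (ℝ × ℝ × (Circle × Y)) => (((1 + a.1 * (a.2.1 - 1) : ℝ) : ℂ) * exp ((a.1 * a.2.2.1 : ℝ) * I), a.2.2.2)) (by fun_prop) ?_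
    rintro ⟨t, ρ, s, w⟩ ⟨ht, hρ, -⟩
    refine hT _ ?_
    have h0 := ht.1; have h1 := ht.2; have h2 := hρ.1; have h3 := hρ.2
    simp only at h0 h1 h2 h3
    have : (3 / 4 : ℝ) ≤ 1 + t * (ρ - 1) := by nlinarith
    simp only [norm_mul, norm_exp_ofReal_mul_I, norm_real, mul_one]
    rw [Real.norm_of_nonneg (by linarith)]
    exact ⟨this, by nlinarith⟩
  obtain ⟨f, hf⟩ := h1.homotopy
  simp only [zero_mul, add_zero, ofReal_one, ofReal_zero, exp_zero, one_mul, add_sub_cancel] at hf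
  refine ⟨_, (IsIso.of_polar (R := Icc (3 / 4 : ℝ) 1) (W := univ) (fun x hx => ?_) hf ?_).mono fun p hp => ⟨hp, mem_univ _⟩⟩
  · exact lt_of_lt_of_le (by norm_num) hx.1
  · rintro ρ hρ s ⟨v, y⟩ -
    have hτy : IsCoc (soTorus \ cable N r η '' soTorus) (fun a b => τ (a.1, a.2, y) (b.1, b.2, y)) :=
      hτ.comp (φ := fun a : ℂ × Circle => (a.1, a.2, y)) (by fun_prop) fun a ha => ha
    refine cable_meridian hN hr hr2 hη hη' hG hτy hρ v (h := fun s => f (ρ, s, v, y)) ?_ s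
    refine Loc.imp (Loc.comp (φ := fun s : ℝ => (ρ, s, v, y)) hf (s := univ) (by fun_prop)
      fun _ _ => ⟨hρ, mem_univ _, mem_univ _⟩) ?_
    intro a _ b _ h
    have : τ (1, v, y) (1, v, y) = 1 := hτ.self (hT _ (by norm_num))
    simpa [this] using h

end CableUpper

section Chain

open Complex

/-- The level function of the chain in the solid torus. -/
noncomputable def chE (k : ℕ) (p : ℂ × Circle) : ℝ :=
  2 * ((p.2 : ℂ) ^ k).re - 9 * p.1.re ^ 2 + 9 * p.1.im ^ 2

/-- The defining function of the rings of the first kind. -/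
noncomputable def chA (k : ℕ) (p : ℂ × Circle) : ℂ := ⟨chE k p + 1, 3 * p.1.im⟩

/-- The defining function of the rings of the second kind. -/
noncomputable def chB (k : ℕ) (p : ℂ × Circle) : ℂ := ⟨1 - chE k p, 3 * p.1.re⟩

/-- The radius of a ring in the chain. -/
noncomputable def chRad (ζ : ℂ) : ℝ := √(3 + (ζ.im / 8) ^ 2 - ζ.re / 8)

/-- The meridional coordinate of a ring. -/
noncomputable def chZ (p : ℂ × ℂ) : ℂ := ((chRad p.1 * p.2.re / 3 : ℝ) : ℂ) + ((p.1.im / 24 : ℝ) : ℂ) * I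

/-- The longitudinal coordinate of a ring. -/
noncomputable def chθ (p : ℂ × ℂ) : ℝ := 2 * Real.arcsin (chRad p.1 * p.2.im / 2)

/-- The rings of the first kind. -/
noncomputable def ringA (k : ℕ) (j : Fin k) (p : ℂ × Circle) : ℂ × Circle :=
  (chZ (p.1, p.2), Circle.exp ((2 * Real.pi * j + chθ (p.1, p.2)) / k))

/-- The symmetry exchanging the two kinds of rings. -/
noncomputable def chSymm (k : ℕ) (p : ℂ × Circle) : ℂ × Circle :=
  (I * starRingEnd ℂ p.1, p.2 * Circle.exp (Real.pi / k))

/-- The rings of the chain. -/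
noncomputable def ring (k : ℕ) (i : Bool × Fin k) (p : ℂ × Circle) : ℂ × Circle :=
  if i.1 then chSymm k (ringA k i.2 p) else ringA k i.2 p

variable {k : ℕ}

theorem continuous_chE : Continuous (chE k) := by unfold chE; fun_prop

theorem chA_eq (p : ℂ × Circle) : chA k p = ((chE k p + 1 : ℝ) : ℂ) + ((3 * p.1.im : ℝ) : ℂ) * I :=
  mk_eq_add_mul_I _ _

theorem chB_eq (p : ℂ × Circle) : chB k p = ((1 - chE k p : ℝ) : ℂ) + ((3 * p.1.re : ℝ) : ℂ) * I :=
  mk_eq_add_mul_I _ _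

theorem continuous_chA : Continuous (chA k) := by
  have := continuous_chE (k := k)
  simp only [funext chA_eq]; fun_prop

theorem continuous_chB : Continuous (chB k) := by
  have := continuous_chE (k := k)
  simp only [funext chB_eq]; fun_prop

theorem Circle.exp_pi_div_pow (hk : k ≠ 0) : (Circle.exp (Real.pi / k) : ℂ) ^ k = -1 := by
  rw [Circle.coe_exp, ← exp_nat_mul, ← exp_pi_mul_I]
  congr 1; push_cast; field_simp

theorem chE_chSymm (hk : k ≠ 0) (p : ℂ × Circle) : chE k (chSymm k p) = -chE k p := by
  have : (((chSymm k p).2 : ℂ) ^ k).re = -((p.2 : ℂ) ^ k).re := by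
    simp only [chSymm, Circle.coe_mul, mul_pow, Circle.exp_pi_div_pow hk]; simp
  simp only [chE, this]
  simp only [chSymm, mul_re, mul_im, I_re, I_im, conj_re, conj_im]; ring

theorem chA_chSymm (hk : k ≠ 0) (p : ℂ × Circle) : chA k (chSymm k p) = chB k p := by
  simp only [chA, chB, chE_chSymm hk]
  apply Complex.ext <;> simp [chSymm]; ring

theorem chB_chSymm (hk : k ≠ 0) (p : ℂ × Circle) : chB k (chSymm k p) = chA k p := by
  simp only [chA, chB, chE_chSymm hk]
  apply Complex.ext <;> simp [chSymm]; ring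

theorem chSymm_injective : Function.Injective (chSymm k) := by
  intro p q h
  have h1 := congrArg Prod.fst h
  have h2 := congrArg Prod.snd h
  simp only [chSymm, mul_right_inj' I_ne_zero, mul_left_inj] at h1 h2
  exact Prod.ext ((starRingEnd ℂ).injective h1) h2

theorem chSymm_surjective : Function.Surjective (chSymm k) := by
  intro q
  refine ⟨(I * starRingEnd ℂ q.1, q.2 * (Circle.exp (Real.pi / k))⁻¹), Prod.ext ?_ (by simp [chSymm])⟩
  simp only [chSymm, map_mul, conj_I, conj_conj]
  linear_combination -q.1 * I_sq

theorem chRad_bounds {ζ : ℂ} (h : ‖ζ‖ ≤ 1) : 1 ≤ chRad ζ ∧ chRad ζ ≤ 9 / 5 ∧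
    chRad ζ ^ 2 = 3 + (ζ.im / 8) ^ 2 - ζ.re / 8 := by
  have h1 := abs_le.mp ((abs_re_le_norm ζ).trans h)
  have h2 := abs_le.mp ((abs_im_le_norm ζ).trans h)
  refine ⟨?_, ?_, Real.sq_sqrt (by nlinarith)⟩
  · rw [chRad, Real.one_le_sqrt]; nlinarith
  · rw [chRad, Real.sqrt_le_left (by norm_num)]; nlinarith

theorem Circle.re_sq_add_im_sq (u : Circle) : (u : ℂ).re ^ 2 + (u : ℂ).im ^ 2 = 1 := by
  have := Circle.normSq_coe u
  rw [normSq_apply] at this; linarith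

theorem chRad_im_bound {ζ w : ℂ} (h : ‖ζ‖ ≤ 1) (hw : ‖w‖ ≤ 1) : |chRad ζ * w.im / 2| ≤ 9 / 10 := by
  obtain ⟨h1, h2, -⟩ := chRad_bounds h
  have h3 := (abs_im_le_norm w).trans hw
  rw [abs_div, abs_mul, abs_of_nonneg (by linarith : 0 ≤ chRad ζ), abs_two]
  nlinarith [abs_nonneg w.im]

theorem sin_chθ {ζ w : ℂ} (h : ‖ζ‖ ≤ 1) (hw : ‖w‖ ≤ 1) :
    2 * Real.sin (chθ (ζ, w) / 2) = chRad ζ * w.im := by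
  have := abs_le.mp (chRad_im_bound h hw)
  rw [chθ, mul_div_cancel_left₀ _ two_ne_zero, Real.sin_arcsin (by linarith) (by linarith)]
  ring

theorem abs_chθ_lt {ζ w : ℂ} (h : ‖ζ‖ ≤ 1) (hw : ‖w‖ ≤ 1) : |chθ (ζ, w)| < Real.pi := by
  have := abs_le.mp (chRad_im_bound h hw)
  rw [chθ, abs_mul, abs_two]
  have : |Real.arcsin (chRad ζ * w.im / 2)| < Real.pi / 2 := by
    rw [abs_lt]
    exact ⟨Real.neg_pi_div_two_lt_arcsin.mpr (by linarith), Real.arcsin_lt_pi_div_two.mpr (by linarith)⟩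
  linarith

theorem ringA_snd_pow (hk : k ≠ 0) (j : Fin k) (p : ℂ × Circle) :
    ((ringA k j p).2 : ℂ) ^ k = exp (chθ (p.1, p.2) * I) := by
  rw [ringA, Circle.coe_exp, ← exp_nat_mul, ← exp_periodic.nat_mul j (chθ (p.1, p.2) * I)]
  congr 1; push_cast; field_simp; ring

theorem chA_ringA (hk : k ≠ 0) (j : Fin k) {p : ℂ × Circle} (hp : p ∈ soTorus) :
    chA k (ringA k j p) = ((1 / 8 : ℝ) : ℂ) * p.1 := by
  obtain ⟨-, -, h3⟩ := chRad_bounds (ζ := p.1) hp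
  have h4 := sin_chθ (ζ := p.1) (w := p.2) hp (Circle.norm_coe _).le
  have h5 := Circle.re_sq_add_im_sq p.2
  have him : (ringA k j p).1.im = p.1.im / 24 := by
    simp only [ringA, chZ, add_im, ofReal_im, zero_add, im_ofReal_mul, I_im, mul_one]
  have hre : (ringA k j p).1.re = chRad p.1 * (p.2 : ℂ).re / 3 := by
    simp only [ringA, chZ, add_re, ofReal_re, re_ofReal_mul, I_re, mul_zero, add_zero]
  rw [chA, chE, ringA_snd_pow hk, hre, him, exp_ofReal_mul_I_re]
  have h6 : Real.cos (chθ (p.1, p.2)) = 1 - 2 * Real.sin (chθ (p.1, p.2) / 2) ^ 2 := by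
    have := Real.cos_two_mul' (chθ (p.1, p.2) / 2)
    rw [mul_div_cancel₀ _ two_ne_zero] at this
    nlinarith [Real.sin_sq_add_cos_sq (chθ (p.1, p.2) / 2)]
  have h7 : Real.sin (chθ (p.1, p.2) / 2) = chRad p.1 * (p.2 : ℂ).im / 2 := by linarith
  apply Complex.ext
  · rw [re_ofReal_mul, h6, h7]
    simp only
    nlinarith
  · rw [im_ofReal_mul]; simp only; ring

theorem ringA_injective (hk : k ≠ 0) {i j : Fin k} {p q : ℂ × Circle} (hp : p ∈ soTorus) (hq : q ∈ soTorus)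
    (h : ringA k i p = ringA k j q) : i = j ∧ p = q := by
  have h1 : p.1 = q.1 := by
    have := chA_ringA hk i hp
    rw [h, chA_ringA hk j hq] at this
    exact (mul_left_cancel₀ (by norm_num) this).symm
  obtain ⟨hr, -, -⟩ := chRad_bounds (ζ := p.1) hp
  have h2 : (p.2 : ℂ).re = (q.2 : ℂ).re := by
    have := congrArg (fun r => r.1.re) h
    simp only [ringA, chZ, add_re, ofReal_re, re_ofReal_mul, I_re, mul_zero, add_zero, ← h1] at this
    field_simp at this
    exact this
  have h3 : Circle.exp ((2 * Real.pi * i + chθ (p.1, p.2)) / k) = Circle.exp ((2 * Real.pi * j + chθ (q.1, q.2)) / k) :=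
    congrArg Prod.snd h
  obtain ⟨m, hm⟩ := Circle.exp_eq_exp.mp h3
  have hm' : 2 * Real.pi * i + chθ (p.1, p.2) = 2 * Real.pi * j + chθ (q.1, q.2) + k * m * (2 * Real.pi) := by
    field_simp at hm; linarith
  have b1 := abs_lt.mp (abs_chθ_lt (ζ := p.1) (w := p.2) hp (Circle.norm_coe _).le)
  have b2 := abs_lt.mp (abs_chθ_lt (ζ := q.1) (w := q.2) hq (Circle.norm_coe _).le)
  have h4 : (i : ℤ) = j + k * m := by
    have e1 : ((i : ℝ) - j - k * m) * (2 * Real.pi) = chθ (q.1, q.2) - chθ (p.1, p.2) := by linarith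
    have e2 : |((i : ℝ) - j - k * m)| < 1 := by
      rw [abs_lt]; constructor <;> nlinarith [Real.pi_pos]
    have e3 : |((i : ℤ) - j - k * m)| < 1 := by exact_mod_cast e2
    rw [Int.abs_lt_one_iff] at e3; linarith
  have h5 : i = j := by
    apply Fin.ext
    have e := congrArg (fun x : ℤ => x % k) h4
    simp only [Int.add_mul_emod_self_left] at e
    rw [Int.emod_eq_of_lt (by positivity) (by exact_mod_cast i.2),
      Int.emod_eq_of_lt (by positivity) (by exact_mod_cast j.2)] at e
    exact_mod_cast e
  have h6 : m = 0 := by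
    rw [h5] at h4
    have : (k : ℤ) * m = 0 := by linarith
    rcases mul_eq_zero.mp this with h | h
    · exact absurd (by exact_mod_cast h) hk
    · exact h
  refine ⟨h5, Prod.ext h1 (Circle.ext (Complex.ext h2 ?_))⟩
  rw [h6, h5] at hm'
  have h7 : chθ (p.1, p.2) = chθ (q.1, q.2) := by push_cast at hm'; linarith
  have e1 := sin_chθ (ζ := p.1) (w := p.2) hp (Circle.norm_coe _).le
  have e2 := sin_chθ (ζ := q.1) (w := q.2) hq (Circle.norm_coe _).le
  rw [h7, e2, h1] at e1
  rw [h1] at hr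
  exact (mul_left_cancel₀ (by linarith) e1).symm

theorem exists_ringA (hk : k ≠ 0) {q : ℂ × Circle} (hq : ‖chA k q‖ ≤ 1 / 8) :
    ∃ j, ∃ p ∈ soTorus, ringA k j p = q := by
  set ζ : ℂ := 8 * chA k q with hζ
  have hζ1 : ‖ζ‖ ≤ 1 := by
    rw [hζ, norm_mul]; norm_num; linarith
  obtain ⟨hr, -, hr2⟩ := chRad_bounds hζ1
  obtain ⟨ψ, hψ⟩ := Circle.exp_surjective q.2
  set n : ℤ := round (k * ψ / (2 * Real.pi)) with hn
  set θ : ℝ := k * ψ - n * (2 * Real.pi) with hθ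
  have hθπ : |θ / 2| ≤ Real.pi / 2 := by
    have := abs_sub_round (k * ψ / (2 * Real.pi))
    rw [← hn] at this
    have e : θ / 2 = (k * ψ / (2 * Real.pi) - n) * Real.pi := by
      rw [hθ]; field_simp
    rw [e, abs_mul, abs_of_pos Real.pi_pos]
    nlinarith [Real.pi_pos]
  have hvk : ((q.2 : ℂ) ^ k).re = Real.cos θ := by
    rw [← hψ, Circle.coe_exp, ← exp_nat_mul, ← exp_ofReal_mul_I_re,
      show (k : ℂ) * (ψ * I) = θ * I + n * (2 * Real.pi * I) by rw [hθ]; push_cast; ring]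
    rw [exp_periodic.int_mul n]
  have hζre : ζ.re = 8 * (chE k q + 1) := by simp [hζ, chA]
  have hζim : ζ.im = 24 * q.1.im := by simp [hζ, chA]; ring
  have h6 : Real.cos θ = 1 - 2 * Real.sin (θ / 2) ^ 2 := by
    have := Real.cos_two_mul' (θ / 2)
    rw [mul_div_cancel₀ _ two_ne_zero] at this
    nlinarith [Real.sin_sq_add_cos_sq (θ / 2)]
  have hcirc : (3 * q.1.re) ^ 2 + (2 * Real.sin (θ / 2)) ^ 2 = chRad ζ ^ 2 := by
    rw [hr2, hζre, hζim, chE, hvk, h6]; ring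
  set w : ℂ := ⟨3 * q.1.re / chRad ζ, 2 * Real.sin (θ / 2) / chRad ζ⟩ with hw
  have hw1 : ‖w‖ = 1 := by
    have : ‖w‖ ^ 2 = 1 := by
      rw [← normSq_eq_norm_sq, normSq_apply]
      simp only [hw]
      field_simp
      linarith
    nlinarith [norm_nonneg w]
  obtain ⟨u, hu⟩ : ∃ u : Circle, (u : ℂ) = w := ⟨⟨w, mem_sphere_zero_iff_norm.mpr hw1⟩, rfl⟩
  have hθeq : chθ (ζ, w) = θ := by
    rw [chθ]
    simp only [hw]
    rw [show chRad ζ * (2 * Real.sin (θ / 2) / chRad ζ) / 2 = Real.sin (θ / 2) by field_simp,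
      Real.arcsin_sin (by linarith [(abs_le.mp hθπ).1]) (abs_le.mp hθπ).2]
    ring
  have hk0 : (0 : ℤ) < k := by exact_mod_cast Nat.pos_of_ne_zero hk
  refine ⟨⟨(n % k).toNat, ?_⟩, (ζ, u), hζ1, Prod.ext ?_ ?_⟩
  · have := Int.emod_nonneg n hk0.ne'
    have := Int.emod_lt_of_pos n hk0
    omega
  · simp only [ringA, chZ, hu]
    apply Complex.ext
    · simp [hw]; field_simp
    · simp [hζim]
  · simp only [ringA, hu, hθeq]
    rw [← hψ, Circle.exp_eq_exp]
    refine ⟨-(n / k), ?_⟩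
    have e1 : (((n % k).toNat : ℕ) : ℝ) = n - k * (n / k : ℤ) := by
      have e2 : (((n % k).toNat : ℕ) : ℤ) = n - k * (n / k) := by
        rw [Int.toNat_of_nonneg (Int.emod_nonneg n hk0.ne'), Int.emod_def]
      exact_mod_cast e2
    rw [e1, hθ]
    field_simp
    push_cast; ring

theorem chB_norm_of_chA {p : ℂ × Circle} (h : ‖chA k p‖ ≤ 1 / 8) : 0 < (chB k p).re ∧ 1 / 8 < ‖chB k p‖ := by
  have h1 := abs_le.mp ((abs_re_le_norm _).trans h)
  have h2 := re_le_norm (chB k p)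
  simp only [chA, chB] at h1 h2 ⊢
  constructor <;> linarith

theorem chA_ring_norm (hk : k ≠ 0) (j : Fin k) {p : ℂ × Circle} (hp : p ∈ soTorus) :
    ‖chA k (ringA k j p)‖ ≤ 1 / 8 := by
  have : ‖p.1‖ ≤ 1 := hp
  rw [chA_ringA hk j hp, norm_mul, norm_real]; norm_num; linarith

theorem ring_injective (hk : k ≠ 0) {i j : Bool × Fin k} {p q : ℂ × Circle} (hp : p ∈ soTorus) (hq : q ∈ soTorus)
    (h : ring k i p = ring k j q) : i = j ∧ p = q := by
  obtain ⟨i1, i2⟩ := i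
  obtain ⟨j1, j2⟩ := j
  have hx := chA_ring_norm hk i2 hp
  have hy := chA_ring_norm hk j2 hq
  cases i1 <;> cases j1 <;> simp only [ring, if_true, Bool.false_eq_true, if_false] at h
  · obtain ⟨h1, h2⟩ := ringA_injective hk hp hq h
    exact ⟨by rw [h1], h2⟩
  · have := (chB_norm_of_chA hx).2
    rw [h, chB_chSymm hk] at this; linarith
  · have := (chB_norm_of_chA hy).2
    rw [← h, chB_chSymm hk] at this; linarith
  · obtain ⟨h1, h2⟩ := ringA_injective hk hp hq (chSymm_injective h)
    exact ⟨by rw [h1], h2⟩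

theorem iUnion_ring (hk : k ≠ 0) :
    ⋃ i, ring k i '' soTorus = {q | ‖chA k q‖ ≤ 1 / 8 ∨ ‖chB k q‖ ≤ 1 / 8} := by
  ext q
  simp only [mem_iUnion, Prod.exists, Bool.exists_bool]
  constructor
  · rintro (⟨j, ⟨p, hp, rfl⟩⟩ | ⟨j, ⟨p, hp, rfl⟩⟩)
    · exact Or.inl (chA_ring_norm hk j hp)
    · refine Or.inr ?_
      simp only [ring, if_true, chB_chSymm hk]
      exact chA_ring_norm hk j hp
  · rintro (h | h)
    · obtain ⟨j, p, hp, rfl⟩ := exists_ringA hk h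
      exact Or.inl ⟨j, p, hp, rfl⟩
    · obtain ⟨q', rfl⟩ := chSymm_surjective (k := k) q
      rw [chB_chSymm hk] at h
      obtain ⟨j, p, hp, rfl⟩ := exists_ringA hk h
      exact Or.inr ⟨j, p, hp, by simp [ring]⟩

theorem ring_norm_lt (i : Bool × Fin k) {p : ℂ × Circle} (hp : p ∈ soTorus) : ‖(ring k i p).1‖ < 3 / 4 := by
  have hA : ‖(ringA k i.2 p).1‖ < 3 / 4 := by
    obtain ⟨h1, h2, -⟩ := chRad_bounds (ζ := p.1) hp
    have h3 := abs_le.mp ((abs_im_le_norm p.1).trans hp)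
    have h4 := abs_le.mp ((abs_re_le_norm (p.2 : ℂ)).trans (Circle.norm_coe _).le)
    have : ‖(ringA k i.2 p).1‖ ≤ 3 / 5 + 1 / 24 := by
      refine (norm_add_le _ _).trans (add_le_add ?_ ?_)
      · rw [norm_real, Real.norm_eq_abs, abs_le]; constructor <;> nlinarith
      · rw [norm_mul, norm_real, norm_I, mul_one, Real.norm_eq_abs, abs_le]
        constructor <;> nlinarith
    linarith
  obtain ⟨b, j⟩ := i
  cases b
  · exact hA
  · simpa [ring, chSymm] using hA

end Chain

section ChainConnected

open Complex

variable {k : ℕ}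

/-- The planar region through which the complement of the chain is reached. -/
def chW (c : ℝ) : Set (ℝ × ℝ) :=
  {p | 1 / 64 < (1 + c - p.1 ^ 2 + p.2 ^ 2) ^ 2 + p.2 ^ 2 ∧ 1 / 64 < (1 - c + p.1 ^ 2 - p.2 ^ 2) ^ 2 + p.1 ^ 2 ∧
    p.1 ^ 2 + p.2 ^ 2 ≤ 81 / 16}

theorem chW_swap {c : ℝ} {p : ℝ × ℝ} (h : p.swap ∈ chW (-c)) : p ∈ chW c := by
  obtain ⟨h1, h2, h3⟩ := h
  simp only [Prod.fst_swap, Prod.snd_swap] at h1 h2 h3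
  exact ⟨by linarith, by linarith, by linarith⟩

theorem sq_add_raise {κ s₀ s : ℝ} (h0 : 0 ≤ s₀) (h : s₀ ≤ s) (hk : 1 / 64 < (κ + s₀) ^ 2 + s₀) :
    1 / 64 < (κ + s) ^ 2 + s := by
  rcases le_total (-κ - 1 / 2) s₀ with h1 | h1
  · nlinarith
  · nlinarith [sq_nonneg (s + κ + 1 / 2)]

/-- The point `p` can be joined inside `chW c` to the circle of radius `9 / 4`. -/
def ChWReach (c : ℝ) (p : ℝ × ℝ) : Prop :=
  ∃ t ⊆ chW c, IsPreconnected t ∧ p ∈ t ∧ ∃ q ∈ t, q.1 ^ 2 + q.2 ^ 2 = 81 / 16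

theorem ChWReach.swap {c X Y : ℝ} (h : ChWReach (-c) (Y, X)) : ChWReach c (X, Y) := by
  obtain ⟨t, h1, h2, h3, q, h4, h5⟩ := h
  exact ⟨Prod.swap '' t, by rintro _ ⟨p, hp, rfl⟩; exact chW_swap (by simpa using h1 hp),
    h2.image _ (by fun_prop), ⟨_, h3, rfl⟩, _, ⟨q, h4, rfl⟩, by rw [← h5]; simp; ring⟩

theorem chW_reach_snd {c X Y : ℝ} (hX : 1 / 8 < X) (hY : 0 ≤ Y) (h : (X, Y) ∈ chW c) : ChWReach c (X, Y) := by
  obtain ⟨h1, h2, h3⟩ := h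
  simp only at h1 h2 h3
  have hs : √(81 / 16 - X ^ 2) ^ 2 = 81 / 16 - X ^ 2 := Real.sq_sqrt (by nlinarith)
  have hY' : Y ≤ √(81 / 16 - X ^ 2) := Real.le_sqrt_of_sq_le (by linarith)
  refine ⟨(fun y => (X, y)) '' Icc Y √(81 / 16 - X ^ 2), ?_, isPreconnected_Icc.image _ (by fun_prop),
    ⟨Y, ⟨le_rfl, hY'⟩, rfl⟩, _, ⟨_, ⟨hY', le_rfl⟩, rfl⟩, by simp only [hs]; ring⟩
  rintro _ ⟨y, ⟨hy1, hy2⟩, rfl⟩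
  have e1 : Y ^ 2 ≤ y ^ 2 := pow_le_pow_left₀ hY hy1 2
  have e2 : y ^ 2 ≤ 81 / 16 - X ^ 2 := by rw [← hs]; exact pow_le_pow_left₀ (by linarith) hy2 2
  exact ⟨sq_add_raise (sq_nonneg Y) e1 h1, by simp only; nlinarith, by simp only; linarith⟩

theorem chW_reach_fst {c X Y : ℝ} (hX : 0 ≤ X) (hY : 1 / 8 < Y) (h : (X, Y) ∈ chW c) : ChWReach c (X, Y) := by
  exact (chW_reach_snd hY hX (chW_swap (c := -c) (p := (Y, X)) (by simpa using h))).swap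

theorem chW_reach_of_nonneg {c X Y : ℝ} (hc : 0 ≤ c) (hX : 0 ≤ X) (hX' : X ≤ 1 / 8) (hY : 0 ≤ Y) (hY' : Y ≤ 1 / 8)
    (h : (X, Y) ∈ chW c) : ChWReach c (X, Y) := by
  obtain ⟨h1, h2, h3⟩ := h
  simp only at h1 h2 h3
  have hsub : (fun x => (x, Y)) '' Icc X (1 / 4) ⊆ chW c := by
    rintro _ ⟨x, ⟨hx1, hx2⟩, rfl⟩
    have e1 : X ^ 2 ≤ x ^ 2 := pow_le_pow_left₀ hX hx1 2
    have e2 : x ^ 2 ≤ 1 / 16 := by nlinarith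
    refine ⟨by simp only; nlinarith [sq_nonneg Y], ?_, by simp only; nlinarith⟩
    have := sq_add_raise (κ := 1 - c - Y ^ 2) (sq_nonneg X) e1 (by linarith)
    simp only; linarith
  obtain ⟨t, g1, g2, g3, q, g4, g5⟩ := chW_reach_snd (c := c) (X := 1 / 4) (Y := Y) (by norm_num) hY
    (hsub ⟨1 / 4, ⟨by linarith, le_rfl⟩, rfl⟩)
  exact ⟨(fun x => (x, Y)) '' Icc X (1 / 4) ∪ t, union_subset hsub g1,
    (isPreconnected_Icc.image _ (by fun_prop)).union (1 / 4, Y) ⟨1 / 4, ⟨by linarith, le_rfl⟩, rfl⟩ g3 g2,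
    Or.inl ⟨X, ⟨le_rfl, by linarith⟩, rfl⟩, q, Or.inr g4, g5⟩

theorem chW_reach {c X Y : ℝ} (hX : 0 ≤ X) (hY : 0 ≤ Y) (h : (X, Y) ∈ chW c) : ChWReach c (X, Y) := by
  rcases lt_or_ge (1 / 8) X with hX' | hX'
  · exact chW_reach_snd hX' hY h
  rcases lt_or_ge (1 / 8) Y with hY' | hY'
  · exact chW_reach_fst hX hY' h
  rcases le_total 0 c with hc | hc
  · exact chW_reach_of_nonneg hc hX hX' hY hY' h
  · exact (chW_reach_of_nonneg (by linarith) hY hY' hX hX'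
      (chW_swap (c := -c) (p := (Y, X)) (by simpa using h))).swap

theorem lt_norm_chA_iff (p : ℂ × Circle) : 1 / 8 < ‖chA k p‖ ↔ 1 / 64 < (1 + 2 * ((p.2 : ℂ) ^ k).re
    - (3 * p.1.re) ^ 2 + (3 * p.1.im) ^ 2) ^ 2 + (3 * p.1.im) ^ 2 := by
  rw [← sq_lt_sq₀ (by norm_num) (norm_nonneg _), ← normSq_eq_norm_sq, normSq_apply]
  simp only [chA, chE]
  ring_nf

theorem lt_norm_chB_iff (p : ℂ × Circle) : 1 / 8 < ‖chB k p‖ ↔ 1 / 64 < (1 - 2 * ((p.2 : ℂ) ^ k).re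
    + (3 * p.1.re) ^ 2 - (3 * p.1.im) ^ 2) ^ 2 + (3 * p.1.re) ^ 2 := by
  rw [← sq_lt_sq₀ (by norm_num) (norm_nonneg _), ← normSq_eq_norm_sq, normSq_apply]
  simp only [chB, chE]
  ring_nf

set_option maxHeartbeats 800000 in
theorem isPreconnected_compl_rings (hk : k ≠ 0) {S : Set (ℂ × Circle)} (hS : {p : ℂ × Circle | ‖p.1‖ < 1} ⊆ S)
    (hS' : S ⊆ soTorus) : IsPreconnected (S \ ⋃ i, ring k i '' soTorus) := by
  refine isPreconnected_solid hS hS' ?_ ?_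
  · rintro ⟨z, v⟩ hpS hpA hz
    obtain ⟨sx, hsx, hsx'⟩ : ∃ s : ℝ, s * |z.re| = z.re ∧ s ^ 2 = 1 := by
      rcases le_total 0 z.re with h | h
      · exact ⟨1, by rw [abs_of_nonneg h]; ring, by norm_num⟩
      · exact ⟨-1, by rw [abs_of_nonpos h]; ring, by norm_num⟩
    obtain ⟨sy, hsy, hsy'⟩ : ∃ s : ℝ, s * |z.im| = z.im ∧ s ^ 2 = 1 := by
      rcases le_total 0 z.im with h | h
      · exact ⟨1, by rw [abs_of_nonneg h]; ring, by norm_num⟩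
      · exact ⟨-1, by rw [abs_of_nonpos h]; ring, by norm_num⟩
    have hnorm : ∀ a b : ℝ, ‖((sx * a / 3 : ℝ) : ℂ) + ((sy * b / 3 : ℝ) : ℂ) * I‖ ^ 2 = (a ^ 2 + b ^ 2) / 9 := by
      intro a b
      rw [← normSq_eq_norm_sq, normSq_add_mul_I]
      linear_combination (a ^ 2 * hsx' + b ^ 2 * hsy') / 9
    rw [iUnion_ring hk] at hpA ⊢
    simp only [mem_ofPred_eq, not_or, not_le] at hpA
    obtain ⟨hA, hB⟩ := hpA
    rw [lt_norm_chA_iff] at hA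
    rw [lt_norm_chB_iff] at hB
    simp only at hA hB hz
    have hz2 : z.re ^ 2 + z.im ^ 2 ≤ 9 / 16 := by
      have : ‖z‖ ^ 2 = z.re ^ 2 + z.im ^ 2 := by rw [← normSq_eq_norm_sq, normSq_apply]; ring
      have := pow_le_pow_left₀ (norm_nonneg z) hz.le 2
      linarith
    obtain ⟨t, h1, h2, h3, q, h4, h5⟩ := chW_reach (c := 2 * ((v : ℂ) ^ k).re) (X := 3 * |z.re|) (Y := 3 * |z.im|)
      (by positivity) (by positivity) (by simp only [chW, mem_ofPred_eq, mul_pow, sq_abs] at hA hB ⊢; exact ⟨hA, hB, by linarith⟩)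
    refine ⟨(fun x : ℝ × ℝ => (((sx * x.1 / 3 : ℝ) : ℂ) + ((sy * x.2 / 3 : ℝ) : ℂ) * I, v)) '' t, ?_,
      h2.image _ (by fun_prop), ⟨_, h3, ?_⟩, _, ⟨q, h4, rfl⟩, ?_⟩
    · rintro _ ⟨⟨x, y⟩, hx, rfl⟩
      obtain ⟨g1, g2, g3⟩ := h1 hx
      simp only at g1 g2 g3
      refine ⟨hS ?_, ?_⟩
      · have := hnorm x y
        show ‖((sx * x / 3 : ℝ) : ℂ) + ((sy * y / 3 : ℝ) : ℂ) * I‖ < 1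
        exact lt_of_pow_lt_pow_left₀ 2 zero_le_one (by rw [this]; linarith)
      · simp only [mem_ofPred_eq, not_or, not_le, lt_norm_chA_iff, lt_norm_chB_iff]
        have e1 : (3 * (((sx * x / 3 : ℝ) : ℂ) + ((sy * y / 3 : ℝ) : ℂ) * I).re) ^ 2 = x ^ 2 := by
          simp only [add_re, ofReal_re, re_ofReal_mul, I_re, mul_zero, add_zero]
          linear_combination x ^ 2 * hsx'
        have e2 : (3 * (((sx * x / 3 : ℝ) : ℂ) + ((sy * y / 3 : ℝ) : ℂ) * I).im) ^ 2 = y ^ 2 := by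
          simp only [add_im, ofReal_im, im_ofReal_mul, I_im, mul_one, zero_add]
          linear_combination y ^ 2 * hsy'
        rw [e1, e2]
        exact ⟨g1, g2⟩
    · refine Prod.ext ?_ rfl
      apply Complex.ext
      · simp only [add_re, ofReal_re, re_ofReal_mul, I_re, mul_zero, add_zero]; linear_combination hsx
      · simp only [add_im, ofReal_im, im_ofReal_mul, I_im, mul_one, zero_add]; linear_combination hsy
    · have := hnorm q.1 q.2
      rw [h5] at this
      have e : ‖((sx * q.1 / 3 : ℝ) : ℂ) + ((sy * q.2 / 3 : ℝ) : ℂ) * I‖ ^ 2 = (3 / 4) ^ 2 := by rw [this]; norm_num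
      exact (sq_eq_sq₀ (norm_nonneg _) (by norm_num)).mp e
  · simp only [mem_iUnion]
    rintro _ ⟨i, p, hp, rfl⟩
    exact ring_norm_lt i hp

end ChainConnected

section ChainLower

open Complex

variable {k : ℕ} {G : Type*} [Group G]

theorem isCoc_chain (a b : G) : IsCoc {p | chA k p ≠ 0 ∧ chB k p ≠ 0}
    (fun p q => st a (chA k p) (chA k q) * st b (chB k p) (chB k q)) := by
  have hA : IsCoc {p | chA k p ≠ 0 ∧ chB k p ≠ 0} (fun p q => st a (chA k p) (chA k q)) :=
    (isCoc_st a).comp continuous_chA.continuousOn fun p hp => hp.1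
  have hB : IsCoc {p | chA k p ≠ 0 ∧ chB k p ≠ 0} (fun p q => st b (chB k p) (chB k q)) :=
    (isCoc_st b).comp continuous_chB.continuousOn fun p hp => hp.2
  intro p hp
  have hE := continuous_chE (k := k)
  rcases lt_or_ge (chE k p) 1 with h | h
  · obtain ⟨f, O, hO, hf⟩ := hA p hp
    have hO' : {q | chE k q < 1} ∈ 𝓝[{p | chA k p ≠ 0 ∧ chB k p ≠ 0}] p :=
      mem_nhdsWithin_of_mem_nhds ((isOpen_lt hE continuous_const).mem_nhds h)
    refine ⟨f, O ∩ {q | chE k q < 1}, Filter.inter_mem hO hO', fun x hx y hy => ?_⟩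
    beta_reduce
    rw [st_eq_one_of_re_nonneg (g := b) (by simp only [chB]; linarith [hx.2.out]), mul_one]
    exact hf x hx.1 y hy.1
  · obtain ⟨f, O, hO, hf⟩ := hB p hp
    have hO' : {q | -1 < chE k q} ∈ 𝓝[{p | chA k p ≠ 0 ∧ chB k p ≠ 0}] p :=
      mem_nhdsWithin_of_mem_nhds ((isOpen_lt continuous_const hE).mem_nhds (by simp only [mem_ofPred_eq]; linarith))
    refine ⟨f, O ∩ {q | -1 < chE k q}, Filter.inter_mem hO hO', fun x hx y hy => ?_⟩
    beta_reduce
    rw [st_eq_one_of_re_nonneg (g := a) (by simp only [chA]; linarith [hx.2.out]), one_mul]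
    exact hf x hx.1 y hy.1

open Classical in
/-- The potential comparing the cocycle of a chain with a standard one near the boundary. -/
noncomputable def chPot (a b : G) (z : ℂ) : G := (if z.im < 0 then a else 1) * (if z.re < 0 then b else 1)

theorem isIso_chain (a b : G) : IsIso {p : ℂ × Circle | 3 / 4 ≤ ‖p.1‖}
    (fun p q => st a (chA k p) (chA k q) * st b (chB k p) (chB k q))
    (fun p q => st (b * a * b⁻¹ * a⁻¹) p.1 q.1) (fun p => chPot a b p.1) := by
  have hE := continuous_chE (k := k)
  have key : ∀ p : ℂ × Circle, |((p.2 : ℂ) ^ k).re| ≤ 1 := fun p =>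
    (abs_re_le_norm _).trans (by rw [norm_pow, Circle.norm_coe, one_pow])
  have hre : Continuous fun p : ℂ × Circle => p.1.re := by fun_prop
  have him : Continuous fun p : ℂ × Circle => p.1.im := by fun_prop
  rintro p (hp : 3 / 4 ≤ ‖p.1‖)
  have hn : 9 / 16 ≤ p.1.re ^ 2 + p.1.im ^ 2 := by
    have : ‖p.1‖ ^ 2 = p.1.re ^ 2 + p.1.im ^ 2 := by rw [← normSq_eq_norm_sq, normSq_apply]; ring
    nlinarith
  have hk := abs_le.mp (key p)
  have pos_re : 0 < p.1.re → ∀ᶠ q in 𝓝 p, 0 < q.1.re := fun h => (isOpen_lt continuous_const hre).mem_nhds h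
  have neg_re : p.1.re < 0 → ∀ᶠ q in 𝓝 p, q.1.re < 0 := fun h => (isOpen_lt hre continuous_const).mem_nhds h
  have pos_im : 0 < p.1.im → ∀ᶠ q in 𝓝 p, 0 < q.1.im := fun h => (isOpen_lt continuous_const him).mem_nhds h
  have neg_im : p.1.im < 0 → ∀ᶠ q in 𝓝 p, q.1.im < 0 := fun h => (isOpen_lt him continuous_const).mem_nhds h
  have im0 : p.1.im = 0 → ∀ᶠ q in 𝓝 p, chE k q < -1 := fun h =>
    (isOpen_lt hE continuous_const).mem_nhds (by simp only [chE, mem_ofPred_eq, h] at hn ⊢; nlinarith)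
  have re0 : p.1.re = 0 → ∀ᶠ q in 𝓝 p, 1 < chE k q := fun h =>
    (isOpen_lt continuous_const hE).mem_nhds (by simp only [chE, mem_ofPred_eq, h] at hn ⊢; nlinarith)
  suffices h : ∃ O ∈ 𝓝 p, ∀ x ∈ O, ∀ y ∈ O, st a (chA k x) (chA k y) * st b (chB k x) (chB k y)
      = (chPot a b x.1)⁻¹ * st (b * a * b⁻¹ * a⁻¹) x.1 y.1 * chPot a b y.1 by
    obtain ⟨O, hO, h⟩ := h
    exact ⟨O, mem_nhdsWithin_of_mem_nhds hO, h⟩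
  have eqA : ∀ {x y : ℂ × Circle}, (0 < x.1.im ∧ 0 < y.1.im) ∨ (x.1.im < 0 ∧ y.1.im < 0) →
      st a (chA k x) (chA k y) = 1 ∧ st (b * a * b⁻¹ * a⁻¹) x.1 y.1 = 1 := by
    rintro x y (⟨h1, h2⟩ | ⟨h1, h2⟩)
    · exact ⟨st_eq_one_of_im_nonneg (by simp only [chA]; linarith) (by simp only [chA]; linarith),
        st_eq_one_of_im_nonneg h1.le h2.le⟩
    · exact ⟨st_eq_one_of_im_neg (by simp only [chA]; linarith) (by simp only [chA]; linarith),
        st_eq_one_of_im_neg h1 h2⟩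
  have eqB : ∀ {x y : ℂ × Circle}, (0 < x.1.re ∧ 0 < y.1.re) ∨ (x.1.re < 0 ∧ y.1.re < 0) →
      st b (chB k x) (chB k y) = 1 := by
    rintro x y (⟨h1, h2⟩ | ⟨h1, h2⟩)
    · exact st_eq_one_of_im_nonneg (by simp only [chB]; linarith) (by simp only [chB]; linarith)
    · exact st_eq_one_of_im_neg (by simp only [chB]; linarith) (by simp only [chB]; linarith)
  have e3 : ∀ r : ℝ, 3 * r < 0 ↔ r < 0 := fun r => ⟨fun h => by linarith, fun h => by linarith⟩
  have jumpA : ∀ {x y : ℂ × Circle}, chE k x < -1 → chE k y < -1 → st a (chA k x) (chA k y) =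
      (if x.1.im < 0 then a else 1)⁻¹ * (if y.1.im < 0 then a else 1) := by
    intro x y hx hy
    rw [st_of_re_neg (by simp only [chA]; linarith) (by simp only [chA]; linarith)]
    simp only [cutFun, chA, ← not_lt, ite_not, e3]
  have jumpB : ∀ {x y : ℂ × Circle}, 1 < chE k x → 1 < chE k y → st b (chB k x) (chB k y) =
      (if x.1.re < 0 then b else 1)⁻¹ * (if y.1.re < 0 then b else 1) := by
    intro x y hx hy
    rw [st_of_re_neg (by simp only [chB]; linarith) (by simp only [chB]; linarith)]
    simp only [cutFun, chB, ← not_lt, ite_not, e3]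
  rcases lt_trichotomy p.1.im 0 with h | h | h
  · rcases lt_trichotomy p.1.re 0 with h' | h' | h'
    · refine ⟨_, (neg_im h).and (neg_re h'), fun x hx y hy => ?_⟩
      obtain ⟨e1, e2⟩ := eqA (Or.inr ⟨hx.1, hy.1⟩)
      simp [e1, e2, eqB (Or.inr ⟨hx.2, hy.2⟩), chPot, hx.1, hx.2, hy.1, hy.2]
    · refine ⟨_, (neg_im h).and (re0 h'), fun x hx y hy => ?_⟩
      obtain ⟨e1, e2⟩ := eqA (Or.inr ⟨hx.1, hy.1⟩)
      simp only [e1, e2, jumpB hx.2 hy.2, chPot, hx.1, hy.1, if_true]; group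
    · refine ⟨_, (neg_im h).and (pos_re h'), fun x hx y hy => ?_⟩
      obtain ⟨e1, e2⟩ := eqA (Or.inr ⟨hx.1, hy.1⟩)
      simp [e1, e2, eqB (Or.inl ⟨hx.2, hy.2⟩), chPot, hx.1, hx.2.not_gt, hy.1, hy.2.not_gt]
  · rcases lt_trichotomy p.1.re 0 with h' | h' | h'
    · refine ⟨_, (im0 h).and (neg_re h'), fun x hx y hy => ?_⟩
      rw [jumpA hx.1 hy.1, eqB (Or.inr ⟨hx.2, hy.2⟩), st_of_re_neg hx.2 hy.2]
      simp only [chPot, hx.2, hy.2, if_true, cutFun, ← not_lt, ite_not]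
      split_ifs <;> group
    · rw [h, h'] at hn; norm_num at hn
    · refine ⟨_, (im0 h).and (pos_re h'), fun x hx y hy => ?_⟩
      rw [jumpA hx.1 hy.1, eqB (Or.inl ⟨hx.2, hy.2⟩), st_eq_one_of_re_nonneg hx.2.le]
      simp [chPot, hx.2.not_gt, hy.2.not_gt]
  · rcases lt_trichotomy p.1.re 0 with h' | h' | h'
    · refine ⟨_, (pos_im h).and (neg_re h'), fun x hx y hy => ?_⟩
      obtain ⟨e1, e2⟩ := eqA (Or.inl ⟨hx.1, hy.1⟩)
      simp [e1, e2, eqB (Or.inr ⟨hx.2, hy.2⟩), chPot, hx.1.not_gt, hx.2, hy.1.not_gt, hy.2]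
    · refine ⟨_, (pos_im h).and (re0 h'), fun x hx y hy => ?_⟩
      obtain ⟨e1, e2⟩ := eqA (Or.inl ⟨hx.1, hy.1⟩)
      simp only [e1, e2, jumpB hx.2 hy.2, chPot, hx.1.not_gt, hy.1.not_gt, if_false]; group
    · refine ⟨_, (pos_im h).and (pos_re h'), fun x hx y hy => ?_⟩
      obtain ⟨e1, e2⟩ := eqA (Or.inl ⟨hx.1, hy.1⟩)
      simp [e1, e2, eqB (Or.inl ⟨hx.2, hy.2⟩), chPot, hx.1.not_gt, hx.2.not_gt, hy.1.not_gt, hy.2.not_gt]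

theorem chA_ring_eq (hk : k ≠ 0) (j : Fin k) {p : ℂ × Circle} (hp : p ∈ soTorus) :
    chA k (ring k (false, j) p) = ((1 / 8 : ℝ) : ℂ) * p.1 ∧ 0 < (chB k (ring k (false, j) p)).re := by
  simp only [ring, Bool.false_eq_true, if_false]
  exact ⟨chA_ringA hk j hp, (chB_norm_of_chA (chA_ring_norm hk j hp)).1⟩

theorem chB_ring_eq (hk : k ≠ 0) (j : Fin k) {p : ℂ × Circle} (hp : p ∈ soTorus) :
    chB k (ring k (true, j) p) = ((1 / 8 : ℝ) : ℂ) * p.1 ∧ 0 < (chA k (ring k (true, j) p)).re := by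
  simp only [ring, if_true, chA_chSymm hk, chB_chSymm hk]
  exact ⟨chA_ringA hk j hp, (chB_norm_of_chA (chA_ring_norm hk j hp)).1⟩

theorem chain_lower (hk : k ≠ 0) (a b : G) : ∃ τ : ℂ × Circle → ℂ × Circle → G,
    IsCoc {p | chA k p ≠ 0 ∧ chB k p ≠ 0} τ ∧
    Loc {p : ℂ × Circle | 3 / 4 ≤ ‖p.1‖} (fun p q => τ p q = st (b * a * b⁻¹ * a⁻¹) p.1 q.1) ∧
    ∀ i, ∀ p ∈ soTorus, ∀ q ∈ soTorus, τ (ring k i p) (ring k i q) = st (if i.1 then b else a) p.1 q.1 := by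
  classical
  let f : ℂ × Circle → G := fun p => if 3 / 4 ≤ ‖p.1‖ then chPot a b p.1 else 1
  refine ⟨fun p q => f p * (st a (chA k p) (chA k q) * st b (chB k p) (chB k q)) * (f q)⁻¹, ?_, ?_, ?_⟩
  · refine IsIso.isCoc (f := fun a => (f a)⁻¹) ?_ (isCoc_chain a b)
    refine fun p hp => ⟨univ, Filter.univ_mem, fun a _ b _ => ?_⟩
    simp
  · refine (isIso_chain (k := k) a b).imp ?_
    rintro x (hx : 3 / 4 ≤ ‖x.1‖) y (hy : 3 / 4 ≤ ‖y.1‖) e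
    beta_reduce at e ⊢
    rw [e]
    simp only [f, hx, hy, if_true]
    group
  · rintro ⟨i, j⟩ p hp q hq
    have e1 := (ring_norm_lt (i, j) hp).not_ge
    have e2 := (ring_norm_lt (i, j) hq).not_ge
    simp only [f, e1, e2, if_false, one_mul, inv_one, mul_one]
    cases i
    · obtain ⟨g1, g2⟩ := chA_ring_eq hk j hp
      rw [g1, (chA_ring_eq hk j hq).1, st_eq_one_of_re_nonneg (g := b) g2.le, st_pos_mul _ (by norm_num)]
      simp
    · obtain ⟨g1, g2⟩ := chB_ring_eq hk j hp
      rw [g1, (chB_ring_eq hk j hq).1, st_eq_one_of_re_nonneg (g := a) g2.le, st_pos_mul _ (by norm_num)]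
      simp

end ChainLower

section ChainLipschitz

open Complex

variable {k : ℕ}

theorem contDiffOn_chRad {s : Set (ℂ × ℂ)} (hs : ∀ p ∈ s, ‖p.1‖ ≤ 1) :
    ContDiffOn ℝ 1 (fun p : ℂ × ℂ => chRad p.1) s := by
  have h1 : ContDiff ℝ 1 fun p : ℂ × ℂ => p.1.re := reCLM.contDiff.comp contDiff_fst
  have h2 : ContDiff ℝ 1 fun p : ℂ × ℂ => p.1.im := imCLM.contDiff.comp contDiff_fst
  intro p hp
  refine (ContDiffAt.sqrt (by fun_prop) ?_).contDiffWithinAt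
  obtain ⟨h3, -, h4⟩ := chRad_bounds (hs p hp)
  rw [← h4]; positivity

theorem chZ_lipschitz : ∃ C, LipschitzOnWith C chZ (closedBall (0 : ℂ) 1 ×ˢ closedBall (0 : ℂ) 1) := by
  refine ContDiffOn.exists_lipschitzOnWith (n := 1) ?_ one_ne_zero
    ((convex_closedBall _ _).prod (convex_closedBall _ _)) ((isCompact_closedBall _ _).prod (isCompact_closedBall _ _))
  have h1 := contDiffOn_chRad (s := closedBall (0 : ℂ) 1 ×ˢ closedBall (0 : ℂ) 1) fun p hp => by simpa using hp.1
  have h2 : ContDiff ℝ 1 fun p : ℂ × ℂ => p.2.re := reCLM.contDiff.comp contDiff_snd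
  have h3 : ContDiff ℝ 1 fun p : ℂ × ℂ => p.1.im := imCLM.contDiff.comp contDiff_fst
  have h4 : ContDiff ℝ 1 (fun r : ℝ => (r : ℂ)) := ofRealCLM.contDiff
  unfold chZ
  exact (h4.comp_contDiffOn ((h1.mul h2.contDiffOn).div_const 3)).add
    ((h4.comp_contDiffOn (h3.contDiffOn.div_const 24)).mul contDiffOn_const)

theorem chθ_lipschitz : ∃ C, LipschitzOnWith C chθ (closedBall (0 : ℂ) 1 ×ˢ closedBall (0 : ℂ) 1) := by
  refine ContDiffOn.exists_lipschitzOnWith (n := 1) ?_ one_ne_zero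
    ((convex_closedBall _ _).prod (convex_closedBall _ _)) ((isCompact_closedBall _ _).prod (isCompact_closedBall _ _))
  have h1 := contDiffOn_chRad (s := closedBall (0 : ℂ) 1 ×ˢ closedBall (0 : ℂ) 1) fun p hp => by simpa using hp.1
  have h2 : ContDiff ℝ 1 fun p : ℂ × ℂ => p.2.im := imCLM.contDiff.comp contDiff_snd
  unfold chθ
  refine contDiffOn_const.mul fun p hp => ?_
  have := abs_le.mp (chRad_im_bound (ζ := p.1) (w := p.2) (by simpa using hp.1) (by simpa using hp.2))
  exact (Real.contDiffAt_arcsin (by linarith) (by linarith)).comp_contDiffWithinAt p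
    (((h1.mul h2.contDiffOn).div_const 2) p hp)

theorem Circle.dist_exp_le (x y : ℝ) : dist (Circle.exp x) (Circle.exp y) ≤ |x - y| := by
  rw [Circle.dist_eq', Circle.coe_exp, Circle.coe_exp]
  have : cexp (x * I) - cexp (y * I) = cexp (y * I) * (cexp (I * (x - y : ℝ)) - 1) := by
    rw [mul_sub, ← Complex.exp_add]; congr 2 <;> push_cast <;> ring_nf
  rw [this, norm_mul, norm_exp_ofReal_mul_I, one_mul]
  exact Real.norm_exp_I_mul_ofReal_sub_one_le

theorem dist_chSymm_fst (p q : ℂ × Circle) : dist (chSymm k p).1 (chSymm k q).1 = dist p.1 q.1 := by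
  simp only [chSymm, dist_eq_norm, ← mul_sub, ← map_sub, norm_mul, norm_I, one_mul, RCLike.norm_conj]

theorem dist_chSymm_snd (p q : ℂ × Circle) : dist (chSymm k p).2 (chSymm k q).2 = dist p.2 q.2 := by
  simp only [chSymm, Circle.dist_eq', Circle.coe_mul, ← sub_mul, norm_mul, Circle.norm_coe, mul_one]

theorem ring_lipschitz : ∃ C : ℝ, 0 ≤ C ∧ ∀ k ≠ 0, ∀ i : Bool × Fin k, ∀ p ∈ soTorus, ∀ q ∈ soTorus,
    dist (ring k i p).1 (ring k i q).1 ≤ C * dist p q ∧ dist (ring k i p).2 (ring k i q).2 ≤ C / k * dist p q := by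
  obtain ⟨C1, h1⟩ := chZ_lipschitz
  obtain ⟨C2, h2⟩ := chθ_lipschitz
  have hmem : ∀ p ∈ soTorus, ((p.1, (p.2 : ℂ)) : ℂ × ℂ) ∈ closedBall (0 : ℂ) 1 ×ˢ closedBall (0 : ℂ) 1 :=
    fun p hp => ⟨mem_closedBall_zero_iff.mpr hp, mem_closedBall_zero_iff.mpr (Circle.norm_coe _).le⟩
  have hd : ∀ p q : ℂ × Circle, dist ((p.1, (p.2 : ℂ)) : ℂ × ℂ) (q.1, (q.2 : ℂ)) = dist p q := fun p q => by
    rw [Prod.dist_eq, Prod.dist_eq]; rfl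
  refine ⟨C1 + C2, by positivity, fun k hk i p hp q hq => ?_⟩
  have hA : dist (ringA k i.2 p).1 (ringA k i.2 q).1 ≤ (C1 + C2) * dist p q ∧
      dist (ringA k i.2 p).2 (ringA k i.2 q).2 ≤ (C1 + C2) / k * dist p q := by
    have g1 := h1.dist_le_mul _ (hmem p hp) _ (hmem q hq)
    have g2 := h2.dist_le_mul _ (hmem p hp) _ (hmem q hq)
    rw [hd] at g1 g2
    constructor
    · refine g1.trans ?_
      gcongr
      simp
    · refine (Circle.dist_exp_le _ _).trans ?_
      rw [Real.dist_eq] at g2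
      rw [← sub_div, add_sub_add_left_eq_sub, abs_div, Nat.abs_cast, div_mul_eq_mul_div]
      gcongr
      refine g2.trans ?_
      gcongr
      simp
  obtain ⟨b, j⟩ := i
  cases b
  · exact hA
  · simp only [ring, if_true, dist_chSymm_fst, dist_chSymm_snd]
    exact hA

end ChainLipschitz

section InvFun

theorem IsCompact.continuousOn_invFunOn {α β : Type*} [TopologicalSpace α] [TopologicalSpace β] [T2Space β] [Nonempty α]
    {K : Set α} (hK : IsCompact K) {f : α → β} (hf : ContinuousOn f K) (hi : InjOn f K) :
    ContinuousOn (Function.invFunOn f K) (f '' K) := by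
  rw [continuousOn_iff_isClosed]
  intro t ht
  refine ⟨f '' (K ∩ t), ((hK.inter_right ht).image_of_continuousOn (hf.mono inter_subset_left)).isClosed, ?_⟩
  ext y
  constructor
  · rintro ⟨h1, x, hx, rfl⟩
    refine ⟨⟨x, ⟨hx, ?_⟩, rfl⟩, x, hx, rfl⟩
    have : Function.invFunOn f K (f x) ∈ t := h1
    rwa [hi.leftInvOn_invFunOn hx] at this
  · rintro ⟨⟨x, ⟨hx, hxt⟩, rfl⟩, -⟩
    refine ⟨?_, x, hx, rfl⟩
    show Function.invFunOn f K (f x) ∈ t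
    rwa [hi.leftInvOn_invFunOn hx]

end InvFun

section Pattern

open Complex

/-- The radius of the core of a cable. -/
noncomputable def cabRad (b : Bool) : ℝ := if b then 1 / 2 else 1 / 4

theorem cabRad_pos (b : Bool) : 0 < cabRad b := by unfold cabRad; split_ifs <;> norm_num

theorem cabRad_le (b : Bool) : cabRad b ≤ 1 / 2 := by unfold cabRad; split_ifs <;> norm_num

/-- The pattern in the solid torus: a chain inside each of two parallel cables. -/
noncomputable def pat (N : ℕ) (η : ℝ) (k : ℕ) (b : Bool) (i : Bool × Fin k) (p : ℂ × Circle) : ℂ × Circle :=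
  cable N (cabRad b) η (ring k i p)

theorem isCompact_soTorus : IsCompact soTorus := by
  have : soTorus = closedBall (0 : ℂ) 1 ×ˢ (univ : Set Circle) := by
    ext p; simp [soTorus]
  rw [this]
  exact (isCompact_closedBall _ _).prod isCompact_univ

theorem ring_mem {k : ℕ} (i : Bool × Fin k) {p : ℂ × Circle} (hp : p ∈ soTorus) : ring k i p ∈ soTorus :=
  (ring_norm_lt i hp).le.trans (by norm_num)

theorem continuousOn_ring {k : ℕ} (hk : k ≠ 0) (i : Bool × Fin k) : ContinuousOn (ring k i) soTorus := by
  obtain ⟨C, hC, h⟩ := ring_lipschitz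
  have : LipschitzOnWith (Real.toNNReal C) (ring k i) soTorus := by
    refine LipschitzOnWith.of_dist_le_mul fun p hp q hq => ?_
    obtain ⟨h1, h2⟩ := h k hk i p hp q hq
    rw [Real.coe_toNNReal _ hC, Prod.dist_eq]
    refine max_le h1 (h2.trans ?_)
    gcongr
    exact div_le_self hC (by exact_mod_cast Nat.one_le_iff_ne_zero.mpr hk)
  exact this.continuousOn

variable {N : ℕ} {η : ℝ} {k : ℕ}

theorem cable_mem (hN : N ≠ 0) (hη : 0 < η) (hη' : η ≤ 1 / 8) (b : Bool) {p : ℂ × Circle} (hp : p ∈ soTorus) :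
    cable N (cabRad b) η p ∈ soTorus :=
  (cable_norm_lt hN (cabRad_pos b) (cabRad_le b) hη hη' hp).le.trans (by norm_num)

theorem pat_norm_lt (hN : N ≠ 0) (hη : 0 < η) (hη' : η ≤ 1 / 8) (b : Bool) (i : Bool × Fin k) {p : ℂ × Circle}
    (hp : p ∈ soTorus) : ‖(pat N η k b i p).1‖ < 3 / 4 :=
  cable_norm_lt hN (cabRad_pos b) (cabRad_le b) hη hη' (ring_mem i hp)

theorem continuousOn_pat (hη : 0 < η) (hη' : η ≤ 1 / 8) (hk : k ≠ 0) (b : Bool) (i : Bool × Fin k) :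
    ContinuousOn (pat N η k b i) soTorus :=
  (continuousOn_cable (cabRad_pos b) ((cabRad_le b).trans (by norm_num)) hη hη').comp (continuousOn_ring hk i)
    fun _ hp => ring_mem i hp

theorem pat_injective (hN : N ≠ 0) (hη : 0 < η) (hη' : η ≤ 1 / 8) (hk : k ≠ 0) {b b' : Bool} {i i' : Bool × Fin k}
    {p p' : ℂ × Circle} (hp : p ∈ soTorus) (hp' : p' ∈ soTorus) (h : pat N η k b i p = pat N η k b' i' p') :
    b = b' ∧ i = i' ∧ p = p' := by
  have hb : b = b' := by
    cases b <;> cases b' <;> first | rfl | exfalso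
    · exact cable_ne hN hη hη' (ring_mem i hp) (ring_mem i' hp') h
    · exact cable_ne hN hη hη' (ring_mem i' hp') (ring_mem i hp) h.symm
  subst hb
  exact ⟨rfl, ring_injective hk hp hp'
    (cable_injOn hN (cabRad_pos b) hη (by linarith) (ring_mem i hp) (ring_mem i' hp') h)⟩

theorem exists_pat_lipschitz (N : ℕ) {c : ℝ} (hc : 0 < c) : ∃ η, 0 < η ∧ η ≤ 1 / 8 ∧ ∃ k : ℕ, k ≠ 0 ∧
    ∀ b, ∀ i : Bool × Fin k, ∀ p ∈ soTorus, ∀ q ∈ soTorus, dist (pat N η k b i p) (pat N η k b i q) ≤ c * dist p q := by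
  obtain ⟨C1, hC1, h1⟩ := cable_lipschitz N
  obtain ⟨C2, hC2, h2⟩ := ring_lipschitz
  set M := C1 * C2 + 1 with hM
  have hM0 : 0 < M := by positivity
  obtain ⟨k, hk⟩ := exists_nat_gt (2 * M / c)
  have hk0 : (0 : ℝ) < k := lt_trans (by positivity) hk
  have hη8 : min (1 / 8) (c / (2 * M)) ≤ 1 / 8 := min_le_left _ _
  have hη2 : min (1 / 8) (c / (2 * M)) ≤ c / (2 * M) := min_le_right _ _
  have hη0 : 0 < min (1 / 8) (c / (2 * M)) := by positivity
  set η := min (1 / 8) (c / (2 * M)) with hη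
  have hMη : M * η ≤ c / 2 := by
    calc M * η ≤ M * (c / (2 * M)) := by gcongr
      _ = c / 2 := by field_simp
  have hMk : M / k ≤ c / 2 := by
    rw [div_lt_iff₀ hc] at hk
    rw [div_le_iff₀ hk0]; linarith
  have hk1 : k ≠ 0 := by rintro rfl; simp at hk0
  refine ⟨η, hη0, hη8, k, hk1, fun b i p hp q hq => ?_⟩
  obtain ⟨g1, g2⟩ := h2 k hk1 i p hp q hq
  obtain ⟨g3, g4⟩ := h1 (cabRad b) η (cabRad_pos b) ((cabRad_le b).trans (by norm_num)) hη0 hη8 _ (ring_mem i hp)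
    _ (ring_mem i hq)
  have e1 : C1 * C2 * η * dist p q ≤ c / 2 * dist p q := by
    gcongr
    refine le_trans ?_ hMη
    gcongr; linarith
  have e2 : C1 * (C2 / k) * dist p q ≤ c / 2 * dist p q := by
    gcongr
    refine le_trans ?_ hMk
    rw [← mul_div_assoc]
    gcongr; linarith
  rw [Prod.dist_eq]
  refine max_le (g3.trans ?_) (g4.trans ?_)
  · calc _ ≤ C1 * (η * (C2 * dist p q) + C2 / k * dist p q) := by gcongr
      _ = C1 * C2 * η * dist p q + C1 * (C2 / k) * dist p q := by ring
      _ ≤ c * dist p q := by linarith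
  · calc _ ≤ C1 * (C2 / k * dist p q) := by gcongr
      _ = C1 * (C2 / k) * dist p q := by ring
      _ ≤ c * dist p q := by nlinarith

theorem isPreconnected_compl_pat (hN : N ≠ 0) (hη : 0 < η) (hη' : η ≤ 1 / 8) (hk : k ≠ 0)
    {S : Set (ℂ × Circle)} (hS : {p : ℂ × Circle | ‖p.1‖ < 1} ⊆ S) (hS' : S ⊆ soTorus) :
    IsPreconnected (S \ ⋃ b, ⋃ i, pat N η k b i '' soTorus) := by
  have hcont := fun b => continuousOn_cable (N := N) (cabRad_pos b) ((cabRad_le b).trans (by norm_num)) hη hη'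
  have hinj := fun b => cable_injOn hN (cabRad_pos b) hη (by linarith)
  have hsub : ∀ b, cable N (cabRad b) η '' soTorus ⊆ S := by
    rintro b _ ⟨p, hp, rfl⟩
    exact hS ((cable_norm_lt hN (cabRad_pos b) (cabRad_le b) hη hη' hp).trans (by norm_num))
  have hQ := isPreconnected_compl_cables hN hη hη' hS hS'
  have hQ' : (cable N (1 / 4) η '' soTorus ∪ cable N (1 / 2) η '' soTorus) = ⋃ b, cable N (cabRad b) η '' soTorus := by
    ext p; simp [cabRad, Bool.exists_bool]
  rw [hQ'] at hQ
  have htouch : ∀ b, ((cable N (cabRad b) η '' (soTorus \ ⋃ i, ring k i '' soTorus)) ∩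
      closure (S \ ⋃ b, cable N (cabRad b) η '' soTorus)).Nonempty := by
    intro b
    set e : ℝ := if b then 3 / 4 else 0 with he
    have hpw : 0 < cabRad b ^ N * η := mul_pos (pow_pos (cabRad_pos b) N) hη
    have himg : ∀ b, cable N (cabRad b) η '' soTorus = {q | ‖cableFun N (cabRad b) q‖ ≤ cabRad b ^ N * η} :=
      fun b => cable_image hN (cabRad_pos b) hη (by linarith)
    have hcl : IsClosed (cable N (cabRad b) η '' soTorus) :=
      (isCompact_soTorus.image_of_continuousOn (hcont b)).isClosed
    have hL : IsPreconnected ((fun t : ℝ => ((t : ℂ), (1 : Circle))) '' uIcc (cabRad b) e) :=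
      isPreconnected_uIcc.image _ (by fun_prop)
    have hLS : (fun t : ℝ => ((t : ℂ), (1 : Circle))) '' uIcc (cabRad b) e ⊆ S := by
      rintro _ ⟨t, ht, rfl⟩
      refine hS ?_
      rw [mem_uIcc] at ht
      show ‖(t : ℂ)‖ < 1
      rw [norm_real, Real.norm_eq_abs, abs_lt]
      cases b <;> simp only [cabRad, he, if_true, Bool.false_eq_true, if_false] at ht <;> constructor <;>
        rcases ht with ht | ht <;> linarith [ht.1, ht.2]
    have hLb : ∀ b' ≠ b, ∀ p ∈ (fun t : ℝ => ((t : ℂ), (1 : Circle))) '' uIcc (cabRad b) e,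
        p ∉ cable N (cabRad b') η '' soTorus := by
      rintro b' hb _ ⟨t, ht, rfl⟩ ⟨q, hq, h⟩
      rw [mem_uIcc] at ht
      have h1 := cable_norm hN (cabRad_pos b') hη (by linarith) hq
      rw [h, norm_real, Real.norm_eq_abs] at h1
      cases b <;> cases b' <;> simp only [cabRad, he, if_true, Bool.false_eq_true, if_false, ne_eq, not_true] at ht hb h1
      · rcases ht with ht | ht
        · linarith [ht.1, ht.2]
        · rw [abs_of_nonneg ht.1] at h1; linarith [ht.2, h1.1]
      · rcases ht with ht | ht
        · rw [abs_of_nonneg (by linarith [ht.1])] at h1; linarith [ht.1, h1.2]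
        · linarith [ht.1, ht.2]
    obtain ⟨t, ⟨ht1, ht2⟩, ht3⟩ := hL.closure_sdiff_inter_nonempty hcl
      ⟨_, ⟨e, right_mem_uIcc, rfl⟩, by
        rw [himg b]
        refine fun (hle : ‖cableFun N (cabRad b) ((e : ℂ), 1)‖ ≤ cabRad b ^ N * η) => hle.not_gt ?_
        cases b
        · simp only [he, cabRad, cableFun, Bool.false_eq_true, if_false, ofReal_zero, zero_pow hN, zero_sub, norm_neg,
            Circle.coe_one, mul_one, norm_pow, norm_real]
          norm_num
          nlinarith [pow_pos (show (0 : ℝ) < 4⁻¹ by norm_num) N]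
        · have h3 : (3 / 2 : ℝ) ≤ (3 / 2) ^ N := le_self_pow₀ (by norm_num) hN
          have h4 : (3 / 4 : ℝ) ^ N = (3 / 2) ^ N * (1 / 2) ^ N := by rw [← mul_pow]; norm_num
          simp only [he, cabRad, cableFun, if_true, Circle.coe_one, mul_one, ← ofReal_pow, ← ofReal_sub, norm_real]
          refine lt_of_lt_of_le ?_ (le_abs_self _)
          have h2 := pow_pos (show (0 : ℝ) < 1 / 2 by norm_num) N
          rw [h4]
          nlinarith⟩
      ⟨_, ⟨cabRad b, left_mem_uIcc, rfl⟩, by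
        rw [himg b]; simp [cableFun, hpw.le]⟩
    obtain ⟨q, hq, rfl⟩ := ht2
    refine ⟨_, ⟨q, ⟨hq, ?_⟩, rfl⟩, ?_⟩
    · simp only [mem_iUnion, not_exists]
      rintro i ⟨x, hx, rfl⟩
      have hc2 : closure ((fun t : ℝ => ((t : ℂ), (1 : Circle))) '' uIcc (cabRad b) e \ cable N (cabRad b) η '' soTorus) ⊆
          {q | cabRad b ^ N * η ≤ ‖cableFun N (cabRad b) q‖} := by
        refine closure_minimal ?_ (isClosed_le continuous_const continuous_cableFun.norm)
        rintro p ⟨-, hp⟩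
        rw [himg b] at hp
        exact le_of_not_ge fun (hle : ‖cableFun N (cabRad b) p‖ ≤ cabRad b ^ N * η) => hp hle
      have h1 : cabRad b ^ N * η ≤ ‖cableFun N (cabRad b) (cable N (cabRad b) η (ring k i x))‖ := hc2 ht3
      rw [cableFun_cable hN, norm_mul, norm_real, Real.norm_of_nonneg hpw.le] at h1
      have h2 := ring_norm_lt i hx
      nlinarith
    · refine closure_mono ?_ ht3
      rintro p ⟨hp1, hp2⟩
      refine ⟨hLS hp1, ?_⟩
      simp only [mem_iUnion, not_exists]
      intro b'
      by_cases hb : b' = b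
      · rw [hb]; exact hp2
      · exact hLb b' hb p hp1
  have := hQ.union_touching (A := fun b => cable N (cabRad b) η '' (soTorus \ ⋃ i, ring k i '' soTorus))
    (fun b => (isPreconnected_compl_rings hk (fun p (hp : ‖p.1‖ < 1) => hp.le) subset_rfl).image _
      ((hcont b).mono sdiff_subset)) htouch
  convert this using 1
  ext p
  simp only [mem_sdiff, mem_union, mem_iUnion, not_exists]
  constructor
  · rintro ⟨hp, h⟩
    by_cases hb : ∃ b, p ∈ cable N (cabRad b) η '' soTorus
    · obtain ⟨b, q, hq, rfl⟩ := hb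
      refine Or.inr ⟨b, q, ⟨hq, ?_⟩, rfl⟩
      simp only [mem_iUnion, not_exists]
      rintro i ⟨x, hx, rfl⟩
      exact h b i ⟨x, hx, rfl⟩
    · push Not at hb
      exact Or.inl ⟨hp, hb⟩
  · rintro (⟨hp, h⟩ | ⟨b, q, ⟨hq, hq'⟩, rfl⟩)
    · refine ⟨hp, ?_⟩
      rintro b i ⟨x, hx, rfl⟩
      exact h b ⟨_, ring_mem i hx, rfl⟩
    · refine ⟨hsub b ⟨q, hq, rfl⟩, ?_⟩
      rintro b' i ⟨x, hx, h⟩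
      have hbb : b' = b := by
        cases b <;> cases b' <;> first | rfl | exfalso
        · exact cable_ne hN hη hη' hq (ring_mem i hx) h.symm
        · exact cable_ne hN hη hη' (ring_mem i hx) hq h
      subst hbb
      have := hinj b' (ring_mem i hx) hq h
      exact hq' (mem_iUnion.mpr ⟨i, x, hx, this⟩)

variable {G : Type*} [Group G]

theorem pat_lower (hN : N ≠ 0) (hη : 0 < η) (hη' : η ≤ 1 / 8) (hk : k ≠ 0) (b : Bool) {m a c : G}
    (hm : (c * a * c⁻¹ * a⁻¹) ^ N = m) : ∃ π : ℂ × Circle → ℂ × Circle → G,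
    IsCoc (soTorus \ ⋃ i, pat N η k b i '' {p | p.1 = 0}) π ∧
    Loc {p : ℂ × Circle | 3 / 4 ≤ ‖p.1‖} (fun p q => π p q = st m p.1 q.1) ∧
    ∀ i, ∀ p ∈ soTorus, ∀ q ∈ soTorus, π (pat N η k b i p) (pat N η k b i q) = st (if i.1 then c else a) p.1 q.1 := by
  set r := cabRad b
  have hr : 0 < r := cabRad_pos b
  have hr2 : r ≤ 1 / 2 := cabRad_le b
  set x := c * a * c⁻¹ * a⁻¹ with hx
  obtain ⟨τ0, h1, h2, h3⟩ := cable_lower hN hr hr2 hη hη' x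
  obtain ⟨τ1, g1, g2, g3⟩ := chain_lower hk a c
  have hcont := continuousOn_cable (N := N) hr (hr2.trans (by norm_num)) hη hη'
  have hinj := cable_injOn hN hr hη (by linarith)
  set T := cable N r η '' soTorus with hT
  have hTc : IsClosed T := (isCompact_soTorus.image_of_continuousOn hcont).isClosed
  set g := Function.invFunOn (cable N r η) soTorus with hg
  have hgc : ContinuousOn g T := isCompact_soTorus.continuousOn_invFunOn hcont hinj
  have hgl : ∀ p ∈ soTorus, g (cable N r η p) = p := fun p hp => hinj.leftInvOn_invFunOn hp
  have hpw : 0 < r ^ N * η := by positivity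
  have hTi : T = {q | ‖cableFun N r q‖ ≤ r ^ N * η} := cable_image hN hr hη (by linarith)
  set T' := {q : ℂ × Circle | ‖cableFun N r q‖ < r ^ N * η} with hT'
  have hTnorm : ∀ p ∈ T, ‖p.1‖ < 3 / 4 := by
    rintro _ ⟨p, hp, rfl⟩; exact cable_norm_lt hN hr hr2 hη hη' hp
  set C' := ⋃ i, pat N η k b i '' {p | p.1 = 0} with hC'
  have h0 : IsCompact {p : ℂ × Circle | p.1 = 0} :=
    isCompact_soTorus.of_isClosed_subset (isClosed_eq continuous_fst continuous_const) fun p hp => by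
      rw [mem_ofPred_eq] at hp; simp [soTorus, hp]
  have h0S : {p : ℂ × Circle | p.1 = 0} ⊆ soTorus := fun p hp => by
    rw [mem_ofPred_eq] at hp; simp [soTorus, hp]
  have hC'c : IsClosed C' := isClosed_iUnion_of_finite fun i =>
    (h0.image_of_continuousOn ((continuousOn_pat hη hη' hk b i).mono h0S)).isClosed
  refine ⟨replaceCoc T (fun p q => τ1 (g p) (g q)) τ0, ?_, ?_, ?_⟩
  · refine IsCoc.replace (C := {p | cableFun N r p = 0}) (T' := T') hTc
      (isOpen_lt continuous_cableFun.norm continuous_const)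
      (by rw [hTi]; exact fun p (hp : ‖_‖ < _) => hp.le)
      (fun p hp => by rw [mem_ofPred_eq] at hp; simp [T', hp, hpw])
      (h1.mono fun p hp => hp.2) (isClosed_eq continuous_cableFun continuous_const) hC'c ?_ ?_
    · refine g1.comp (hgc.mono fun p hp => hp.1.1) ?_
      rintro _ ⟨⟨⟨p, hp, rfl⟩, -⟩, hpC⟩
      rw [hgl p hp]
      constructor <;> intro h
      · obtain ⟨j, q, hq, rfl⟩ := exists_ringA hk (q := p) (by rw [h]; norm_num)
        rw [chA_ringA hk j hq] at h
        have hq0 : q.1 = 0 := by simpa using h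
        exact hpC (mem_iUnion.mpr ⟨(false, j), q, hq0, by simp [pat, ring]; rfl⟩)
      · obtain ⟨q', rfl⟩ := chSymm_surjective (k := k) p
        rw [chB_chSymm hk] at h
        obtain ⟨j, q, hq, rfl⟩ := exists_ringA hk (q := q') (by rw [h]; norm_num)
        rw [chA_ringA hk j hq] at h
        have hq0 : q.1 = 0 := by simpa using h
        exact hpC (mem_iUnion.mpr ⟨(true, j), q, hq0, by simp [pat, ring]; rfl⟩)
    · rintro _ ⟨⟨⟨p, hp, rfl⟩, hpS⟩, hpT'⟩
      have hp1 : ‖p.1‖ = 1 := by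
        refine le_antisymm hp (not_lt.mp fun h => hpT' ?_)
        show ‖cableFun N r (cable N r η p)‖ < _
        rw [cableFun_cable hN, norm_mul, norm_real, Real.norm_of_nonneg hpw.le]
        exact mul_lt_of_lt_one_right hpw h
      obtain ⟨O, hO, hO'⟩ := g2 p (by rw [mem_ofPred_eq, hp1]; norm_num)
      obtain ⟨V, hV, hVO⟩ := mem_nhdsWithin_iff_exists_mem_nhds_inter.mp hO
      have hcw : ContinuousWithinAt g (T ∩ soTorus) (cable N r η p) := (hgc.mono inter_subset_left) _ ⟨⟨p, hp, rfl⟩, hpS⟩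
      have hV2 : V ∩ {q : ℂ × Circle | 3 / 4 < ‖q.1‖} ∈ 𝓝 (g (cable N r η p)) := by
        rw [hgl p hp]
        refine Filter.inter_mem hV ((isOpen_lt continuous_const (by fun_prop)).mem_nhds ?_)
        rw [mem_ofPred_eq, hp1]; norm_num
      refine ⟨g ⁻¹' (V ∩ {q | 3 / 4 < ‖q.1‖}) ∩ (T ∩ soTorus), Filter.inter_mem (hcw hV2) self_mem_nhdsWithin, ?_⟩
      rintro _ ⟨⟨ha1, ha2⟩, ⟨a', ha', rfl⟩, -⟩ _ ⟨⟨hb1, hb2⟩, ⟨b', hb', rfl⟩, -⟩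
      rw [h3 _ ⟨a', ha', rfl⟩ _ ⟨b', hb', rfl⟩, cableFun_cable hN, cableFun_cable hN, st_pos_mul _ hpw]
      rw [hgl a' ha'] at ha1 ha2
      rw [hgl b' hb'] at hb1 hb2
      rw [hgl a' ha', hgl b' hb']
      exact (hO' a' (hVO ⟨ha1, le_of_lt (mem_ofPred_eq ▸ ha2)⟩) b' (hVO ⟨hb1, le_of_lt (mem_ofPred_eq ▸ hb2)⟩)).symm
  · refine h2.imp fun p (hp : 3 / 4 ≤ ‖p.1‖) q hq h => ?_
    rw [replaceCoc, if_neg fun h => (hTnorm p h.1).not_ge hp, h, hm]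
  · intro i p hp q hq
    rw [replaceCoc, if_pos ⟨⟨_, ring_mem i hp, rfl⟩, ⟨_, ring_mem i hq, rfl⟩⟩]
    simp only [pat]
    rw [hgl _ (ring_mem i hp), hgl _ (ring_mem i hq), g3 i p hp q hq]

theorem pat_upper (hN : N ≠ 0) (hη : 0 < η) (hη' : η ≤ 1 / 8) (b : Bool) (hG : ∀ g : G, g ^ N = 1)
    {Y : Type*} [TopologicalSpace Y] {τ : ℂ × (Circle × Y) → ℂ × (Circle × Y) → G}
    (hτ : IsCoc {p | (p.1, p.2.1) ∈ soTorus \ ⋃ i, pat N η k b i '' soTorus} τ) :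
    ∃ f, IsIso {p : ℂ × (Circle × Y) | ‖p.1‖ ∈ Icc (3 / 4 : ℝ) 1} τ (fun a b => τ (1, a.2) (1, b.2)) f := by
  refine cable_upper hN (cabRad_pos b) (cabRad_le b) hη hη' hG (hτ.mono fun p hp => ⟨hp.1, fun h => hp.2 ?_⟩)
  obtain ⟨i, q, hq, h⟩ := mem_iUnion.mp h
  exact ⟨_, ring_mem i hq, h⟩

end Pattern

noncomputable section Tree

/-- The product of the plane with a `(d+1)`-torus. -/
abbrev TT (d : ℕ) := ℂ × (Fin (d + 1) → Circle)

/-- The solid torus `𝔻² × (S¹)^{d+1}`. -/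
def MM (d : ℕ) : Set (TT d) := {p | ‖p.1‖ ≤ 1}

variable {d : ℕ}

/-- Apply a map of `ℂ × S¹` to the first two coordinates and rotate the circle coordinates. -/
def stepMap (f : ℂ × Circle → ℂ × Circle) (p : TT d) : TT d :=
  ((f (p.1, p.2 0)).1, Fin.snoc (Fin.tail p.2) (f (p.1, p.2 0)).2)

/-- Coordinatewise closeness with weights. -/
def Close (δ : ℝ) (p q : TT d) : Prop :=
  dist p.1 q.1 ≤ δ ∧ ∀ i : Fin (d + 1), dist (p.2 i) (q.2 i) * 2 ^ (i : ℕ) ≤ δ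

theorem Close.step {f : ℂ × Circle → ℂ × Circle} {δ : ℝ} {p q : TT d} (h : Close δ p q)
    (hf : dist (f (p.1, p.2 0)) (f (q.1, q.2 0)) ≤ (1 / 2) ^ (d + 1) * dist (p.1, p.2 0) (q.1, q.2 0)) :
    Close (δ / 2) (stepMap f p) (stepMap f q) := by
  have h0 : dist (p.1, p.2 0) (q.1, q.2 0) ≤ δ := by
    rw [Prod.dist_eq]
    exact max_le h.1 (by simpa using h.2 0)
  have hδ : 0 ≤ δ := dist_nonneg.trans h0
  have h1 : dist (f (p.1, p.2 0)) (f (q.1, q.2 0)) ≤ (1 / 2) ^ (d + 1) * δ :=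
    hf.trans (by gcongr)
  rw [Prod.dist_eq] at h1
  refine ⟨(le_max_left _ _).trans (h1.trans ?_), fun i => ?_⟩
  · have : ((1 : ℝ) / 2) ^ d ≤ 1 := pow_le_one₀ (by norm_num) (by norm_num)
    rw [pow_succ]; nlinarith
  · induction i using Fin.lastCases with
    | last =>
      simp only [stepMap, Fin.snoc_last, Fin.val_last]
      have := (le_max_right _ _).trans h1
      calc _ ≤ (1 / 2) ^ (d + 1) * δ * 2 ^ d := by gcongr
        _ = δ / 2 := by rw [pow_succ, one_div, inv_pow]; field_simp
    | cast i =>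
      simp only [stepMap, Fin.snoc_castSucc, Fin.val_castSucc, Fin.tail]
      have := h.2 i.succ
      rw [Fin.val_succ, pow_succ] at this
      linarith

theorem stepMap_injective {f f' : ℂ × Circle → ℂ × Circle} {p q : TT d} (h : stepMap f p = stepMap f' q) :
    f (p.1, p.2 0) = f' (q.1, q.2 0) ∧ Fin.tail p.2 = Fin.tail q.2 := by
  obtain ⟨h1, h2⟩ := Prod.ext_iff.mp h
  refine ⟨Prod.ext h1 ?_, funext fun i => ?_⟩
  · simpa [stepMap] using congrFun h2 (Fin.last d)
  · simpa [stepMap] using congrFun h2 i.castSucc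

theorem stepMap_eq_of {p q : TT d} (h : p.1 = q.1) (h0 : p.2 0 = q.2 0)
    (ht : Fin.tail p.2 = Fin.tail q.2) : p = q := by
  refine Prod.ext h ?_
  rw [← Fin.cons_self_tail p.2, ← Fin.cons_self_tail q.2, h0, ht]

theorem continuousOn_stepMap {f : ℂ × Circle → ℂ × Circle} (hf : ContinuousOn f soTorus) :
    ContinuousOn (stepMap f) (MM d) := by
  have h1 : ContinuousOn (fun p : TT d => f (p.1, p.2 0)) (MM d) :=
    hf.comp (by fun_prop) fun p hp => hp
  refine h1.fst.prodMk (continuousOn_pi.mpr fun i => ?_)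
  induction i using Fin.lastCases with
  | last => simpa using h1.snd
  | cast i => simp only [Fin.snoc_castSucc, Fin.tail]; fun_prop

theorem isCompact_MM : IsCompact (MM d) := by
  have : MM d = closedBall (0 : ℂ) 1 ×ˢ univ := by
    ext p; simp [MM]
  rw [this]
  exact (isCompact_closedBall _ _).prod isCompact_univ

/-- Codes of the children of a node: the bit, the type of ring, the index. -/
abbrev Code := Bool × Bool × ℕ

/-- The bits along a node, the latest first. -/
abbrev hist (w : List Code) : List Bool := w.map Prod.fst

/-- A chosen thickness of the pattern. -/
def patEta (d N : ℕ) : ℝ := (exists_pat_lipschitz N (c := (1 / 2) ^ (d + 1)) (by positivity)).choose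

/-- A chosen number of rings of the pattern. -/
def patK (d N : ℕ) : ℕ :=
  (exists_pat_lipschitz N (c := (1 / 2) ^ (d + 1)) (by positivity)).choose_spec.2.2.choose

theorem patEta_pos (d N : ℕ) : 0 < patEta d N :=
  (exists_pat_lipschitz N (c := (1 / 2) ^ (d + 1)) (by positivity)).choose_spec.1

theorem patEta_le (d N : ℕ) : patEta d N ≤ 1 / 8 :=
  (exists_pat_lipschitz N (c := (1 / 2) ^ (d + 1)) (by positivity)).choose_spec.2.1

theorem patK_ne_zero (d N : ℕ) : patK d N ≠ 0 :=
  (exists_pat_lipschitz N (c := (1 / 2) ^ (d + 1)) (by positivity)).choose_spec.2.2.choose_spec.1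

theorem pat_dist_le (d N : ℕ) (b : Bool) (i : Bool × Fin (patK d N)) {p q : ℂ × Circle} (hp : p ∈ soTorus)
    (hq : q ∈ soTorus) : dist (pat N (patEta d N) (patK d N) b i p) (pat N (patEta d N) (patK d N) b i q) ≤
      (1 / 2) ^ (d + 1) * dist p q :=
  (exists_pat_lipschitz N (c := (1 / 2) ^ (d + 1)) (by positivity)).choose_spec.2.2.choose_spec.2 b i p hp q hq

/-- The first two coordinates of the embedding of a child. -/
def phi (d N : ℕ) (e : Code) : ℂ × Circle → ℂ × Circle :=
  if h : e.2.2 < patK d N then pat N (patEta d N) (patK d N) e.1 (e.2.1, ⟨e.2.2, h⟩) else id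

theorem phi_of_lt {N : ℕ} {e : Code} (h : e.2.2 < patK d N) :
    phi d N e = pat N (patEta d N) (patK d N) e.1 (e.2.1, ⟨e.2.2, h⟩) := dif_pos h

/-- A tower of solid tori in a space. -/
structure Tower (d : ℕ) (E : Type*) [MetricSpace E] where
  /-- the winding numbers -/
  N : List Bool → ℕ
  hN : ∀ v, N v ≠ 0
  /-- the embedding of the root -/
  J : TT d → E
  continuous_J : Continuous J
  injective_J : Function.Injective J
  isOpen_image : ∀ f : TT d → TT d, ContinuousOn f (MM d) → InjOn f (MM d) →
    IsOpen ((fun p => J (f p)) '' {p | ‖p.1‖ < 1})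

namespace Tower

variable {E : Type*} [MetricSpace E] (𝒯 : Tower d E)

/-- The valid nodes. -/
def IsNode : List Code → Prop
  | [] => True
  | e :: w => IsNode w ∧ e.2.2 < patK d (𝒯.N (hist w))

/-- The embedding of a node into the model torus. -/
def Ψ : List Code → TT d → TT d
  | [] => id
  | e :: w => Ψ w ∘ stepMap (phi d (𝒯.N (hist w)) e)

/-- The embedding of a node into the space. -/
def chart (w : List Code) (p : TT d) : E := 𝒯.J (𝒯.Ψ w p)

/-- The closed solid torus of a node. -/
def T (w : List Code) : Set E := 𝒯.chart w '' MM d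

/-- The open solid torus of a node. -/
def I (w : List Code) : Set E := 𝒯.chart w '' {p | ‖p.1‖ < 1}

variable {𝒯}

theorem step_mem {N : ℕ} (hN : N ≠ 0) {e : Code} (he : e.2.2 < patK d N) {p : TT d} (hp : p ∈ MM d) :
    ‖(stepMap (phi d N e) p).1‖ < 3 / 4 := by
  rw [phi_of_lt he]
  exact pat_norm_lt hN (patEta_pos d N) (patEta_le d N) _ _ hp

theorem mem_MM_of_lt {p : TT d} (hp : ‖p.1‖ < 3 / 4) : p ∈ MM d := (hp.trans (by norm_num)).le

theorem continuousOn_step {N : ℕ} {e : Code} (he : e.2.2 < patK d N) :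
    ContinuousOn (stepMap (phi d N e)) (MM d) := by
  rw [phi_of_lt he]
  exact continuousOn_stepMap (continuousOn_pat (patEta_pos d N) (patEta_le d N) (patK_ne_zero d N) _ _)

theorem step_injective {N : ℕ} (hN : N ≠ 0) {e e' : Code} (he : e.2.2 < patK d N) (he' : e'.2.2 < patK d N)
    {p p' : TT d} (hp : p ∈ MM d) (hp' : p' ∈ MM d) (h : stepMap (phi d N e) p = stepMap (phi d N e') p') :
    e = e' ∧ p = p' := by
  rw [phi_of_lt he, phi_of_lt he'] at h
  obtain ⟨h1, h2⟩ := stepMap_injective h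
  obtain ⟨h3, h4, h5⟩ := pat_injective hN (patEta_pos d N) (patEta_le d N) (patK_ne_zero d N)
    (p := (p.1, p.2 0)) (p' := (p'.1, p'.2 0)) hp hp' h1
  rw [Prod.ext_iff, Fin.ext_iff] at h4
  exact ⟨Prod.ext h3 (Prod.ext h4.1 h4.2), stepMap_eq_of (Prod.ext_iff.mp h5).1 (Prod.ext_iff.mp h5).2 h2⟩

theorem IsNode.mapsTo {w : List Code} (hw : 𝒯.IsNode w) : MapsTo (𝒯.Ψ w) (MM d) (MM d) := by
  induction w with
  | nil => exact fun p hp => hp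
  | cons e w ih => exact fun p hp => ih hw.1 (mem_MM_of_lt (step_mem (𝒯.hN _) hw.2 hp))

theorem IsNode.continuousOn_Ψ {w : List Code} (hw : 𝒯.IsNode w) : ContinuousOn (𝒯.Ψ w) (MM d) := by
  induction w with
  | nil => exact continuousOn_id
  | cons e w ih =>
    exact (ih hw.1).comp (continuousOn_step hw.2) fun p hp => mem_MM_of_lt (step_mem (𝒯.hN _) hw.2 hp)

theorem IsNode.injective {w w' : List Code} (hw : 𝒯.IsNode w) (hw' : 𝒯.IsNode w') (hl : w.length = w'.length)
    {p p' : TT d} (hp : p ∈ MM d) (hp' : p' ∈ MM d) (h : 𝒯.chart w p = 𝒯.chart w' p') : w = w' ∧ p = p' := by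
  replace h := 𝒯.injective_J h
  induction w generalizing w' p p' with
  | nil =>
    obtain rfl := List.eq_nil_of_length_eq_zero hl.symm
    exact ⟨rfl, h⟩
  | cons e w ih =>
    cases w' with
    | nil => simp at hl
    | cons e' w' =>
      obtain ⟨rfl, h2⟩ := ih hw.1 hw'.1 (by simpa using hl) (mem_MM_of_lt (step_mem (𝒯.hN _) hw.2 hp))
        (mem_MM_of_lt (step_mem (𝒯.hN _) hw'.2 hp')) h
      obtain ⟨rfl, rfl⟩ := step_injective (𝒯.hN _) hw.2 hw'.2 hp hp' h2
      exact ⟨rfl, rfl⟩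

theorem IsNode.continuousOn_chart {w : List Code} (hw : 𝒯.IsNode w) : ContinuousOn (𝒯.chart w) (MM d) :=
  𝒯.continuous_J.comp_continuousOn hw.continuousOn_Ψ

theorem IsNode.injOn_chart {w : List Code} (hw : 𝒯.IsNode w) : InjOn (𝒯.chart w) (MM d) :=
  fun _ hp _ hq h => (hw.injective hw rfl hp hq h).2

theorem IsNode.isCompact_T {w : List Code} (hw : 𝒯.IsNode w) : IsCompact (𝒯.T w) :=
  isCompact_MM.image_of_continuousOn hw.continuousOn_chart

theorem IsNode.isOpen_I {w : List Code} (hw : 𝒯.IsNode w) : IsOpen (𝒯.I w) :=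
  𝒯.isOpen_image _ hw.continuousOn_Ψ fun _ hp _ hq h => hw.injOn_chart hp hq (congrArg 𝒯.J h)

theorem I_subset_T (w : List Code) : 𝒯.I w ⊆ 𝒯.T w :=
  image_mono fun _ (hp : ‖_‖ < (1 : ℝ)) => (hp.le : ‖_‖ ≤ (1 : ℝ))

theorem IsNode.T_cons_subset {e : Code} {w : List Code} (hw : 𝒯.IsNode (e :: w)) :
    𝒯.T (e :: w) ⊆ 𝒯.chart w '' {p | ‖p.1‖ < 3 / 4} := by
  rintro _ ⟨p, hp, rfl⟩
  exact ⟨stepMap (phi d (𝒯.N (hist w)) e) p, step_mem (𝒯.hN _) hw.2 hp, rfl⟩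

theorem image_three_quarters_subset (w : List Code) : 𝒯.chart w '' {p | ‖p.1‖ < 3 / 4} ⊆ 𝒯.I w :=
  image_mono fun _ (hp : ‖_‖ < (3 / 4 : ℝ)) => (hp.trans (by norm_num) : ‖_‖ < (1 : ℝ))

theorem IsNode.T_cons_subset_I {e : Code} {w : List Code} (hw : 𝒯.IsNode (e :: w)) :
    𝒯.T (e :: w) ⊆ 𝒯.I w := hw.T_cons_subset.trans (image_three_quarters_subset w)

theorem IsNode.of_append {u w : List Code} (h : 𝒯.IsNode (u ++ w)) : 𝒯.IsNode w := by
  induction u with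
  | nil => exact h
  | cons e u ih => exact ih h.1

theorem IsNode.T_append_subset {u w : List Code} (h : 𝒯.IsNode (u ++ w)) : 𝒯.T (u ++ w) ⊆ 𝒯.T w := by
  induction u with
  | nil => exact subset_rfl
  | cons e u ih => exact (h.T_cons_subset_I.trans (I_subset_T _)).trans (ih h.1)

theorem IsNode.eq_of_mem {w w' : List Code} (hw : 𝒯.IsNode w) (hw' : 𝒯.IsNode w') (hl : w.length = w'.length)
    {x : E} (hx : x ∈ 𝒯.T w) (hx' : x ∈ 𝒯.T w') : w = w' := by
  obtain ⟨p, hp, rfl⟩ := hx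
  obtain ⟨p', hp', h⟩ := hx'
  exact ((hw'.injective hw hl.symm hp' hp h).1).symm

/-- Nodes sharing a point are comparable. -/
theorem IsNode.suffix_of_mem {w w' : List Code} (hw : 𝒯.IsNode w) (hw' : 𝒯.IsNode w') (hl : w.length ≤ w'.length)
    {x : E} (hx : x ∈ 𝒯.T w) (hx' : x ∈ 𝒯.T w') : ∃ u, w' = u ++ w := by
  obtain ⟨u, v, rfl, hv⟩ : ∃ u v, w' = u ++ v ∧ w.length = v.length :=
    ⟨w'.take (w'.length - w.length), w'.drop (w'.length - w.length), (List.take_append_drop _ _).symm,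
      by rw [List.length_drop]; omega⟩
  exact ⟨u, by rw [hw.eq_of_mem hw'.of_append hv hx (hw'.T_append_subset hx')]⟩

theorem IsNode.close {w : List Code} (hw : 𝒯.IsNode w) {δ : ℝ} {p q : TT d} (hp : p ∈ MM d) (hq : q ∈ MM d)
    (h : Close δ p q) : Close (δ / 2 ^ w.length) (𝒯.Ψ w p) (𝒯.Ψ w q) := by
  induction w generalizing p q δ with
  | nil => simpa [Ψ] using h
  | cons e w ih =>
    have := ih hw.1 (mem_MM_of_lt (step_mem (𝒯.hN _) hw.2 hp)) (mem_MM_of_lt (step_mem (𝒯.hN _) hw.2 hq))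
      (δ := δ / 2) (h.step (by rw [phi_of_lt hw.2]; exact pat_dist_le _ _ _ _ hp hq))
    rw [div_div, ← pow_succ'] at this
    exact this

theorem IsNode.dist_le {w : List Code} (hw : 𝒯.IsNode w) {p q : TT d} (hp : p ∈ MM d) (hq : q ∈ MM d) :
    dist (𝒯.Ψ w p) (𝒯.Ψ w q) ≤ 2 ^ (d + 1) / 2 ^ w.length := by
  have h := hw.close (δ := 2 ^ (d + 1)) hp hq ⟨?_, fun i => ?_⟩
  · rw [Prod.dist_eq]
    refine max_le h.1 ((dist_pi_le_iff (by positivity)).mpr fun i => le_trans ?_ (h.2 i))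
    exact le_mul_of_one_le_right dist_nonneg (one_le_pow₀ (by norm_num))
  · rw [dist_eq_norm]
    have := norm_sub_le p.1 q.1
    have h1 : (1 : ℝ) ≤ 2 ^ d := one_le_pow₀ (by norm_num)
    have hp' : ‖p.1‖ ≤ 1 := hp
    have hq' : ‖q.1‖ ≤ 1 := hq
    rw [pow_succ]; linarith
  · have h1 : dist (p.2 i) (q.2 i) ≤ 2 := by
      rw [Circle.dist_eq']
      refine (norm_sub_le _ _).trans ?_
      simp only [Circle.norm_coe]; norm_num
    have h2 : (2 : ℝ) ^ (i : ℕ) ≤ 2 ^ d := pow_le_pow_right₀ (by norm_num) (by omega)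
    rw [pow_succ]
    nlinarith [pow_pos (two_pos : (0 : ℝ) < 2) (i : ℕ)]

/-- The tori of the nodes shrink uniformly. -/
theorem exists_small (𝒯 : Tower d E) {ε : ℝ} (hε : 0 < ε) : ∃ l, ∀ w, 𝒯.IsNode w → l ≤ w.length →
    ∀ x ∈ 𝒯.T w, ∀ y ∈ 𝒯.T w, dist x y < ε := by
  have huc := isCompact_MM.uniformContinuousOn_of_continuous (𝒯.continuous_J.continuousOn (s := MM d))
  obtain ⟨δ, hδ, h⟩ := Metric.uniformContinuousOn_iff.mp huc ε hε
  obtain ⟨l, hl⟩ := exists_pow_lt_of_lt_one (div_pos hδ (by positivity : (0 : ℝ) < 2 ^ (d + 1))) (by norm_num : (1 / 2 : ℝ) < 1)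
  refine ⟨l, fun w hw hwl => ?_⟩
  rintro _ ⟨p, hp, rfl⟩ _ ⟨q, hq, rfl⟩
  refine h _ (hw.mapsTo hp) _ (hw.mapsTo hq) ((hw.dist_le hp hq).trans_lt ?_)
  rw [lt_div_iff₀ (by positivity), one_div, inv_pow] at hl
  calc (2 : ℝ) ^ (d + 1) / 2 ^ w.length ≤ 2 ^ (d + 1) / 2 ^ l := by gcongr; norm_num
    _ = (2 ^ l)⁻¹ * 2 ^ (d + 1) := by ring
    _ < δ := hl

end Tower

end Tree

noncomputable section TreeConn

variable {d : ℕ}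

theorem stepMap_image (f : ℂ × Circle → ℂ × Circle) (A : Set (ℂ × Circle)) :
    stepMap (d := d) f '' {p | (p.1, p.2 0) ∈ A} = {p | (p.1, p.2 (Fin.last d)) ∈ f '' A} := by
  ext q
  constructor
  · rintro ⟨p, hp, rfl⟩
    exact ⟨_, hp, by simp [stepMap]⟩
  · rintro ⟨x, hx, h⟩
    refine ⟨(x.1, Fin.cons x.2 (Fin.init q.2)), by simpa using hx, ?_⟩
    obtain ⟨h1, h2⟩ := Prod.ext_iff.mp h
    refine Prod.ext (by simpa [stepMap] using h1) ?_
    simp only [stepMap, Fin.cons_zero, Fin.tail_cons]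
    rw [show (x.1, x.2) = x from rfl, h2]
    exact Fin.snoc_init_self q.2

theorem isPreconnected_lift_last {A : Set (ℂ × Circle)} (hA : IsPreconnected A) :
    IsPreconnected {p : TT d | (p.1, p.2 (Fin.last d)) ∈ A} := by
  have h1 : IsPreconnected (univ : Set (Fin d → Circle)) := by
    exact (Set.pi_univ (univ : Set (Fin d)) : _ = _) ▸ isPreconnected_univ_pi fun _ => isPreconnected_circle
  have := (hA.prod h1).image (fun p : (ℂ × Circle) × (Fin d → Circle) => (p.1.1, (Fin.snoc p.2 p.1.2 : Fin (d + 1) → Circle)))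
    (by
      refine ContinuousOn.prodMk (by fun_prop) (continuousOn_pi.mpr fun i => ?_)
      induction i using Fin.lastCases with
      | last => simp only [Fin.snoc_last]; fun_prop
      | cast i => simp only [Fin.snoc_castSucc]; fun_prop)
  convert this using 1
  ext p
  constructor
  · intro hp
    exact ⟨((p.1, p.2 (Fin.last d)), Fin.init p.2), ⟨hp, mem_univ _⟩, Prod.ext rfl (Fin.snoc_init_self p.2)⟩
  · rintro ⟨q, hq, rfl⟩
    simpa using hq.1

namespace Tower

variable {E : Type*} [MetricSpace E] {𝒯 : Tower d E}

theorem isPreconnected_model {A : Set (TT d)} (hA : A = {p | ‖p.1‖ < 1} ∨ A = MM d) {N : ℕ} (hN : N ≠ 0) :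
    IsPreconnected (A \ ⋃ e ∈ {e : Code | e.2.2 < patK d N}, stepMap (phi d N e) '' MM d) := by
  obtain ⟨S, hS, hS', rfl⟩ : ∃ S : Set (ℂ × Circle), {p : ℂ × Circle | ‖p.1‖ < 1} ⊆ S ∧ S ⊆ soTorus ∧
      A = {p | (p.1, p.2 (Fin.last d)) ∈ S} := by
    rcases hA with rfl | rfl
    · exact ⟨{p | ‖p.1‖ < 1}, subset_rfl, fun _ (hp : ‖_‖ < (1 : ℝ)) => (hp.le : ‖_‖ ≤ (1 : ℝ)), rfl⟩
    · exact ⟨soTorus, fun _ (hp : ‖_‖ < (1 : ℝ)) => (hp.le : ‖_‖ ≤ (1 : ℝ)), subset_rfl, rfl⟩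
  have := isPreconnected_lift_last (d := d)
    (isPreconnected_compl_pat hN (patEta_pos d N) (patEta_le d N) (patK_ne_zero d N) hS hS')
  convert this using 1
  ext p
  refine and_congr_right fun _ => not_congr ?_
  have key : ∀ e : Code, p ∈ stepMap (phi d N e) '' MM d ↔ (p.1, p.2 (Fin.last d)) ∈ phi d N e '' soTorus := by
    intro e
    rw [← mem_ofPred_eq (p := fun p : TT d => (p.1, p.2 (Fin.last d)) ∈ phi d N e '' soTorus), ← stepMap_image]
    rfl
  simp only [mem_iUnion, key, exists_prop]
  constructor
  · rintro ⟨e, he, h⟩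
    rw [phi_of_lt he] at h
    exact ⟨_, _, h⟩
  · rintro ⟨b, i, h⟩
    refine ⟨(b, i.1, i.2), i.2.2, ?_⟩
    rw [phi_of_lt (e := (b, i.1, i.2)) i.2.2]
    exact h

theorem IsNode.isPreconnected_sdiff {w : List Code} (hw : 𝒯.IsNode w) {S : Set E} (hS : S = 𝒯.I w ∨ S = 𝒯.T w) :
    IsPreconnected (S \ ⋃ e ∈ {e | 𝒯.IsNode (e :: w)}, 𝒯.T (e :: w)) := by
  obtain ⟨A, hA, rfl⟩ : ∃ A : Set (TT d), (A = {p | ‖p.1‖ < 1} ∨ A = MM d) ∧ S = 𝒯.chart w '' A := by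
    rcases hS with rfl | rfl
    · exact ⟨_, Or.inl rfl, rfl⟩
    · exact ⟨_, Or.inr rfl, rfl⟩
  have hAM : A ⊆ MM d := by
    rcases hA with rfl | rfl
    · exact fun _ (hp : ‖_‖ < (1 : ℝ)) => (hp.le : ‖_‖ ≤ (1 : ℝ))
    · exact subset_rfl
  have := (isPreconnected_model hA (𝒯.hN (hist w))).image (𝒯.chart w)
    (hw.continuousOn_chart.mono (sdiff_subset.trans hAM))
  convert this using 1
  ext x
  constructor
  · rintro ⟨⟨p, hp, rfl⟩, hx⟩
    refine ⟨p, ⟨hp, fun h => hx ?_⟩, rfl⟩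
    simp only [mem_iUnion, exists_prop] at h ⊢
    obtain ⟨e, he, q, hq, rfl⟩ := h
    exact ⟨e, ⟨hw, he⟩, q, hq, rfl⟩
  · rintro ⟨p, ⟨hp, hp'⟩, rfl⟩
    refine ⟨⟨p, hp, rfl⟩, fun h => hp' ?_⟩
    simp only [mem_iUnion, exists_prop] at h ⊢
    obtain ⟨e, he, q, hq, h⟩ := h
    exact ⟨e, he.2, q, hq, hw.injOn_chart (mem_MM_of_lt (step_mem (𝒯.hN _) he.2 hq)) (hAM hp) h⟩

theorem finite_children (w : List Code) : {e | 𝒯.IsNode (e :: w)}.Finite :=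
  ((finite_univ (α := Bool)).prod ((finite_univ (α := Bool)).prod (finite_lt_nat (patK d (𝒯.N (hist w)))))).subset
    fun _ he => ⟨mem_univ _, mem_univ _, he.2⟩

theorem finite_nodes (l : ℕ) : {w | 𝒯.IsNode w ∧ w.length = l}.Finite := by
  induction l with
  | zero => exact (finite_singleton []).subset fun w hw => List.eq_nil_of_length_eq_zero hw.2
  | succ l ih =>
    refine (ih.biUnion fun w _ => (finite_children (𝒯 := 𝒯) w).image (· :: w)).subset ?_
    rintro (_ | ⟨e, w⟩) ⟨hw, hl⟩
    · simp at hl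
    · exact mem_biUnion (x := w) ⟨hw.1, by simpa using hl⟩ ⟨e, hw, rfl⟩

theorem IsNode.isPreconnected_T {w : List Code} (hw : 𝒯.IsNode w) : IsPreconnected (𝒯.T w) := by
  refine IsPreconnected.image ?_ _ hw.continuousOn_chart
  have : IsPreconnected soTorus := by
    have := ((convex_closedBall (0 : ℂ) 1).isPreconnected.prod isPreconnected_circle)
    convert this using 1
    ext p; simp [soTorus]
  exact isPreconnected_lift_last this

theorem IsNode.I_nonempty (𝒯 : Tower d E) (w : List Code) : (𝒯.I w).Nonempty :=
  ⟨𝒯.chart w (0, 1), mem_image_of_mem _ (by simp)⟩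

theorem IsNode.disjoint_children {e e' : Code} {w : List Code} (h : 𝒯.IsNode (e :: w)) (h' : 𝒯.IsNode (e' :: w))
    (hne : e ≠ e') : Disjoint (𝒯.T (e :: w)) (𝒯.T (e' :: w)) :=
  disjoint_left.mpr fun _ hx hx' => hne (List.cons.inj (h.eq_of_mem h' rfl hx hx')).1

/-- The boundary of a child touches the complement of the children. -/
theorem IsNode.exists_touch {e : Code} {w : List Code} (h : 𝒯.IsNode (e :: w)) {S : Set E} (hS : S = 𝒯.I w ∨ S = 𝒯.T w) :
    ∃ x ∈ 𝒯.T (e :: w), x ∉ 𝒯.I (e :: w) ∧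
      x ∈ closure (S \ ⋃ e ∈ {e | 𝒯.IsNode (e :: w)}, 𝒯.T (e :: w)) := by
  have hIS : 𝒯.I w ⊆ S := by
    rcases hS with rfl | rfl
    exacts [subset_rfl, I_subset_T w]
  have hpre : IsPreconnected (𝒯.I w) := by
    have : IsPreconnected {p : TT d | ‖p.1‖ < 1} := by
      have h2 : IsPreconnected ({p : ℂ × Circle | ‖p.1‖ < 1}) := by
        have := ((convex_ball (0 : ℂ) 1).isPreconnected.prod isPreconnected_circle)
        convert this using 1
        ext p; simp
      exact isPreconnected_lift_last h2
    exact this.image _ (h.1.continuousOn_chart.mono fun _ (hp : ‖_‖ < (1 : ℝ)) => (hp.le : ‖_‖ ≤ (1 : ℝ)))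
  obtain ⟨x, ⟨-, hx⟩, hx'⟩ := hpre.closure_sdiff_inter_nonempty h.isCompact_T.isClosed
    (by
      refine ⟨𝒯.chart w (((7 / 8 : ℝ) : ℂ), 1), mem_image_of_mem _ (by simp only [mem_ofPred_eq, Complex.norm_real]; norm_num), fun hc => ?_⟩
      obtain ⟨p, hp, hpx⟩ := h.T_cons_subset hc
      have := h.1.injOn_chart (mem_MM_of_lt hp) (by simp only [MM, mem_ofPred_eq, Complex.norm_real]; norm_num) hpx
      rw [this] at hp
      simp only [mem_ofPred_eq, Complex.norm_real] at hp; norm_num at hp)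
    ((IsNode.I_nonempty 𝒯 (e :: w)).mono fun x hx => ⟨h.T_cons_subset_I (I_subset_T _ hx), I_subset_T _ hx⟩)
  refine ⟨x, hx, fun hxI => ?_, ?_⟩
  · obtain ⟨y, hy, hy'⟩ := mem_closure_iff.mp hx' _ h.isOpen_I hxI
    exact hy'.2 (I_subset_T _ hy)
  · have hcl : IsClosed (⋃ e' ∈ {e' | 𝒯.IsNode (e' :: w)} \ {e}, 𝒯.T (e' :: w)) :=
      ((finite_children (𝒯 := 𝒯) w).subset sdiff_subset).isClosed_biUnion fun e' he' => IsNode.isCompact_T he'.1 |>.isClosed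
    have hxn : x ∉ ⋃ e' ∈ {e' | 𝒯.IsNode (e' :: w)} \ {e}, 𝒯.T (e' :: w) := by
      simp only [mem_iUnion, not_exists]
      exact fun e' he' hxe => he'.2 (List.cons.inj (IsNode.eq_of_mem he'.1 h rfl hxe hx)).1
    refine mem_closure_iff.mpr fun O hO hxO => ?_
    obtain ⟨y, ⟨hyO, hyn⟩, hy⟩ := mem_closure_iff.mp hx' _ (hO.inter hcl.isOpen_compl) ⟨hxO, hxn⟩
    refine ⟨y, hyO, hIS hy.1, ?_⟩
    simp only [mem_iUnion, not_exists]
    intro e' he' hye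
    by_cases hee : e' = e
    · exact hy.2 (hee ▸ hye)
    · exact hyn (mem_biUnion (x := e') ⟨he', hee⟩ hye)

theorem IsNode.T_append_subset_I {u w : List Code} (h : 𝒯.IsNode (u ++ w)) (hu : u ≠ []) : 𝒯.T (u ++ w) ⊆ 𝒯.I w := by
  induction u with
  | nil => exact absurd rfl hu
  | cons e u ih =>
    refine h.T_cons_subset_I.trans ?_
    rcases eq_or_ne u [] with rfl | hu'
    · exact subset_rfl
    · exact (I_subset_T _).trans (ih h.1 hu')

/-- Removing some of the descendants of a fixed generation keeps a solid torus connected. -/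
theorem IsNode.isPreconnected_sdiff_descendants (P : Set (List Code)) (k : ℕ) {w : List Code} (hw : 𝒯.IsNode w) {S : Set E}
    (hS : S = 𝒯.I w ∨ S = 𝒯.T w) :
    IsPreconnected (S \ ⋃ v ∈ {v | 𝒯.IsNode v ∧ v.length = w.length + k + 1 ∧ v ∈ P}, 𝒯.T v) := by
  have hIS : 𝒯.I w ⊆ S := by
    rcases hS with rfl | rfl
    exacts [subset_rfl, I_subset_T w]
  induction k generalizing w S with
  | zero =>
    have := (hw.isPreconnected_sdiff hS).union_touching
      (A := fun e : {e // 𝒯.IsNode (e :: w) ∧ e :: w ∉ P} => 𝒯.T (e.1 :: w)) (fun e => e.2.1.isPreconnected_T)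
      fun e => by
        obtain ⟨x, hx, -, hx'⟩ := e.2.1.exists_touch hS
        exact ⟨x, hx, hx'⟩
    convert this using 1
    ext x
    constructor
    · rintro ⟨hx, hx'⟩
      by_cases h : ∃ e, 𝒯.IsNode (e :: w) ∧ x ∈ 𝒯.T (e :: w)
      · obtain ⟨e, he, hxe⟩ := h
        exact Or.inr (mem_iUnion.mpr ⟨⟨e, he, fun hP => hx' (mem_biUnion (x := e :: w) ⟨he, by simp, hP⟩ hxe)⟩, hxe⟩)
      · refine Or.inl ⟨hx, fun hx2 => h ?_⟩
        simpa using hx2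
    · rintro (⟨hx, hx'⟩ | hx)
      · refine ⟨hx, fun hx2 => hx' ?_⟩
        simp only [mem_iUnion] at hx2 ⊢
        obtain ⟨_ | ⟨e, v⟩, ⟨hv, hl, -⟩, hxv⟩ := hx2
        · simp at hl
        · obtain rfl := hv.1.eq_of_mem hw (by simpa using hl) (I_subset_T _ (hv.T_cons_subset_I hxv)) (by
            rcases hS with rfl | rfl
            exacts [I_subset_T _ hx, hx])
          exact ⟨e, hv, hxv⟩
      · obtain ⟨⟨e, he, hP⟩, hx⟩ := mem_iUnion.mp hx
        refine ⟨hIS (he.T_cons_subset_I hx), fun hx2 => ?_⟩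
        simp only [mem_iUnion] at hx2
        obtain ⟨v, ⟨hv, hl, hvP⟩, hxv⟩ := hx2
        exact hP (he.eq_of_mem hv (by simpa using hl.symm) hx hxv ▸ hvP)
  | succ k ih =>
    set R := ⋃ v ∈ {v | 𝒯.IsNode v ∧ v.length = w.length + (k + 1) + 1 ∧ v ∈ P}, 𝒯.T v with hR
    have key : ∀ e : {e // 𝒯.IsNode (e :: w)}, IsPreconnected (𝒯.T (e.1 :: w) \ R) := fun e => by
      rw [hR, show w.length + (k + 1) + 1 = (e.1 :: w).length + k + 1 by simp only [List.length_cons]; omega]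
      exact ih e.2 (Or.inr rfl) (I_subset_T _)
    have := (hw.isPreconnected_sdiff hS).union_touching key fun e => by
        obtain ⟨x, hx, hxI, hx'⟩ := e.2.exists_touch hS
        refine ⟨x, ⟨hx, fun hxR => hxI ?_⟩, hx'⟩
        simp only [hR, mem_iUnion] at hxR
        obtain ⟨v, ⟨hv, hl, -⟩, hxv⟩ := hxR
        obtain ⟨u, rfl⟩ := e.2.suffix_of_mem hv (by simp; omega) hx hxv
        refine hv.T_append_subset_I ?_ hxv
        rintro rfl
        simp at hl
    convert this using 1
    ext x
    constructor
    · rintro ⟨hx, hx'⟩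
      by_cases h : ∃ e, 𝒯.IsNode (e :: w) ∧ x ∈ 𝒯.T (e :: w)
      · obtain ⟨e, he, hxe⟩ := h
        exact Or.inr (mem_iUnion.mpr ⟨⟨e, he⟩, hxe, hx'⟩)
      · refine Or.inl ⟨hx, fun hx2 => h ?_⟩
        simpa using hx2
    · rintro (⟨hx, hx'⟩ | hx)
      · refine ⟨hx, fun hx2 => hx' ?_⟩
        simp only [hR, mem_iUnion] at hx2 ⊢
        obtain ⟨v, ⟨hv, hl, -⟩, hxv⟩ := hx2
        have hxT : x ∈ 𝒯.T w := by
          rcases hS with rfl | rfl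
          exacts [I_subset_T _ hx, hx]
        obtain ⟨u, rfl⟩ := hw.suffix_of_mem hv (by omega) hxT hxv
        obtain ⟨u, e, rfl⟩ : ∃ u' e, u = u' ++ [e] := by
          rcases List.eq_nil_or_concat u with rfl | h
          · simp at hl; omega
          · simpa using h
        rw [List.append_assoc] at hv hxv
        exact ⟨e, hv.of_append, hv.T_append_subset hxv⟩
      · obtain ⟨⟨e, he⟩, hx, hx'⟩ := mem_iUnion.mp hx
        exact ⟨hIS (he.T_cons_subset_I hx), hx'⟩

end Tower

end TreeConn

noncomputable section TreeLower

variable {d : ℕ}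

/-- The list of the first values of a sequence, the latest first. -/
def initBits (s : ℕ → Bool) : ℕ → List Bool
  | 0 => []
  | l + 1 => s l :: initBits s l

namespace Tower

variable {E : Type*} [MetricSpace E] {𝒯 : Tower d E} {s : ℕ → Bool}

/-- The nodes that lie over the branch `s`. -/
def OnBranch (𝒯 : Tower d E) (s : ℕ → Bool) (w : List Code) : Prop :=
  𝒯.IsNode w ∧ hist w = initBits s w.length

/-- The Cantor set of a branch. -/
def Z (𝒯 : Tower d E) (s : ℕ → Bool) : Set E :=
  ⋂ l, ⋃ w ∈ {w | 𝒯.OnBranch s w ∧ w.length = l}, 𝒯.T w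

theorem onBranch_nil : 𝒯.OnBranch s [] := ⟨trivial, rfl⟩

theorem onBranch_cons {e : Code} {w : List Code} :
    𝒯.OnBranch s (e :: w) ↔ 𝒯.IsNode (e :: w) ∧ 𝒯.OnBranch s w ∧ e.1 = s w.length := by
  simp only [OnBranch, hist, List.map_cons, List.length_cons, initBits, List.cons.injEq]
  exact ⟨fun h => ⟨h.1, ⟨h.1.1, h.2.2⟩, h.2.1⟩, fun h => ⟨h.1, h.2.2, h.2.1.2⟩⟩

theorem OnBranch.of_append {u w : List Code} (h : 𝒯.OnBranch s (u ++ w)) : 𝒯.OnBranch s w := by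
  induction u with
  | nil => exact h
  | cons e u ih => exact ih (onBranch_cons.mp h).2.1

theorem mem_Z {x : E} : x ∈ 𝒯.Z s ↔ ∀ l, ∃ w, (𝒯.OnBranch s w ∧ w.length = l) ∧ x ∈ 𝒯.T w := by
  simp [Z]

theorem isClosed_Z : IsClosed (𝒯.Z s) :=
  isClosed_iInter fun l => ((finite_nodes (𝒯 := 𝒯) l).subset fun _ hw => ⟨hw.1.1, hw.2⟩).isClosed_biUnion
    fun _ hw => hw.1.1.isCompact_T.isClosed

theorem Z_subset : 𝒯.Z s ⊆ 𝒯.I [] := by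
  intro x hx
  obtain ⟨_ | ⟨e, w⟩, ⟨hw, hl⟩, hxw⟩ := mem_Z.mp hx 1
  · simp at hl
  · obtain rfl := List.eq_nil_of_length_eq_zero (by simpa using hl)
    exact hw.1.T_cons_subset_I hxw

/-- Two points share the node `w` of the branch, but none of its children. -/
def Deep (𝒯 : Tower d E) (s : ℕ → Bool) (a b : E) (w : List Code) : Prop :=
  𝒯.OnBranch s w ∧ a ∈ 𝒯.T w ∧ b ∈ 𝒯.T w ∧ ∀ e, 𝒯.OnBranch s (e :: w) → ¬ (a ∈ 𝒯.T (e :: w) ∧ b ∈ 𝒯.T (e :: w))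

theorem Deep.unique {a b : E} {w w' : List Code} (h : 𝒯.Deep s a b w) (h' : 𝒯.Deep s a b w') : w = w' := by
  wlog hl : w.length ≤ w'.length generalizing w w'
  · exact (this h' h (le_of_not_ge hl)).symm
  obtain ⟨u, rfl⟩ := h.1.1.suffix_of_mem h'.1.1 hl h.2.1 h'.2.1
  rcases List.eq_nil_or_concat u with rfl | ⟨u, e, rfl⟩
  · rfl
  · simp only [List.concat_eq_append, List.append_assoc, List.singleton_append] at h'
    exact (h.2.2.2 e h'.1.of_append ⟨h'.1.1.T_append_subset h'.2.1, h'.1.1.T_append_subset h'.2.2.1⟩).elim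

theorem exists_deep {a : E} (ha : a ∈ 𝒯.T []) (hZ : a ∉ 𝒯.Z s) : ∃ w, 𝒯.Deep s a a w := by
  classical
  have h : ∃ l, ¬ ∃ w, (𝒯.OnBranch s w ∧ w.length = l) ∧ a ∈ 𝒯.T w := by
    simpa [mem_Z] using hZ
  obtain ⟨l, hl⟩ : ∃ l, Nat.find h = l + 1 := by
    refine Nat.exists_eq_succ_of_ne_zero fun h0 => ?_
    have := Nat.find_spec h
    rw [h0] at this
    exact this ⟨[], ⟨onBranch_nil, rfl⟩, ha⟩
  obtain ⟨w, ⟨hw, hwl⟩, hwa⟩ := not_not.mp (Nat.find_min h (m := l) (by omega))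
  refine ⟨w, hw, hwa, hwa, fun e he hc => Nat.find_spec h ⟨e :: w, ⟨he, by rw [List.length_cons, hwl]; exact hl.symm⟩, hc.1⟩⟩

/-- A chart is a homeomorphism on the closed solid torus. -/
theorem IsNode.exists_inverse {w : List Code} (hw : 𝒯.IsNode w) : ∃ g : E → TT d, ContinuousOn g (𝒯.T w) ∧
    ∀ p ∈ MM d, g (𝒯.chart w p) = p :=
  ⟨_, isCompact_MM.continuousOn_invFunOn hw.continuousOn_chart hw.injOn_chart,
    fun _ hp => hw.injOn_chart.leftInvOn_invFunOn hp⟩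

theorem isClosed_three_quarters {w : List Code} (hw : 𝒯.IsNode w) : IsClosed (𝒯.chart w '' {p | ‖p.1‖ ≤ 3 / 4}) := by
  have hsub : {p : TT d | ‖p.1‖ ≤ 3 / 4} ⊆ MM d := fun p (hp : ‖p.1‖ ≤ (3 / 4 : ℝ)) => hp.trans (by norm_num)
  refine ((isCompact_MM.of_isClosed_subset ?_ hsub).image_of_continuousOn (hw.continuousOn_chart.mono hsub)).isClosed
  exact isClosed_le (by fun_prop) continuous_const

variable {G : Type*} [Group G]

/-- The local systems on the levels of the branch. -/
structure LevelSystem (𝒯 : Tower d E) (s : ℕ → Bool) (G : Type*) [Group G] where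
  /-- the local systems -/
  π : List Code → TT d → TT d → G
  /-- the monodromies -/
  m : List Code → G
  isCoc : ∀ w, 𝒯.OnBranch s w → IsCoc (MM d \ ⋃ e ∈ {e | 𝒯.OnBranch s (e :: w)},
    stepMap (phi d (𝒯.N (hist w)) e) '' {p | p.1 = 0}) (π w)
  collar : ∀ w, 𝒯.OnBranch s w → Loc {p : TT d | 3 / 4 ≤ ‖p.1‖} fun p q => π w p q = st (m w) p.1 q.1
  step : ∀ w e, 𝒯.OnBranch s (e :: w) → ∀ p ∈ MM d, ∀ q ∈ MM d, π w (stepMap (phi d (𝒯.N (hist w)) e) p)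
    (stepMap (phi d (𝒯.N (hist w)) e) q) = st (m (e :: w)) p.1 q.1

theorem exists_levelSystem (𝒯 : Tower d E) (s : ℕ → Bool) {S : Set G} (hS : S.Nonempty)
    (hroot : ∀ l, ∀ m ∈ S, ∃ x ∈ S, x ^ 𝒯.N (initBits s l) = m)
    (hcomm : ∀ x ∈ S, ∃ a ∈ S, ∃ c ∈ S, c * a * c⁻¹ * a⁻¹ = x) :
    ∃ L : LevelSystem 𝒯 s G, ∀ w, L.m w ∈ S := by
  obtain ⟨m0, hm0⟩ := hS
  have h1 : ∀ l, ∀ m : S, ∃ ac : S × S, ((ac.2 : G) * ac.1 * (ac.2 : G)⁻¹ * (ac.1 : G)⁻¹) ^ 𝒯.N (initBits s l) = m := by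
    intro l m
    obtain ⟨x, hx, hxm⟩ := hroot l m m.2
    obtain ⟨a, ha, c, hc, h⟩ := hcomm x hx
    exact ⟨(⟨a, ha⟩, ⟨c, hc⟩), by simp only [h, hxm]⟩
  choose ac hac using h1
  let m : List Code → S := fun w => List.rec (motive := fun _ => S) ⟨m0, hm0⟩
    (fun e w r => if e.2.1 then (ac w.length r).2 else (ac w.length r).1) w
  have hm : ∀ e w, m (e :: w) = if e.2.1 then (ac w.length (m w)).2 else (ac w.length (m w)).1 := fun _ _ => rfl
  have key : ∀ w, ∃ π : ℂ × Circle → ℂ × Circle → G, 𝒯.OnBranch s w →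
      IsCoc (soTorus \ ⋃ i, pat (𝒯.N (hist w)) (patEta d (𝒯.N (hist w))) (patK d (𝒯.N (hist w))) (s w.length) i '' {p | p.1 = 0}) π ∧
      Loc {p : ℂ × Circle | 3 / 4 ≤ ‖p.1‖} (fun p q => π p q = st (m w).1 p.1 q.1) ∧
      ∀ i, ∀ p ∈ soTorus, ∀ q ∈ soTorus,
        π (pat (𝒯.N (hist w)) (patEta d (𝒯.N (hist w))) (patK d (𝒯.N (hist w))) (s w.length) i p)
          (pat (𝒯.N (hist w)) (patEta d (𝒯.N (hist w))) (patK d (𝒯.N (hist w))) (s w.length) i q) =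
        st (if i.1 then ((ac w.length (m w)).2 : G) else (ac w.length (m w)).1) p.1 q.1 := by
    intro w
    by_cases hw : 𝒯.OnBranch s w
    · obtain ⟨π, h⟩ := pat_lower (𝒯.hN (hist w)) (patEta_pos d _) (patEta_le d (𝒯.N (hist w))) (patK_ne_zero d (𝒯.N (hist w)))
        (s w.length) (m := (m w).1) (a := (ac w.length (m w)).1) (c := (ac w.length (m w)).2) (by rw [hw.2]; exact hac _ _)
      exact ⟨π, fun _ => h⟩
    · exact ⟨1, fun h => (hw h).elim⟩
  choose π hπ using key
  refine ⟨⟨fun w p q => π w (p.1, p.2 (Fin.last d)) (q.1, q.2 (Fin.last d)), fun w => (m w).1, fun w hw => ?_, fun w hw => ?_,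
    fun w e he p hp q hq => ?_⟩, fun w => (m w).2⟩
  · refine (hπ w hw).1.comp (by fun_prop) fun p hp => ⟨hp.1, fun h => hp.2 ?_⟩
    obtain ⟨i, h⟩ := mem_iUnion.mp h
    have hi : 𝒯.OnBranch s ((s w.length, i.1, i.2.1) :: w) := onBranch_cons.mpr ⟨⟨hw.1, i.2.2⟩, hw, rfl⟩
    refine mem_biUnion (x := (s w.length, i.1, i.2.1)) hi ?_
    have := (stepMap_image (d := d) (phi d (𝒯.N (hist w)) (s w.length, i.1, i.2.1)) {p | p.1 = 0}).ge
    refine this ?_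
    rw [phi_of_lt (e := (s w.length, i.1, i.2.1)) i.2.2]
    exact h
  · exact Loc.comp (φ := fun p : TT d => (p.1, p.2 (Fin.last d))) (hπ w hw).2.1 (by fun_prop) fun p hp => hp
  · obtain ⟨he1, hw, he2⟩ := onBranch_cons.mp he
    have := (hπ w hw).2.2 (e.2.1, ⟨e.2.2, he1.2⟩) (p.1, p.2 0) hp (q.1, q.2 0) hq
    rw [← he2] at this
    simp only [stepMap, Fin.snoc_last, Prod.mk.eta, phi_of_lt he1.2]
    rw [he2] at this
    rw [he2, this, hm]
    split_ifs <;> simp_all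

open Classical in
/-- The local system on the complement of the Cantor set of a branch. -/
def LevelSystem.glue (L : LevelSystem 𝒯 s G) (g : List Code → E → TT d) (a b : E) : G :=
  if h : ∃ w, 𝒯.Deep s a b w then L.π h.choose (g h.choose a) (g h.choose b) else 1

theorem LevelSystem.glue_eq (L : LevelSystem 𝒯 s G) (g : List Code → E → TT d) {a b : E} {w : List Code}
    (h : 𝒯.Deep s a b w) : L.glue g a b = L.π w (g w a) (g w b) := by
  have h' : ∃ w, 𝒯.Deep s a b w := ⟨w, h⟩
  rw [LevelSystem.glue, dif_pos h', h'.choose_spec.unique h]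

theorem LevelSystem.isCoc_glue (L : LevelSystem 𝒯 s G) {g : List Code → E → TT d}
    (hg : ∀ w, 𝒯.IsNode w → ContinuousOn (g w) (𝒯.T w))
    (hgc : ∀ w, 𝒯.IsNode w → ∀ p ∈ MM d, g w (𝒯.chart w p) = p) : IsCoc (𝒯.I [] \ 𝒯.Z s) (L.glue g) := by
  have hfin : ∀ w, {e | 𝒯.OnBranch s (e :: w)}.Finite := fun w => (finite_children (𝒯 := 𝒯) w).subset fun _ h => h.1
  suffices H : ∀ p ∈ 𝒯.I [] \ 𝒯.Z s, ∃ w, 𝒯.OnBranch s w ∧ ∃ O, IsOpen O ∧ p ∈ O ∧ O ⊆ 𝒯.T w ∧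
      (∀ e, 𝒯.OnBranch s (e :: w) → ∀ x ∈ O, ∀ q : TT d, q.1 = 0 → x ≠ 𝒯.chart (e :: w) q) ∧
      ∀ a ∈ O, ∀ b ∈ O, L.glue g a b = L.π w (g w a) (g w b) by
    refine IsCoc.of_cover fun p hp => ?_
    obtain ⟨w, hw, O, hO, hpO, hOT, hch, hOeq⟩ := H p hp
    refine ⟨O, hO, hpO, IsCoc.of_loc_eq ((L.isCoc w hw).comp ((hg w hw.1).mono (inter_subset_right.trans hOT)) ?_)
      fun x hx => ⟨_, self_mem_nhdsWithin, fun a ha b hb => (hOeq a ha.2 b hb.2).symm⟩⟩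
    rintro x ⟨-, hxO⟩
    obtain ⟨q, hq, rfl⟩ := hOT hxO
    rw [hgc w hw.1 q hq]
    refine ⟨hq, fun hc => ?_⟩
    simp only [mem_iUnion] at hc
    obtain ⟨e, he, r, hr, rfl⟩ := hc
    exact hch e he _ hxO r hr rfl
  rintro p ⟨hpI, hpZ⟩
  obtain ⟨w, hwd⟩ := exists_deep (I_subset_T _ hpI) hpZ
  have core : ∀ (w : List Code) (q : TT d), q.1 = 0 → 𝒯.chart w q ∈ 𝒯.chart w '' {p | ‖p.1‖ < 3 / 4} :=
    fun w q hq => mem_image_of_mem _ (by simp [hq])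
  by_cases hpw : p ∈ 𝒯.I w
  · have hcl : IsClosed (⋃ e ∈ {e | 𝒯.OnBranch s (e :: w)}, 𝒯.T (e :: w)) :=
      (hfin w).isClosed_biUnion fun e he => he.1.isCompact_T.isClosed
    refine ⟨w, hwd.1, 𝒯.I w \ ⋃ e ∈ {e | 𝒯.OnBranch s (e :: w)}, 𝒯.T (e :: w), hwd.1.1.isOpen_I.sdiff hcl,
      ⟨hpw, fun hc => ?_⟩, sdiff_subset.trans (I_subset_T _), ?_, ?_⟩
    · simp only [mem_iUnion] at hc
      obtain ⟨e, he, h⟩ := hc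
      exact hwd.2.2.2 e he ⟨h, h⟩
    · rintro e he x hx q hq rfl
      exact hx.2 (mem_biUnion (x := e) he (I_subset_T _ (image_three_quarters_subset _ (core _ q hq))))
    · intro a ha b hb
      exact L.glue_eq g ⟨hwd.1, I_subset_T _ ha.1, I_subset_T _ hb.1,
        fun e he h => ha.2 (mem_biUnion (x := e) he h.1)⟩
  · obtain _ | ⟨e, w⟩ := w
    · exact (hpw hpI).elim
    obtain ⟨he1, hw, he2⟩ := onBranch_cons.mp hwd.1
    have hcl : IsClosed (⋃ e' ∈ {e' | 𝒯.OnBranch s (e' :: w)} \ {e}, 𝒯.T (e' :: w)) :=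
      ((hfin w).subset sdiff_subset).isClosed_biUnion fun e he => he.1.1.isCompact_T.isClosed
    have hcollar : Loc (𝒯.T (e :: w) \ 𝒯.chart (e :: w) '' {p | ‖p.1‖ < 3 / 4})
        fun a b => L.π (e :: w) (g (e :: w) a) (g (e :: w) b) = st (L.m (e :: w)) (g (e :: w) a).1 (g (e :: w) b).1 := by
      refine (L.collar _ hwd.1).comp ((hg _ he1).mono sdiff_subset) ?_
      rintro _ ⟨⟨q, hq, rfl⟩, h⟩
      rw [hgc _ he1 q hq]
      by_contra hlt
      exact h ⟨q, (not_le.mp hlt : ‖q.1‖ < (3 / 4 : ℝ)), rfl⟩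
    obtain ⟨O, hO, hOe⟩ := hcollar p ⟨hwd.2.1, fun h => hpw (image_three_quarters_subset _ h)⟩
    obtain ⟨O', hO', hpO', hOO'⟩ := mem_nhdsWithin.mp hO
    have hp34 : p ∉ 𝒯.chart (e :: w) '' {p | ‖p.1‖ ≤ 3 / 4} := by
      rintro ⟨q, hq, rfl⟩
      exact hpw ⟨q, (lt_of_le_of_lt hq (by norm_num) : ‖q.1‖ < (1 : ℝ)), rfl⟩
    have hsub : ∀ {x}, x ∉ 𝒯.chart (e :: w) '' {p | ‖p.1‖ ≤ 3 / 4} → x ∉ 𝒯.chart (e :: w) '' {p | ‖p.1‖ < 3 / 4} :=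
      fun hx hx' => hx (image_mono (fun _ (h : ‖_‖ < (3 / 4 : ℝ)) => (h.le : ‖_‖ ≤ (3 / 4 : ℝ))) hx')
    refine ⟨w, hw, ((𝒯.I w \ ⋃ e' ∈ {e' | 𝒯.OnBranch s (e' :: w)} \ {e}, 𝒯.T (e' :: w)) \
      𝒯.chart (e :: w) '' {p | ‖p.1‖ ≤ 3 / 4}) ∩ O',
      ((hw.1.isOpen_I.sdiff hcl).sdiff (isClosed_three_quarters he1)).inter hO',
      ⟨⟨⟨he1.T_cons_subset_I hwd.2.1, fun hc => ?_⟩, hp34⟩, hpO'⟩, fun x hx => I_subset_T _ hx.1.1.1, ?_, ?_⟩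
    · simp only [mem_iUnion] at hc
      obtain ⟨e', he', h⟩ := hc
      exact he'.2 (List.cons.inj (he'.1.1.eq_of_mem he1 rfl h hwd.2.1)).1
    · rintro e' he' x hx q hq rfl
      by_cases hee : e' = e
      · subst hee
        exact hsub hx.1.2 (core _ q hq)
      · exact hx.1.1.2 (mem_biUnion (x := e') ⟨he', hee⟩ (I_subset_T _ (image_three_quarters_subset _ (core _ q hq))))
    · intro a ha b hb
      by_cases hab : a ∈ 𝒯.T (e :: w) ∧ b ∈ 𝒯.T (e :: w)
      · have hd : 𝒯.Deep s a b (e :: w) := ⟨hwd.1, hab.1, hab.2, fun e' he' h => hsub ha.1.2 (he'.1.T_cons_subset h.1)⟩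
        rw [L.glue_eq g hd, hOe a (hOO' ⟨ha.2, hab.1, hsub ha.1.2⟩) b (hOO' ⟨hb.2, hab.2, hsub hb.1.2⟩)]
        obtain ⟨⟨q, hq, rfl⟩, ⟨r, hr, rfl⟩⟩ := hab
        rw [hgc _ he1 q hq, hgc _ he1 r hr]
        have h1 : ∀ q ∈ MM d, g w (𝒯.chart (e :: w) q) = stepMap (phi d (𝒯.N (hist w)) e) q := fun q hq =>
          hgc w hw.1 (stepMap (phi d (𝒯.N (hist w)) e) q) (mem_MM_of_lt (step_mem (𝒯.hN _) he1.2 hq))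
        rw [h1 q hq, h1 r hr, L.step w e hwd.1 q hq r hr]
      · refine L.glue_eq g ⟨hw, I_subset_T _ ha.1.1.1, I_subset_T _ hb.1.1.1, fun e' he' h => ?_⟩
        by_cases hee : e' = e
        · exact hab (hee ▸ h)
        · exact ha.1.1.2 (mem_biUnion (x := e') ⟨he', hee⟩ h.1)

/-- A nontrivial local system around the Cantor set of a branch. -/
theorem exists_wild_cocycle (𝒯 : Tower d E) (s : ℕ → Bool) {S : Set G} (hS : S.Nonempty) (h1 : 1 ∉ S)
    (hroot : ∀ l, ∀ m ∈ S, ∃ x ∈ S, x ^ 𝒯.N (initBits s l) = m)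
    (hcomm : ∀ x ∈ S, ∃ a ∈ S, ∃ c ∈ S, c * a * c⁻¹ * a⁻¹ = x) :
    ∃ τ : E → E → G, IsCoc (𝒯.I [] \ 𝒯.Z s) τ ∧ ∀ p ∈ 𝒯.Z s, ∀ V ∈ 𝓝 p, ∀ f, ¬ IsPot (V \ 𝒯.Z s) τ f := by
  obtain ⟨L, hL⟩ := 𝒯.exists_levelSystem s hS hroot hcomm
  have hg : ∀ w, ∃ g : E → TT d, 𝒯.IsNode w → ContinuousOn g (𝒯.T w) ∧ ∀ p ∈ MM d, g (𝒯.chart w p) = p := fun w => by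
    by_cases hw : 𝒯.IsNode w
    · obtain ⟨g, h⟩ := hw.exists_inverse
      exact ⟨g, fun _ => h⟩
    · exact ⟨fun _ => (0, 1), fun h => (hw h).elim⟩
  choose g hg using hg
  refine ⟨L.glue g, L.isCoc_glue (fun w hw => (hg w hw).1) fun w hw => (hg w hw).2, fun p hp V hV f hf => ?_⟩
  obtain ⟨ε, hε, hεV⟩ := Metric.mem_nhds_iff.mp hV
  obtain ⟨l, hl⟩ := 𝒯.exists_small hε
  obtain ⟨w, ⟨hw, hwl⟩, hpw⟩ := mem_Z.mp hp l
  have hTV : 𝒯.T w ⊆ V := fun x hx => hεV (hl w hw.1 hwl.ge x hx p hpw)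
  have hnorm : ∀ z ∈ sphere (0 : ℂ) 1, ‖((7 / 8 : ℝ) : ℂ) * z‖ = 7 / 8 := fun z hz => by
    rw [norm_mul, Complex.norm_real, mem_sphere_zero_iff_norm.mp hz]; norm_num
  set c : ℂ → E := fun z => 𝒯.chart w (((7 / 8 : ℝ) : ℂ) * z, 1) with hc
  have hcM : ∀ z ∈ sphere (0 : ℂ) 1, ((((7 / 8 : ℝ) : ℂ) * z, 1) : TT d) ∈ MM d := fun z hz => by
    simp only [MM, mem_ofPred_eq, hnorm z hz]; norm_num
  have hc34 : ∀ z ∈ sphere (0 : ℂ) 1, c z ∉ 𝒯.chart w '' {p | ‖p.1‖ < 3 / 4} := by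
    rintro z hz ⟨q, hq, h⟩
    have := hw.1.injOn_chart (mem_MM_of_lt hq) (hcM z hz) h
    subst this
    simp only [mem_ofPred_eq, hnorm z hz] at hq
    norm_num at hq
  have hcV : MapsTo c (sphere 0 1) (V \ 𝒯.Z s) := fun z hz => by
    refine ⟨hTV (mem_image_of_mem _ (hcM z hz)), fun hzZ => ?_⟩
    obtain ⟨_ | ⟨e, w'⟩, ⟨hw', hl'⟩, hz'⟩ := mem_Z.mp hzZ (w.length + 1)
    · simp at hl'
    · obtain rfl := hw'.1.1.eq_of_mem hw.1 (by simpa using hl') (I_subset_T _ (hw'.1.T_cons_subset_I hz')) (mem_image_of_mem _ (hcM z hz))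
      exact hc34 z hz (hw'.1.T_cons_subset hz')
  have hcc : ContinuousOn c (sphere 0 1) := hw.1.continuousOn_chart.comp (by fun_prop) hcM
  have h2 : Loc (sphere (0 : ℂ) 1) fun a b => L.π w (((7 / 8 : ℝ) : ℂ) * a, 1) (((7 / 8 : ℝ) : ℂ) * b, 1) =
      st (L.m w) (((7 / 8 : ℝ) : ℂ) * a) (((7 / 8 : ℝ) : ℂ) * b) :=
    Loc.comp (φ := fun a : ℂ => ((((7 / 8 : ℝ) : ℂ) * a, 1) : TT d)) (L.collar w hw) (by fun_prop) fun z hz => by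
      simp only [mem_ofPred_eq, hnorm z hz]; norm_num
  have h3 : IsPot (sphere (0 : ℂ) 1) (st (L.m w)) (f ∘ c) := by
    refine (Loc.and (hf.comp hcc hcV) h2).imp fun a ha b hb hab => ?_
    have hd : 𝒯.Deep s (c a) (c b) w := ⟨hw, mem_image_of_mem _ (hcM a ha), mem_image_of_mem _ (hcM b hb),
      fun e he h => hc34 a ha (he.1.T_cons_subset h.1)⟩
    rw [L.glue_eq g hd, (hg w hw.1).2 _ (hcM a ha), (hg w hw.1).2 _ (hcM b hb)] at hab
    rw [← st_pos_mul _ (by norm_num : (0 : ℝ) < 7 / 8), ← hab.2, hab.1]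
    rfl
  exact h1 (st_nontrivial h3 ▸ hL w)

end Tower

end TreeLower

section Exhaust

variable {X G : Type*} [TopologicalSpace X] [Group G]

/-- Potentials on an increasing sequence of connected open sets yield a potential on the union. -/
theorem IsPot.exists_iUnion {D : ℕ → Set X} (hD : Monotone D) (hc : ∀ k, IsPreconnected (D k))
    (ho : ∀ k, IsOpen (D k)) {x₀ : X} (hx : ∀ k, x₀ ∈ D k) {τ : X → X → G} (h : ∀ k, ∃ f, IsPot (D k) τ f) :
    ∃ f, IsPot (⋃ k, D k) τ f := by
  classical
  have h' : ∀ k, ∃ f, IsPot (D k) τ f ∧ f x₀ = 1 := fun k => by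
    obtain ⟨f, hf⟩ := h k
    exact ⟨_, hf.const_mul (f x₀)⁻¹, by simp⟩
  choose f hf hf1 using h'
  have heq : ∀ k l, k ≤ l → ∀ x ∈ D k, f k x = f l x := fun k l hkl x hxk =>
    (hf k).eq ((hf l).mono (hD hkl)) (hc k) (hx k) hxk (by rw [hf1, hf1])
  let F : X → G := fun x => if h : ∃ k, x ∈ D k then f h.choose x else 1
  have hF : ∀ k, ∀ x ∈ D k, F x = f k x := fun k x hxk => by
    have h : ∃ k, x ∈ D k := ⟨k, hxk⟩
    simp only [F, dif_pos h]
    rcases le_total h.choose k with hle | hle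
    · exact heq _ _ hle x h.choose_spec
    · exact (heq _ _ hle x hxk).symm
  refine ⟨F, Loc.of_cover fun p hp => ?_⟩
  obtain ⟨k, hk⟩ := mem_iUnion.mp hp
  exact ⟨D k, ho k, hk, ((hf k).mono inter_subset_right).congr fun x hx => (hF k x hx.2).symm⟩

end Exhaust

noncomputable section TreeUpper

variable {d : ℕ}

namespace Tower

variable {E : Type*} [MetricSpace E] {𝒯 : Tower d E} {t : ℕ → Bool} {G : Type*} [Group G]

theorem OnBranch.exists_collar {v : List Code} (hv : 𝒯.OnBranch t v) (hG : ∀ g : G, g ^ 𝒯.N (hist v) = 1)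
    {τ : E → E → G} (hτ : IsCoc (𝒯.T v \ ⋃ e ∈ {e | 𝒯.OnBranch t (e :: v)}, 𝒯.T (e :: v)) τ) :
    ∃ f : TT d → G, IsIso {p : TT d | ‖p.1‖ ∈ Icc (3 / 4 : ℝ) 1} (fun a b => τ (𝒯.chart v a) (𝒯.chart v b))
      (fun a b => τ (𝒯.chart v (1, a.2)) (𝒯.chart v (1, b.2))) f := by
  let c : ℂ × (Circle × (Fin d → Circle)) → TT d := fun p => (p.1, Fin.snoc p.2.2 p.2.1)
  let c' : TT d → ℂ × (Circle × (Fin d → Circle)) := fun p => (p.1, p.2 (Fin.last d), Fin.init p.2)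
  have hcc' : ∀ p, c (c' p) = p := fun p => Prod.ext rfl (Fin.snoc_init_self p.2)
  have hc : Continuous c := by
    refine Continuous.prodMk (by fun_prop) (continuous_pi fun i => ?_)
    induction i using Fin.lastCases with
    | last => simp only [Fin.snoc_last]; fun_prop
    | cast i => simp only [Fin.snoc_castSucc]; fun_prop
  have hc' : Continuous c' := by
    refine Continuous.prodMk (by fun_prop) (Continuous.prodMk (by fun_prop) (continuous_pi fun i => ?_))
    simp only [Fin.init]; fun_prop
  obtain ⟨f, hf⟩ := pat_upper (𝒯.hN (hist v)) (patEta_pos d _) (patEta_le d (𝒯.N (hist v))) (k := patK d (𝒯.N (hist v)))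
    (t v.length) hG (Y := Fin d → Circle) (τ := fun a b => τ (𝒯.chart v (c a)) (𝒯.chart v (c b))) (by
      refine hτ.comp (hv.1.continuousOn_chart.comp hc.continuousOn fun p hp => hp.1) fun p hp => ⟨⟨_, hp.1, rfl⟩, fun h => hp.2 ?_⟩
      simp only [mem_iUnion] at h ⊢
      obtain ⟨e, he, q, hq, h⟩ := h
      obtain ⟨he1, -, he2⟩ := onBranch_cons.mp he
      refine ⟨(e.2.1, ⟨e.2.2, he1.2⟩), ?_⟩
      have h1 := hv.1.injOn_chart (mem_MM_of_lt (step_mem (𝒯.hN _) he1.2 hq)) hp.1 h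
      have h2 := (stepMap_image (d := d) (phi d (𝒯.N (hist v)) e) soTorus).le ⟨q, hq, h1⟩
      rw [phi_of_lt he1.2, he2] at h2
      simpa [c] using h2)
  refine ⟨f ∘ c', ?_⟩
  refine (Loc.comp (φ := c') hf hc'.continuousOn fun p hp => hp).imp fun a _ b _ h => ?_
  simp only [hcc'] at h
  refine h.trans ?_
  have h1 : ∀ a : TT d, c (1, (c' a).2) = (1, a.2) := fun a => Prod.ext rfl (Fin.snoc_init_self a.2)
  simp only [h1, Function.comp_apply]

/-- Over a branch of trivial exponents a cocycle extends across the solid tori of a level. -/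
theorem exists_fill {Ω K : Set E} (hK : K ⊆ 𝒯.Z t) {Λ : Set (List Code)} {l : ℕ}
    (hΛ : ∀ v ∈ Λ, 𝒯.OnBranch t v ∧ v.length = l ∧ 𝒯.T v ⊆ Ω) (hG : ∀ g : G, g ^ 𝒯.N (initBits t l) = 1)
    (hKΛ : K ∩ Ω ⊆ ⋃ v ∈ Λ, 𝒯.T v) {τ : E → E → G} (hτ : IsCoc (Ω \ K) τ) :
    ∃ τ', IsCoc Ω τ' ∧ ∀ a ∉ ⋃ v ∈ Λ, 𝒯.T v, ∀ b, τ' a b = τ a b := by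
  classical
  have hchild : ∀ v ∈ Λ, 𝒯.T v \ ⋃ e ∈ {e | 𝒯.OnBranch t (e :: v)}, 𝒯.T (e :: v) ⊆ Ω \ K := by
    rintro v hv x ⟨hx, hx'⟩
    refine ⟨(hΛ v hv).2.2 hx, fun hxK => hx' ?_⟩
    obtain ⟨_ | ⟨e, w⟩, ⟨hw, hl⟩, hxw⟩ := mem_Z.mp (hK hxK) (v.length + 1)
    · simp at hl
    · obtain rfl := hw.1.1.eq_of_mem (hΛ v hv).1.1 (by simpa using hl) (I_subset_T _ (hw.1.T_cons_subset_I hxw)) hx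
      exact mem_biUnion (x := e) hw hxw
  have hf : ∀ v, ∃ f : TT d → G, v ∈ Λ → IsIso {p : TT d | ‖p.1‖ ∈ Icc (3 / 4 : ℝ) 1}
      (fun a b => τ (𝒯.chart v a) (𝒯.chart v b)) (fun a b => τ (𝒯.chart v (1, a.2)) (𝒯.chart v (1, b.2))) f := by
    intro v
    by_cases hv : v ∈ Λ
    · obtain ⟨f, hf⟩ := (hΛ v hv).1.exists_collar (fun g => by rw [(hΛ v hv).1.2, (hΛ v hv).2.1]; exact hG g)
        (hτ.mono (hchild v hv))
      exact ⟨f, fun _ => hf⟩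
    · exact ⟨1, fun h => (hv h).elim⟩
  choose f hf using hf
  have hg : ∀ v, ∃ g : E → TT d, v ∈ Λ → ContinuousOn g (𝒯.T v) ∧ ∀ p ∈ MM d, g (𝒯.chart v p) = p := fun v => by
    by_cases hv : v ∈ Λ
    · obtain ⟨g, h⟩ := (hΛ v hv).1.1.exists_inverse
      exact ⟨g, fun _ => h⟩
    · exact ⟨fun _ => (0, 1), fun h => (hv h).elim⟩
  choose g hg using hg
  have huniq : ∀ v ∈ Λ, ∀ v' ∈ Λ, ∀ x, x ∈ 𝒯.T v → x ∈ 𝒯.T v' → v = v' := fun v hv v' hv' x hx hx' =>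
    (hΛ v hv).1.1.eq_of_mem (hΛ v' hv').1.1 ((hΛ v hv).2.1.trans (hΛ v' hv').2.1.symm) hx hx'
  have hfin : Λ.Finite := (finite_nodes (𝒯 := 𝒯) l).subset fun v hv => ⟨(hΛ v hv).1.1, (hΛ v hv).2.1⟩
  let τ' : E → E → G := fun a b => if h : ∃ v ∈ Λ, a ∈ 𝒯.T v ∧ b ∈ 𝒯.T v then
    (f h.choose (g h.choose a))⁻¹ * τ (𝒯.chart h.choose (1, (g h.choose a).2)) (𝒯.chart h.choose (1, (g h.choose b).2)) *
      f h.choose (g h.choose b) else τ a b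
  have hpos : ∀ v ∈ Λ, ∀ a ∈ 𝒯.T v, ∀ b ∈ 𝒯.T v, τ' a b = (f v (g v a))⁻¹ *
      τ (𝒯.chart v (1, (g v a).2)) (𝒯.chart v (1, (g v b).2)) * f v (g v b) := by
    intro v hv a ha b hb
    have h : ∃ v ∈ Λ, a ∈ 𝒯.T v ∧ b ∈ 𝒯.T v := ⟨v, hv, ha, hb⟩
    have h2 : h.choose = v := huniq _ h.choose_spec.1 _ hv a h.choose_spec.2.1 ha
    simp only [τ', dif_pos h]
    rw [h2]
  have hneg : ∀ a b, (¬ ∃ v ∈ Λ, a ∈ 𝒯.T v ∧ b ∈ 𝒯.T v) → τ' a b = τ a b := fun a b h => dif_neg h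
  refine ⟨τ', IsCoc.of_cover fun p hp => ?_, fun a ha b => hneg a b fun ⟨v, hv, h, _⟩ => ha (mem_biUnion hv h)⟩
  by_cases hpv : ∃ v ∈ Λ, p ∈ 𝒯.T v
  · obtain ⟨v, hv, hpv⟩ := hpv
    have hnode := (hΛ v hv).1.1
    have h1M : ∀ p : TT d, ((1, p.2) : TT d) ∈ MM d := fun p => by simp [MM]
    by_cases hpI : p ∈ 𝒯.I v
    · refine ⟨𝒯.I v, hnode.isOpen_I, hpI, ?_⟩
      have hcont : ContinuousOn (fun x => 𝒯.chart v (1, (g v x).2)) (Ω ∩ 𝒯.I v) :=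
        hnode.continuousOn_chart.comp (((continuous_const.prodMk continuous_snd).comp_continuousOn
          (hg v hv).1).mono (inter_subset_right.trans (I_subset_T v))) fun x _ => h1M _
      have h1 := hτ.comp hcont fun x _ => hchild v hv ⟨mem_image_of_mem _ (h1M _), fun hc => by
        simp only [mem_iUnion] at hc
        obtain ⟨e, he, hc⟩ := hc
        obtain ⟨q, hq, hqx⟩ := he.1.T_cons_subset hc
        have := hnode.injOn_chart (mem_MM_of_lt hq) (h1M (g v x)) hqx
        subst this
        simp only [mem_ofPred_eq, norm_one] at hq
        norm_num at hq⟩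
      refine (IsIso.isCoc (f := fun x => f v (g v x)) (τ := τ') ?_ h1)
      exact fun x hx => ⟨_, self_mem_nhdsWithin, fun a ha b hb => hpos v hv a (I_subset_T _ ha.2) b (I_subset_T _ hb.2)⟩
    · have hcl : IsClosed (⋃ v' ∈ Λ \ {v}, 𝒯.T v') :=
        (hfin.subset sdiff_subset).isClosed_biUnion fun v' hv' => (hΛ v' hv'.1).1.1.isCompact_T.isClosed
      have hcollar : Loc (𝒯.T v \ 𝒯.chart v '' {p | ‖p.1‖ < 3 / 4}) fun a b => τ a b = τ' a b := by
        have hm : MapsTo (g v) (𝒯.T v \ 𝒯.chart v '' {p | ‖p.1‖ < 3 / 4}) {p : TT d | ‖p.1‖ ∈ Icc (3 / 4 : ℝ) 1} := by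
          rintro _ ⟨⟨q, hq, rfl⟩, h⟩
          rw [(hg v hv).2 q hq]
          refine ⟨?_, hq⟩
          by_contra hlt
          exact h ⟨q, (not_le.mp hlt : ‖q.1‖ < (3 / 4 : ℝ)), rfl⟩
        refine ((hf v hv).comp ((hg v hv).1.mono sdiff_subset) hm).imp fun a ha b hb h => ?_
        rw [hpos v hv a ha.1 b hb.1, ← h]
        obtain ⟨⟨q, hq, rfl⟩, -⟩ := ha
        obtain ⟨⟨r, hr, rfl⟩, -⟩ := hb
        rw [(hg v hv).2 q hq, (hg v hv).2 r hr]
      obtain ⟨O, hO, hOe⟩ := hcollar p ⟨hpv, fun h => hpI (image_three_quarters_subset _ h)⟩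
      obtain ⟨O', hO', hpO', hOO'⟩ := mem_nhdsWithin.mp hO
      have hp34 : p ∉ 𝒯.chart v '' {p | ‖p.1‖ ≤ 3 / 4} := by
        rintro ⟨q, hq, rfl⟩
        exact hpI ⟨q, (lt_of_le_of_lt hq (by norm_num) : ‖q.1‖ < (1 : ℝ)), rfl⟩
      have hsub : ∀ {x}, x ∉ 𝒯.chart v '' {p | ‖p.1‖ ≤ 3 / 4} → x ∉ 𝒯.chart v '' {p | ‖p.1‖ < 3 / 4} :=
        fun hx hx' => hx (image_mono (fun _ (h : ‖_‖ < (3 / 4 : ℝ)) => (h.le : ‖_‖ ≤ (3 / 4 : ℝ))) hx')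
      have hOp : IsOpen (((⋃ v' ∈ Λ \ {v}, 𝒯.T v')ᶜ \ 𝒯.chart v '' {p | ‖p.1‖ ≤ 3 / 4}) ∩ O') :=
        (hcl.isOpen_compl.sdiff (isClosed_three_quarters hnode)).inter hO'
      have hmemΛ : ∀ x ∈ ((⋃ v' ∈ Λ \ {v}, 𝒯.T v')ᶜ \ 𝒯.chart v '' {p | ‖p.1‖ ≤ 3 / 4}) ∩ O', ∀ v' ∈ Λ, x ∈ 𝒯.T v' → v' = v := by
        intro x hx v' hv' hxv
        by_contra hne
        exact hx.1.1 (mem_biUnion (x := v') ⟨hv', hne⟩ hxv)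
      refine ⟨_, hOp, ⟨⟨fun hc => ?_, hp34⟩, hpO'⟩, ?_⟩
      · simp only [mem_iUnion] at hc
        obtain ⟨v', hv', hc⟩ := hc
        exact hv'.2 (huniq v' hv'.1 v hv p hc hpv)
      · refine IsCoc.of_loc_eq (hτ.mono ?_) fun x hx => ⟨_, self_mem_nhdsWithin, fun a ha b hb => ?_⟩
        · rintro x ⟨hxΩ, hx⟩
          refine ⟨hxΩ, fun hxK => ?_⟩
          have := hKΛ ⟨hxK, hxΩ⟩
          simp only [mem_iUnion] at this
          obtain ⟨v', hv', hxv⟩ := this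
          obtain rfl := hmemΛ x hx v' hv' hxv
          refine (hchild v' hv ⟨hxv, fun hc => ?_⟩).2 hxK
          simp only [mem_iUnion] at hc
          obtain ⟨e, he, hc⟩ := hc
          exact hsub hx.1.2 (he.1.T_cons_subset hc)
        · by_cases hab : a ∈ 𝒯.T v ∧ b ∈ 𝒯.T v
          · exact hOe a (hOO' ⟨ha.2.2, hab.1, hsub ha.2.1.2⟩) b (hOO' ⟨hb.2.2, hab.2, hsub hb.2.1.2⟩)
          · refine (hneg a b ?_).symm
            rintro ⟨v', hv', h, h'⟩
            obtain rfl := hmemΛ a ha.2 v' hv' h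
            exact hab ⟨h, h'⟩
  · have hcl : IsClosed (⋃ v ∈ Λ, 𝒯.T v) := hfin.isClosed_biUnion fun v hv => (hΛ v hv).1.1.isCompact_T.isClosed
    refine ⟨(⋃ v ∈ Λ, 𝒯.T v)ᶜ, hcl.isOpen_compl, by simpa using hpv, ?_⟩
    refine IsCoc.of_loc_eq (hτ.mono ?_) fun x hx => ⟨_, self_mem_nhdsWithin, fun a ha b hb => ?_⟩
    · exact fun x hx => ⟨hx.1, fun hxK => hx.2 (hKΛ ⟨hxK, hx.1⟩)⟩
    · exact (hneg a b fun ⟨v, hv, h, _⟩ => ha.2 (mem_biUnion hv h)).symm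

/-- Over a branch of eventually trivial exponents cocycles are locally trivial. -/
theorem exists_isPot_near {E : Type*} [NormedAddCommGroup E] [NormedSpace ℝ E] {𝒯 : Tower d E} {l₀ : ℕ}
    (hG : ∀ l ≥ l₀, ∀ g : G, g ^ 𝒯.N (initBits t l) = 1) {K : Set E} (hK : IsClosed K) (hKZ : K ⊆ 𝒯.Z t) {p : E}
    {U : Set E} (hU : U ∈ 𝓝 p) {τ : E → E → G} (hτ : IsCoc (U \ K) τ) : ∃ V ∈ 𝓝 p, ∃ f, IsPot (V \ K) τ f := by
  have hball : ∀ O ∈ 𝓝 p, ∃ ε > 0, ball p ε ⊆ O := fun O hO => Metric.mem_nhds_iff.mp hO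
  have hdeep : ∀ O ∈ 𝓝 p, ∀ l₁, p ∈ K → ∃ w, 𝒯.OnBranch t w ∧ l₁ ≤ w.length ∧ 𝒯.T w ⊆ O ∧ p ∈ 𝒯.I w := by
    intro O hO l₁ hpK
    obtain ⟨ε, hε, hεO⟩ := hball O hO
    obtain ⟨l, hl⟩ := 𝒯.exists_small hε
    obtain ⟨_ | ⟨e, w⟩, ⟨hw, hwl⟩, hpw⟩ := mem_Z.mp (hKZ hpK) (max l l₁ + 1)
    · simp at hwl
    · have hwl' : w.length = max l l₁ := by simpa using hwl
      have hpI := hw.1.T_cons_subset_I hpw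
      exact ⟨w, (onBranch_cons.mp hw).2.1, hwl' ▸ le_max_right _ _, fun x hx => hεO (hl w hw.1.1 (hwl' ▸ le_max_left _ _)
        x hx p (I_subset_T _ hpI)), hpI⟩
  by_cases hpK : p ∈ K
  swap
  · obtain ⟨ε, hε, h⟩ := hball _ (Filter.inter_mem hU (hK.isOpen_compl.mem_nhds hpK))
    obtain ⟨f, hf⟩ := IsCoc.trivial_of_convex (convex_ball p ε) (hτ.mono h)
    exact ⟨_, ball_mem_nhds p hε, f, hf.mono sdiff_subset⟩
  obtain ⟨w₀, hw₀, hl₀, hwU, hpw₀⟩ := hdeep U hU l₀ hpK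
  obtain ⟨ε, hε, hB⟩ := hball _ (hw₀.1.isOpen_I.mem_nhds hpw₀)
  obtain ⟨w, hw, hl, hwB, hpw⟩ := hdeep _ (ball_mem_nhds p hε) w₀.length hpK
  set P : Set (List Code) := {v | 𝒯.OnBranch t v ∧ (𝒯.T v ∩ K).Nonempty} with hP
  let D : ℕ → Set E := fun k => 𝒯.I w \ ⋃ v ∈ {v | 𝒯.IsNode v ∧ v.length = w.length + k + 1 ∧ v ∈ P}, 𝒯.T v
  have hmemD : ∀ k x, x ∈ D k ↔ x ∈ 𝒯.I w ∧ ∀ v, 𝒯.OnBranch t v → v.length = w.length + k + 1 →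
      (𝒯.T v ∩ K).Nonempty → x ∉ 𝒯.T v := fun k x => by
    simp only [D, hP, mem_sdiff, mem_iUnion, mem_ofPred_eq, not_exists]
    exact and_congr_right fun _ => ⟨fun h v h1 h2 h3 h4 => h v ⟨h1.1, h2, h1, h3⟩ h4, fun h v h1 h4 => h v h1.2.2.1 h1.2.1 h1.2.2.2 h4⟩
  have hDmono : Monotone D := monotone_nat_of_le_succ fun k x hx => by
    rw [hmemD] at hx ⊢
    refine ⟨hx.1, fun v hv hl hvK hxv => ?_⟩
    obtain _ | ⟨e, v⟩ := v
    · simp at hl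
    · have hsub := hv.1.T_cons_subset_I.trans (I_subset_T _)
      exact hx.2 v (onBranch_cons.mp hv).2.1 (by simp at hl; omega) (hvK.mono (inter_subset_inter_left _ hsub)) (hsub hxv)
  have hDU : ⋃ k, D k = 𝒯.I w \ K := by
    ext x
    simp only [mem_iUnion]
    constructor
    · rintro ⟨k, hx⟩
      rw [hmemD] at hx
      refine ⟨hx.1, fun hxK => ?_⟩
      obtain ⟨v, ⟨hv, hvl⟩, hxv⟩ := mem_Z.mp (hKZ hxK) (w.length + k + 1)
      exact hx.2 v hv hvl ⟨x, hxv, hxK⟩ hxv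
    · rintro ⟨hx, hxK⟩
      obtain ⟨δ, hδ, hδK⟩ := Metric.mem_nhds_iff.mp (hK.isOpen_compl.mem_nhds hxK)
      obtain ⟨k, hk⟩ := 𝒯.exists_small hδ
      refine ⟨k, (hmemD k x).mpr ⟨hx, fun v hv hvl ⟨y, hyv, hyK⟩ hxv => hδK ?_ hyK⟩⟩
      exact hk v hv.1 (by omega) y hyv x hxv
  have hpot : ∀ k, ∃ f, IsPot (D k) τ f := by
    intro k
    have hsubI : ∀ v, 𝒯.OnBranch t v → v.length = w.length + k + 1 → (𝒯.T v ∩ 𝒯.I w₀).Nonempty → 𝒯.T v ⊆ 𝒯.I w₀ := by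
      rintro v hv hvl ⟨x, hxv, hx0⟩
      obtain ⟨u, rfl⟩ := hw₀.1.suffix_of_mem hv.1 (by omega) (I_subset_T _ hx0) hxv
      refine hv.1.T_append_subset_I ?_
      rintro rfl
      simp at hvl; omega
    obtain ⟨τ', hτ', heq⟩ := exists_fill (𝒯 := 𝒯) (t := t) (Ω := 𝒯.I w₀) (K := K) hKZ
      (Λ := {v | 𝒯.OnBranch t v ∧ v.length = w.length + k + 1 ∧ (𝒯.T v ∩ K).Nonempty ∧ 𝒯.T v ⊆ 𝒯.I w₀})
      (fun v hv => ⟨hv.1, hv.2.1, hv.2.2.2⟩) (hG _ (by omega)) (fun x hx => by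
        obtain ⟨v, ⟨hv, hvl⟩, hxv⟩ := mem_Z.mp (hKZ hx.1) (w.length + k + 1)
        exact mem_biUnion (x := v) ⟨hv, hvl, ⟨x, hxv, hx.1⟩, hsubI v hv hvl ⟨x, hxv, hx.2⟩⟩ hxv)
      (hτ.mono (sdiff_subset_sdiff_left ((I_subset_T _).trans hwU)))
    obtain ⟨f, hf⟩ := IsCoc.trivial_of_convex (convex_ball p ε) (hτ'.mono hB)
    refine ⟨f, (hf.mono fun x hx => hwB (I_subset_T _ hx.1)).imp fun a ha b _ h => ?_⟩
    rw [← h, heq a _ b]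
    simp only [mem_iUnion, not_exists]
    exact fun v hv hav => ((hmemD k a).mp ha).2 v hv.1 hv.2.1 hv.2.2.1 hav
  have hVp : 𝒯.I w ∈ 𝓝 p := hw.1.isOpen_I.mem_nhds hpw
  refine ⟨_, hVp, ?_⟩
  rcases (𝒯.I w \ K).eq_empty_or_nonempty with h0 | ⟨x₀, hx₀⟩
  · exact ⟨1, h0 ▸ fun p hp => hp.elim⟩
  rw [← hDU] at hx₀ ⊢
  obtain ⟨k₀, hk₀⟩ := mem_iUnion.mp hx₀
  have hshift : ⋃ k, D k = ⋃ k, D (k₀ + k) :=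
    subset_antisymm (iUnion_mono' fun k => ⟨k, hDmono (Nat.le_add_left _ _)⟩) (iUnion_mono' fun k => ⟨k₀ + k, subset_rfl⟩)
  rw [hshift]
  refine IsPot.exists_iUnion (fun i j hij => hDmono (Nat.add_le_add_left hij _))
    (fun k => hw.1.isPreconnected_sdiff_descendants P _ (Or.inl rfl)) (fun k => ?_) (x₀ := x₀) (fun k => hDmono (Nat.le_add_right _ _) hk₀)
    fun k => hpot _
  refine hw.1.isOpen_I.sdiff (((finite_nodes (𝒯 := 𝒯) (w.length + (k₀ + k) + 1)).subset fun v hv => ⟨hv.1, hv.2.1⟩).isClosed_biUnion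
    fun v hv => hv.1.isCompact_T.isClosed)

end Tower

end TreeUpper

section Groups

theorem exists_prime_seq : ∃ p : ℕ → ℕ, (∀ n, (p n).Prime ∧ 7 < p n) ∧
    ∀ m n, m < n → (p m ^ 2 + p m + 1 < p n ∧ (p n : ZMod (p m)) = 2) := by
  refine exists_seq_of_forall_finset_exists (fun q : ℕ => q.Prime ∧ 7 < q)
    (fun q r : ℕ => q ^ 2 + q + 1 < r ∧ (r : ZMod q) = 2) fun s hs => ?_
  have hcop : Nat.Coprime 2 (∏ q ∈ s, q) := by
    refine Nat.Coprime.prod_right fun q hq => ?_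
    rw [Nat.coprime_primes Nat.prime_two (hs q hq).1]
    have := (hs q hq).2
    omega
  have hunit : IsUnit ((2 : ℕ) : ZMod (∏ q ∈ s, q)) := (ZMod.isUnit_iff_coprime _ _).mpr hcop
  have : NeZero (∏ q ∈ s, q) := ⟨Finset.prod_ne_zero_iff.mpr fun q hq => (hs q hq).1.ne_zero⟩
  obtain ⟨r, hr, hrp, hr2⟩ := Nat.forall_exists_prime_gt_and_eq_mod hunit
    (7 + ∑ q ∈ s, (q ^ 2 + q + 1))
  refine ⟨r, ⟨hrp, by omega⟩, fun q hq => ⟨?_, ?_⟩⟩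
  · have := Finset.single_le_sum (f := fun q => q ^ 2 + q + 1) (fun i _ => Nat.zero_le _) hq
    omega
  · have h := (ZMod.natCast_eq_natCast_iff _ _ _).mp hr2
    have h' : r ≡ 2 [MOD q] := h.of_dvd (Finset.dvd_prod_of_mem _ hq)
    simpa using (ZMod.natCast_eq_natCast_iff _ _ _).mpr h'

theorem card_GL_three (q : ℕ) [Fact q.Prime] : Nat.card (Matrix.GeneralLinearGroup (Fin 3) (ZMod q)) =
    (q ^ 3 - 1) * (q ^ 3 - q) * (q ^ 3 - q ^ 2) := by
  rw [Matrix.card_GL_field]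
  simp [Fin.prod_univ_three, ZMod.card]

theorem not_dvd_card_GL_of_lt {p q : ℕ} [Fact q.Prime] (hp : p.Prime) (h : q ^ 2 + q + 1 < p) :
    ¬ p ∣ Nat.card (Matrix.GeneralLinearGroup (Fin 3) (ZMod q)) := by
  have hq : 2 ≤ q := (Fact.out : q.Prime).two_le
  obtain ⟨k, rfl⟩ : ∃ k, q = k + 1 := ⟨q - 1, by omega⟩
  have e1 : (k + 1) ^ 3 - 1 = k * ((k + 1) ^ 2 + (k + 1) + 1) := by
    rw [Nat.sub_eq_iff_eq_add (Nat.one_le_pow _ _ (by omega))]; ring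
  have e2 : (k + 1) ^ 3 - (k + 1) = (k + 1) * (k * (k + 2)) := by
    rw [Nat.sub_eq_iff_eq_add (Nat.le_self_pow (by norm_num) _)]; ring
  have e3 : (k + 1) ^ 3 - (k + 1) ^ 2 = (k + 1) ^ 2 * k := by
    rw [Nat.sub_eq_iff_eq_add (Nat.pow_le_pow_right (by omega) (by norm_num))]; ring
  have key : ∀ m, 0 < m → m < p → ¬ p ∣ m := fun m h0 h1 => Nat.not_dvd_of_pos_of_lt h0 h1
  have b1 : (k + 1) ^ 2 = k * k + 2 * k + 1 := by ring
  rw [card_GL_three, e1, e2, e3]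
  simp only [hp.dvd_mul, pow_two]
  rw [b1] at h
  push Not
  refine ⟨⟨⟨key _ (by omega) (by omega), key _ (by positivity) (by nlinarith)⟩,
    key _ (by omega) (by omega), key _ (by omega) (by omega), key _ (by omega) (by omega)⟩,
    ⟨key _ (by omega) (by omega), key _ (by omega) (by omega)⟩, key _ (by omega) (by omega)⟩

theorem not_dvd_card_GL_of_two {p q : ℕ} [Fact q.Prime] (hp : p.Prime) (h7 : 7 < p)
    (h : (q : ZMod p) = 2) :
    ¬ p ∣ Nat.card (Matrix.GeneralLinearGroup (Fin 3) (ZMod q)) := by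
  have hq : 1 ≤ q := (Fact.out : q.Prime).one_le
  rw [card_GL_three]
  intro hd
  rw [← ZMod.natCast_eq_zero_iff] at hd
  rw [Nat.cast_mul, Nat.cast_mul, Nat.cast_sub (Nat.one_le_pow _ _ hq),
    Nat.cast_sub (Nat.le_self_pow (by norm_num) _),
    Nat.cast_sub (Nat.pow_le_pow_right hq (by norm_num))] at hd
  push_cast at hd
  rw [h] at hd
  have h168 : ((168 : ℕ) : ZMod p) = 0 := by
    rw [← hd]; push_cast; norm_num
  rw [ZMod.natCast_eq_zero_iff, show 168 = 2 ^ 3 * 3 * 7 by norm_num, hp.dvd_mul, hp.dvd_mul] at h168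
  rcases h168 with (h | h) | h
  · have := Nat.le_of_dvd (by norm_num) (hp.dvd_of_dvd_pow h); omega
  · have := Nat.le_of_dvd (by norm_num) h; omega
  · have := Nat.le_of_dvd (by norm_num) h; omega

open Matrix in
/-- Elementary transvections as invertible matrices. -/
def elem {F : Type*} [Field F] (i j : Fin 3) (h : i ≠ j) (c : F) : GL (Fin 3) F :=
  ⟨transvection i j c, transvection i j (-c), by
    rw [transvection_mul_transvection_same i j h, add_neg_cancel, transvection_zero], by
    rw [transvection_mul_transvection_same i j h, neg_add_cancel, transvection_zero]⟩

open Matrix in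
theorem elem_pow {F : Type*} [Field F] (i j : Fin 3) (h : i ≠ j) (c : F) (N : ℕ) :
    elem i j h c ^ N = elem i j h (N * c) := by
  induction N with
  | zero => ext1; simp [elem]
  | succ k ih =>
    rw [pow_succ, ih]
    ext1
    simp only [elem, Units.val_mul]
    rw [transvection_mul_transvection_same i j h]
    congr 1; push_cast; ring

open Matrix in
theorem elem_comm {F : Type*} [Field F] (i j k : Fin 3) (h : i ≠ j) (hik : i ≠ k) (hkj : k ≠ j) (c : F) :
    elem i k hik c * elem k j hkj 1 * (elem i k hik c)⁻¹ * (elem k j hkj 1)⁻¹ = elem i j h c := by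
  rw [mul_inv_eq_iff_eq_mul, mul_inv_eq_iff_eq_mul]
  ext1
  simp only [elem, Units.val_mul, transvection, mul_add, add_mul, mul_one, one_mul,
    single_mul_single_same, single_mul_single_of_ne _ _ _ _ h.symm,
    single_mul_single_of_ne _ _ _ _ hkj.symm, add_zero]
  abel

/-- The nontrivial elementary transvections. -/
def elems (F : Type*) [Field F] : Set (Matrix.GeneralLinearGroup (Fin 3) F) :=
  {g | ∃ i j, ∃ h : i ≠ j, ∃ c : F, c ≠ 0 ∧ g = elem i j h c}

theorem elems_nonempty (F : Type*) [Field F] : (elems F).Nonempty :=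
  ⟨_, 0, 1, by decide, 1, one_ne_zero, rfl⟩

theorem one_notMem_elems (F : Type*) [Field F] : 1 ∉ elems F := by
  rintro ⟨i, j, h, c, hc, he⟩
  have := congrArg (fun g : Matrix.GeneralLinearGroup (Fin 3) F => (g : Matrix (Fin 3) (Fin 3) F) i j) he
  simp [elem, Matrix.transvection, h] at this
  exact hc this.symm

theorem elems_root {F : Type*} [Field F] {N : ℕ} (hN : (N : F) ≠ 0) {m : Matrix.GeneralLinearGroup (Fin 3) F}
    (hm : m ∈ elems F) : ∃ x ∈ elems F, x ^ N = m := by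
  obtain ⟨i, j, h, c, hc, rfl⟩ := hm
  refine ⟨_, ⟨i, j, h, c / N, div_ne_zero hc hN, rfl⟩, ?_⟩
  rw [elem_pow, mul_div_cancel₀ _ hN]

theorem elems_comm {F : Type*} [Field F] {x : Matrix.GeneralLinearGroup (Fin 3) F}
    (hx : x ∈ elems F) : ∃ a ∈ elems F, ∃ c ∈ elems F, c * a * c⁻¹ * a⁻¹ = x := by
  obtain ⟨i, j, h, c, hc, rfl⟩ := hx
  obtain ⟨k, hik, hkj⟩ : ∃ k, i ≠ k ∧ k ≠ j := by revert i j; decide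
  exact ⟨_, ⟨k, j, hkj, 1, one_ne_zero, rfl⟩, _, ⟨i, k, hik, c, hc, rfl⟩, elem_comm i j k h hik hkj c⟩

/-- The exponents of the tower. -/
def expo (c : ℕ → ℕ) : List Bool → ℕ
  | [] => 2
  | b :: v => expo c v * c (2 * v.length + (!b).toNat)

/-- Bit sequences are distinguished by families of finite groups. -/
theorem exists_groups : ∃ (N : List Bool → ℕ) (G : ℕ → Type) (_ : ∀ i, Group (G i))
    (S : ∀ i, Set (G i)), (∀ v, N v ≠ 0 ∧ 2 ∣ N v) ∧
    (∀ i, (S i).Nonempty ∧ 1 ∉ S i ∧ ∀ x ∈ S i, ∃ a ∈ S i, ∃ c ∈ S i, c * a * c⁻¹ * a⁻¹ = x) ∧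
    ∀ (s : ℕ → Bool) (k : ℕ),
      (∀ l, ∀ m ∈ S (2 * k + (s k).toNat), ∃ x ∈ S (2 * k + (s k).toNat), x ^ N (initBits s l) = m) ∧
      ∀ l, k < l → ∀ g : G (2 * k + (!s k).toNat), g ^ N (initBits s l) = 1 := by
  obtain ⟨p, hp, hpp⟩ := exists_prime_seq
  have hpf : ∀ n, Fact (p n).Prime := fun n => ⟨(hp n).1⟩
  let G : ℕ → Type := fun i => Matrix.GeneralLinearGroup (Fin 3) (ZMod (p i))
  have hG : ∀ i j, i ≠ j → ¬ p i ∣ Nat.card (G j) := fun i j hij => by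
    rcases lt_or_gt_of_ne hij with h | h
    · exact not_dvd_card_GL_of_two (hp i).1 (hp i).2 (hpp i j h).2
    · exact not_dvd_card_GL_of_lt (hp i).1 (hpp j i h).1
  have hc : ∀ i, Nat.card (G i) ≠ 0 := fun i => Nat.card_pos.ne'
  refine ⟨expo fun i => Nat.card (G i), G, fun i => inferInstance, fun i => elems (ZMod (p i)), ?_, ?_, ?_⟩
  · intro v
    induction v with
    | nil => exact ⟨two_ne_zero, dvd_rfl⟩
    | cons b v ih => exact ⟨mul_ne_zero ih.1 (hc _), ih.2.mul_right _⟩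
  · exact fun i => ⟨elems_nonempty _, one_notMem_elems _, fun x hx => elems_comm hx⟩
  · intro s k
    have hlen : ∀ l, (initBits s l).length = l := fun l => by
      induction l with
      | zero => rfl
      | succ l ih => simp [initBits, ih]
    have hs : ∀ l, expo (fun i => Nat.card (G i)) (initBits s (l + 1)) =
        expo (fun i => Nat.card (G i)) (initBits s l) * Nat.card (G (2 * l + (!s l).toNat)) := fun l => by
      simp only [initBits, expo, hlen]
    constructor
    · intro l m hm
      refine elems_root ?_ hm
      rw [Ne, ZMod.natCast_eq_zero_iff]
      clear hm m
      induction l with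
      | zero =>
        intro h
        have := Nat.le_of_dvd (by norm_num [initBits, expo]) h
        have := (hp (2 * k + (s k).toNat)).2
        simp [initBits, expo] at *; omega
      | succ l ih =>
        rw [hs, (hp _).1.dvd_mul]
        refine not_or.mpr ⟨ih, hG _ _ fun h => ?_⟩
        have h1 := Bool.toNat_le (s k)
        have h2 := Bool.toNat_le (!s l)
        obtain rfl : k = l := by omega
        cases h3 : s k <;> simp [h3] at h
    · intro l hl
      induction l, hl using Nat.le_induction with
      | base => intro g; rw [hs, pow_mul', pow_card_eq_one', one_pow]
      | succ l hl ih => intro g; rw [hs, pow_mul, ih, one_pow]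

end Groups

section Retraction

variable {E : Type*} [NormedAddCommGroup E] [InnerProductSpace ℝ E] [FiniteDimensional ℝ E]

open Polynomial in
/-- The determinant of `1 + tA` is determined by its values at `dim + 1` points. -/
theorem exists_det_interpolation (v : ℕ → ℝ) (hv : Function.Injective v) :
    ∃ w : ℕ → ℝ, ∑ i ∈ Finset.range (Module.finrank ℝ E + 1), w i = 1 ∧
      ∀ A : E →L[ℝ] E, (1 + A).det =
        ∑ i ∈ Finset.range (Module.finrank ℝ E + 1), w i * (1 + v i • A).det := by
  set m := Module.finrank ℝ E with hm
  refine ⟨fun i => (Lagrange.basis (Finset.range (m + 1)) v i).eval 1, ?_, fun A => ?_⟩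
  · rw [← eval_finsetSum, Lagrange.sum_basis hv.injOn ⟨0, by simp⟩, eval_one]
  · let b := Module.finBasis ℝ E
    let M := LinearMap.toMatrix b b (A : E →ₗ[ℝ] E)
    let P : ℝ[X] := Matrix.det ((X : ℝ[X]) • M.map C + (1 : Matrix _ _ ℝ).map C)
    have hP : ∀ t, P.eval t = (1 + t • A).det := fun t => by
      have e : (1 + t • A).det = (1 + t • M).det := by
        rw [ContinuousLinearMap.det, ← LinearMap.det_toMatrix b]
        congr 1
        simp [M]
      rw [e, ← coe_evalRingHom, RingHom.map_det]
      congr 1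
      ext i j
      by_cases h : i = j <;> simp [h, mul_comm t, add_comm (M j j * t)]
    have hdeg : P.degree < (Finset.range (m + 1)).card := by
      rw [Finset.card_range]
      refine degree_le_natDegree.trans_lt (Nat.cast_lt.mpr ?_)
      have := natDegree_det_X_add_C_le M 1
      rw [Fintype.card_fin] at this
      exact Nat.lt_succ_of_le this
    have h1 := congrArg (eval 1) (Lagrange.eq_interpolate (v := v) hv.injOn hdeg)
    rw [hP, Lagrange.interpolate_apply, eval_finsetSum, one_smul] at h1
    rw [h1]
    refine Finset.sum_congr rfl fun i _ => ?_
    rw [eval_mul, eval_C, hP, mul_comm]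

theorem det_one_add_pos {A : E →L[ℝ] E} {t : ℝ} (ht : 0 ≤ t) (h : t * ‖A‖ < 1) :
    0 < (1 + t • A).det := by
  have hne : ∀ s ∈ Icc 0 t, (1 + s • A).det ≠ 0 := fun s hs h0 => by
    have hk := LinearMap.bot_lt_ker_of_det_eq_zero (f := ((1 + s • A : E →L[ℝ] E) : E →ₗ[ℝ] E)) h0
    obtain ⟨x, hx, hx0⟩ := (Submodule.ne_bot_iff _).mp hk.ne'
    have h1 : x = -(s • A x) := by
      have : x + s • A x = 0 := hx
      exact eq_neg_of_add_eq_zero_left this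
    have h2 : ‖x‖ ≤ t * ‖A‖ * ‖x‖ := by
      calc ‖x‖ = s * ‖A x‖ := by
            conv_lhs => rw [h1]
            rw [norm_neg, norm_smul, Real.norm_of_nonneg hs.1]
        _ ≤ t * (‖A‖ * ‖x‖) := mul_le_mul hs.2 (A.le_opNorm x) (norm_nonneg _) ht
        _ = _ := by ring
    have := norm_pos_iff.mpr hx0
    nlinarith
  have hc : ContinuousOn (fun s : ℝ => (1 + s • A).det) (Icc 0 t) :=
    (ContinuousLinearMap.continuous_det.comp (by fun_prop)).continuousOn
  by_contra hcon
  obtain ⟨s, hs, h0⟩ := intermediate_value_Icc' ht hc (show (0 : ℝ) ∈ _ from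
    ⟨not_lt.mp hcon, by simp [ContinuousLinearMap.det]⟩)
  exact hne s hs h0

omit [FiniteDimensional ℝ E] in
theorem exists_norm_eq_of_segment {x y : E} {R : ℝ} (hx : ‖x‖ ≤ R) (hy : R ≤ ‖y‖) :
    ∃ z, ‖z‖ = R ∧ dist x z ≤ dist x y := by
  obtain ⟨s, hs, h⟩ := intermediate_value_Icc (zero_le_one' ℝ)
    (f := fun s : ℝ => ‖AffineMap.lineMap x y s‖) (by fun_prop) (show R ∈ _ from by simpa using ⟨hx, hy⟩)
  refine ⟨_, h, ?_⟩
  rw [dist_left_lineMap, Real.norm_of_nonneg hs.1]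
  exact mul_le_of_le_one_left dist_nonneg hs.2

open MeasureTheory in
theorem no_smooth_retraction {r : E → E} (hr : ContDiff ℝ 1 r) {R : ℝ} (hR : 0 < R)
    (hn : ∀ x, ‖r x‖ = R) (hid : ∀ x, ‖x‖ = R → r x = x) : False := by
  let _ : MeasurableSpace E := borel E
  have _ : BorelSpace E := ⟨rfl⟩
  let μ : Measure E := Measure.addHaar
  set B : Set E := closedBall 0 R with hB
  have hBm : MeasurableSet B := isClosed_closedBall.measurableSet
  let A : E → E →L[ℝ] E := fun x => fderiv ℝ r x - 1
  have hA : Continuous A := (hr.continuous_fderiv one_ne_zero).sub continuous_const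
  have hg : ContDiff ℝ 1 (fun x => r x - x) := hr.sub contDiff_id
  have hgd : ∀ x, HasFDerivAt (fun x => r x - x) (A x) x := fun x =>
    (hr.differentiable one_ne_zero x).hasFDerivAt.sub (hasFDerivAt_id x)
  obtain ⟨L, hL⟩ : ∃ L : NNReal, LipschitzOnWith L (fun x => r x - x) B :=
    hg.contDiffOn.exists_lipschitzOnWith one_ne_zero (convex_closedBall _ _) (isCompact_closedBall _ _)
  let G : E → E := fun x => if ‖x‖ ≤ R then r x - x else 0
  have hGB : ∀ x, ‖x‖ ≤ R → G x = r x - x := fun x h => if_pos h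
  have hG0 : ∀ x, R ≤ ‖x‖ → G x = 0 := fun x h => by
    rcases h.eq_or_lt with h | h
    · rw [hGB x h.ge, hid x h.symm, sub_self]
    · exact if_neg (not_le.mpr h)
  have hmix : ∀ x y, ‖x‖ ≤ R → R ≤ ‖y‖ → dist (G x) (G y) ≤ L * dist x y := fun x y hx hy => by
    obtain ⟨z, hz, hd⟩ := exists_norm_eq_of_segment hx hy
    have := hL.dist_le_mul x (by simpa [hB] using hx) z (by simpa [hB] using hz.le)
    rw [hG0 y hy, ← hG0 z hz.ge, hGB x hx, hGB z hz.le]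
    exact this.trans (by gcongr)
  have hGL : LipschitzWith L G := LipschitzWith.of_dist_le_mul fun x y => by
    rcases le_total ‖x‖ R with hx | hx <;> rcases le_total ‖y‖ R with hy | hy
    · rw [hGB x hx, hGB y hy]
      exact hL.dist_le_mul x (by simpa [hB] using hx) y (by simpa [hB] using hy)
    · exact hmix x y hx hy
    · rw [dist_comm, dist_comm x]; exact hmix y x hy hx
    · rw [hG0 x hx, hG0 y hy, dist_self]; positivity
  obtain ⟨C, hC⟩ : ∃ C, ∀ x ∈ B, ‖A x‖ ≤ C :=
    (isCompact_closedBall (0 : E) R).exists_bound_of_continuousOn hA.continuousOn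
  have hC0 : 0 ≤ C := (norm_nonneg _).trans (hC 0 (by simp [hB, hR.le]))
  have hstep : ∀ t : ℝ, 0 < t → t < 1 → t * L < 1 → t * C < 1 →
      ∫ x in B, (1 + t • A x).det ∂μ = μ.real B := fun t ht0 ht1 htL htC => by
    let H : E → E := fun x => x + t • G x
    have hHB : ∀ x, ‖x‖ ≤ R → H x = (1 - t) • x + t • r x := fun x hx => by
      simp only [H, hGB x hx, smul_sub, sub_smul, one_smul]; abel
    have hinj : Function.Injective H := fun x y hxy => by
      have h1 : x - y = t • (G y - G x) := by
        have h2 : x + t • G x = y + t • G y := hxy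
        rw [smul_sub, sub_eq_sub_iff_add_eq_add, h2, add_comm]
      have h2 : ‖x - y‖ ≤ t * (L * ‖x - y‖) := by
        conv_lhs => rw [h1]
        rw [norm_smul, Real.norm_of_nonneg ht0.le]
        have := hGL.dist_le_mul y x
        rw [dist_eq_norm, dist_eq_norm, norm_sub_rev y x] at this
        gcongr
      have h3 : ‖x - y‖ = 0 := by nlinarith [norm_nonneg (x - y)]
      exact sub_eq_zero.mp (norm_eq_zero.mp h3)
    have hsurj : ∀ y, ∃ x, H x = y := fun y => by
      have hcon : ContractingWith (⟨t, ht0.le⟩ * L) (fun x => y - t • G x) := by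
        refine ⟨by rw [← NNReal.coe_lt_coe]; exact htL, LipschitzWith.of_dist_le_mul fun a b => ?_⟩
        rw [dist_sub_left, dist_smul₀, Real.norm_of_nonneg ht0.le]
        refine le_of_le_of_eq ?_ (mul_assoc t (L : ℝ) (dist a b)).symm
        exact mul_le_mul_of_nonneg_left (hGL.dist_le_mul a b) ht0.le
      have := hcon.fixedPoint_isFixedPt
      refine ⟨_, sub_eq_iff_eq_add.mp (?_ : y - t • G (hcon.fixedPoint _) = _) |>.symm⟩
      exact this
    have himage : H '' B = B := by
      refine Subset.antisymm ?_ fun y hy => ?_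
      · rintro _ ⟨x, hx, rfl⟩
        have hx' : ‖x‖ ≤ R := by simpa [hB] using hx
        rw [hHB x hx']
        exact convex_closedBall (0 : E) R hx (by simp [hn x]) (by linarith) ht0.le (by ring)
      · obtain ⟨x, rfl⟩ := hsurj y
        by_cases hx : ‖x‖ ≤ R
        · exact ⟨x, by simpa [hB] using hx, rfl⟩
        · have : H x = x := by simp [H, hG0 x (not_le.mp hx).le]
          rw [this] at hy ⊢
          exact absurd (by simpa [hB] using hy) hx
    have hder : ∀ x ∈ B, HasFDerivWithinAt H (1 + t • A x) B x := fun x hx => by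
      have h1 : HasFDerivWithinAt (fun x => x + t • (r x - x)) (1 + t • A x) B x :=
        ((hasFDerivAt_id x).add ((hgd x).const_smul t)).hasFDerivWithinAt
      refine h1.congr (fun y hy => ?_) ?_
      · simp only [H, hGB y (by simpa [hB] using hy)]
      · simp only [H, hGB x (by simpa [hB] using hx)]
    have hint := integral_image_eq_integral_abs_det_fderiv_smul μ hBm hder hinj.injOn (fun _ => (1 : ℝ))
    rw [himage] at hint
    simp only [integral_const, smul_eq_mul, mul_one, measureReal_restrict_apply_univ] at hint
    rw [hint]
    refine setIntegral_congr_fun hBm fun x hx => ?_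
    have := det_one_add_pos ht0.le (A := A x) (by nlinarith [hC x hx, norm_nonneg (A x)])
    exact (abs_of_pos this).symm
  let τ : ℝ := 1 / (2 + L + C)
  have hD : 0 < 2 + (L : ℝ) + C := by positivity
  let v : ℕ → ℝ := fun i => τ / (i + 1)
  have hv : Function.Injective v := fun i j h => by
    have hτ : τ ≠ 0 := by positivity
    have h1 := (div_eq_div_iff (by positivity) (by positivity)).mp h
    have := mul_left_cancel₀ hτ h1
    have : (j : ℝ) = i := by linarith
    exact_mod_cast this.symm
  obtain ⟨w, hw, hdet⟩ := exists_det_interpolation (E := E) v hv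
  have hvi : ∀ i, ∫ x in B, (1 + v i • A x).det ∂μ = μ.real B := fun i => by
    have h0 : 0 < v i := by positivity
    have h1 : v i ≤ τ := div_le_self (by positivity) (by simp)
    have h2 : τ * (2 + L + C) = 1 := one_div_mul_cancel hD.ne'
    have h3 : 0 < τ := by positivity
    have hL0 : (0 : ℝ) ≤ L := L.2
    refine hstep _ h0 ?_ ?_ ?_ <;> nlinarith [mul_nonneg h3.le hL0, mul_nonneg h3.le hC0, mul_le_mul_of_nonneg_right h1 hL0, mul_le_mul_of_nonneg_right h1 hC0]
  have hzero : ∀ x, (1 + A x).det = 0 := fun x => by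
    have e : 1 + A x = fderiv ℝ r x := by simp [A]
    rw [e]
    by_contra hne
    have hu : IsUnit (LinearMap.det (fderiv ℝ r x : E →ₗ[ℝ] E)) := isUnit_iff_ne_zero.mpr hne
    have hsurj : Function.Surjective (fderiv ℝ r x) :=
      ((Module.End.isUnit_iff _).mp ((LinearMap.isUnit_iff_isUnit_det _).mpr hu)).2
    obtain ⟨u, hu⟩ := hsurj (r x)
    have h1 : HasFDerivAt (fun y => inner ℝ (r y) (r y)) _ x :=
      (hr.differentiable one_ne_zero x).hasFDerivAt.inner ℝ (hr.differentiable one_ne_zero x).hasFDerivAt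
    have h2 : (fun y => inner ℝ (r y) (r y)) = fun _ => R ^ 2 := by
      funext y; rw [real_inner_self_eq_norm_sq, hn]
    rw [h2] at h1
    have h3 := congrArg (fun T : E →L[ℝ] ℝ => T u) (h1.unique (hasFDerivAt_const (R ^ 2) x))
    simp only [ContinuousLinearMap.comp_apply, fderivInnerCLM_apply, ContinuousLinearMap.prod_apply, hu,
      real_inner_self_eq_norm_sq, hn, _root_.zero_apply] at h3
    nlinarith [mul_pos hR hR]
  have hcont : ∀ t : ℝ, IntegrableOn (fun x => (1 + t • A x).det) B μ := fun t =>
    (ContinuousLinearMap.continuous_det.comp (by fun_prop)).continuousOn.integrableOn_compact (isCompact_closedBall _ _)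
  have hfin : ∫ x in B, (1 + A x).det ∂μ = μ.real B := by
    rw [show (fun x => (1 + A x).det) = _ from funext fun x => hdet (A x),
      integral_finsetSum _ fun i _ => (hcont (v i)).const_mul (w i)]
    simp_rw [integral_const_mul, hvi]
    rw [← Finset.sum_mul, hw, one_mul]
  simp_rw [hzero] at hfin
  rw [integral_zero] at hfin
  have hpos : 0 < μ.real B := ENNReal.toReal_pos
    ((measure_ball_pos μ 0 hR).trans_le (measure_mono ball_subset_closedBall)).ne'
    (isCompact_closedBall _ _).measure_lt_top.ne
  exact hpos.ne hfin

end Retraction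

section Domain

variable {E : Type*} [NormedAddCommGroup E] [InnerProductSpace ℝ E] [FiniteDimensional ℝ E]

omit [InnerProductSpace ℝ E] [FiniteDimensional ℝ E] in
theorem exists_pos_le_norm {K : Set E} (hK : IsCompact K) {F : E → E} (hF : ContinuousOn F K)
    (h0 : ∀ x ∈ K, F x ≠ 0) : ∃ δ > 0, ∀ x ∈ K, δ ≤ ‖F x‖ := by
  rcases K.eq_empty_or_nonempty with rfl | hne
  · exact ⟨1, one_pos, by simp⟩
  obtain ⟨x, hx, hmin⟩ := hK.exists_isMinOn hne hF.norm
  exact ⟨‖F x‖, norm_pos_iff.mpr (h0 x hx), fun y hy => hmin hy⟩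

theorem exists_zero_of_eq_self {F : E → E} (hF : Continuous F) {R : ℝ} (hR : 0 < R)
    (hid : ∀ x, R ≤ ‖x‖ → F x = x) : ∃ x, F x = 0 := by
  by_contra! h
  obtain ⟨δ₀, hδ₀, hδ⟩ := exists_pos_le_norm (isCompact_closedBall (0 : E) R) hF.continuousOn fun x _ => h x
  set δ := min δ₀ R with hd
  have hδ' : ∀ x, δ ≤ ‖F x‖ := fun x => by
    rcases le_total ‖x‖ R with hx | hx
    · exact (min_le_left _ _).trans (hδ x (by simpa using hx))
    · rw [hid x hx]; exact (min_le_right _ _).trans hx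
  have hδp : 0 < δ := lt_min hδ₀ hR
  have hUo : IsOpen {x : E | R < ‖x‖} := isOpen_lt continuous_const continuous_norm
  obtain ⟨g, hg, hgd, hgS, -⟩ := hF.exists_contDiff_approx_and_eqOn 1 (ε := fun _ => δ) continuous_const
    (fun _ => hδp) (S := {x : E | 2 * R ≤ ‖x‖}) (U := {x : E | R < ‖x‖})
    (isClosed_le continuous_const continuous_norm)
    (hUo.mem_nhdsSet.mpr fun x (hx : 2 * R ≤ ‖x‖) => (by linarith : R < ‖x‖))
    (contDiffOn_id.congr fun x (hx : R < ‖x‖) => hid x hx.le)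
  have hg0 : ∀ x, g x ≠ 0 := fun x h0 => by
    have := hgd x
    rw [h0, dist_zero_left] at this
    exact absurd this (not_lt.mpr (hδ' x))
  refine no_smooth_retraction (r := fun x => ((2 * R) * ‖g x‖⁻¹) • g x) ?_ (R := 2 * R) (by positivity) ?_ ?_
  · exact (contDiff_const.mul ((hg.norm ℝ hg0).inv fun x => norm_ne_zero_iff.mpr (hg0 x))).smul hg
  · intro x
    rw [norm_smul, norm_mul, norm_inv, norm_norm, Real.norm_of_nonneg (by positivity), mul_assoc,
      inv_mul_cancel₀ (norm_ne_zero_iff.mpr (hg0 x)), mul_one]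
  · intro x hx
    have : g x = x := (hgS (show 2 * R ≤ ‖x‖ from hx.ge)).trans (hid x (by linarith))
    simp only [this, hx]
    rw [mul_inv_cancel₀ (by positivity), one_smul]

omit [FiniteDimensional ℝ E] in
theorem norm_inv_max_smul_le (x : E) : ‖(max 1 ‖x‖)⁻¹ • x‖ ≤ 1 := by
  have : 0 < max 1 ‖x‖ := lt_max_of_lt_left one_pos
  rw [norm_smul, norm_inv, Real.norm_of_nonneg this.le, inv_mul_le_iff₀ this, mul_one]
  exact le_max_right _ _

theorem exists_zero_of_near_self {F : E → E} (hF : ContinuousOn F (closedBall 0 1))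
    (hd : ∀ x, ‖x‖ ≤ 1 → ‖F x - x‖ ≤ 1) : ∃ x ∈ closedBall (0 : E) 1, F x = 0 := by
  let π : E → E := fun x => (max 1 ‖x‖)⁻¹ • x
  have hπ : Continuous π := ((continuous_const.max continuous_norm).inv₀ fun x =>
    (lt_max_of_lt_left one_pos).ne').smul continuous_id
  have hπm : ∀ x, π x ∈ closedBall (0 : E) 1 := fun x => by
    rw [mem_closedBall_zero_iff]; exact norm_inv_max_smul_le x
  have hπ1 : ∀ x, ‖x‖ ≤ 1 → π x = x := fun x hx => by simp [π, max_eq_left hx]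
  let φ : E → ℝ := fun x => max 0 (min 1 (2 - ‖x‖))
  have hc : Continuous fun x => x + φ x • (F (π x) - π x) := by
    have h1 : Continuous fun x => F (π x) := hF.comp_continuous hπ hπm
    have h2 : Continuous φ := by fun_prop
    exact continuous_id.add (h2.smul (h1.sub hπ))
  obtain ⟨x, hx⟩ := exists_zero_of_eq_self hc (R := 2) two_pos fun x hx => by
    have : φ x = 0 := max_eq_left ((min_le_right _ _).trans (by linarith))
    rw [this, zero_smul, add_zero]
  by_cases h1 : ‖x‖ ≤ 1
  · have : φ x = 1 := by simp only [φ]; rw [min_eq_left (by linarith), max_eq_right zero_le_one]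
    rw [this, hπ1 x h1, one_smul, add_sub_cancel] at hx
    exact ⟨x, by simpa using h1, hx⟩
  · exfalso
    push Not at h1
    have h2 : φ x < 1 := max_lt one_pos ((min_le_right _ _).trans_lt (by linarith))
    have h3 : x = -(φ x • (F (π x) - π x)) := eq_neg_of_add_eq_zero_left hx
    have h0 : 0 ≤ φ x := le_max_left _ _
    have h4 : ‖x‖ ≤ φ x * 1 := by
      conv_lhs => rw [h3]
      rw [norm_neg, norm_smul, Real.norm_of_nonneg h0]
      exact mul_le_mul_of_nonneg_left (hd _ (by simpa using hπm x)) h0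
    linarith

open MeasureTheory in
theorem image_closedBall_mem_nhds {f : E → E} (hf : ContinuousOn f (closedBall 0 1))
    (hi : InjOn f (closedBall 0 1)) : f '' closedBall 0 1 ∈ 𝓝 (f 0) := by
  let _ : MeasurableSpace E := borel E
  have _ : BorelSpace E := ⟨rfl⟩
  let μ : Measure E := Measure.addHaar
  set B : Set E := closedBall 0 1 with hB
  have hBc : IsCompact B := isCompact_closedBall _ _
  have h0B : (0 : E) ∈ B := by simp [hB]
  have hfBc : IsCompact (f '' B) := hBc.image_of_continuousOn hf
  obtain ⟨G, hG⟩ : ∃ G : C(E, E), ∀ x ∈ B, G (f x) = x := by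
    have hinv := hBc.continuousOn_invFunOn hf hi
    have _ := TietzeExtension.of_tvs (E := E) ℝ
    obtain ⟨G, hG⟩ := ContinuousMap.exists_restrict_eq (Y := E) hfBc.isClosed ⟨_, hinv.domRestrict⟩
    refine ⟨G, fun x hx => ?_⟩
    have := DFunLike.congr_fun hG ⟨f x, mem_image_of_mem f hx⟩
    exact Eq.trans this (hi.leftInvOn_invFunOn hx)
  by_contra hnot
  obtain ⟨ε', hε', hε⟩ := Metric.continuous_iff.mp G.continuous (f 0) (1 / 10) (by norm_num)
  rw [hG 0 h0B] at hε
  obtain ⟨ε, hε0, rfl⟩ : ∃ ε > 0, ε' = 2 * ε := ⟨ε' / 2, by positivity, by ring⟩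
  obtain ⟨c, hcd, hc⟩ : ∃ c, dist c (f 0) < ε ∧ c ∉ f '' B := by
    by_contra! h
    exact hnot (Filter.mem_of_superset (ball_mem_nhds _ hε0) fun c hc => h c hc)
  have hGε : ∀ y, dist y c ≤ ε → ‖G y‖ < 1 / 10 := fun y hy => by
    have := hε y ((dist_triangle _ c _).trans_lt (by linarith))
    rwa [dist_zero_right] at this
  obtain ⟨δ₀, hδ₀, hδ⟩ := exists_pos_le_norm (hfBc.inter_right (t := {y | ε ≤ dist y c})
      (isClosed_le continuous_const (by fun_prop))) (F := G) G.continuous.continuousOn (by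
    rintro _ ⟨⟨x, hx, rfl⟩, hy⟩ h0
    rw [hG x hx] at h0
    rw [h0, mem_ofPred_eq, dist_comm] at hy
    linarith)
  set δ := min δ₀ (1 / 10) with hd
  have hδp : 0 < δ := lt_min hδ₀ (by norm_num)
  obtain ⟨P, hP, hPd, -⟩ := G.continuous.exists_contDiff_approx 1 (ε := fun _ => δ / 2) continuous_const
    (fun _ => half_pos hδp)
  have hPs : μ (P '' sphere c ε) = 0 :=
    addHaar_image_eq_zero_of_differentiableOn_of_addHaar_eq_zero μ (hP.differentiable one_ne_zero).differentiableOn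
      (Measure.addHaar_sphere_of_ne_zero μ c hε0.ne')
  obtain ⟨v, hv, hvP⟩ : ∃ v ∈ ball (0 : E) (δ / 2), v ∉ P '' sphere c ε := by
    by_contra! h
    exact (measure_ball_pos μ (0 : E) (half_pos hδp)).ne' (measure_mono_null h hPs)
  have hPv : ∀ z, ‖P z - v - G z‖ < δ := fun z => by
    have h1 := hPd z
    rw [dist_eq_norm] at h1
    rw [mem_ball_zero_iff] at hv
    calc ‖P z - v - G z‖ = ‖(P z - G z) - v‖ := by congr 1; abel
      _ ≤ _ := norm_sub_le _ _
      _ < _ := by linarith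
  let Φ : E → E := fun y => c + max 1 (ε / ‖y - c‖) • (y - c)
  have hΦ1 : ∀ y, y ≠ c → ε ≤ dist y c → Φ y = y := fun y hy h => by
    have : ε / ‖y - c‖ ≤ 1 := by
      rw [div_le_one (norm_pos_iff.mpr (sub_ne_zero.mpr hy)), ← dist_eq_norm]; exact h
    simp [Φ, max_eq_left this]
  have hΦ2 : ∀ y, y ≠ c → dist y c ≤ ε → dist (Φ y) c = ε := fun y hy h => by
    have hp := norm_pos_iff.mpr (sub_ne_zero.mpr hy)
    have : 1 ≤ ε / ‖y - c‖ := by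
      rw [one_le_div hp, ← dist_eq_norm]; exact h
    simp only [Φ, max_eq_right this, dist_self_add_left, norm_smul]
    rw [Real.norm_of_nonneg (by positivity), div_mul_cancel₀ _ hp.ne']
  have hfc : ∀ x ∈ B, f x ≠ c := fun x hx h => hc ⟨x, hx, h⟩
  have hF : ContinuousOn (fun x => P (Φ (f x)) - v) B := by
    have h1 : ContinuousOn (fun x => Φ (f x)) B := by
      have h2 : ContinuousOn (fun x => f x - c) B := hf.sub continuousOn_const
      exact continuousOn_const.add ((ContinuousOn.sup continuousOn_const (continuousOn_const.div h2.norm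
        fun x hx => norm_ne_zero_iff.mpr (sub_ne_zero.mpr (hfc x hx)))).smul h2)
    exact (hP.continuous.comp_continuousOn h1).sub continuousOn_const
  obtain ⟨x, hx, hx0⟩ := exists_zero_of_near_self hF fun x hx => by
    have hxB : x ∈ B := by simpa [hB] using hx
    conv_lhs => rw [← hG x hxB]
    simp only [hG x hxB]
    rcases le_total ε (dist (f x) c) with h | h
    · rw [hΦ1 _ (hfc x hxB) h]
      have h2 := (hPv (f x)).le.trans (min_le_right _ _)
      rw [hG x hxB] at h2
      linarith
    · have h1 := hGε _ (hΦ2 _ (hfc x hxB) h).le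
      have h2 := (hPv (Φ (f x))).le.trans (min_le_right _ _)
      have h3 := hGε _ h
      rw [hG x hxB] at h3
      calc ‖P (Φ (f x)) - v - x‖ = ‖(P (Φ (f x)) - v - G (Φ (f x))) + G (Φ (f x)) - x‖ := by congr 1; abel
        _ ≤ ‖P (Φ (f x)) - v - G (Φ (f x))‖ + ‖G (Φ (f x))‖ + ‖x‖ :=
            (norm_sub_le _ _).trans (by gcongr; exact norm_add_le _ _)
        _ ≤ 1 := by linarith
  rcases le_or_gt ε (dist (f x) c) with h | h
  · rw [hΦ1 _ (hfc x hx) h] at hx0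
    have h1 := hPv (f x)
    rw [hx0, zero_sub, norm_neg] at h1
    exact absurd (h1.trans_le (min_le_left _ _)) (not_lt.mpr (hδ _ ⟨mem_image_of_mem f hx, h⟩))
  · exact hvP ⟨Φ (f x), hΦ2 _ (hfc x hx) h.le, sub_eq_zero.mp hx0⟩

theorem isOpen_image_of_injOn {f : E → E} {U : Set E} (hU : IsOpen U) (hf : ContinuousOn f U)
    (hi : InjOn f U) : IsOpen (f '' U) := by
  rw [isOpen_iff_mem_nhds]
  rintro _ ⟨x, hx, rfl⟩
  obtain ⟨r, hr, hrU⟩ := nhds_basis_closedBall.mem_iff.mp (hU.mem_nhds hx)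
  let a : E → E := fun z => x + r • z
  have ha : MapsTo a (closedBall 0 1) U := fun z hz => hrU (by
    rw [mem_closedBall_zero_iff] at hz
    rw [mem_closedBall, dist_eq_norm, add_sub_cancel_left, norm_smul, Real.norm_of_nonneg hr.le]
    exact mul_le_of_le_one_right hr.le hz)
  have hai : Function.Injective a := fun z w h => smul_right_injective E hr.ne' (add_left_cancel h)
  have h := image_closedBall_mem_nhds (f := f ∘ a) (hf.comp (by fun_prop) ha) (hi.comp hai.injOn ha)
  have h0 : a 0 = x := by simp [a]
  rw [Function.comp_apply, h0, image_comp] at h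
  exact Filter.mem_of_superset h (image_mono ha.image_subset)

end Domain

section Tameness

/-- Every cocycle near `p` off `K` is trivial on a smaller neighborhood. -/
def Tame {X : Type*} [TopologicalSpace X] (G : Type*) [Group G] (K : Set X) (p : X) : Prop :=
  ∀ U ∈ 𝓝 p, ∀ τ : X → X → G, IsCoc (U \ K) τ → ∃ V ∈ 𝓝 p, ∃ f, IsPot (V \ K) τ f

theorem Tame.of_openPartialHomeomorph {X Y : Type*} [TopologicalSpace X] [TopologicalSpace Y] {G : Type*} [Group G]
    (e : OpenPartialHomeomorph X Y) {K : Set X} {K' : Set Y} {p : X} (hp : p ∈ e.source)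
    (hK : ∀ x ∈ e.source, x ∈ K ↔ e x ∈ K') (h : Tame G K' (e p)) : Tame G K p := by
  intro U hU τ hτ
  obtain ⟨W, hWU, hWo, hpW⟩ := _root_.mem_nhds_iff.mp (Filter.inter_mem hU (e.open_source.mem_nhds hp))
  have hW : W ⊆ e.source := fun x hx => (hWU hx).2
  have hW' : e '' W ⊆ e.target := by rintro _ ⟨x, hx, rfl⟩; exact e.map_source (hW hx)
  obtain ⟨V, hV, f, hf⟩ := h (e '' W) ((e.isOpen_image_of_subset_source hWo hW).mem_nhds ⟨p, hpW, rfl⟩)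
    (fun a b => τ (e.symm a) (e.symm b)) (hτ.comp (e.continuousOn_symm.mono (sdiff_subset.trans hW')) (by
      rintro _ ⟨⟨x, hx, rfl⟩, hxK⟩
      rw [e.left_inv (hW hx)]
      exact ⟨(hWU hx).1, fun h => hxK ((hK x (hW hx)).mp h)⟩))
  refine ⟨W ∩ e ⁻¹' V, Filter.inter_mem (hWo.mem_nhds hpW) (e.continuousAt hp hV), f ∘ e, ?_⟩
  have h1 : ContinuousOn e ((W ∩ e ⁻¹' V) \ K) := e.continuousOn.mono fun x hx => hW hx.1.1
  refine Loc.imp (Loc.comp hf h1 fun x hx => ⟨hx.1.2, fun h => hx.2 ((hK x (hW hx.1.1)).mpr h)⟩) ?_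
  intro a ha b hb hab
  simpa only [e.left_inv (hW ha.1.1), e.left_inv (hW hb.1.1), Function.comp_apply] using hab

variable {E : Type*} [NormedAddCommGroup E] [NormedSpace ℝ E] {G : Type*} [Group G]

theorem exists_starConvex_half {ℓ : E →L[ℝ] ℝ} {e : E} (he : 0 < ℓ e) {K : Set E} {q : E} (hq : ℓ q = 0) {r : ℝ}
    (hr : 0 < r) (hflat : ∀ x ∈ K ∩ ball q r, ℓ x = 0) :
    ∃ x ∈ {x ∈ ball q r \ K | 0 ≤ ℓ x}, StarConvex ℝ x {x ∈ ball q r \ K | 0 ≤ ℓ x} := by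
  have he0 : 0 < ‖e‖ := norm_pos_iff.mpr fun h => by simp [h] at he
  set x₀ := q + (r / (2 * ‖e‖)) • e with hx₀
  have hb : x₀ ∈ ball q r := by
    rw [mem_ball, dist_eq_norm, hx₀, add_sub_cancel_left, norm_smul, Real.norm_of_nonneg (by positivity)]
    field_simp
    linarith
  have hl : 0 < ℓ x₀ := by simp only [hx₀, map_add, map_smul, hq, smul_eq_mul]; positivity
  refine ⟨x₀, ⟨⟨hb, fun h => hl.ne' (hflat _ ⟨h, hb⟩)⟩, hl.le⟩, fun y hy a b ha hb' hab => ?_⟩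
  rcases ha.eq_or_lt with rfl | ha
  · rw [zero_add] at hab; subst hab; simpa using hy
  · have h1 : a • x₀ + b • y ∈ ball q r := convex_ball q r hb hy.1.1 ha.le hb' hab
    have h2 : 0 < ℓ (a • x₀ + b • y) := by
      have h3 : 0 ≤ ℓ y := hy.2
      simp only [map_add, map_smul, smul_eq_mul]; positivity
    exact ⟨⟨h1, fun h => h2.ne' (hflat _ ⟨h, h1⟩)⟩, h2.le⟩

/-- For flat sets tameness is detected by elementary abelian two-groups. -/
theorem Tame.of_flat {ℓ : E →L[ℝ] ℝ} {e : E} (he : ℓ e = 1) {K : Set E} {q : E} (hq : q ∈ K) {r : ℝ}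
    (hr : 0 < r) (hopen : IsOpen (ball q r \ K)) (hflat : ∀ x ∈ K ∩ ball q r, ℓ x = 0)
    (hA : Tame (Multiplicative (G → ZMod 2)) K q) : Tame G K q := by
  classical
  intro U hU τ hτ
  obtain ⟨r', hr', hrU⟩ := Metric.mem_nhds_iff.mp (Filter.inter_mem hU (ball_mem_nhds q hr))
  have hopen' : IsOpen (ball q r' \ K) := by
    have : ball q r' \ K = ball q r' ∩ (ball q r \ K) := by
      ext x; exact ⟨fun h => ⟨h.1, (hrU h.1).2, h.2⟩, fun h => ⟨h.1, h.2.2⟩⟩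
    rw [this]; exact isOpen_ball.inter hopen
  have hflat' : ∀ x ∈ K ∩ ball q r', ℓ x = 0 := fun x hx => hflat x ⟨hx.1, (hrU hx.2).2⟩
  have hτ' : IsCoc (ball q r' \ K) τ := hτ.mono (sdiff_subset_sdiff_left fun x hx => (hrU hx).1)
  have hq0 : ℓ q = 0 := hflat q ⟨hq, mem_ball_self hr⟩
  clear hopen hflat hrU hU hτ
  obtain ⟨f₁, hf₁⟩ : ∃ f, IsPot {x ∈ ball q r' \ K | 0 ≤ ℓ x} τ f := by
    obtain ⟨x, hx, hs⟩ := exists_starConvex_half (ℓ := ℓ) (e := e) (by rw [he]; norm_num) hq0 hr' hflat'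
    exact (hτ'.mono fun x hx => hx.1).trivial_of_starConvex hs hx
  obtain ⟨f₂, hf₂⟩ : ∃ f, IsPot {x ∈ ball q r' \ K | ℓ x ≤ 0} τ f := by
    obtain ⟨x, hx, hs⟩ := exists_starConvex_half (ℓ := -ℓ) (e := -e) (K := K) (q := q) (by simp [he]) (by simp [hq0]) hr'
      (fun x hx => by simp [hflat' x hx])
    simp only [neg_apply, neg_nonneg] at hs hx
    exact (hτ'.mono fun x hx => hx.1).trivial_of_starConvex hs hx
  let g : E → G := fun a => f₁ a * (f₂ a)⁻¹
  have hg : LocConst {x ∈ ball q r' \ K | ℓ x = 0} g :=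
    (hf₁.mono fun x hx => ⟨hx.1, (hx.2 : ℓ x = 0).ge⟩).div_locConst (hf₂.mono fun x hx => ⟨hx.1, (hx.2 : ℓ x = 0).le⟩)
  let π : E → E := fun a => a - ℓ a • e
  have hπ : Continuous π := by fun_prop
  have hπ0 : ∀ a, ℓ (π a) = 0 := fun a => by simp [π, he]
  have hπ1 : ∀ a, ℓ a = 0 → π a = a := fun a h => by simp [π, h]
  let σ : G → Multiplicative (G → ZMod 2) := fun c => Multiplicative.ofAdd (Pi.single c 1)
  have hσσ : ∀ c, (σ c)⁻¹ = σ c := fun c => by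
    have : -(Pi.single c (1 : ZMod 2) : G → ZMod 2) = Pi.single c 1 := by
      rw [← Pi.single_neg]; rfl
    simp only [σ, ← ofAdd_neg, this]
  have hσ : Function.Injective σ := fun c d h => by
    have h1 : (Pi.single c (1 : ZMod 2) : G → ZMod 2) = Pi.single d 1 := Multiplicative.ofAdd.injective h
    have h2 := congrFun h1 c
    by_contra hne
    rw [Pi.single_eq_same, Pi.single_eq_of_ne hne] at h2
    exact one_ne_zero h2
  let η : E → E → Multiplicative (G → ZMod 2) := fun a b => if (0 ≤ ℓ a ↔ 0 ≤ ℓ b) then 1 else σ (g (π a))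
  have hη : IsCoc (ball q r' \ K) η := by
    intro p hp
    rcases lt_trichotomy (ℓ p) 0 with h | h | h
    · refine ⟨fun _ => 1, {a | ℓ a < 0}, mem_nhdsWithin_of_mem_nhds
        ((isOpen_lt ℓ.continuous continuous_const).mem_nhds h), fun a (ha : ℓ a < 0) b (hb : ℓ b < 0) => ?_⟩
      simp [η, not_le.mpr ha, not_le.mpr hb]
    · obtain ⟨O, hO, hOg⟩ := hg p ⟨hp, h⟩
      obtain ⟨O', hO', hOO⟩ := mem_nhdsWithin_iff_exists_mem_nhds_inter.mp hO
      have hπp : ∀ᶠ a in 𝓝 p, π a ∈ O' ∩ (ball q r' \ K) := by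
        refine hπ.continuousAt.eventually_mem (Filter.inter_mem ?_ ?_)
        · rwa [hπ1 p h]
        · rw [hπ1 p h]; exact hopen'.mem_nhds hp
      have hpO : p ∈ O := mem_of_mem_nhdsWithin (mem_sep hp h) hO
      refine ⟨fun a => if 0 ≤ ℓ a then 1 else σ (g p), {a | π a ∈ O' ∩ (ball q r' \ K)},
        mem_nhdsWithin_of_mem_nhds hπp, fun a (ha : π a ∈ O' ∩ (ball q r' \ K)) b (_ : π b ∈ O' ∩ (ball q r' \ K)) => ?_⟩
      have hma : π a ∈ {x ∈ ball q r' \ K | ℓ x = 0} := ⟨ha.2, hπ0 a⟩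
      have hga : g (π a) = g p := hOg (π a) (hOO (mem_inter ha.1 hma)) p hpO
      simp only [η, hga]
      have hs : σ (g p) * σ (g p) = 1 := by nth_rw 1 [← hσσ]; exact inv_mul_cancel _
      by_cases h1 : 0 ≤ ℓ a <;> by_cases h2 : 0 ≤ ℓ b <;> simp [h1, h2, hσσ, hs]
    · refine ⟨fun _ => 1, {a | 0 < ℓ a}, mem_nhdsWithin_of_mem_nhds
        ((isOpen_lt continuous_const ℓ.continuous).mem_nhds h), fun a (ha : 0 < ℓ a) b (hb : 0 < ℓ b) => ?_⟩
      simp [η, ha.le, hb.le]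
  obtain ⟨V, hV, F, hF⟩ := hA _ (ball_mem_nhds q hr') η hη
  obtain ⟨ε, hε, hεV⟩ := Metric.mem_nhds_iff.mp (Filter.inter_mem hV (ball_mem_nhds q hr'))
  have hflatε : ∀ x ∈ K ∩ ball q ε, ℓ x = 0 := fun x hx => hflat' x ⟨hx.1, (hεV hx.2).2⟩
  replace hF : IsPot (ball q ε \ K) η F := hF.mono (sdiff_subset_sdiff_left fun x hx => (hεV hx).1)
  have hsub : ball q ε \ K ⊆ ball q r' \ K := sdiff_subset_sdiff_left fun x hx => (hεV hx).2
  obtain ⟨x₁, hx₁, hs₁⟩ := exists_starConvex_half (ℓ := ℓ) (e := e) (by rw [he]; norm_num) hq0 hε hflatε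
  have hF₁ : ∀ y ∈ {x ∈ ball q ε \ K | 0 ≤ ℓ x}, F y = F x₁ := fun y hy => by
    refine LocConst.eq (Loc.imp (hF.mono fun x hx => hx.1) fun a ha b hb h => ?_)
      (StarConvex.isPathConnected hs₁ hx₁).isConnected.isPreconnected hy hx₁
    have h1 : 0 ≤ ℓ a := ha.2
    have h2 : 0 ≤ ℓ b := hb.2
    simp only [η, h1, h2, if_true] at h
    exact inv_mul_eq_one.mp h.symm
  have hneg : Convex ℝ {x ∈ ball q ε | ℓ x < 0} :=
    (convex_ball q ε).inter (convex_halfSpace_lt ℓ.isLinear 0)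
  have hx₂ : ∃ x₂, ∀ y ∈ {x ∈ ball q ε | ℓ x < 0}, F y = F x₂ := by
    rcases {x ∈ ball q ε | ℓ x < 0}.eq_empty_or_nonempty with h | ⟨x₂, hx₂⟩
    · exact ⟨q, fun y hy => by rw [h] at hy; exact hy.elim⟩
    · refine ⟨x₂, fun y hy => LocConst.eq (Loc.imp (hF.mono fun x hx => ⟨hx.1, fun h => (hx.2 : ℓ x < 0).ne (hflatε x ⟨h, hx.1⟩)⟩)
        fun a ha b hb h => ?_) hneg.isPreconnected hy hx₂⟩
      have h1 : ¬ 0 ≤ ℓ a := not_le.mpr ha.2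
      have h2 : ¬ 0 ≤ ℓ b := not_le.mpr hb.2
      simp only [η, h1, h2, if_true] at h
      exact inv_mul_eq_one.mp h.symm
  obtain ⟨x₂, hx₂⟩ := hx₂
  have hcross : ∀ y ∈ ball q ε \ K, ℓ y = 0 → σ (g y) = (F x₁)⁻¹ * F x₂ := fun y hy hy0 => by
    obtain ⟨O, hO, hOF⟩ := hF y hy
    obtain ⟨O', hO', hOO⟩ := mem_nhdsWithin_iff_exists_mem_nhds_inter.mp hO
    have hop : IsOpen (ball q ε \ K) := by
      have : ball q ε \ K = ball q ε ∩ (ball q r' \ K) := by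
        ext x; exact ⟨fun h => ⟨h.1, hsub h⟩, fun h => ⟨h.1, h.2.2⟩⟩
      rw [this]; exact isOpen_ball.inter hopen'
    have hc : Filter.Tendsto (fun t : ℝ => y - t • e) (𝓝[>] 0) (𝓝 y) := by
      have : Continuous fun t : ℝ => y - t • e := by fun_prop
      simpa using (this.tendsto 0).mono_left nhdsWithin_le_nhds
    obtain ⟨t, ⟨ht1, ht2⟩, ht0⟩ := ((hc.eventually_mem (Filter.inter_mem hO' (hop.mem_nhds hy))).and
      (self_mem_nhdsWithin : Ioi (0 : ℝ) ∈ 𝓝[>] 0)).exists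
    have hlt : ℓ (y - t • e) < 0 := by simpa [hy0, he] using ht0
    have h1 : η y (y - t • e) = (F y)⁻¹ * F (y - t • e) := hOF y (mem_of_mem_nhdsWithin hy hO) _ (hOO ⟨ht1, ht2⟩)
    rw [hF₁ y ⟨hy, hy0.ge⟩, hx₂ _ ⟨ht2.1, hlt⟩] at h1
    rw [← h1]
    simp only [η, hy0, not_le.mpr hlt, hπ1 y hy0, le_refl, true_iff, if_false]
  obtain ⟨g₀, hg₀⟩ : ∃ g₀, ∀ y ∈ ball q ε \ K, ℓ y = 0 → g y = g₀ := by
    by_cases h : ∃ y ∈ ball q ε \ K, ℓ y = 0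
    · obtain ⟨y₀, hy₀, h0⟩ := h
      exact ⟨g y₀, fun y hy h => hσ ((hcross y hy h).trans (hcross y₀ hy₀ h0).symm)⟩
    · exact ⟨1, fun y hy h0 => (h ⟨y, hy, h0⟩).elim⟩
  refine ⟨ball q ε, ball_mem_nhds q hε, fun a => if 0 ≤ ℓ a then f₁ a else g₀ * f₂ a, ?_⟩
  refine IsPot.glue_closed (A := (ball q ε \ K) ∩ {x | 0 ≤ ℓ x}) (B := (ball q ε \ K) ∩ {x | ℓ x ≤ 0})
    (hτ'.mono hsub) ?_ ⟨_, isClosed_le continuous_const ℓ.continuous, rfl⟩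
    ⟨_, isClosed_le ℓ.continuous continuous_const, rfl⟩ ?_ ?_
  · rw [← inter_union_distrib_left]
    refine (inter_eq_left.mpr fun x _ => ?_).symm
    exact le_total 0 (ℓ x)
  · refine IsPot.congr (hf₁.mono fun x hx => ⟨hsub hx.1, hx.2⟩) fun x hx => ?_
    exact (if_pos hx.2).symm
  · refine IsPot.congr ((hf₂.const_mul g₀).mono fun x hx => ⟨hsub hx.1, hx.2⟩) fun x hx => ?_
    have hx0 : ℓ x ≤ 0 := hx.2
    rcases hx0.eq_or_lt with h | h
    · have h1 := hg₀ x hx.1 h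
      simp only [h, le_refl, if_true, ← h1, g, inv_mul_cancel_right]
    · exact (if_neg (not_le.mpr h)).symm

theorem Tame.of_locallyHyperplanarAt {n : ℕ} (hn : 1 ≤ n) {K : Set (EuclideanSpace ℝ (Fin n))} (hK : IsClosed K)
    {p : EuclideanSpace ℝ (Fin n)} (hp : p ∈ K) (hl : LocallyHyperplanarAt K p)
    (hA : Tame (Multiplicative (G → ZMod 2)) K p) : Tame G K p := by
  classical
  obtain ⟨U, hU, h, hh, hhK⟩ := hl
  set f : EuclideanSpace ℝ (Fin n) → EuclideanSpace ℝ (Fin n) :=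
    fun x => if hx : x ∈ U then h ⟨x, hx⟩ else 0 with hf
  have hfU : ∀ x (hx : x ∈ U), f x = h ⟨x, hx⟩ := fun x hx => dif_pos hx
  have hfc : ContinuousOn f U := by
    rw [continuousOn_iff_continuous_domRestrict]
    exact hh.continuous.congr fun x => (hfU x x.2).symm
  have hfi : InjOn f U := fun x hx y hy hxy => by
    rw [hfU x hx, hfU y hy] at hxy
    exact congrArg Subtype.val (hh.injective hxy)
  obtain ⟨W, hWU, hWo, hpW⟩ := _root_.mem_nhds_iff.mp hU
  have hop : IsOpenMap (W.domRestrict f) := fun O hO => by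
    obtain ⟨O', hO', rfl⟩ := isOpen_induced_iff.mp hO
    have : W.domRestrict f '' (Subtype.val ⁻¹' O') = f '' (W ∩ O') := by
      rw [domRestrict_eq, image_comp, Subtype.image_preimage_coe]
    rw [this]
    exact isOpen_image_of_injOn (hWo.inter hO') (hfc.mono fun x hx => hWU hx.1) (hfi.mono fun x hx => hWU hx.1)
  let e : OpenPartialHomeomorph (EuclideanSpace ℝ (Fin n)) (EuclideanSpace ℝ (Fin n)) :=
    OpenPartialHomeomorph.ofContinuousOpenRestrict ((hfi.mono hWU).toPartialEquiv f W) (hfc.mono hWU) hop hWo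
  have h1 : ∀ x ∈ e.source, x ∈ K ↔ e x ∈ e '' (K ∩ W) := fun x hx =>
    ⟨fun hxK => ⟨x, ⟨hxK, hx⟩, rfl⟩, fun ⟨y, hy, hyx⟩ => by rw [← e.injOn hy.2 hx hyx]; exact hy.1⟩
  refine Tame.of_openPartialHomeomorph e hpW h1 ?_
  obtain ⟨r, hr, hrW⟩ := Metric.isOpen_iff.mp e.open_target _ (e.map_source hpW)
  have hA' : Tame (Multiplicative (G → ZMod 2)) (e '' (K ∩ W)) (e p) := by
    refine Tame.of_openPartialHomeomorph e.symm (K' := K) (e.map_source hpW) (fun x hx => ?_)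
      (by rwa [e.left_inv hpW])
    rw [h1 _ (e.map_target hx), e.right_inv hx]
  have hopen : IsOpen (ball (e p) r \ e '' (K ∩ W)) := by
    have : ball (e p) r \ e '' (K ∩ W) = ball (e p) r ∩ e '' (W \ K) := by
      ext x
      refine ⟨fun hx => ⟨hx.1, e.symm x, ⟨e.map_target (hrW hx.1), fun hxK =>
        hx.2 ⟨_, ⟨hxK, e.map_target (hrW hx.1)⟩, e.right_inv (hrW hx.1)⟩⟩, e.right_inv (hrW hx.1)⟩, ?_⟩
      rintro ⟨hx, y, hy, rfl⟩
      exact ⟨hx, fun hyK => hy.2 ((h1 y hy.1).mpr hyK)⟩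
    rw [this]
    exact isOpen_ball.inter (e.isOpen_image_of_subset_source (hWo.sdiff hK) sdiff_subset)
  let i : Fin n := ⟨n - 1, by omega⟩
  refine Tame.of_flat (ℓ := EuclideanSpace.proj i) (e := EuclideanSpace.single i 1) (by simp)
    ⟨p, ⟨hp, hpW⟩, rfl⟩ hr hopen ?_ hA'
  rintro _ ⟨⟨x, hx, rfl⟩, -⟩
  have := hhK ⟨x, hWU hx.2⟩ hx.1 i rfl
  rwa [← hfU x (hWU hx.2)] at this

end Tameness

noncomputable section

section ModelEmbedding

/-- The tube around a circle. -/
def spin (m : ℕ) (q : (Fin (m + 2) → ℝ) × Circle) : Fin (m + 3) → ℝ :=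
  Fin.cons (Real.exp (q.1 0) * (q.2 : ℂ).re) (Fin.cons (Real.exp (q.1 0) * (q.2 : ℂ).im) (Fin.tail q.1))

theorem continuous_spin (m : ℕ) : Continuous (spin m) := by
  refine continuous_pi fun i => ?_
  refine Fin.cases ?_ (fun i => Fin.cases ?_ (fun i => ?_) i) i
  · simp only [spin, Fin.cons_zero]; fun_prop
  · simp only [spin, Fin.cons_zero, Fin.cons_succ]; fun_prop
  · simp only [spin, Fin.cons_succ, Fin.tail]; fun_prop

theorem spin_injective (m : ℕ) : Function.Injective (spin m) := by
  rintro ⟨v, u⟩ ⟨v', u'⟩ h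
  have h0 := congrFun h 0
  have h1 := congrFun h (Fin.succ 0)
  have h2 : ∀ i : Fin (m + 1), v i.succ = v' i.succ := fun i => congrFun h i.succ.succ
  simp only [spin, Fin.cons_zero, Fin.cons_succ] at h0 h1
  have hc : (Real.exp (v 0) : ℂ) * u = (Real.exp (v' 0) : ℂ) * u' :=
    Complex.ext (by simpa [← Complex.ofReal_exp] using h0) (by simpa [← Complex.ofReal_exp] using h1)
  have hn := congrArg norm hc
  simp only [norm_mul, Circle.norm_coe, mul_one, Complex.norm_real, Real.norm_eq_abs, Real.abs_exp] at hn
  have h00 : v 0 = v' 0 := Real.exp_injective hn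
  have hv : v = v' := funext fun i => Fin.cases h00 h2 i
  subst hv
  have := mul_left_cancel₀ (by simp) hc
  rw [Circle.coe_inj.mp this]

/-- The standard embedding of `ℂ × (S¹)^m` into `ℝ^{m+2}`. -/
def torusEmb : (m : ℕ) → ℂ × (Fin m → Circle) → (Fin (m + 2) → ℝ)
  | 0, p => Fin.cons p.1.re (Fin.cons p.1.im Fin.elim0)
  | m + 1, p => spin m (torusEmb m (p.1, Fin.tail p.2), p.2 0)

theorem continuous_torusEmb (m : ℕ) : Continuous (torusEmb m) := by
  induction m with
  | zero =>
    refine continuous_pi fun i => ?_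
    refine Fin.cases ?_ (fun i => Fin.cases ?_ (fun i => i.elim0) i) i
    · simp only [torusEmb, Fin.cons_zero]; fun_prop
    · simp only [torusEmb, Fin.cons_zero, Fin.cons_succ]; fun_prop
  | succ m ih =>
    have : Continuous fun p : ℂ × (Fin (m + 1) → Circle) => ((p.1, Fin.tail p.2) : ℂ × (Fin m → Circle)) :=
      continuous_fst.prodMk (continuous_pi fun i => by simp only [Fin.tail]; fun_prop)
    exact (continuous_spin m).comp ((ih.comp this).prodMk (by fun_prop))

theorem torusEmb_injective (m : ℕ) : Function.Injective (torusEmb m) := by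
  induction m with
  | zero =>
    rintro ⟨z, a⟩ ⟨w, b⟩ h
    have h0 : z.re = w.re := congrFun h 0
    have h1 : z.im = w.im := congrFun h (Fin.succ 0)
    rw [Complex.ext h0 h1, Subsingleton.elim a b]
  | succ m ih =>
    rintro ⟨z, a⟩ ⟨w, b⟩ h
    have h1 := Prod.ext_iff.mp (spin_injective m h)
    have h2 := Prod.ext_iff.mp (ih h1.1)
    refine Prod.ext h2.1 (funext fun i => Fin.cases h1.2 (fun j => congrFun h2.2 j) i)

/-- Exponential coordinates. -/
def expChart (d : ℕ) (x : EuclideanSpace ℝ (Fin (d + 3))) : TT d :=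
  (⟨x 0, x 1⟩, fun i => Circle.exp (x i.succ.succ))

theorem continuous_expChart (d : ℕ) : Continuous (expChart d) := by
  refine Continuous.prodMk ?_ (continuous_pi fun i => Circle.exp.continuous.comp (by fun_prop))
  exact Complex.equivRealProdCLM.symm.continuous.comp
    ((by fun_prop : Continuous fun x : EuclideanSpace ℝ (Fin (d + 3)) => (x 0, x 1)))

theorem expChart_surjective (d : ℕ) : Function.Surjective (expChart d) := fun p => by
  refine ⟨WithLp.toLp 2 (Fin.cons p.1.re (Fin.cons p.1.im fun i => Complex.arg (p.2 i))), ?_⟩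
  refine Prod.ext rfl (funext fun i => ?_)
  simp [expChart, Circle.exp_arg]

theorem expChart_injOn (d : ℕ) (a : EuclideanSpace ℝ (Fin (d + 3))) : InjOn (expChart d) (ball a 1) := by
  intro x hx y hy h
  have h1 := Prod.ext_iff.mp h
  have hc : ∀ i, |x i - y i| < 2 := fun i => by
    have h2 : ∀ z ∈ ball a 1, |z i - a i| < 1 := fun z hz => by
      have := (PiLp.norm_apply_le (z - a) i).trans_lt (mem_ball_iff_norm.mp hz)
      simpa using this
    have h3 := abs_lt.mp (h2 x hx)
    have h4 := abs_lt.mp (h2 y hy)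
    exact abs_lt.mpr ⟨by linarith, by linarith⟩
  ext i
  refine Fin.cases (congrArg Complex.re h1.1) (fun i => Fin.cases (congrArg Complex.im h1.1) (fun i => ?_) i) i
  obtain ⟨m, hm⟩ := Circle.exp_eq_exp.mp (congrFun h1.2 i)
  have h2 := hc i.succ.succ
  have hm0 : m = 0 := by
    by_contra hne
    have h3 : (1 : ℝ) ≤ |(m : ℝ)| := by exact_mod_cast Int.one_le_abs hne
    rw [hm, add_sub_cancel_left, abs_mul, abs_of_pos (by positivity : 0 < 2 * Real.pi)] at h2
    nlinarith [Real.pi_gt_three]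
  simpa [hm0] using hm

/-- Invariance of domain for the model torus. -/
theorem isOpen_image_model {d : ℕ} {f : TT d → EuclideanSpace ℝ (Fin (d + 3))} (hf : ContinuousOn f (MM d))
    (hi : InjOn f (MM d)) : IsOpen (f '' {p | ‖p.1‖ < 1}) := by
  rw [isOpen_iff_mem_nhds]
  rintro _ ⟨p, hp, rfl⟩
  obtain ⟨a, rfl⟩ := expChart_surjective d p
  have hW : IsOpen (ball a 1 ∩ expChart d ⁻¹' {p | ‖p.1‖ < 1}) :=
    isOpen_ball.inter ((isOpen_lt (by fun_prop) continuous_const).preimage (continuous_expChart d))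
  have hm : MapsTo (expChart d) (ball a 1 ∩ expChart d ⁻¹' {p | ‖p.1‖ < 1}) (MM d) :=
    fun x hx => by
    have h : ‖(expChart d x).1‖ < 1 := hx.2
    exact h.le
  have := isOpen_image_of_injOn hW (hf.comp (continuous_expChart d).continuousOn hm)
    (hi.comp ((expChart_injOn d a).mono inter_subset_left) hm)
  refine Filter.mem_of_superset (this.mem_nhds ⟨a, ⟨mem_ball_self one_pos, hp⟩, rfl⟩) ?_
  rintro _ ⟨x, hx, rfl⟩
  exact ⟨_, hx.2, rfl⟩

/-- The tower with given winding numbers. -/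
def euclideanTower (d : ℕ) (N : List Bool → ℕ) (hN : ∀ v, N v ≠ 0) : Tower d (EuclideanSpace ℝ (Fin (d + 3))) where
  N := N
  hN := hN
  J := fun p => WithLp.toLp 2 (torusEmb (d + 1) p)
  continuous_J := (PiLp.continuous_toLp 2 _).comp (continuous_torusEmb (d + 1))
  injective_J := (WithLp.toLp_injective 2).comp (torusEmb_injective (d + 1))
  isOpen_image := fun _ hf hi => isOpen_image_model
    (((PiLp.continuous_toLp 2 _).comp (continuous_torusEmb (d + 1))).comp_continuousOn hf)
    (((WithLp.toLp_injective 2).comp (torusEmb_injective (d + 1))).injOn.comp hi (mapsTo_univ _ _))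

end ModelEmbedding
end

section Separation

variable {α : Type*} [TopologicalSpace α]

/-- A closed set which locally does not separate does not separate. -/
theorem IsPreconnected.sdiff_of_local {Q A : Set α} (hQ : IsPreconnected Q) (hQo : IsOpen Q) (hA : IsClosed A)
    (h : ∀ x ∈ A ∩ Q, ∃ N, IsOpen N ∧ x ∈ N ∧ N ⊆ Q ∧ IsPreconnected (N \ A) ∧ N ⊆ closure (N \ A)) :
    IsPreconnected (Q \ A) := by
  rw [isPreconnected_iff_subset_of_disjoint]
  intro u v hu hv huv hd
  let W : Set α → Set α := fun u => ⋃ N ∈ {N | IsOpen N ∧ N ⊆ Q ∧ N ⊆ closure (N \ A) ∧ N \ A ⊆ u}, N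
  have hW : ∀ u, IsOpen (W u) := fun u => isOpen_biUnion fun N hN => hN.1
  have hself : ∀ {u : Set α}, IsOpen u → (Q \ A) ∩ u ⊆ W u := by
    intro u hu x hx
    have e : ((Q \ A) ∩ u) \ A = (Q \ A) ∩ u := by
      ext y; simp only [mem_sdiff, mem_inter_iff]; tauto
    refine mem_biUnion (⟨(hQo.sdiff hA).inter hu, fun y hy => hy.1.1, ?_, ?_⟩ : _ ∈ {N | IsOpen N ∧ N ⊆ Q ∧ N ⊆ closure (N \ A) ∧ N \ A ⊆ u}) hx
    · rw [e]; exact subset_closure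
    · rw [e]; exact inter_subset_right
  have hcov : Q ⊆ W u ∪ W v := by
    intro x hx
    by_cases hxA : x ∈ A
    · obtain ⟨N, hN, hxN, hNQ, hNc, hNd⟩ := h x ⟨hxA, hx⟩
      have hs : N \ A ⊆ Q \ A := sdiff_subset_sdiff_left hNQ
      rcases isPreconnected_iff_subset_of_disjoint.mp hNc u v hu hv (hs.trans huv)
        (subset_eq_empty (inter_subset_inter_left _ hs) hd) with h1 | h1
      · exact Or.inl (mem_biUnion (⟨hN, hNQ, hNd, h1⟩ : N ∈ {N | IsOpen N ∧ N ⊆ Q ∧ N ⊆ closure (N \ A) ∧ N \ A ⊆ u}) hxN)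
      · exact Or.inr (mem_biUnion (⟨hN, hNQ, hNd, h1⟩ : N ∈ {N | IsOpen N ∧ N ⊆ Q ∧ N ⊆ closure (N \ A) ∧ N \ A ⊆ v}) hxN)
    · rcases huv ⟨hx, hxA⟩ with h1 | h1
      · exact Or.inl (hself hu ⟨⟨hx, hxA⟩, h1⟩)
      · exact Or.inr (hself hv ⟨⟨hx, hxA⟩, h1⟩)
  have hdis : Q ∩ (W u ∩ W v) = ∅ := by
    rw [eq_empty_iff_forall_notMem]
    rintro x ⟨-, h1, h2⟩
    obtain ⟨N, ⟨hN, hNQ, hNd, hNu⟩, hxN⟩ := mem_iUnion₂.mp h1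
    obtain ⟨M, ⟨hM, hMQ, hMd, hMv⟩, hxM⟩ := mem_iUnion₂.mp h2
    obtain ⟨y, hyM, hyN⟩ := mem_closure_iff.mp (hNd hxN) M hM hxM
    exact (eq_empty_iff_forall_notMem.mp hd) y ⟨⟨hNQ hyN.1, hyN.2⟩, hNu hyN, hMv ⟨hyM, hyN.2⟩⟩
  have hkey : ∀ {u v : Set α}, IsOpen v → (Q \ A) ∩ (u ∩ v) = ∅ → Q ⊆ W u → Q \ A ⊆ u := by
    intro u v hv hd hQu x hx
    obtain ⟨N, ⟨hN, hNQ, hNd, hNu⟩, hxN⟩ := mem_iUnion₂.mp (hQu hx.1)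
    exact hNu ⟨hxN, hx.2⟩
  rcases isPreconnected_iff_subset_of_disjoint.mp hQ _ _ (hW u) (hW v) hcov hdis with h1 | h1
  · exact Or.inl (hkey hv hd h1)
  · exact Or.inr (hkey hu (by rwa [inter_comm v u]) h1)

end Separation

section Arcs

variable {V : Type*} [NormedAddCommGroup V] [NormedSpace ℝ V]

theorem isPreconnected_ball_sdiff_singleton (hV : 1 < Module.rank ℝ V) (y : V) {r : ℝ} (hr : 0 < r) :
    IsPreconnected (ball y r \ {y}) := by
  have : ball y r \ {y} = OpenPartialHomeomorph.univBall y r '' {0}ᶜ := by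
    set e := OpenPartialHomeomorph.univBall y r
    have hs : e.source = univ := OpenPartialHomeomorph.univBall_source y r
    have ht : e.target = ball y r := OpenPartialHomeomorph.univBall_target y hr
    have h0 : e 0 = y := OpenPartialHomeomorph.univBall_apply_zero y r
    ext x
    constructor
    · rintro ⟨hx, hxy⟩
      have hr' : e (e.symm x) = x := e.right_inv (by rwa [ht])
      refine ⟨e.symm x, fun h => hxy ?_, hr'⟩
      rw [mem_singleton_iff, ← hr', mem_singleton_iff.mp h, h0]
    · rintro ⟨z, hz, rfl⟩
      refine ⟨ht ▸ e.map_source (hs ▸ mem_univ _), fun h => hz ?_⟩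
      exact e.injOn (hs ▸ mem_univ _) (hs ▸ mem_univ _) (h.trans h0.symm)
  rw [this]
  exact (isConnected_compl_singleton_of_one_lt_rank hV 0).isPreconnected.image _
    (OpenPartialHomeomorph.continuous_univBall y r).continuousOn

theorem ball_subset_closure_sdiff_singleton (hV : 1 < Module.rank ℝ V) (y : V) (r : ℝ) :
    ball y r ⊆ closure (ball y r \ {y}) := by
  have : Nontrivial V := rank_pos_iff_nontrivial.mp (zero_lt_one.trans hV)
  have hd : Dense ({y}ᶜ : Set V) := dense_compl_singleton_iff_not_open.mpr fun h => by
    exact not_isOpen_singleton y h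
  exact hd.open_subset_closure_inter isOpen_ball

theorem IsPreconnected.sdiff_segment (hV : 1 < Module.rank ℝ V) {Q : Set (V × ℝ)} (hQ : IsPreconnected Q)
    (hQo : IsOpen Q) (y : V) (a b : ℝ) : IsPreconnected (Q \ ({y} ×ˢ Icc a b)) := by
  refine hQ.sdiff_of_local hQo (isClosed_singleton.prod isClosed_Icc) ?_
  rintro ⟨y', t⟩ ⟨⟨rfl, ht⟩, hQt⟩
  obtain ⟨r, hr, hrQ⟩ := Metric.isOpen_iff.mp hQo _ hQt
  rw [← ball_prod_same] at hrQ
  have h1 : (ball y' r \ {y'}) ×ˢ ball t r ⊆ (ball y' r ×ˢ ball t r) \ ({y'} ×ˢ Icc a b) :=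
    fun x hx => ⟨⟨hx.1.1, hx.2⟩, fun h => hx.1.2 h.1⟩
  have h2 : ball y' r ×ˢ ball t r ⊆ closure ((ball y' r \ {y'}) ×ˢ ball t r) := by
    rw [closure_prod_eq]
    exact prod_mono (ball_subset_closure_sdiff_singleton hV y' r) subset_closure
  exact ⟨ball y' r ×ˢ ball t r, isOpen_ball.prod isOpen_ball, ⟨mem_ball_self hr, mem_ball_self hr⟩, hrQ,
    ((isPreconnected_ball_sdiff_singleton hV y' hr).prod (convex_ball t r).isPreconnected).subset_closure h1
      (sdiff_subset.trans h2), h2.trans (closure_mono h1)⟩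

/-- Tame arcs do not separate. -/
theorem IsPreconnected.sdiff_arcs {E : Type*} [TopologicalSpace E] (hV : 1 < Module.rank ℝ V) (K : V × ℝ ≃ₜ E) {Q : Set E}
    (hQ : IsPreconnected Q) (hQo : IsOpen Q) {ι : Type*} (J : Finset ι) (y : ι → V) (a b : ι → ℝ) :
    IsPreconnected (Q \ ⋃ i ∈ J, K '' ({y i} ×ˢ Icc (a i) (b i))) := by
  classical
  have hcl : ∀ i, IsClosed (K '' ({y i} ×ˢ Icc (a i) (b i))) := fun i =>
    K.isClosedMap _ (isClosed_singleton.prod isClosed_Icc)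
  induction J using Finset.induction_on with
  | empty => simpa using hQ
  | insert i J hi ih =>
    have ho : IsOpen (Q \ ⋃ i ∈ J, K '' ({y i} ×ˢ Icc (a i) (b i))) :=
      hQo.sdiff (J.finite_toSet.isClosed_biUnion fun i _ => hcl i)
    have := ((K.isPreconnected_preimage.mpr ih).sdiff_segment hV (ho.preimage K.continuous) (y i) (a i) (b i)).image K
      K.continuous.continuousOn
    rw [image_sdiff K.injective, image_preimage_eq _ K.surjective, sdiff_sdiff] at this
    rwa [Finset.set_biUnion_insert, union_comm]

end Arcs

section Homogeneity

variable {E : Type*} [NormedAddCommGroup E] [NormedSpace ℝ E] [CompleteSpace E]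

theorem exists_homeomorph_of_dist_lt {a b : E} {r : ℝ} (h : dist b a < r) :
    ∃ g : E ≃ₜ E, g a = b ∧ ∀ x ∉ ball a r, g x = x := by
  have hr : 0 < r := dist_nonneg.trans_lt h
  let f : E → E := fun x => x + max 0 (1 - dist x a / r) • (b - a)
  have hc : dist b a / r < 1 := (div_lt_one hr).mpr h
  have hf : ApproximatesLinearOn f ((ContinuousLinearEquiv.refl ℝ E : E ≃L[ℝ] E) : E →L[ℝ] E) univ
      ⟨dist b a / r, by positivity⟩ := by
    intro x _ y _
    have e : f x - f y - ((ContinuousLinearEquiv.refl ℝ E : E ≃L[ℝ] E) : E →L[ℝ] E) (x - y) =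
        (max 0 (1 - dist x a / r) - max 0 (1 - dist y a / r)) • (b - a) := by
      simp only [f, ContinuousLinearEquiv.coe_refl, ContinuousLinearMap.id_apply, sub_smul]
      abel
    have h1 : |max 0 (1 - dist x a / r) - max 0 (1 - dist y a / r)| ≤ dist x y / r := by
      refine (abs_max_sub_max_le_max _ _ _ _).trans ?_
      rw [sub_self, abs_zero, max_eq_right (abs_nonneg _)]
      rw [show 1 - dist x a / r - (1 - dist y a / r) = (dist y a - dist x a) / r by ring, abs_div, abs_of_pos hr]
      gcongr
      rw [abs_sub_comm]
      exact abs_dist_sub_le x y a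
    rw [e, norm_smul, Real.norm_eq_abs, ← dist_eq_norm, ← dist_eq_norm x y]
    calc _ ≤ dist x y / r * dist b a := by gcongr
      _ = dist b a / r * dist x y := by ring
  have hN : Subsingleton E ∨ (⟨dist b a / r, by positivity⟩ : NNReal) <
      ‖((ContinuousLinearEquiv.refl ℝ E).symm : E →L[ℝ] E)‖₊⁻¹ := by
    rcases subsingleton_or_nontrivial E with h0 | h0
    · exact Or.inl h0
    · right
      simp only [ContinuousLinearEquiv.refl_symm, ContinuousLinearEquiv.coe_refl]
      rw [ContinuousLinearMap.nnnorm_id, inv_one]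
      exact hc
  refine ⟨hf.toHomeomorph f hN, ?_, fun x hx => ?_⟩
  · change f a = b
    simp [f]
  · change f x = x
    have : 1 - dist x a / r ≤ 0 := by
      rw [sub_nonpos, one_le_div hr]
      simpa using hx
    simp [f, max_eq_left this]

theorem exists_homeomorph_of_isPreconnected {Q : Set E} (hQ : IsPreconnected Q) (hQo : IsOpen Q) {a b : E}
    (ha : a ∈ Q) (hb : b ∈ Q) : ∃ g : E ≃ₜ E, g a = b ∧ ∀ x ∉ Q, g x = x := by
  refine hQ.induction₂ (fun a b => ∃ g : E ≃ₜ E, g a = b ∧ ∀ x ∉ Q, g x = x) (fun x hx => ?_) ?_ ?_ ha hb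
  · obtain ⟨r, hr, hrQ⟩ := Metric.isOpen_iff.mp hQo x hx
    refine mem_nhdsWithin_of_mem_nhds (Filter.mem_of_superset (ball_mem_nhds x hr) fun y hy => ?_)
    obtain ⟨g, h1, h2⟩ := exists_homeomorph_of_dist_lt (mem_ball.mp hy)
    exact ⟨g, h1, fun z hz => h2 z fun h => hz (hrQ h)⟩
  · rintro x y z - - - ⟨g, rfl, hg⟩ ⟨g', rfl, hg'⟩
    exact ⟨g.trans g', rfl, fun x hx => by simp [hg x hx, hg' x hx]⟩
  · rintro x y - - ⟨g, rfl, hg⟩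
    exact ⟨g.symm, by simp, fun z hz => by rw [Homeomorph.symm_apply_eq, hg z hz]⟩

end Homogeneity

section Antennas

variable {V E ι : Type*} [NormedAddCommGroup V] [NormedAddCommGroup E]

/-- Data for growing fingers on a closed set `S`: disjoint compact targets `T j` inside regions `O j` which are
accessible from the tops `(y j, t j)` of fibres of `S`. -/
structure FingerData (S : Set (V × ℝ)) (R : V × ℝ ≃ₜ E) (J : Finset ι) (y : ι → V) (t : ι → ℝ) (O T : ι → Set E) :
    Prop where
  y_inj : InjOn y J
  top : ∀ j ∈ J, ∀ τ, (y j, τ) ∈ S ↔ τ ≤ t j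
  isOpen : ∀ j ∈ J, IsOpen (O j)
  eq_or_disjoint : ∀ i ∈ J, ∀ j ∈ J, O i = O j ∨ Disjoint (O i) (O j)
  disjoint : ∀ j ∈ J, ∀ x ∈ S, R x ∉ O j
  isCompact : ∀ j ∈ J, IsCompact (T j)
  subset : ∀ j ∈ J, T j ⊆ O j
  nonempty : ∀ j ∈ J, (T j).Nonempty
  pairwise : ∀ i ∈ J, ∀ j ∈ J, i ≠ j → Disjoint (T i) (T j)
  conn : ∀ j ∈ J, IsPreconnected (O j \ ⋃ i ∈ {i | i ∈ J ∧ i ≠ j}, T i)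
  acc : ∀ j ∈ J, ∀ᶠ x in 𝓝 (y j, t j), x ∉ S → R x ∈ O j

namespace FingerData

variable {S : Set (V × ℝ)} {R : V × ℝ ≃ₜ E} {J : Finset ι} {y : ι → V} {t : ι → ℝ} {O T : ι → Set E}

theorem isClosed_iUnion (D : FingerData S R J y t O T) : IsClosed (⋃ i ∈ J, T i) :=
  J.finite_toSet.isClosed_biUnion fun i hi => (D.isCompact i hi).isClosed

theorem mem_S (D : FingerData S R J y t O T) {j : ι} (hj : j ∈ J) : (y j, t j) ∈ S := (D.top j hj _).mpr le_rfl

theorem notMem_iUnion (D : FingerData S R J y t O T) {x : V × ℝ} (hx : x ∈ S) : R x ∉ ⋃ i ∈ J, T i := by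
  simp only [mem_iUnion, not_exists]
  exact fun i hi h => D.disjoint i hi x hx (D.subset i hi h)

/-- The state of the antennas when those in `P` have reached their targets. -/
def Antennas (_ : FingerData S R J y t O T) (P : Finset ι) (K : V × ℝ ≃ₜ E) (h : ι → ℝ) : Prop :=
  (∀ x ∈ S, K x = R x) ∧ (∀ j ∈ J, ∀ᶠ x in 𝓝 (y j, t j), x ∉ S → K x ∈ O j) ∧ ∀ j ∈ J, 0 < h j ∧
    (∀ τ, 0 < τ → τ ≤ h j → K (y j, t j + τ) ∈ O j) ∧ (∀ τ, 0 < τ → τ < h j → K (y j, t j + τ) ∉ ⋃ i ∈ J, T i) ∧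
    (j ∈ P → K (y j, t j + h j) ∈ T j) ∧ (j ∉ P → K (y j, t j + h j) ∉ ⋃ i ∈ J, T i)

theorem exists_antennas_empty (D : FingerData S R J y t O T) : ∃ h, D.Antennas ∅ R h := by
  have H : ∀ j ∈ J, ∃ h, 0 < h ∧ (∀ τ, 0 < τ → τ ≤ h → R (y j, t j + τ) ∈ O j) ∧
      ∀ τ, 0 < τ → τ ≤ h → R (y j, t j + τ) ∉ ⋃ i ∈ J, T i := by
    intro j hj
    have h1 : ∀ᶠ x in 𝓝 (y j, t j), R x ∉ ⋃ i ∈ J, T i :=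
      R.continuous.continuousAt.eventually (D.isClosed_iUnion.isOpen_compl.mem_nhds (D.notMem_iUnion (D.mem_S hj)))
    have h2 : Filter.Tendsto (fun τ : ℝ => (y j, t j + τ)) (𝓝 0) (𝓝 (y j, t j)) := by
      have : Continuous fun τ : ℝ => (y j, t j + τ) := by fun_prop
      simpa using this.tendsto 0
    obtain ⟨ε, hε, h3⟩ := Metric.eventually_nhds_iff.mp (h2.eventually ((D.acc j hj).and h1))
    have h4 : ∀ τ, 0 < τ → τ ≤ ε / 2 → dist τ 0 < ε := fun τ h0 h1 => by
      rw [Real.dist_eq, sub_zero, abs_of_pos h0]; linarith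
    refine ⟨ε / 2, by positivity, fun τ h0 h5 => (h3 (h4 τ h0 h5)).1 fun hS => ?_, fun τ h0 h5 => (h3 (h4 τ h0 h5)).2⟩
    have := (D.top j hj _).mp hS
    linarith
  choose! h h0 h1 h2 using H
  exact ⟨h, fun _ _ => rfl, D.acc, fun j hj => ⟨h0 j hj, h1 j hj, fun τ h3 h4 => h2 j hj τ h3 h4.le,
    fun h => absurd h (Finset.notMem_empty j), fun _ => h2 j hj _ (h0 j hj) le_rfl⟩⟩

theorem Antennas.insert [NormedSpace ℝ V] [NormedSpace ℝ E] [CompleteSpace E] [DecidableEq ι]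
    (hV : 1 < Module.rank ℝ V) {D : FingerData S R J y t O T} {P : Finset ι} {K : V × ℝ ≃ₜ E}
    {h : ι → ℝ} (H : D.Antennas P K h) {j : ι} (hj : j ∈ J) (hjP : j ∉ P) :
    ∃ K' h', D.Antennas (insert j P) K' h' := by
  obtain ⟨hKS, hKA, hK⟩ := H
  obtain ⟨hj0, hjO, hjT, -, hjb⟩ := hK j hj
  set Q : Set E := (O j \ ⋃ i ∈ {i | i ∈ J ∧ i ≠ j}, T i) \
    ⋃ i ∈ J.erase j, K '' ({y i} ×ˢ Icc (t i) (t i + h i)) with hQdef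
  have hO : IsOpen (O j \ ⋃ i ∈ {i | i ∈ J ∧ i ≠ j}, T i) :=
    (D.isOpen j hj).sdiff ((J.finite_toSet.subset fun i hi => hi.1).isClosed_biUnion
      fun i hi => (D.isCompact i hi.1).isClosed)
  have hQ : IsPreconnected Q := (D.conn j hj).sdiff_arcs hV K hO _ _ _ _
  have hQo : IsOpen Q := hO.sdiff ((J.erase j).finite_toSet.isClosed_biUnion fun i _ =>
    K.isClosedMap _ (isClosed_singleton.prod isClosed_Icc))
  have hbQ : K (y j, t j + h j) ∈ Q := by
    refine ⟨⟨hjO _ hj0 le_rfl, fun hT => hjb hjP ?_⟩, fun ha => ?_⟩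
    · obtain ⟨i, hi, hT⟩ := mem_iUnion₂.mp hT
      exact mem_biUnion (hi.1 : i ∈ (J : Set ι)) hT
    · obtain ⟨i, hi, x, hx, hxe⟩ := mem_iUnion₂.mp ha
      have := K.injective hxe
      subst this
      rw [Finset.mem_erase] at hi
      exact hi.1 (D.y_inj hi.2 hj hx.1.symm)
  obtain ⟨e, he⟩ := D.nonempty j hj
  have heQ : e ∈ Q := by
    refine ⟨⟨D.subset j hj he, fun hT => ?_⟩, fun ha => ?_⟩
    · obtain ⟨i, hi, hT⟩ := mem_iUnion₂.mp hT
      exact disjoint_left.mp (D.pairwise i hi.1 j hj hi.2) hT he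
    · obtain ⟨i, hi, ⟨x, τ⟩, ⟨hx, hτ⟩, hxe⟩ := mem_iUnion₂.mp ha
      rw [Finset.mem_erase] at hi
      obtain rfl : x = y i := hx
      obtain ⟨-, -, hiT, hiP, hiP'⟩ := hK i hi.2
      have heU : e ∈ ⋃ i ∈ J, T i := mem_biUnion (hj : j ∈ (J : Set ι)) he
      rcases hτ.1.eq_or_lt with h1 | h1
      · simp only at h1
        rw [← h1, hKS _ (D.mem_S hi.2)] at hxe
        exact D.notMem_iUnion (D.mem_S hi.2) (hxe ▸ heU)
      · rcases hτ.2.eq_or_lt with h2 | h2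
        · simp only at h2
          rw [h2] at hxe
          by_cases hP : i ∈ P
          · exact disjoint_left.mp (D.pairwise i hi.2 j hj hi.1) (hiP hP) (hxe ▸ he)
          · exact hiP' hP (hxe ▸ heU)
        · refine hiT (τ - t i) (sub_pos.mpr h1) (by simp only at h2; linarith) ?_
          rw [add_sub_cancel, hxe]
          exact heU
  obtain ⟨g, hge, hgid⟩ := exists_homeomorph_of_isPreconnected hQ hQo hbQ heQ
  have hgQ : ∀ u ∈ Q, g u ∈ Q := fun u hu => by
    by_contra hn
    exact hn (by rwa [g.injective (hgid _ hn)])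
  have hgO : ∀ i ∈ J, ∀ u ∈ O i, g u ∈ O i := by
    intro i hi u hu
    by_cases huQ : u ∈ Q
    · rcases D.eq_or_disjoint i hi j hj with h1 | h1
      · rw [h1]; exact (hgQ u huQ).1.1
      · exact absurd huQ.1.1 (disjoint_left.mp h1 hu)
    · rwa [hgid u huQ]
  have hS : ∀ x ∈ S, g (K x) = R x := fun x hx => by
    rw [hKS x hx]
    exact hgid _ fun hq => D.disjoint j hj x hx hq.1.1
  -- the first time the moved antenna meets its target
  have hcont : Continuous fun τ : ℝ => g (K (y j, t j + τ)) := by fun_prop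
  set A : Set ℝ := {τ | g (K (y j, t j + τ)) ∈ T j} ∩ Icc 0 (h j) with hA
  have hAc : IsCompact A := isCompact_Icc.inter_left ((D.isCompact j hj).isClosed.preimage hcont)
  have hAn : A.Nonempty := ⟨h j, by
    refine ⟨?_, hj0.le, le_rfl⟩
    change g (K (y j, t j + h j)) ∈ T j
    rwa [hge], ⟩
  obtain ⟨τ₀, hτ₀, hmin⟩ := hAc.exists_isLeast hAn
  have hτ₀T : g (K (y j, t j + τ₀)) ∈ T j := hτ₀.1
  have hτ₀0 : 0 < τ₀ := by
    refine lt_of_le_of_ne hτ₀.2.1 fun h0 => ?_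
    rw [← h0, add_zero, hS _ (D.mem_S hj)] at hτ₀T
    exact D.disjoint j hj _ (D.mem_S hj) (D.subset j hj hτ₀T)
  refine ⟨K.trans g, Function.update h j τ₀, hS, fun i hi => (hKA i hi).mono fun x hx hxS => hgO i hi _ (hx hxS),
    fun i hi => ?_⟩
  by_cases hij : i = j
  · subst hij
    simp only [Function.update_self, Homeomorph.trans_apply, Finset.mem_insert, true_or, true_implies, not_true,
      false_implies, and_true]
    refine ⟨hτ₀0, fun τ h1 h2 => hgO i hi _ (hjO τ h1 (h2.trans hτ₀.2.2)), fun τ h1 h2 hT => ?_, hτ₀T⟩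
    have hτh : τ < h i := h2.trans_le hτ₀.2.2
    obtain ⟨k, hk, hT⟩ := mem_iUnion₂.mp hT
    by_cases hki : k = i
    · subst hki
      exact absurd (hmin ⟨hT, h1.le, hτh.le⟩) (not_le.mpr h2)
    · by_cases huQ : K (y i, t i + τ) ∈ Q
      · exact (hgQ _ huQ).1.2 (mem_biUnion (⟨hk, hki⟩ : k ∈ {k | k ∈ J ∧ k ≠ i}) hT)
      · rw [hgid _ huQ] at hT
        exact hjT τ h1 hτh (mem_biUnion (hk : k ∈ (J : Set ι)) hT)
  · obtain ⟨hi0, hiO, hiT, hiP, hiP'⟩ := hK i hi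
    have hfix : ∀ τ, 0 < τ → τ ≤ h i → g (K (y i, t i + τ)) = K (y i, t i + τ) := fun τ h1 h2 =>
      hgid _ fun hq => hq.2 (mem_biUnion (Finset.mem_erase.mpr ⟨hij, hi⟩ : i ∈ (J.erase j : Set ι))
        ⟨(y i, t i + τ), ⟨mem_singleton _, by simp only; linarith, by simp only; linarith⟩, rfl⟩)
    simp only [Function.update_of_ne hij, Homeomorph.trans_apply, Finset.mem_insert, hij, false_or]
    refine ⟨hi0, fun τ h1 h2 => ?_, fun τ h1 h2 => ?_, ?_⟩
    · rw [hfix τ h1 h2]; exact hiO τ h1 h2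
    · rw [hfix τ h1 h2.le]; exact hiT τ h1 h2
    rw [hfix _ hi0 le_rfl]
    exact ⟨hiP, hiP'⟩

theorem exists_antennas [NormedSpace ℝ V] [NormedSpace ℝ E] [CompleteSpace E] (hV : 1 < Module.rank ℝ V) (D : FingerData S R J y t O T) : ∃ K h, D.Antennas J K h := by
  classical
  suffices H : ∀ P : Finset ι, P ⊆ J → ∃ K h, D.Antennas P K h from H J subset_rfl
  intro P
  induction P using Finset.induction_on with
  | empty => exact fun _ => ⟨R, D.exists_antennas_empty⟩
  | insert j P hjP ih =>
    intro hP
    obtain ⟨K, h, H⟩ := ih ((Finset.subset_insert j P).trans hP)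
    exact H.insert hV (hP (Finset.mem_insert_self j P)) hjP

end FingerData

end Antennas

section Push

variable {V : Type*} [NormedAddCommGroup V]

/-- A family of increasing maps of the line with bounded displacement is a homeomorphism. -/
theorem exists_homeomorph_of_strictMono {Y : Type*} [TopologicalSpace Y] {ψ : Y × ℝ → ℝ} (hψ : Continuous ψ)
    (hm : ∀ y, StrictMono fun t => ψ (y, t)) {B : ℝ} (hl : ∀ x, x.2 ≤ ψ x) (hu : ∀ x, ψ x ≤ x.2 + B) :
    ∃ θ : Y × ℝ ≃ₜ Y × ℝ, ∀ x, θ x = (x.1, ψ x) := by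
  have hbij : Function.Bijective fun x : Y × ℝ => (x.1, ψ x) := by
    constructor
    · rintro ⟨y, t⟩ ⟨y', t'⟩ h
      obtain ⟨h1, h2⟩ := Prod.ext_iff.mp h
      obtain rfl : y = y' := h1
      rw [(hm y).injective h2]
    · rintro ⟨y, u⟩
      have hc : ContinuousOn (fun t => ψ (y, t)) (Icc (u - B) u) := by fun_prop
      have hB : 0 ≤ B := by have := (hl (y, u)).trans (hu (y, u)); simp only at this; linarith
      have hu' : u ∈ Icc (ψ (y, u - B)) (ψ (y, u)) := ⟨by simpa using hu (y, u - B), hl (y, u)⟩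
      obtain ⟨t, -, ht⟩ := intermediate_value_Icc (by linarith) hc hu'
      exact ⟨(y, t), Prod.ext rfl ht⟩
  let e := Equiv.ofBijective _ hbij
  refine ⟨⟨e, by change Continuous fun x : Y × ℝ => (x.1, ψ x); fun_prop, ?_⟩, fun x => rfl⟩
  refine continuous_iff_continuousAt.mpr fun z => ?_
  obtain ⟨⟨y, t⟩, rfl⟩ := e.surjective z
  have he : ∀ x, e x = (x.1, ψ x) := fun x => rfl
  have hfst : ∀ z, (e.symm z).1 = z.1 := fun z => by
    obtain ⟨x, rfl⟩ := e.surjective z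
    rw [e.symm_apply_apply, he]
  have hsnd : ∀ z, ψ (z.1, (e.symm z).2) = z.2 := fun z => by
    obtain ⟨x, rfl⟩ := e.surjective z
    rw [e.symm_apply_apply, he]
  have h1 : ContinuousAt (fun z => (e.symm z).1) (e (y, t)) := by
    simp_rw [hfst]; exact continuousAt_fst
  have h2 : ContinuousAt (fun z => (e.symm z).2) (e (y, t)) := by
    rw [ContinuousAt, e.symm_apply_apply]
    refine (tendsto_order.mpr ⟨fun s hs => ?_, fun s hs => ?_⟩)
    · have hlt : ψ ((e (y, t)).1, s) < (e (y, t)).2 := hm y hs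
      have hev : ∀ᶠ z : Y × ℝ in 𝓝 (e (y, t)), ψ (z.1, s) < z.2 :=
        (isOpen_lt (by fun_prop) continuous_snd).mem_nhds hlt
      refine hev.mono fun z hz => ?_
      rw [← hsnd z] at hz
      exact (hm z.1).lt_iff_lt.mp hz
    · have hlt : (e (y, t)).2 < ψ ((e (y, t)).1, s) := hm y hs
      have hev : ∀ᶠ z : Y × ℝ in 𝓝 (e (y, t)), z.2 < ψ (z.1, s) :=
        (isOpen_lt continuous_snd (by fun_prop)).mem_nhds hlt
      refine hev.mono fun z hz => ?_
      rw [← hsnd z] at hz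
      exact (hm z.1).lt_iff_lt.mp hz
  exact h1.prodMk h2

/-- Pushing upwards near a point. -/
theorem exists_push (y : V) (t : ℝ) {a c H : ℝ} (ha : 0 < a) (hc : 0 < c) (hH : 0 < H) :
    ∃ θ : V × ℝ ≃ₜ V × ℝ, (∀ x, (θ x).1 = x.1) ∧ (∀ x, x.1 ∉ ball y a → θ x = x) ∧ (∀ x, x.2 ≤ t - c → θ x = x) ∧
      (∀ x, x.2 ≤ (θ x).2) ∧ (∀ x, (θ x).2 ≤ max x.2 t + H) ∧ (∀ y s s', s < s' → (θ (y, s)).2 < (θ (y, s')).2) ∧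
      θ (y, t) = (y, t + H) := by
  let α : V → ℝ := fun z => max 0 (1 - dist z y / a)
  let g : ℝ → ℝ := fun τ => max 0 (min (H * (1 + τ / c)) (H - τ / 2))
  have hα0 : ∀ z, 0 ≤ α z := fun z => le_max_left _ _
  have hα1 : ∀ z, α z ≤ 1 := fun z => max_le zero_le_one (by have : 0 ≤ dist z y / a := by positivity
                                                             linarith)
  have hg0 : ∀ τ, 0 ≤ g τ := fun τ => le_max_left _ _
  have hgl : ∀ τ, τ ≤ -c → g τ = 0 := fun τ h => max_eq_left ((min_le_left _ _).trans (by
    have : τ / c ≤ -1 := by rw [div_le_iff₀ hc]; linarith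
    nlinarith))
  have hgneg : ∀ τ, τ ≤ 0 → g τ ≤ H := fun τ h => max_le hH.le ((min_le_left _ _).trans (by
    have : τ / c ≤ 0 := div_nonpos_of_nonpos_of_nonneg h hc.le
    nlinarith))
  have hgpos : ∀ τ, 0 ≤ τ → g τ ≤ H := fun τ h => max_le hH.le ((min_le_right _ _).trans (by linarith))
  have hgH : ∀ τ, g τ ≤ H := fun τ => (le_total τ 0).elim (hgneg τ) (hgpos τ)
  have hgL : ∀ τ τ', τ ≤ τ' → g τ - g τ' ≤ (τ' - τ) / 2 := by
    intro τ τ' h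
    have h1 : τ / c ≤ τ' / c := by gcongr
    have h2 : H * (1 + τ / c) ≤ H * (1 + τ' / c) := by gcongr
    rw [sub_le_iff_le_add]
    refine max_le (by have := hg0 τ'; linarith) ?_
    by_cases h3 : H * (1 + τ' / c) ≤ H - τ' / 2
    · have : min (H * (1 + τ' / c)) (H - τ' / 2) ≤ g τ' := le_max_right _ _
      rw [min_eq_left h3] at this
      linarith [min_le_left (H * (1 + τ / c)) (H - τ / 2)]
    · have : min (H * (1 + τ' / c)) (H - τ' / 2) ≤ g τ' := le_max_right _ _
      rw [min_eq_right (not_le.mp h3).le] at this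
      linarith [min_le_right (H * (1 + τ / c)) (H - τ / 2)]
  have hmul0 : ∀ z τ, 0 ≤ α z * g τ := fun z τ => mul_nonneg (hα0 z) (hg0 τ)
  have hmulH : ∀ z τ, α z * g τ ≤ H := fun z τ =>
    (mul_le_of_le_one_left (hg0 τ) (hα1 z)).trans (hgH τ)
  let ψ : V × ℝ → ℝ := fun x => x.2 + α x.1 * g (x.2 - t)
  have hmono : ∀ z, StrictMono fun s => ψ (z, s) := by
    intro z s s' h
    have h1 := hgL (s - t) (s' - t) (by linarith)
    have h2 : α z * (g (s - t) - g (s' - t)) ≤ (s' - s) / 2 := by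
      calc _ ≤ α z * ((s' - s) / 2) := mul_le_mul_of_nonneg_left (by linarith) (hα0 z)
        _ ≤ _ := mul_le_of_le_one_left (by linarith) (hα1 z)
    change s + α z * g (s - t) < s' + α z * g (s' - t)
    linarith
  have hψ : Continuous ψ := by
    simp only [ψ, α, g]
    fun_prop (disch := positivity)
  obtain ⟨θ, hθ⟩ := exists_homeomorph_of_strictMono (B := H) hψ hmono
    (fun x => le_add_of_nonneg_right (hmul0 _ _)) (fun x => add_le_add_right (hmulH _ _) _)
  refine ⟨θ, fun x => by rw [hθ], fun x hx => ?_, fun x hx => ?_, fun x => ?_, fun x => ?_, fun z s s' h => ?_, ?_⟩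
  · have : α x.1 = 0 := max_eq_left (by rw [sub_nonpos, one_le_div ha]; simpa using hx)
    rw [hθ]; simp [ψ, this]
  · rw [hθ]; simp [ψ, hgl (x.2 - t) (by linarith)]
  · rw [hθ]; exact le_add_of_nonneg_right (hmul0 _ _)
  · rw [hθ]
    exact add_le_add (le_max_left _ _) (hmulH _ _)
  · rw [hθ, hθ]; exact hmono z h
  · have h1 : α y = 1 := by simp [α]
    have h2 : g 0 = H := by simp [g, hH.le]
    rw [hθ]; simp [ψ, h1, h2]

/-- Combine fibre preserving homeomorphisms with disjoint supports. -/
theorem exists_glue_homeomorph {Y ι : Type*} [TopologicalSpace Y] (J : Finset ι) (B : ι → Set Y)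
    (hB : ∀ i ∈ J, ∀ j ∈ J, i ≠ j → Disjoint (B i) (B j)) (θ : ι → Y × ℝ ≃ₜ Y × ℝ) (h1 : ∀ j ∈ J, ∀ x, (θ j x).1 = x.1)
    (h2 : ∀ j ∈ J, ∀ x, x.1 ∉ B j → θ j x = x) :
    ∃ Θ : Y × ℝ ≃ₜ Y × ℝ, (∀ x, (Θ x).1 = x.1) ∧ (∀ j ∈ J, ∀ x, x.1 ∈ B j → Θ x = θ j x) ∧
      ∀ x, (∀ j ∈ J, x.1 ∉ B j) → Θ x = x := by
  classical
  induction J using Finset.induction_on with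
  | empty => exact ⟨Homeomorph.refl _, fun x => rfl, by simp, fun x _ => rfl⟩
  | insert i J hi ih =>
    obtain ⟨Θ, h3, h4, h5⟩ := ih (fun a ha b hb => hB a (Finset.mem_insert_of_mem ha) b (Finset.mem_insert_of_mem hb))
      (fun j hj => h1 j (Finset.mem_insert_of_mem hj)) (fun j hj => h2 j (Finset.mem_insert_of_mem hj))
    have hii := Finset.mem_insert_self i J
    refine ⟨Θ.trans (θ i), fun x => ?_, fun j hj x hx => ?_, fun x hx => ?_⟩
    · rw [Homeomorph.trans_apply, h1 i hii, h3]
    · rw [Homeomorph.trans_apply]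
      rcases Finset.mem_insert.mp hj with rfl | hj'
      · rw [h5 x fun k hk hxk => disjoint_left.mp (hB _ hj k (Finset.mem_insert_of_mem hk) fun h => hi (h ▸ hk)) hx hxk]
      · rw [h4 j hj' x hx]
        refine h2 i hii _ fun hxi => ?_
        rw [h1 j hj] at hxi
        exact disjoint_left.mp (hB i hii j hj fun h => hi (h ▸ hj')) hxi hx
    · rw [Homeomorph.trans_apply, h5 x fun j hj => hx j (Finset.mem_insert_of_mem hj), h2 i hii x (hx i hii)]

end Push

section Fingers

variable {V E ι : Type*} [NormedAddCommGroup V] [NormedAddCommGroup E]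

/-- A tube lemma for vertical segments. -/
theorem exists_tube {y : V} {a b : ℝ} {W : Set (V × ℝ)} (h : ∀ s, a ≤ s → s ≤ b → W ∈ 𝓝 (y, s)) :
    ∃ δ > 0, ∀ x : V × ℝ, x.1 ∈ ball y δ → a - δ < x.2 → x.2 < b + δ → a ≤ b → x ∈ W := by
  have hc : IsCompact (({y} : Set V) ×ˢ Icc a b) := isCompact_singleton.prod isCompact_Icc
  obtain ⟨δ, hδ, hs⟩ := hc.exists_thickening_subset_open (t := interior W) isOpen_interior
    (by rintro ⟨z, s⟩ ⟨hz, hs⟩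
        obtain rfl : z = y := hz
        exact mem_interior_iff_mem_nhds.mpr (h s hs.1 hs.2))
  refine ⟨δ, hδ, fun x h1 h2 h3 hab => interior_subset (hs ?_)⟩
  rw [mem_thickening_iff]
  refine ⟨(y, max a (min x.2 b)), ⟨rfl, le_max_left _ _, max_le hab (min_le_right _ _)⟩, ?_⟩
  rw [Prod.dist_eq]
  refine max_lt h1 ?_
  rw [Real.dist_eq, abs_lt]
  rcases max_cases a (min x.2 b) with h4 | h4 <;> rcases min_cases x.2 b with h5 | h5 <;> constructor <;>
    simp only <;> linarith

theorem exists_push_parameters {S : Set (V × ℝ)} (hS : IsClosed S) {B : ℝ} (hB : ∀ x ∈ S, x.2 ≤ B) (K : V × ℝ ≃ₜ E)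
    {y : V} {t h : ℝ} (hh : 0 < h) (htop : ∀ s, (y, s) ∈ S ↔ s ≤ t) {O C : Set E} (hO : IsOpen O) (hC : IsClosed C)
    (hacc : ∀ᶠ x in 𝓝 (y, t), x ∉ S → K x ∈ O) (hp : K (y, t) ∉ C) (h1 : ∀ τ, 0 < τ → τ < h → K (y, t + τ) ∈ O \ C)
    (h2 : K (y, t + h) ∈ O) {ε δ : ℝ} (hε : 0 < ε) (hδ : 0 < δ) :
    ∃ a c H lo hi, 0 < a ∧ a ≤ δ ∧ a ≤ ε ∧ 0 < c ∧ c ≤ ε ∧ 0 < H ∧ lo < t + H ∧ t + H + c < t + h ∧ t + h < hi ∧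
      (∀ x ∈ S, x.1 ∈ ball y a → x.2 < t + c) ∧
      (∀ x : V × ℝ, x.1 ∈ ball y a → t - c < x.2 → x.2 < t + H + c → x ∈ S ∨ K x ∈ O \ C) ∧
      ∀ x : V × ℝ, x.1 ∈ ball y a → lo < x.2 → x.2 < hi → K x ∈ O ∩ ball (K (y, t + h)) ε := by
  obtain ⟨r, hr, hbox⟩ := exists_tube (y := y) (a := t + h) (b := t + h) (W := K ⁻¹' (O ∩ ball (K (y, t + h)) ε))
    (fun s h3 h4 => by
      obtain rfl := le_antisymm h4 h3
      exact K.continuous.continuousAt ((hO.inter isOpen_ball).mem_nhds ⟨h2, mem_ball_self hε⟩))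
  set η := min r h / 2 with hη
  have hη0 : 0 < η := by positivity
  have hηr : η < r := by have := min_le_left r h; linarith
  have hηh : η < h := by have := min_le_right r h; linarith
  obtain ⟨ρ, hρ, htube⟩ := exists_tube (y := y) (a := t) (b := t + (h - η)) (W := {x | x ∈ S ∨ K x ∈ O \ C})
    (fun s h3 h4 => by
      rcases h3.eq_or_lt with rfl | h3
      · filter_upwards [hacc, K.continuous.continuousAt.eventually (hC.isOpen_compl.mem_nhds hp)] with x hx1 hx2
        by_cases hxS : x ∈ S
        · exact Or.inl hxS
        · exact Or.inr ⟨hx1 hxS, hx2⟩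
      · have h5 : K (y, s) ∈ O \ C := by simpa using h1 (s - t) (by linarith) (by linarith)
        exact Filter.mem_of_superset (K.continuous.continuousAt ((hO.sdiff hC).mem_nhds h5)) fun x hx => Or.inr hx)
  set c := min (min ε ρ) (η / 2) with hc
  have hc0 : 0 < c := by positivity
  have hcε : c ≤ ε := (min_le_left _ _).trans (min_le_left _ _)
  have hcρ : c ≤ ρ := (min_le_left _ _).trans (min_le_right _ _)
  have hcη : c < η := (min_le_right _ _).trans_lt (by linarith)
  obtain ⟨κ, hκ, husc⟩ := exists_tube (y := y) (a := t + c) (b := max B (t + c)) (W := Sᶜ)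
    (fun s h3 _ => hS.isOpen_compl.mem_nhds fun h4 => by
      have := (htop s).mp h4
      linarith)
  set a := min (min (min δ ε) (min r ρ)) κ with ha
  have haδ : a ≤ δ := (min_le_left _ _).trans ((min_le_left _ _).trans (min_le_left _ _))
  have haε : a ≤ ε := (min_le_left _ _).trans ((min_le_left _ _).trans (min_le_right _ _))
  have har : a ≤ r := (min_le_left _ _).trans ((min_le_right _ _).trans (min_le_left _ _))
  have haρ : a ≤ ρ := (min_le_left _ _).trans ((min_le_right _ _).trans (min_le_right _ _))
  have haκ : a ≤ κ := min_le_right _ _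
  refine ⟨a, c, h - η, t + h - r, t + h + r, by positivity, haδ, haε, hc0, hcε, by linarith, by linarith, by linarith,
    by linarith, fun x hx h3 => ?_, fun x h3 h4 h5 => ?_, fun x h3 h4 h5 => hbox x (ball_subset_ball har h3) h4 h5 le_rfl⟩
  · by_contra h4
    push Not at h4
    exact husc x (ball_subset_ball haκ h3) (by linarith) (by have := hB x hx; have := le_max_left B (t + c); linarith)
      (le_max_right _ _) hx
  · exact htube x (ball_subset_ball haρ h3) (by linarith) (by linarith) (by linarith)

theorem exists_disjoint_closedBalls {α ι : Type*} [MetricSpace α] (J : Finset ι) (p : ι → α) (hp : InjOn p J) {b : ℝ}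
    (hb : 0 < b) : ∃ ε > 0, ε ≤ b ∧ ∀ i ∈ J, ∀ j ∈ J, i ≠ j → Disjoint (closedBall (p i) ε) (closedBall (p j) ε) := by
  have h : ∀ᶠ ε in 𝓝[>] (0 : ℝ), ∀ i ∈ J, ∀ j ∈ J, i ≠ j → Disjoint (closedBall (p i) ε) (closedBall (p j) ε) := by
    refine (Finset.eventually_all J).mpr fun i hi => (Finset.eventually_all J).mpr fun j hj => ?_
    by_cases hij : i = j
    · exact Filter.Eventually.of_forall fun _ h => absurd hij h
    · have hd : 0 < dist (p i) (p j) := dist_pos.mpr fun h => hij (hp hi hj h)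
      filter_upwards [Ioo_mem_nhdsGT (half_pos hd)] with δ hδ _
      exact closedBall_disjoint_closedBall (by linarith [hδ.2])
  obtain ⟨ε, h1, h2⟩ := (h.and (Ioo_mem_nhdsGT hb)).exists
  exact ⟨ε, h2.1, h2.2.le, h1⟩

namespace FingerData

variable {S : Set (V × ℝ)} {R : V × ℝ ≃ₜ E} {J : Finset ι} {y : ι → V} {t : ι → ℝ} {O T : ι → Set E}

theorem exists_fingers [NormedSpace ℝ V] [NormedSpace ℝ E] [CompleteSpace E] (hV : 1 < Module.rank ℝ V)
    (D : FingerData S R J y t O T) (hS : IsClosed S) (hSd : ∀ z s s', (z, s) ∈ S → s' ≤ s → (z, s') ∈ S)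
    {B : ℝ} (hB : ∀ x ∈ S, x.2 ≤ B) {ε : ℝ} (hε : 0 < ε)
    (hdis : ∀ i ∈ J, ∀ j ∈ J, i ≠ j → Disjoint (ball (y i, t i) ε) (ball (y j, t j) ε)) {η : ℝ} (hη : 0 < η) :
    ∃ R' : V × ℝ ≃ₜ E, ∃ M : ι → Set E, ∃ e : ι → E,
      (∀ x ∈ S, (∀ j ∈ J, x ∉ ball (y j, t j) ε) → R' x = R x) ∧
      (∀ j ∈ J, ∀ x ∈ S, x ∈ ball (y j, t j) ε → R' x ∈ O j ∨ ∃ x' ∈ S, x' ∈ ball (y j, t j) ε ∧ R' x = R x') ∧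
      (∀ j ∈ J, ∀ x ∈ S, R' x ∉ T j) ∧
      ∀ j ∈ J, e j ∈ T j ∧ e j ∉ interior (T j) ∧ IsOpen (M j) ∧ IsPreconnected (M j) ∧ e j ∈ M j ∧ M j ⊆ O j ∧
        M j ⊆ ball (e j) η ∧ (∀ x ∈ S, R' x ∉ M j) ∧ (∀ᶠ x in 𝓝 (y j, t j), x ∉ S → R' x ∈ M j) ∧
        R' (y j, t j) ∈ ball (e j) η := by
  obtain ⟨K, h, hKS, hKA, hK⟩ := D.exists_antennas hV
  obtain ⟨δ, hδ, -, hsep⟩ := exists_disjoint_closedBalls J y (fun i hi j hj => D.y_inj hi hj) one_pos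
  have hεη : 0 < min ε η := lt_min hε hη
  have hpar := fun j (hj : j ∈ J) => exists_push_parameters hS hB K (hK j hj).1 (D.top j hj) (D.isOpen j hj)
    D.isClosed_iUnion (hKA j hj) (by rw [hKS _ (D.mem_S hj)]; exact D.notMem_iUnion (D.mem_S hj))
    (fun τ h1 h2 => ⟨(hK j hj).2.1 τ h1 h2.le, (hK j hj).2.2.1 τ h1 h2⟩) ((hK j hj).2.1 _ (hK j hj).1 le_rfl) hεη hδ
  choose! a c H lo hi ha haδ haε hc hcε hH hlo htip hhi husc htube hbox using hpar
  have hθ := fun j (hj : j ∈ J) => exists_push (y j) (t j) (ha j hj) (hc j hj) (hH j hj)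
  have hθ' : ∀ j, ∃ θ : V × ℝ ≃ₜ V × ℝ, j ∈ J → (∀ x, (θ x).1 = x.1) ∧ (∀ x, x.1 ∉ ball (y j) (a j) → θ x = x) ∧
      (∀ x, x.2 ≤ t j - c j → θ x = x) ∧ (∀ x, x.2 ≤ (θ x).2) ∧ (∀ x, (θ x).2 ≤ max x.2 (t j) + H j) ∧
      (∀ y s s', s < s' → (θ (y, s)).2 < (θ (y, s')).2) ∧ θ (y j, t j) = (y j, t j + H j) := fun j => by
    by_cases hj : j ∈ J
    · obtain ⟨θ, h⟩ := hθ j hj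
      exact ⟨θ, fun _ => h⟩
    · exact ⟨Homeomorph.refl _, fun h => absurd h hj⟩
  choose θ hθ1 hθ2 hθ3 hθ4 hθ5 hθ6 hθ7 using hθ'
  obtain ⟨Θ, hΘ1, hΘ2, hΘ3⟩ := exists_glue_homeomorph J (fun j => ball (y j) (a j))
    (fun i hi j hj hij => (hsep i hi j hj hij).mono
      ((ball_subset_ball (haδ i hi)).trans ball_subset_closedBall) ((ball_subset_ball (haδ j hj)).trans ball_subset_closedBall))
    θ hθ1 hθ2
  have hball : ∀ j ∈ J, ∀ x : V × ℝ, x.1 ∈ ball (y j) (a j) → t j - c j < x.2 → x.2 < t j + c j →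
      x ∈ ball (y j, t j) ε := by
    intro j hj x h1 h2 h3
    have hcj := (hcε j hj).trans (min_le_left _ _)
    rw [mem_ball, Prod.dist_eq]
    refine max_lt ((mem_ball.mp h1).trans_le ((haε j hj).trans (min_le_left _ _))) ?_
    rw [Real.dist_eq, abs_lt]
    constructor <;> simp only <;> linarith
  have hup : ∀ j ∈ J, ∀ x ∈ S, x.1 ∈ ball (y j) (a j) → (Θ x).2 < t j + H j + c j := by
    intro j hj x hx h1
    have := husc j hj x hx h1
    have h2 := hθ5 j hj x
    rw [hΘ2 j hj x h1]
    have : max x.2 (t j) < t j + c j := max_lt this (by linarith [hc j hj])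
    linarith
  have hmove : ∀ x ∈ S, Θ x = x ∨ ∃ j ∈ J, x.1 ∈ ball (y j) (a j) ∧ x ∈ ball (y j, t j) ε ∧ t j - c j < (Θ x).2 ∧
      (Θ x ∈ S ∨ K (Θ x) ∈ O j \ ⋃ i ∈ J, T i) := by
    intro x hx
    by_cases h1 : ∃ j ∈ J, x.1 ∈ ball (y j) (a j)
    · obtain ⟨j, hj, h1⟩ := h1
      by_cases h2 : x.2 ≤ t j - c j
      · exact Or.inl (by rw [hΘ2 j hj x h1, hθ3 j hj x h2])
      · push Not at h2
        have h3 : t j - c j < (Θ x).2 := by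
          rw [hΘ2 j hj x h1]
          exact h2.trans_le (hθ4 j hj x)
        exact Or.inr ⟨j, hj, h1, hball j hj x h1 h2 (husc j hj x hx h1), h3,
          htube j hj _ (by rwa [hΘ1]) h3 (hup j hj x hx h1)⟩
    · push Not at h1
      exact Or.inl (hΘ3 x h1)
  let W : ι → Set (V × ℝ) := fun j => ball (y j) (a j) ×ˢ Ioo (lo j) (hi j)
  have hWo : ∀ j, IsOpen (W j) := fun j => isOpen_ball.prod isOpen_Ioo
  have hΘS : IsClosed (Θ '' S) := Θ.isClosedMap _ hS
  have hΘS' : ∀ j ∈ J, ∀ x ∈ Θ '' S, x.1 ∈ ball (y j) (a j) → x.2 < t j + H j + c j := by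
    rintro j hj _ ⟨x, hx, rfl⟩ h1
    exact hup j hj x hx (by rwa [hΘ1] at h1)
  have hupset : ∀ j ∈ J, ∀ z s s', z ∈ ball (y j) (a j) → (z, s) ∉ Θ '' S → s < s' → (z, s') ∉ Θ '' S := by
    rintro j hj z s s' hz hs hss ⟨⟨z', v'⟩, hv', he⟩
    obtain ⟨⟨z'', v⟩, hv⟩ := Θ.surjective (z, s)
    have e1 : z' = z := by have := hΘ1 (z', v'); rw [he] at this; exact this.symm
    have e2 : z'' = z := by have := hΘ1 (z'', v); rw [hv] at this; exact this.symm
    subst e1 e2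
    refine hs ⟨(z'', v), hSd _ _ _ hv' ?_, hv⟩
    by_contra hlt
    push Not at hlt
    have := hθ6 j hj z'' v' v hlt
    rw [← hΘ2 j hj _ hz, ← hΘ2 j hj _ hz, he, hv] at this
    exact absurd this (not_lt.mpr hss.le)
  have hconn : ∀ j ∈ J, IsPreconnected (W j \ Θ '' S) := by
    intro j hj
    have hslab : ball (y j) (a j) ×ˢ Ioo (t j + H j + c j) (hi j) ⊆ W j \ Θ '' S := fun x hx =>
      ⟨⟨hx.1, by linarith [hlo j hj, hc j hj, hx.2.1], hx.2.2⟩, fun h => absurd (hΘS' j hj x h hx.1) (not_lt.mpr hx.2.1.le)⟩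
    have hsc : IsPreconnected (ball (y j) (a j) ×ˢ Ioo (t j + H j + c j) (hi j)) :=
      (convex_ball _ _).isPreconnected.prod isPreconnected_Ioo
    refine hsc.of_reach hslab ?_
    rintro ⟨z, s⟩ ⟨⟨hz, hs1, hs2⟩, hs⟩
    have hmax : max s (t j + h j) < hi j := max_lt hs2 (hhi j hj)
    refine ⟨{z} ×ˢ Icc s (max s (t j + h j)), ?_, isPreconnected_singleton.prod isPreconnected_Icc,
      ⟨mem_singleton _, le_rfl, le_max_left _ _⟩, ⟨(z, max s (t j + h j)), ⟨mem_singleton _, le_max_left _ _, le_rfl⟩,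
        hz, (htip j hj).trans_le (le_max_right _ _), hmax⟩⟩
    rintro ⟨z', s'⟩ ⟨hz', h1, h2⟩
    obtain rfl : z' = z := hz'
    refine ⟨⟨hz, hs1.trans_le h1, lt_of_le_of_lt h2 hmax⟩, ?_⟩
    rcases (show s ≤ s' from h1).eq_or_lt with rfl | h3
    · exact hs
    · exact hupset j hj _ _ _ hz hs h3
  have hpW : ∀ j ∈ J, Θ (y j, t j) ∈ W j := by
    intro j hj
    rw [hΘ2 j hj _ (mem_ball_self (ha j hj)), hθ7 j hj]
    exact ⟨mem_ball_self (ha j hj), hlo j hj, by simp only; linarith [hc j hj, htip j hj, hhi j hj]⟩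
  have hKW : ∀ j ∈ J, ∀ x ∈ W j, K x ∈ O j ∩ ball (K (y j, t j + h j)) (min ε η) := fun j hj x hx =>
    hbox j hj x hx.1 hx.2.1 hx.2.2
  refine ⟨Θ.trans K, fun j => K '' (W j \ Θ '' S), fun j => K (y j, t j + h j), fun x hx h1 => ?_, fun j hj x hx h1 => ?_,
    fun j hj x hx h1 => ?_, fun j hj => ⟨?_, fun h1 => ?_, ?_, ?_, ?_, ?_, ?_, fun x hx => ?_, ?_, ?_⟩⟩
  · rcases hmove x hx with h2 | ⟨j, hj, -, h2, -⟩
    · rw [Homeomorph.trans_apply, h2, hKS x hx]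
    · exact absurd h2 (h1 j hj)
  · rcases hmove x hx with h2 | ⟨i, hi', h2, h3, h4, h5⟩
    · exact Or.inr ⟨x, hx, h1, by rw [Homeomorph.trans_apply, h2, hKS x hx]⟩
    · obtain rfl : i = j := by
        by_contra hij
        exact disjoint_left.mp (hdis i hi' j hj hij) h3 h1
      rcases h5 with h5 | h5
      · have h6 : (Θ x).1 ∈ ball (y i) (a i) := by rwa [hΘ1]
        exact Or.inr ⟨Θ x, h5, hball i hj _ h6 h4 (husc i hj _ h5 h6), by rw [Homeomorph.trans_apply, hKS _ h5]⟩
      · exact Or.inl h5.1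
  · have h2 : K (Θ x) ∈ ⋃ i ∈ J, T i := mem_biUnion (hj : j ∈ (J : Set ι)) h1
    rcases hmove x hx with h3 | ⟨i, -, -, -, -, h3 | h3⟩
    · rw [h3, hKS x hx] at h2
      exact D.notMem_iUnion hx h2
    · rw [hKS _ h3] at h2
      exact D.notMem_iUnion h3 h2
    · exact h3.2 h2
  · exact (hK j hj).2.2.2.1 hj
  · have hcont : Filter.Tendsto (fun s : ℝ => K (y j, t j + s)) (𝓝[<] h j) (𝓝 (K (y j, t j + h j))) := by
      have : Continuous fun s : ℝ => K (y j, t j + s) := by fun_prop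
      exact this.continuousAt.mono_left nhdsWithin_le_nhds
    have h2 : ∀ᶠ s in 𝓝[<] h j, K (y j, t j + s) ∈ T j := hcont (mem_interior_iff_mem_nhds.mp h1)
    obtain ⟨s, h3, h4, h5⟩ := (h2.and (Ioo_mem_nhdsLT (hK j hj).1)).exists
    exact (hK j hj).2.2.1 s h4 h5 (mem_biUnion (hj : j ∈ (J : Set ι)) h3)
  · exact K.isOpenMap _ ((hWo j).sdiff hΘS)
  · exact (hconn j hj).image _ K.continuous.continuousOn
  · refine ⟨(y j, t j + h j), ⟨⟨mem_ball_self (ha j hj), ?_, hhi j hj⟩, fun h1 => ?_⟩, rfl⟩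
    · simp only; linarith [hlo j hj, htip j hj, hc j hj]
    · exact absurd (hΘS' j hj _ h1 (mem_ball_self (ha j hj))) (not_lt.mpr (htip j hj).le)
  · rintro _ ⟨x, hx, rfl⟩
    exact (hKW j hj x hx.1).1
  · rintro _ ⟨x, hx, rfl⟩
    exact ball_subset_ball (min_le_right _ _) (hKW j hj x hx.1).2
  · rintro ⟨z, hz, he⟩
    exact hz.2 ⟨x, hx, (K.injective he).symm⟩
  · filter_upwards [Θ.continuous.continuousAt.eventually ((hWo j).mem_nhds (hpW j hj))] with x hx hxS
    exact ⟨Θ x, ⟨hx, fun ⟨z, hz, he⟩ => hxS (Θ.injective he ▸ hz)⟩, rfl⟩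
  · exact ball_subset_ball (min_le_right _ _) (hKW j hj _ (hpW j hj)).2

end FingerData

end Fingers

namespace Tower

variable {d : ℕ} {E : Type*} [MetricSpace E] {𝒯 : Tower d E}

theorem IsNode.T_subset_closure_I {w : List Code} (hw : 𝒯.IsNode w) : 𝒯.T w ⊆ closure (𝒯.I w) := by
  rintro _ ⟨p, hp, rfl⟩
  have hc : Continuous fun r : ℝ => (((r : ℂ) * p.1, p.2) : TT d) := by fun_prop
  have h1 : (1 : ℝ) ∈ closure (Ico (0 : ℝ) 1) := by
    rw [closure_Ico zero_ne_one]
    exact ⟨zero_le_one, le_rfl⟩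
  have hn : ∀ r ∈ Icc (0 : ℝ) 1, ‖(r : ℂ) * p.1‖ ≤ r := fun r hr => by
    rw [norm_mul, Complex.norm_real, Real.norm_of_nonneg hr.1]
    exact mul_le_of_le_one_right hr.1 hp
  have hm : MapsTo (fun r : ℝ => (((r : ℂ) * p.1, p.2) : TT d)) (Icc 0 1) (MM d) :=
    fun r hr => (hn r hr).trans hr.2
  have h2 := (hw.continuousOn_chart.comp hc.continuousOn hm 1 ⟨zero_le_one, le_rfl⟩).mono
    Ico_subset_Icc_self |>.mem_closure_image h1
  simp only [Function.comp, Complex.ofReal_one, one_mul] at h2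
  refine closure_mono ?_ h2
  rintro _ ⟨r, hr, rfl⟩
  exact ⟨_, (hn r ⟨hr.1, hr.2.le⟩).trans_lt hr.2, rfl⟩

theorem IsNode.I_subset_interior_T {w : List Code} (hw : 𝒯.IsNode w) : 𝒯.I w ⊆ interior (𝒯.T w) :=
  interior_maximal (I_subset_T w) hw.isOpen_I

/-- Removing all children but one from an open solid torus with a small connected extension. -/
theorem IsNode.isPreconnected_union_sdiff {c : Code} {w : List Code} (hc : 𝒯.IsNode (c :: w)) {M : Set E}
    (hM : IsPreconnected M) (hMo : IsOpen M) (hMI : (M ∩ 𝒯.T w).Nonempty)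
    (hMd : ∀ c', 𝒯.IsNode (c' :: w) → Disjoint M (𝒯.T (c' :: w))) :
    IsPreconnected ((𝒯.I w ∪ M) \ ⋃ c' ∈ {c' | 𝒯.IsNode (c' :: w) ∧ c' ≠ c}, 𝒯.T (c' :: w)) := by
  have hw : 𝒯.IsNode w := hc.1
  have hQ := hw.isPreconnected_sdiff (S := 𝒯.I w) (Or.inl rfl)
  have hA : ∀ b : Bool, IsPreconnected (bif b then M else 𝒯.T (c :: w)) := fun b => by
    cases b
    · exact hc.isPreconnected_T
    · exact hM
  have := hQ.union_touching hA fun b => by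
    cases b
    · obtain ⟨x, hx, -, hx'⟩ := hc.exists_touch (S := 𝒯.I w) (Or.inl rfl)
      exact ⟨x, hx, hx'⟩
    · obtain ⟨x, hxM, hxT⟩ := hMI
      obtain ⟨z, hzM, hzI⟩ := mem_closure_iff.mp (hw.T_subset_closure_I hxT) M hMo hxM
      refine ⟨z, hzM, subset_closure ⟨hzI, ?_⟩⟩
      simp only [mem_iUnion, not_exists]
      exact fun c' hc' hz => disjoint_left.mp (hMd c' hc') hzM hz
  convert this using 1
  ext x
  simp only [mem_sdiff, mem_union, mem_iUnion, Bool.exists_bool, cond_false, cond_true, mem_ofPred_eq, not_exists,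
    exists_prop, not_and]
  constructor
  · rintro ⟨h1 | h1, h2⟩
    · by_cases hx : x ∈ 𝒯.T (c :: w)
      · exact Or.inr (Or.inl hx)
      · exact Or.inl ⟨h1, fun c' hc' hx' => by
          by_cases h : c' = c
          · exact hx (h ▸ hx')
          · exact h2 c' ⟨hc', h⟩ hx'⟩
    · exact Or.inr (Or.inr h1)
  · rintro (⟨h1, h2⟩ | h1 | h1)
    · exact ⟨Or.inl h1, fun c' hc' => h2 c' hc'.1⟩
    · exact ⟨Or.inl (hc.T_cons_subset_I h1), fun c' hc' hx => disjoint_left.mp (hc.disjoint_children hc'.1 hc'.2.symm) h1 hx⟩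
    · exact ⟨Or.inr h1, fun c' hc' hx => disjoint_left.mp (hMd c' hc'.1) h1 hx⟩

end Tower

section Stages

variable {d : ℕ} {F E : Type*} [NormedAddCommGroup F] [NormedAddCommGroup E]

/-- The region below a set of `F × ℝ`, thickened in one further direction. -/
def below (X : Set (F × ℝ)) : Set ((F × ℝ) × ℝ) := {x | ∃ t, x.2 ≤ t ∧ (x.1.1, t) ∈ X}

theorem isClosed_below {X : Set (F × ℝ)} (hX : IsCompact X) : IsClosed (below X) := by
  have : CompactSpace X := isCompact_iff_compactSpace.mp hX
  have h1 : IsClosed {q : ((F × ℝ) × ℝ) × X | (q.2 : F × ℝ).1 = q.1.1.1} := isClosed_eq (by fun_prop) (by fun_prop)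
  have h2 : IsClosed {q : ((F × ℝ) × ℝ) × X | q.1.2 ≤ (q.2 : F × ℝ).2} := isClosed_le (by fun_prop) (by fun_prop)
  convert isClosedMap_fst_of_compactSpace _ (h1.inter h2) using 1
  ext x
  constructor
  · rintro ⟨t, h1, h2⟩
    exact ⟨(x, ⟨_, h2⟩), ⟨rfl, h1⟩, rfl⟩
  · rintro ⟨⟨x, p⟩, h, rfl⟩
    have h1 : (p : F × ℝ).1 = x.1.1 := h.1
    exact ⟨(p : F × ℝ).2, h.2, by rw [← h1]; exact p.2⟩

/-- A set of top points which is dense in itself. -/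
structure IsTopSet (X Γ : Set (F × ℝ)) : Prop where
  subset : Γ ⊆ X
  nonempty : Γ.Nonempty
  top : ∀ g ∈ Γ, ∀ t, (g.1, t) ∈ X → t ≤ g.2
  infinite : ∀ g ∈ Γ, ∀ U ∈ 𝓝 g, (U ∩ Γ).Infinite

variable {X Γ : Set (F × ℝ)}

theorem IsTopSet.injOn (h : IsTopSet X Γ) : InjOn Prod.fst Γ := fun g hg g' hg' he =>
  Prod.ext he (le_antisymm (h.top g' hg' _ (by rw [← he]; exact h.subset hg))
    (h.top g hg _ (by rw [he]; exact h.subset hg')))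

theorem IsTopSet.mem_below_iff (h : IsTopSet X Γ) {g : F × ℝ} (hg : g ∈ Γ) (s t : ℝ) :
    ((g.1, s), t) ∈ below X ↔ t ≤ g.2 :=
  ⟨fun ⟨_, h1, h2⟩ => h1.trans (h.top g hg _ h2), fun h1 => ⟨g.2, h1, h.subset hg⟩⟩

theorem exists_injOn_mem {ι α : Type*} (J : Finset ι) (A : ι → Set α) (h : ∀ j ∈ J, (A j).Infinite) [Nonempty α] :
    ∃ f : ι → α, InjOn f J ∧ ∀ j ∈ J, f j ∈ A j := by
  classical
  induction J using Finset.induction_on with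
  | empty => exact ⟨fun _ => Classical.arbitrary α, by simp, by simp⟩
  | insert i J hi ih =>
    obtain ⟨f, hf, hm⟩ := ih fun j hj => h j (Finset.mem_insert_of_mem hj)
    obtain ⟨a, ha, ha'⟩ := (h i (Finset.mem_insert_self i J)).exists_notMem_finset (J.image f)
    have hne : ∀ j ∈ J, j ≠ i := fun j hj he => hi (he ▸ hj)
    refine ⟨Function.update f i a, ?_, fun j hj => ?_⟩
    · rw [Finset.coe_insert, injOn_insert (by simpa using hi)]
      refine ⟨hf.congr fun j hj => by simp [hne j hj], ?_⟩
      rintro ⟨j, hj, he⟩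
      rw [Function.update_self, Function.update_of_ne (hne j hj)] at he
      exact ha' (he ▸ Finset.mem_image_of_mem f hj)
    · rcases Finset.mem_insert.mp hj with rfl | hj
      · simpa using ha
      · simpa [hne j hj] using hm j hj

/-- The nodes of a given length. -/
noncomputable def Tower.nodes (𝒯 : Tower d E) (l : ℕ) : Finset (List Code) := (𝒯.finite_nodes l).toFinset

theorem Tower.mem_nodes {𝒯 : Tower d E} {l : ℕ} {w : List Code} : w ∈ 𝒯.nodes l ↔ 𝒯.IsNode w ∧ w.length = l := by
  simp [Tower.nodes]

/-- A finite stage of the construction. -/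
structure Stage (𝒯 : Tower d E) (X Γ : Set (F × ℝ)) (l : ℕ) where
  /-- the current embedding -/
  R : (F × ℝ) × ℝ ≃ₜ E
  /-- the points at which fingers grow -/
  p : List Code → (F × ℝ) × ℝ
  /-- the regions in which fingers grow -/
  O : List Code → Set E
  /-- the radius of the roots of the fingers -/
  ε : ℝ
  data : FingerData (below X) R (𝒯.nodes l) (fun w => (p w).1) (fun w => (p w).2) O 𝒯.T
  mem : ∀ w ∈ 𝒯.nodes l, ((p w).1.1, (p w).2) ∈ Γ
  pos : 0 < ε
  disjoint : ∀ w ∈ 𝒯.nodes l, ∀ w' ∈ 𝒯.nodes l, w ≠ w' → Disjoint (closedBall (p w) ε) (closedBall (p w') ε)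

/-- The relation between consecutive stages. -/
structure Stage.Next {𝒯 : Tower d E} {l : ℕ} (σ : Stage 𝒯 X Γ l) (σ' : Stage 𝒯 X Γ (l + 1)) (e : List Code → E)
    (ρ η : ℝ) : Prop where
  pos : 0 < ρ
  le : ρ ≤ σ.ε
  eps_le : σ'.ε ≤ ρ / 8
  eq : ∀ x ∈ below X, (∀ w ∈ 𝒯.nodes l, x ∉ closedBall (σ.p w) σ.ε) → σ'.R x = σ.R x
  mem_or : ∀ w ∈ 𝒯.nodes l, ∀ x ∈ below X, x ∈ closedBall (σ.p w) σ.ε →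
    σ'.R x ∈ σ.O w ∨ ∃ x' ∈ below X, x' ∈ closedBall (σ.p w) σ.ε ∧ σ'.R x = σ.R x'
  notMem : ∀ w ∈ 𝒯.nodes l, ∀ x ∈ below X, σ'.R x ∉ 𝒯.T w
  mem_T : ∀ w ∈ 𝒯.nodes l, e w ∈ 𝒯.T w
  ball_subset : ∀ c w, c :: w ∈ 𝒯.nodes (l + 1) → closedBall (σ'.p (c :: w)) σ'.ε ⊆ closedBall (σ.p w) σ.ε
  image_ball : ∀ c w, c :: w ∈ 𝒯.nodes (l + 1) → ∀ x ∈ closedBall (σ'.p (c :: w)) σ'.ε, σ'.R x ∈ ball (e w) η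
  O_subset : ∀ c w, c :: w ∈ 𝒯.nodes (l + 1) → σ'.O (c :: w) ⊆ σ.O w
  O_subset' : ∀ c w, c :: w ∈ 𝒯.nodes (l + 1) → σ'.O (c :: w) ⊆ 𝒯.T w ∪ ball (e w) η
  coord : ∀ c w, c :: w ∈ 𝒯.nodes (l + 1) → (σ'.p (c :: w)).1.2 = (σ.p w).1.2 + if c.1 then ρ else 0

end Stages

section NextStage

variable {d : ℕ} {F E : Type*} [NormedAddCommGroup F] [NormedAddCommGroup E] {X Γ : Set (F × ℝ)} {𝒯 : Tower d E}

theorem Tower.mem_nodes_succ {l : ℕ} {v : List Code} (hv : v ∈ 𝒯.nodes (l + 1)) :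
    ∃ c w, v = c :: w ∧ w ∈ 𝒯.nodes l ∧ 𝒯.IsNode (c :: w) := by
  obtain ⟨h1, h2⟩ := Tower.mem_nodes.mp hv
  cases v with
  | nil => simp at h2
  | cons c w => exact ⟨c, w, rfl, Tower.mem_nodes.mpr ⟨h1.1, by simpa using h2⟩, h1⟩

theorem Tower.exists_small_margin (𝒯 : Tower d E) (l : ℕ) {η₀ : ℝ} (hη₀ : 0 < η₀) : ∃ η > 0, η ≤ η₀ ∧
    (∀ c w, w ∈ 𝒯.nodes l → 𝒯.IsNode (c :: w) → ∀ e ∉ 𝒯.I w, Disjoint (ball e η) (𝒯.T (c :: w))) ∧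
    ∀ w ∈ 𝒯.nodes l, ∀ w' ∈ 𝒯.nodes l, w ≠ w' → Disjoint (thickening η (𝒯.T w)) (thickening η (𝒯.T w')) := by
  have h1 : ∀ w ∈ 𝒯.nodes l, ∀ᶠ η in 𝓝[>] (0 : ℝ), ∀ c ∈ (𝒯.finite_children w).toFinset, ∀ e ∉ 𝒯.I w,
      Disjoint (ball e η) (𝒯.T (c :: w)) := fun w hw => by
    refine (Finset.eventually_all _).mpr fun c hc => ?_
    have hc : 𝒯.IsNode (c :: w) := (𝒯.finite_children w).mem_toFinset.mp hc
    obtain ⟨δ, hδ, hs⟩ := hc.isCompact_T.exists_thickening_subset_open hc.1.isOpen_I hc.T_cons_subset_I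
    filter_upwards [Ioo_mem_nhdsGT hδ] with η hη e he
    refine disjoint_left.mpr fun z hz hz' => he (hs (mem_thickening_iff.mpr ⟨z, hz', ?_⟩))
    rw [dist_comm]
    exact (mem_ball.mp hz).trans hη.2
  have h2 : ∀ w ∈ 𝒯.nodes l, ∀ᶠ η in 𝓝[>] (0 : ℝ), ∀ w' ∈ 𝒯.nodes l, w ≠ w' →
      Disjoint (thickening η (𝒯.T w)) (thickening η (𝒯.T w')) := fun w hw => by
    refine (Finset.eventually_all _).mpr fun w' hw' => ?_
    by_cases hne : w = w'
    · exact Filter.Eventually.of_forall fun _ h => absurd hne h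
    obtain ⟨hw, hl⟩ := Tower.mem_nodes.mp hw
    obtain ⟨hw', hl'⟩ := Tower.mem_nodes.mp hw'
    have hd : Disjoint (𝒯.T w) (𝒯.T w') :=
      disjoint_left.mpr fun x hx hx' => hne (hw.eq_of_mem hw' (hl.trans hl'.symm) hx hx')
    obtain ⟨δ, hδ, hs⟩ := hd.exists_thickenings hw.isCompact_T hw'.isCompact_T.isClosed
    filter_upwards [Ioo_mem_nhdsGT hδ] with η hη _
    exact hs.mono (thickening_mono hη.2.le _) (thickening_mono hη.2.le _)
  obtain ⟨η, ⟨h1, h2⟩, h3⟩ := ((((Finset.eventually_all _).mpr h1).and ((Finset.eventually_all _).mpr h2)).and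
    (Ioo_mem_nhdsGT hη₀)).exists
  exact ⟨η, h3.1, h3.2.le, fun c w hw hc => h1 w hw c ((𝒯.finite_children w).mem_toFinset.mpr hc), h2⟩

variable [NormedSpace ℝ F] [NormedSpace ℝ E] [CompleteSpace E]

theorem Stage.exists_next (hF : 1 < Module.rank ℝ (F × ℝ)) (hX : IsCompact X) (hΓ : IsTopSet X Γ) {l : ℕ}
    (σ : Stage 𝒯 X Γ l) {η₀ : ℝ} (hη₀ : 0 < η₀) :
    ∃ (σ' : Stage 𝒯 X Γ (l + 1)) (e : List Code → E) (ρ : ℝ), σ.Next σ' e ρ η₀ := by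
  classical
  obtain ⟨η, hη, hηη, hm1, hm2⟩ := 𝒯.exists_small_margin l hη₀
  have hSd : ∀ (z : F × ℝ) (s s' : ℝ), (z, s) ∈ below X → s' ≤ s → (z, s') ∈ below X := by
    rintro z s s' ⟨t, h1, h2⟩ h
    exact ⟨t, h.trans h1, h2⟩
  obtain ⟨B, hB⟩ : ∃ B, ∀ x ∈ below X, x.2 ≤ B := by
    obtain ⟨B, hB⟩ := (hX.image continuous_snd).bddAbove
    refine ⟨B, ?_⟩
    rintro x ⟨t, h1, h2⟩
    exact h1.trans (hB ⟨_, h2, rfl⟩)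
  obtain ⟨R', M, e, hR1, hR2, hR3, hR4⟩ := FingerData.exists_fingers hF σ.data (isClosed_below hX) hSd hB σ.pos
    (fun i hi j hj hij => (σ.disjoint i hi j hj hij).mono ball_subset_closedBall ball_subset_closedBall) hη
  have heI : ∀ w ∈ 𝒯.nodes l, e w ∉ 𝒯.I w := fun w hw h =>
    (hR4 w hw).2.1 ((Tower.mem_nodes.mp hw).1.I_subset_interior_T h)
  obtain ⟨δ, hδ, hδε, hδM⟩ : ∃ δ > 0, δ ≤ σ.ε ∧ ∀ w ∈ 𝒯.nodes l, ∀ x ∈ ball (σ.p w) δ,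
      (x ∉ below X → R' x ∈ M w) ∧ R' x ∈ ball (e w) η := by
    have h : ∀ᶠ δ in 𝓝[>] (0 : ℝ), ∀ w ∈ 𝒯.nodes l, ∀ x ∈ ball (σ.p w) δ,
        (x ∉ below X → R' x ∈ M w) ∧ R' x ∈ ball (e w) η := by
      refine (Finset.eventually_all _).mpr fun w hw => ?_
      obtain ⟨-, -, -, -, -, -, -, -, h1, h2⟩ := hR4 w hw
      obtain ⟨δ, hδ, h⟩ := eventually_nhds_iff_ball.mp
        (h1.and (R'.continuous.continuousAt.eventually (isOpen_ball.mem_nhds h2)))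
      filter_upwards [Ioo_mem_nhdsGT hδ] with δ' hδ' x hx
      exact h x (ball_subset_ball hδ'.2.le hx)
    obtain ⟨δ, h1, h2⟩ := (h.and (Ioo_mem_nhdsGT σ.pos)).exists
    exact ⟨δ, h2.1, h2.2.le, h1⟩
  obtain ⟨g, hgi, hg⟩ : ∃ g : List Code → F × ℝ, InjOn g (𝒯.nodes (l + 1)) ∧ ∀ v ∈ 𝒯.nodes (l + 1),
      g v ∈ ball ((σ.p v.tail).1.1, (σ.p v.tail).2) (δ / 2) ∩ Γ := by
    refine exists_injOn_mem _ _ fun v hv => ?_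
    obtain ⟨c, w, rfl, hw, -⟩ := Tower.mem_nodes_succ hv
    exact hΓ.infinite _ (σ.mem w hw) _ (ball_mem_nhds _ (half_pos hδ))
  let p' : List Code → (F × ℝ) × ℝ := fun v =>
    (((g v).1, (σ.p v.tail).1.2 + if (v.head?.map Prod.fst).getD false then δ / 2 else 0), (g v).2)
  have hp' : ∀ c w, c :: w ∈ 𝒯.nodes (l + 1) → dist (p' (c :: w)) (σ.p w) ≤ δ / 2 := fun c w hv => by
    have h1 : dist (g (c :: w)).1 (σ.p w).1.1 < δ / 2 ∧ dist (g (c :: w)).2 (σ.p w).2 < δ / 2 := by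
      have := (hg _ hv).1
      rw [mem_ball, Prod.dist_eq, max_lt_iff] at this
      exact this
    rw [Prod.dist_eq, Prod.dist_eq]
    refine max_le (max_le h1.1.le ?_) h1.2.le
    simp only [p', List.tail_cons, List.head?_cons, Option.map_some, Option.getD_some]
    rw [Real.dist_eq, add_sub_cancel_left]
    have key : ∀ (b : Prop) [Decidable b], |if b then δ / 2 else (0 : ℝ)| ≤ δ / 2 := fun b _ => by
      split_ifs
      · rw [abs_of_pos (half_pos hδ)]
      · rw [abs_zero]; exact (half_pos hδ).le
    exact key _
  have hpi : InjOn (fun v => (p' v).1) (𝒯.nodes (l + 1)) := fun v hv v' hv' h => by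
    have h1 : (g v).1 = (g v').1 := (Prod.ext_iff.mp h).1
    exact hgi hv hv' (hΓ.injOn (hg v hv).2 (hg v' hv').2 h1)
  obtain ⟨ε', hε', hεδ, hdis⟩ := exists_disjoint_closedBalls (𝒯.nodes (l + 1)) p'
    (fun v hv v' hv' h => hpi hv hv' (congrArg Prod.fst h)) (b := δ / 16) (by linarith)
  have hball : ∀ c w, c :: w ∈ 𝒯.nodes (l + 1) → closedBall (p' (c :: w)) ε' ⊆ ball (σ.p w) δ := fun c w hv x hx => by
    have h1 := hp' c w hv
    have h2 := mem_closedBall.mp hx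
    rw [mem_ball]
    linarith [dist_triangle x (p' (c :: w)) (σ.p w)]
  let O' : List Code → Set E := fun v => 𝒯.I v.tail ∪ M v.tail
  have hO'T : ∀ w ∈ 𝒯.nodes l, 𝒯.I w ∪ M w ⊆ 𝒯.T w ∪ ball (e w) η := fun w hw =>
    union_subset_union (Tower.I_subset_T w) (hR4 w hw).2.2.2.2.2.2.1
  have hO'th : ∀ w ∈ 𝒯.nodes l, 𝒯.I w ∪ M w ⊆ thickening η (𝒯.T w) := fun w hw =>
    (hO'T w hw).trans (union_subset (self_subset_thickening hη _) (ball_subset_thickening (hR4 w hw).1 η))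
  have hMd : ∀ w ∈ 𝒯.nodes l, ∀ c', 𝒯.IsNode (c' :: w) → Disjoint (M w) (𝒯.T (c' :: w)) := fun w hw c' hc' =>
    (hm1 c' w hw hc' (e w) (heI w hw)).mono_left (hR4 w hw).2.2.2.2.2.2.1
  have hdata : FingerData (below X) R' (𝒯.nodes (l + 1)) (fun w => (p' w).1) (fun w => (p' w).2) O' 𝒯.T := by
    refine ⟨hpi, fun v hv τ => hΓ.mem_below_iff (hg v hv).2 _ τ, ?_, ?_, ?_, ?_, ?_, ?_, ?_, ?_, ?_⟩
    · intro v hv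
      obtain ⟨c, w, rfl, hw, hc⟩ := Tower.mem_nodes_succ hv
      exact hc.1.isOpen_I.union (hR4 w hw).2.2.1
    · intro v hv v' hv'
      obtain ⟨c, w, rfl, hw, hc⟩ := Tower.mem_nodes_succ hv
      obtain ⟨c', w', rfl, hw', hc'⟩ := Tower.mem_nodes_succ hv'
      by_cases h : w = w'
      · subst h; exact Or.inl rfl
      · exact Or.inr ((hm2 w hw w' hw' h).mono (hO'th w hw) (hO'th w' hw'))
    · intro v hv x hx
      obtain ⟨c, w, rfl, hw, hc⟩ := Tower.mem_nodes_succ hv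
      rintro (h | h)
      · exact hR3 w hw x hx (Tower.I_subset_T w h)
      · exact (hR4 w hw).2.2.2.2.2.2.2.1 x hx h
    · exact fun v hv => (Tower.mem_nodes.mp hv).1.isCompact_T
    · intro v hv
      obtain ⟨c, w, rfl, hw, hc⟩ := Tower.mem_nodes_succ hv
      exact hc.T_cons_subset_I.trans subset_union_left
    · exact fun v hv => (Tower.IsNode.I_nonempty 𝒯 v).mono (Tower.I_subset_T v)
    · intro v hv v' hv' hne
      obtain ⟨h1, h2⟩ := Tower.mem_nodes.mp hv
      obtain ⟨h1', h2'⟩ := Tower.mem_nodes.mp hv'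
      exact disjoint_left.mpr fun x hx hx' => hne (h1.eq_of_mem h1' (h2.trans h2'.symm) hx hx')
    · intro v hv
      obtain ⟨c, w, rfl, hw, hc⟩ := Tower.mem_nodes_succ hv
      obtain ⟨h1, -, h3, h4, h5, -⟩ := hR4 w hw
      convert hc.isPreconnected_union_sdiff h4 h3 ⟨e w, h5, h1⟩ (hMd w hw) using 1
      ext x
      simp only [O', List.tail_cons, mem_sdiff, mem_iUnion, mem_ofPred_eq, not_exists, exists_prop, not_and]
      refine and_congr_right fun hx => ⟨fun h c' hc' => ?_, fun h v' hv' hxv => ?_⟩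
      · refine h (c' :: w) ⟨Tower.mem_nodes.mpr ⟨hc'.1, ?_⟩, fun he => hc'.2 (List.cons.inj he).1⟩
        simpa using (Tower.mem_nodes.mp hw).2
      · obtain ⟨c', w', rfl, hw', hc'⟩ := Tower.mem_nodes_succ hv'.1
        by_cases he : w' = w
        · subst he
          exact h c' ⟨hc', fun he => hv'.2 (he ▸ rfl)⟩ hxv
        · exact disjoint_left.mp (hm2 w' hw' w hw he) (self_subset_thickening hη _ (Tower.I_subset_T w' (hc'.T_cons_subset_I hxv)))
            (hO'th w hw hx)
    · intro v hv
      obtain ⟨c, w, rfl, hw, hc⟩ := Tower.mem_nodes_succ hv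
      have : p' (c :: w) ∈ ball (σ.p w) δ := hball c w hv (mem_closedBall_self hε'.le)
      filter_upwards [isOpen_ball.mem_nhds this] with x hx hxS
      exact Or.inr ((hδM w hw x hx).1 hxS)
  refine ⟨⟨R', p', O', ε', hdata, fun v hv => (hg v hv).2, hε', hdis⟩, e, δ / 2, ?_⟩
  have hin : ∀ c w, c :: w ∈ 𝒯.nodes (l + 1) → w ∈ 𝒯.nodes l := fun c w hv => by
    obtain ⟨c', w', he, hw, -⟩ := Tower.mem_nodes_succ hv
    rw [(List.cons.inj he).2]; exact hw
  refine ⟨half_pos hδ, by linarith, by linarith, ?_, ?_, hR3, fun w hw => (hR4 w hw).1, ?_, ?_, ?_, ?_, ?_⟩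
  · exact fun x hx h => hR1 x hx fun w hw hxw => h w hw (ball_subset_closedBall hxw)
  · intro w hw x hx hxw
    by_cases hb : x ∈ ball (σ.p w) σ.ε
    · rcases hR2 w hw x hx hb with h | ⟨x', h1, h2, h3⟩
      · exact Or.inl h
      · exact Or.inr ⟨x', h1, ball_subset_closedBall h2, h3⟩
    · refine Or.inr ⟨x, hx, hxw, hR1 x hx fun w' hw' hb' => ?_⟩
      by_cases he : w' = w
      · exact hb (he ▸ hb')
      · exact disjoint_left.mp (σ.disjoint w' hw' w hw he) (ball_subset_closedBall hb') hxw
  · exact fun c w hv => (hball c w hv).trans ((ball_subset_ball hδε).trans ball_subset_closedBall)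
  · exact fun c w hv x hx => ball_subset_ball hηη (hδM w (hin c w hv) x (hball c w hv hx)).2
  · intro c w hv
    have hw := hin c w hv
    exact union_subset ((Tower.I_subset_T w).trans (σ.data.subset w hw)) (hR4 w hw).2.2.2.2.2.1
  · exact fun c w hv => (hO'T w (hin c w hv)).trans (union_subset_union_right _ (ball_subset_ball hηη))
  · intro c w hv
    simp only [p', List.tail_cons, List.head?_cons, Option.map_some, Option.getD_some]
    congr

end NextStage

section Limit

variable {d : ℕ} {F E : Type*} [NormedAddCommGroup F] [NormedAddCommGroup E] {X Γ : Set (F × ℝ)} {𝒯 : Tower d E}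

/-- A sequence of consecutive stages. -/
structure Stages (𝒯 : Tower d E) (X Γ : Set (F × ℝ)) where
  /-- the stages -/
  σ : ∀ l, Stage 𝒯 X Γ l
  /-- the tips of the fingers -/
  e : List Code → E
  /-- the horizontal displacements -/
  ρ : ℕ → ℝ
  next : ∀ l, (σ l).Next (σ (l + 1)) e (ρ l) ((1 / 2) ^ l)

theorem Stage.Next.congr {l : ℕ} {σ : Stage 𝒯 X Γ l} {σ' : Stage 𝒯 X Γ (l + 1)} {e e' : List Code → E} {ρ η : ℝ}
    (h : σ.Next σ' e ρ η) (he : ∀ w, w.length = l → e w = e' w) : σ.Next σ' e' ρ η := by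
  have h1 : ∀ c w, c :: w ∈ 𝒯.nodes (l + 1) → e w = e' w := fun c w hw =>
    he w (by simpa using (Tower.mem_nodes.mp hw).2)
  refine ⟨h.pos, h.le, h.eps_le, h.eq, h.mem_or, h.notMem, fun w hw => ?_, h.ball_subset, fun c w hw => ?_,
    h.O_subset, fun c w hw => ?_, h.coord⟩
  · rw [← he w (Tower.mem_nodes.mp hw).2]; exact h.mem_T w hw
  · rw [← h1 c w hw]; exact h.image_ball c w hw
  · rw [← h1 c w hw]; exact h.O_subset' c w hw

theorem Stage.exists_stages [NormedSpace ℝ F] [NormedSpace ℝ E] [CompleteSpace E] (hF : 1 < Module.rank ℝ (F × ℝ))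
    (hX : IsCompact X) (hΓ : IsTopSet X Γ) (σ₀ : Stage 𝒯 X Γ 0) : ∃ 𝒮 : Stages 𝒯 X Γ, 𝒮.σ 0 = σ₀ := by
  choose nxt e ρ h using fun l (σ : Stage 𝒯 X Γ l) => σ.exists_next hF hX hΓ (η₀ := (1 / 2) ^ l) (by positivity)
  let σ : ∀ l, Stage 𝒯 X Γ l := fun l => Nat.rec σ₀ (fun l s => nxt l s) l
  exact ⟨⟨σ, fun w => e w.length (σ w.length) w, fun l => ρ l (σ l),
    fun l => (h l (σ l)).congr fun w hw => by rw [hw]⟩, rfl⟩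

namespace Stages

variable (𝒮 : Stages 𝒯 X Γ)

/-- The balls around the roots of the fingers. -/
def B (w : List Code) : Set ((F × ℝ) × ℝ) := closedBall ((𝒮.σ w.length).p w) (𝒮.σ w.length).ε

variable {𝒮}

theorem node_mem {w : List Code} (hw : 𝒯.IsNode w) : w ∈ 𝒯.nodes w.length := Tower.mem_nodes.mpr ⟨hw, rfl⟩

theorem B_append {u w : List Code} (h : 𝒯.IsNode (u ++ w)) : 𝒮.B (u ++ w) ⊆ 𝒮.B w := by
  induction u with
  | nil => exact Subset.rfl
  | cons c u ih => exact ((𝒮.next (u ++ w).length).ball_subset c (u ++ w) (node_mem h)).trans (ih h.1)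

theorem O_append {u w : List Code} (h : 𝒯.IsNode (u ++ w)) :
    (𝒮.σ (u ++ w).length).O (u ++ w) ⊆ (𝒮.σ w.length).O w := by
  induction u with
  | nil => exact Subset.rfl
  | cons c u ih => exact ((𝒮.next (u ++ w).length).O_subset c (u ++ w) (node_mem h)).trans (ih h.1)

theorem eq_of_mem_B {v w : List Code} (hv : 𝒯.IsNode v) (hw : 𝒯.IsNode w) (hl : v.length = w.length)
    {x : (F × ℝ) × ℝ} (hx : x ∈ 𝒮.B v) (hx' : x ∈ 𝒮.B w) : v = w := by
  by_contra hne
  have h := (𝒮.σ w.length).disjoint v (hl ▸ node_mem hv) w (node_mem hw) hne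
  refine disjoint_left.mp h ?_ hx'
  have hx1 : x ∈ closedBall ((𝒮.σ v.length).p v) (𝒮.σ v.length).ε := hx
  rw [hl] at hx1
  exact hx1

theorem exists_append {v w : List Code} (hv : 𝒯.IsNode v) (hw : 𝒯.IsNode w) (hl : w.length ≤ v.length)
    {x : (F × ℝ) × ℝ} (hx : x ∈ 𝒮.B v) (hx' : x ∈ 𝒮.B w) : ∃ u, v = u ++ w := by
  have h := List.take_append_drop (v.length - w.length) v
  have hv' : 𝒯.IsNode (v.take (v.length - w.length) ++ v.drop (v.length - w.length)) := by rw [h]; exact hv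
  refine ⟨v.take (v.length - w.length), ?_⟩
  have he := eq_of_mem_B hv'.of_append hw (by simp; omega) (B_append hv' (by rw [h]; exact hx)) hx'
  rw [he] at h
  exact h.symm

theorem exists_mem_B_of_le {l l' : ℕ} (hl : l ≤ l') {x : (F × ℝ) × ℝ} (h : ∃ w, 𝒯.IsNode w ∧ w.length = l' ∧ x ∈ 𝒮.B w) :
    ∃ w, 𝒯.IsNode w ∧ w.length = l ∧ x ∈ 𝒮.B w := by
  obtain ⟨w, hw, rfl, hx⟩ := h
  have h := List.take_append_drop (w.length - l) w
  have hw' : 𝒯.IsNode (w.take (w.length - l) ++ w.drop (w.length - l)) := by rw [h]; exact hw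
  exact ⟨_, hw'.of_append, by simp; omega, B_append hw' (by rw [h]; exact hx)⟩

theorem R_eq_of_stable {l l' : ℕ} (hl : l ≤ l') {x : (F × ℝ) × ℝ} (hx : x ∈ below X)
    (h : ¬ ∃ w, 𝒯.IsNode w ∧ w.length = l ∧ x ∈ 𝒮.B w) : (𝒮.σ l').R x = (𝒮.σ l).R x := by
  induction l', hl using Nat.le_induction with
  | base => rfl
  | succ k hk ih =>
    rw [← ih]
    refine (𝒮.next k).eq x hx fun w hw hxw => h (exists_mem_B_of_le hk ?_)
    obtain ⟨h1, rfl⟩ := Tower.mem_nodes.mp hw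
    exact ⟨w, h1, rfl, hxw⟩

/-- The region where the finger of a node stays. -/
def N (𝒮 : Stages 𝒯 X Γ) (v : List Code) : Set E := 𝒯.T v ∪ ball (𝒮.e v) ((1 / 2) ^ v.length)

theorem R_mem_N {c : Code} {v : List Code} (hv : 𝒯.IsNode (c :: v)) {l : ℕ} (hl : v.length + 1 ≤ l)
    {x : (F × ℝ) × ℝ} (hx : x ∈ below X) (hxB : x ∈ 𝒮.B (c :: v)) : (𝒮.σ l).R x ∈ 𝒮.N v := by
  induction l, hl using Nat.le_induction generalizing x with
  | base => exact Or.inr ((𝒮.next v.length).image_ball c v (node_mem hv) x hxB)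
  | succ k hk ih =>
    by_cases h : ∃ w, 𝒯.IsNode w ∧ w.length = k ∧ x ∈ 𝒮.B w
    · obtain ⟨w, hw, rfl, hxw⟩ := h
      obtain ⟨u, rfl⟩ := exists_append hw hv hk hxw hxB
      rcases (𝒮.next (u ++ c :: v).length).mem_or (u ++ c :: v) (node_mem hw) x hx hxw with h | ⟨x', h1, h2, h3⟩
      · exact (𝒮.next v.length).O_subset' c v (node_mem hv) (O_append hw h)
      · rw [h3]
        exact ih h1 (B_append hw h2)
    · rw [(𝒮.next k).eq x hx]
      · exact ih hx hxB
      · intro w hw hxw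
        obtain ⟨h1, rfl⟩ := Tower.mem_nodes.mp hw
        exact h ⟨w, h1, rfl, hxw⟩

theorem e_mem_T {v : List Code} (hv : 𝒯.IsNode v) : 𝒮.e v ∈ 𝒯.T v := (𝒮.next v.length).mem_T v (node_mem hv)

theorem N_subset_thickening {v : List Code} (hv : 𝒯.IsNode v) : 𝒮.N v ⊆ thickening ((1 / 2) ^ v.length) (𝒯.T v) :=
  union_subset (self_subset_thickening (by positivity) _) (ball_subset_thickening (e_mem_T hv) _)

theorem uniformCauchySeqOn : UniformCauchySeqOn (fun l => (𝒮.σ l).R) Filter.atTop (below X) := by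
  rw [Metric.uniformCauchySeqOn_iff]
  intro ε hε
  obtain ⟨l, hl⟩ := Tower.exists_small 𝒯 (ε := ε / 3) (by positivity)
  obtain ⟨m, hm⟩ := exists_pow_lt_of_lt_one (show 0 < ε / 3 by positivity) (show (1 / 2 : ℝ) < 1 by norm_num)
  refine ⟨max l m + 1, fun a ha b hb x hx => ?_⟩
  by_cases h : ∃ w, 𝒯.IsNode w ∧ w.length = max l m + 1 ∧ x ∈ 𝒮.B w
  · obtain ⟨w, hw, hwl, hxw⟩ := h
    cases w with
    | nil => simp at hwl
    | cons c v =>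
      have hvl : v.length = max l m := by simpa using hwl
      obtain ⟨z, hz, hz'⟩ := mem_thickening_iff.mp (N_subset_thickening hw.1 (R_mem_N hw (by omega : v.length + 1 ≤ a) hx hxw))
      obtain ⟨y, hy, hy'⟩ := mem_thickening_iff.mp (N_subset_thickening hw.1 (R_mem_N hw (by omega : v.length + 1 ≤ b) hx hxw))
      have h1 := hl v hw.1 (by omega) z hz y hy
      have h2 : (1 / 2 : ℝ) ^ v.length ≤ (1 / 2) ^ m := pow_le_pow_of_le_one (by norm_num) (by norm_num) (by omega)
      have h3 := dist_triangle4 ((𝒮.σ a).R x) z y ((𝒮.σ b).R x)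
      rw [dist_comm y] at h3
      linarith
  · rw [R_eq_of_stable ha hx h, R_eq_of_stable hb hx h, dist_self]
    exact hε

/-- The limit embedding. -/
theorem exists_limit [CompleteSpace E] (hε : Filter.Tendsto (fun l => (𝒮.σ l).ε) Filter.atTop (𝓝 0)) :
    ∃ f : (F × ℝ) × ℝ → E, ContinuousOn f (below X) ∧ InjOn f (below X) ∧
      (∀ x ∈ below X, ∀ l, (¬ ∃ w, 𝒯.IsNode w ∧ w.length = l ∧ x ∈ 𝒮.B w) → f x = (𝒮.σ l).R x) ∧
      ∀ x ∈ below X, (∀ l, ∃ w, 𝒯.IsNode w ∧ w.length = l ∧ x ∈ 𝒮.B w) → ∀ w, 𝒯.IsNode w → x ∈ 𝒮.B w → f x ∈ 𝒯.T w := by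
  have hex : ∀ x, ∃ y, x ∈ below X → Filter.Tendsto (fun l => (𝒮.σ l).R x) Filter.atTop (𝓝 y) := fun x => by
    by_cases hx : x ∈ below X
    · obtain ⟨y, hy⟩ := cauchySeq_tendsto_of_complete ((uniformCauchySeqOn (𝒮 := 𝒮)).cauchySeq hx)
      exact ⟨y, fun _ => hy⟩
    · exact ⟨0, fun h => absurd h hx⟩
  choose f hf using hex
  have hstable : ∀ x ∈ below X, ∀ l, (¬ ∃ w, 𝒯.IsNode w ∧ w.length = l ∧ x ∈ 𝒮.B w) → f x = (𝒮.σ l).R x :=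
    fun x hx l h => tendsto_nhds_unique (hf x hx) (tendsto_const_nhds.congr' (by
      filter_upwards [Filter.eventually_ge_atTop l] with k hk
      exact (R_eq_of_stable hk hx h).symm))
  have hunstable : ∀ x ∈ below X, (∀ l, ∃ w, 𝒯.IsNode w ∧ w.length = l ∧ x ∈ 𝒮.B w) → ∀ w, 𝒯.IsNode w →
      x ∈ 𝒮.B w → f x ∈ 𝒯.T w := by
    intro x hx h w hw hxw
    rw [← hw.isCompact_T.isClosed.closure_eq, closure_eq_iInter_cthickening]
    simp only [mem_iInter]
    intro δ hδ
    obtain ⟨m, hm⟩ := exists_pow_lt_of_lt_one hδ (show (1 / 2 : ℝ) < 1 by norm_num)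
    obtain ⟨v, hv, hvl, hxv⟩ := h (max m w.length + 1)
    cases v with
    | nil => simp at hvl
    | cons c v =>
      have hvl : v.length = max m w.length := by simpa using hvl
      obtain ⟨u, rfl⟩ := exists_append hv.1 hw (by omega) (B_append (u := [c]) hv hxv) hxw
      have h2 : (1 / 2 : ℝ) ^ (u ++ w).length ≤ (1 / 2) ^ m :=
        pow_le_pow_of_le_one (by norm_num) (by norm_num) (by omega)
      refine closure_thickening_subset_cthickening _ _ (mem_closure_of_tendsto (hf x hx) ?_)
      filter_upwards [Filter.eventually_ge_atTop ((u ++ w).length + 1)] with k hk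
      exact thickening_mono (h2.trans hm.le) _ (thickening_subset_of_subset _ hv.1.T_append_subset
        (N_subset_thickening hv.1 (R_mem_N hv hk hx hxv)))
  have hmix : ∀ x ∈ below X, ∀ x' ∈ below X, (∀ l, ∃ w, 𝒯.IsNode w ∧ w.length = l ∧ x ∈ 𝒮.B w) →
      (¬ ∀ l, ∃ w, 𝒯.IsNode w ∧ w.length = l ∧ x' ∈ 𝒮.B w) → f x ≠ f x' := by
    intro x hx x' hx' h h'
    push Not at h'
    obtain ⟨l, hl⟩ := h'
    have hl' : ¬ ∃ w, 𝒯.IsNode w ∧ w.length = l ∧ x' ∈ 𝒮.B w := fun ⟨w, h1, h2, h3⟩ => hl w h1 h2 h3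
    obtain ⟨w, hw, rfl, hxw⟩ := h l
    have h1 := (𝒮.next w.length).notMem w (node_mem hw) x' hx'
    rw [R_eq_of_stable (Nat.le_succ _) hx' hl', ← hstable x' hx' _ hl'] at h1
    exact fun he => h1 (he ▸ hunstable x hx h w hw hxw)
  refine ⟨f, ?_, ?_, hstable, hunstable⟩
  · exact ((uniformCauchySeqOn (𝒮 := 𝒮)).tendstoUniformlyOn_of_tendsto fun x hx => hf x hx).continuousOn
      (Filter.Frequently.of_forall fun l => (𝒮.σ l).R.continuous.continuousOn)
  · intro x hx x' hx' he
    by_cases h : ∀ l, ∃ w, 𝒯.IsNode w ∧ w.length = l ∧ x ∈ 𝒮.B w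
    · by_cases h' : ∀ l, ∃ w, 𝒯.IsNode w ∧ w.length = l ∧ x' ∈ 𝒮.B w
      · have hd : ∀ l, dist x x' ≤ 2 * (𝒮.σ l).ε := fun l => by
          obtain ⟨w, hw, rfl, hxw⟩ := h l
          obtain ⟨w', hw', hl, hxw'⟩ := h' w.length
          have heq : w = w' := hw.eq_of_mem hw' hl.symm (hunstable x hx h w hw hxw)
            (by rw [he]; exact hunstable x' hx' h' w' hw' hxw')
          subst heq
          have h1 : dist x _ ≤ (𝒮.σ w.length).ε := hxw
          have h2 : dist x' _ ≤ (𝒮.σ w.length).ε := hxw'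
          linarith [dist_triangle_right x x' ((𝒮.σ w.length).p w)]
        have := ge_of_tendsto' (hε.const_mul 2) hd
        rw [mul_zero] at this
        exact dist_le_zero.mp this
      · exact absurd he (hmix x hx x' hx' h h')
    · by_cases h' : ∀ l, ∃ w, 𝒯.IsNode w ∧ w.length = l ∧ x' ∈ 𝒮.B w
      · exact absurd he.symm (hmix x' hx' x hx h' h)
      · push Not at h h'
        obtain ⟨l, hl⟩ := h
        obtain ⟨l', hl'⟩ := h'
        have h1 : ¬ ∃ w, 𝒯.IsNode w ∧ w.length = l ∧ x ∈ 𝒮.B w := fun ⟨w, h1, h2, h3⟩ => hl w h1 h2 h3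
        have h2 : ¬ ∃ w, 𝒯.IsNode w ∧ w.length = l' ∧ x' ∈ 𝒮.B w := fun ⟨w, h1, h2, h3⟩ => hl' w h1 h2 h3
        rw [hstable x hx l h1, hstable x' hx' l' h2, ← R_eq_of_stable (le_max_left l l') hx h1,
          ← R_eq_of_stable (le_max_right l l') hx' h2] at he
        exact (𝒮.σ _).R.injective he

end Stages

end Limit

section Coding

/-- The point of a Cantor set of reals with a given address. -/
noncomputable def codeSum (ρ : ℕ → ℝ) (s : ℕ → Bool) : ℝ := ∑' k, if s k then ρ k else 0

variable {ρ : ℕ → ℝ}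

theorem le_geom_of_le (h : ∀ l, ρ (l + 1) ≤ ρ l / 8) (l k : ℕ) : ρ (k + l) ≤ ρ l * (1 / 8) ^ k := by
  induction k with
  | zero => simp
  | succ k ih =>
    rw [pow_succ, add_right_comm]
    linarith [h (k + l)]

theorem summable_of_le (h0 : ∀ l, 0 < ρ l) (h : ∀ l, ρ (l + 1) ≤ ρ l / 8) : Summable ρ :=
  Summable.of_nonneg_of_le (fun l => (h0 l).le) (le_geom_of_le h 0)
    ((summable_geometric_of_lt_one (by norm_num) (by norm_num)).mul_left _)

theorem summable_code (h0 : ∀ l, 0 < ρ l) (h : ∀ l, ρ (l + 1) ≤ ρ l / 8) (s : ℕ → Bool) :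
    Summable fun k => if s k then ρ k else 0 :=
  Summable.of_nonneg_of_le (fun l => by split_ifs <;> simp [(h0 l).le])
    (fun l => by split_ifs <;> simp [(h0 l).le]) (summable_of_le h0 h)

theorem continuous_codeSum (h0 : ∀ l, 0 < ρ l) (h : ∀ l, ρ (l + 1) ≤ ρ l / 8) : Continuous (codeSum ρ) := by
  refine continuous_tsum (fun k => ?_) (summable_of_le h0 h) fun k s => ?_
  · exact (continuous_of_discreteTopology (f := fun b : Bool => if b then ρ k else 0)).comp (continuous_apply k)
  · split_ifs <;> simp [(h0 k).le, abs_of_pos (h0 k)]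

theorem codeSum_bounds (h0 : ∀ l, 0 < ρ l) (h : ∀ l, ρ (l + 1) ≤ ρ l / 8) (s : ℕ → Bool) (l : ℕ) :
    (∑ k ∈ Finset.range l, if s k then ρ k else 0) + (if s l then ρ l else 0) ≤ codeSum ρ s ∧
      codeSum ρ s ≤ (∑ k ∈ Finset.range l, if s k then ρ k else 0) + (if s l then ρ l else 0) + ρ l / 7 := by
  rw [← Finset.sum_range_succ, codeSum, ← (summable_code h0 h s).sum_add_tsum_nat_add (l + 1)]
  have hs := (summable_nat_add_iff (l + 1)).mpr (summable_code h0 h s)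
  have hg : HasSum (fun k : ℕ => ρ l / 8 * (1 / 8) ^ k) (ρ l / 8 * (1 - 1 / 8)⁻¹) :=
    (hasSum_geometric_of_lt_one (by norm_num) (by norm_num)).mul_left _
  have h1 : 0 ≤ ∑' k, if s (k + (l + 1)) then ρ (k + (l + 1)) else 0 :=
    tsum_nonneg fun k => by split_ifs <;> simp [(h0 _).le]
  have h2 : (∑' k, if s (k + (l + 1)) then ρ (k + (l + 1)) else 0) ≤ ρ l / 8 * (1 - 1 / 8)⁻¹ := by
    refine hs.hasSum.tsum_eq ▸ hasSum_le (fun k => ?_) hs.hasSum hg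
    have h3 := le_geom_of_le h (l + 1) k
    have h4 : ρ (l + 1) * (1 / 8) ^ k ≤ ρ l / 8 * (1 / 8) ^ k := mul_le_mul_of_nonneg_right (h l) (by positivity)
    split_ifs
    · exact h3.trans h4
    · have := h0 l
      positivity
  norm_num at h2
  constructor
  · linarith
  · linarith

theorem codeSum_injective (h0 : ∀ l, 0 < ρ l) (h : ∀ l, ρ (l + 1) ≤ ρ l / 8) : Function.Injective (codeSum ρ) := by
  intro s t hst
  funext l
  induction l using Nat.strong_induction_on with
  | _ l ih =>
    have h1 := codeSum_bounds h0 h s l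
    have h2 := codeSum_bounds h0 h t l
    have h3 : (∑ k ∈ Finset.range l, if s k then ρ k else 0) = ∑ k ∈ Finset.range l, if t k then ρ k else 0 :=
      Finset.sum_congr rfl fun k hk => by rw [ih k (Finset.mem_range.mp hk)]
    rw [h3, hst] at h1
    have := h0 l
    cases hs : s l <;> cases ht : t l <;> simp only [hs, ht, if_true, if_false, Bool.false_eq_true] at h1 h2 ⊢ <;> linarith

end Coding

section InitialStage

variable {d : ℕ} {F E : Type*} [NormedAddCommGroup F] [NormedAddCommGroup E] {X Γ : Set (F × ℝ)} {𝒯 : Tower d E}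

theorem bddAbove_below (hX : IsCompact X) : ∃ B, ∀ x ∈ below X, x.2 ≤ B := by
  obtain ⟨B, hB⟩ := (hX.image continuous_snd).bddAbove
  refine ⟨B, ?_⟩
  rintro x ⟨t, h1, h2⟩
  exact h1.trans (hB ⟨_, h2, rfl⟩)

theorem isPreconnected_compl_below [NormedSpace ℝ F] (hX : IsCompact X) : IsPreconnected (below X)ᶜ := by
  obtain ⟨B, hB⟩ := bddAbove_below hX
  have hC : IsPreconnected ((univ : Set (F × ℝ)) ×ˢ Ioi B) := isPreconnected_univ.prod isPreconnected_Ioi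
  refine hC.of_reach (fun x hx h => absurd (hB x h) (not_le.mpr hx.2)) fun x hx => ?_
  refine ⟨{x.1} ×ˢ Ici x.2, ?_, isPreconnected_singleton.prod isPreconnected_Ici, ⟨rfl, mem_Ici.mpr le_rfl⟩,
    (x.1, max x.2 (B + 1)), ⟨rfl, mem_Ici.mpr (le_max_left x.2 (B + 1))⟩,
    mem_univ _, ?_⟩
  · rintro ⟨y, s⟩ ⟨h1, h2⟩ ⟨t, h3, h4⟩
    obtain rfl : y = x.1 := h1
    exact hx ⟨t, le_trans h2 h3, h4⟩
  · exact lt_of_lt_of_le (lt_add_one B) (le_max_right _ _)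

theorem Stage.exists_zero [NormedSpace ℝ F] (hX : IsCompact X) (hΓ : IsTopSet X Γ) (R : (F × ℝ) × ℝ ≃ₜ E) :
    Nonempty (Stage 𝒯 X Γ 0) := by
  have hroot : 𝒯.IsNode [] := trivial
  obtain ⟨B, hB⟩ := bddAbove_below hX
  obtain ⟨m, hm⟩ := (hroot.isCompact_T.image (continuous_snd.comp R.symm.continuous)).bddBelow
  let R₀ : (F × ℝ) × ℝ ≃ₜ E := ((Homeomorph.refl _).prodCongr (Homeomorph.addRight (m - 1 - B))).trans R
  have hR₀ : ∀ x ∈ below X, R₀ x ∉ 𝒯.T [] := fun x hx h => by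
    have h1 : m ≤ (R.symm (R₀ x)).2 := hm ⟨_, h, rfl⟩
    have h2 : R.symm (R₀ x) = (x.1, x.2 + (m - 1 - B)) := R.symm_apply_apply _
    rw [h2] at h1
    have h3 := hB x hx
    simp only at h1
    linarith
  obtain ⟨g, hg⟩ := hΓ.nonempty
  have hnil : ∀ w ∈ 𝒯.nodes 0, w = [] := fun w hw => List.eq_nil_of_length_eq_zero (Tower.mem_nodes.mp hw).2
  have hne : ∀ w ∈ 𝒯.nodes 0, ∀ w' ∈ 𝒯.nodes 0, w = w' := fun w hw w' hw' => (hnil w hw).trans (hnil w' hw').symm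
  have himg : ∀ x ∈ (below X)ᶜ, R₀ x ∈ (R₀ '' below X)ᶜ := fun x hx h => hx (R₀.injective.mem_set_image.mp h)
  refine ⟨⟨R₀, fun _ => ((g.1, 0), g.2), fun _ => (R₀ '' below X)ᶜ, 1, ⟨fun w hw w' hw' _ => hne w hw w' hw',
    fun w _ τ => hΓ.mem_below_iff hg 0 τ, fun w _ => ?_, fun _ _ _ _ => Or.inl rfl, fun w _ x hx h => h ⟨x, hx, rfl⟩,
    fun w hw => (Tower.mem_nodes.mp hw).1.isCompact_T, fun w hw => ?_,
    fun w _ => (Tower.IsNode.I_nonempty 𝒯 w).mono (Tower.I_subset_T w), fun w hw w' hw' h => absurd (hne w hw w' hw') h,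
    fun w hw => ?_, fun w _ => Filter.Eventually.of_forall himg⟩, fun _ _ => hg, one_pos,
    fun w hw w' hw' h => absurd (hne w hw w' hw') h⟩⟩
  · exact (R₀.isClosedMap _ (isClosed_below hX)).isOpen_compl
  · rw [hnil w hw]
    rintro z hz ⟨x, hx, rfl⟩
    exact hR₀ x hx hz
  · have h1 : (⋃ i ∈ {i | i ∈ 𝒯.nodes 0 ∧ i ≠ w}, 𝒯.T i) = ∅ := by
      simp only [iUnion_eq_empty]
      exact fun i hi => absurd (hne i hi.1 w hw) hi.2
    rw [h1, sdiff_empty, ← image_compl_eq R₀.bijective]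
    exact (isPreconnected_compl_below hX).image _ R₀.continuous.continuousOn

end InitialStage

section Family

variable {d : ℕ} {F E : Type*} [NormedAddCommGroup F] [NormedAddCommGroup E] {X Γ : Set (F × ℝ)} {𝒯 : Tower d E}

namespace Stages

variable {𝒮 : Stages 𝒯 X Γ}

theorem rho_pos (l : ℕ) : 0 < 𝒮.ρ l := (𝒮.next l).pos

theorem rho_succ_le (l : ℕ) : 𝒮.ρ (l + 1) ≤ 𝒮.ρ l / 8 := (𝒮.next (l + 1)).le.trans (𝒮.next l).eps_le

theorem tendsto_eps : Filter.Tendsto (fun l => (𝒮.σ l).ε) Filter.atTop (𝓝 0) := by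
  rw [← Filter.tendsto_add_atTop_iff_nat 1]
  exact squeeze_zero (fun l => (𝒮.σ _).pos.le)
    (fun l => (𝒮.next l).eps_le.trans (div_le_self (rho_pos l).le (by norm_num)))
    (summable_of_le rho_pos rho_succ_le).tendsto_atTop_zero

/-- The level of a branch. -/
noncomputable def c (𝒮 : Stages 𝒯 X Γ) (s : ℕ → Bool) : ℝ := ((𝒮.σ 0).p []).1.2 + codeSum 𝒮.ρ s

theorem coord_of_onBranch {s : ℕ → Bool} {w : List Code} (h : 𝒯.OnBranch s w) : ((𝒮.σ w.length).p w).1.2 =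
    ((𝒮.σ 0).p []).1.2 + ∑ k ∈ Finset.range w.length, if s k then 𝒮.ρ k else 0 := by
  induction w with
  | nil => simp
  | cons e w ih =>
    obtain ⟨h1, h2, h3⟩ := Tower.onBranch_cons.mp h
    have := (𝒮.next w.length).coord e w (node_mem h1)
    rw [ih h2, h3] at this
    rw [List.length_cons, this, Finset.sum_range_succ, add_assoc]

theorem onBranch_of_mem {s : ℕ → Bool} {w : List Code} (hw : 𝒯.IsNode w) {x : (F × ℝ) × ℝ} (hx : x ∈ 𝒮.B w)
    (hs : x.1.2 = 𝒮.c s) : 𝒯.OnBranch s w := by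
  induction w with
  | nil => exact Tower.onBranch_nil
  | cons e w ih =>
    have h1 := ih hw.1 (B_append (u := [e]) hw hx)
    refine Tower.onBranch_cons.mpr ⟨hw, h1, ?_⟩
    have h2 : dist x.1.2 ((𝒮.σ (w.length + 1)).p (e :: w)).1.2 ≤ (𝒮.σ (w.length + 1)).ε := by
      have h3 : dist x ((𝒮.σ (w.length + 1)).p (e :: w)) ≤ (𝒮.σ (w.length + 1)).ε := hx
      rw [Prod.dist_eq, Prod.dist_eq] at h3
      exact ((le_max_right _ _).trans (le_max_left _ _)).trans h3
    rw [(𝒮.next w.length).coord e w (node_mem hw), coord_of_onBranch h1, hs, c, Real.dist_eq, abs_le] at h2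
    have h3 := (𝒮.next w.length).eps_le
    have h4 := codeSum_bounds (rho_pos (𝒮 := 𝒮)) rho_succ_le s w.length
    have h5 := rho_pos (𝒮 := 𝒮) w.length
    by_cases ha : e.1 = true <;> by_cases hb : s w.length = true
    · rw [ha, hb]
    · rw [if_neg hb] at h4
      rw [if_pos ha] at h2
      linarith [h2.1, h2.2, h4.1, h4.2]
    · rw [if_pos hb] at h4
      rw [if_neg ha] at h2
      linarith [h2.1, h2.2, h4.1, h4.2]
    · rw [Bool.not_eq_true] at ha hb
      rw [ha, hb]

theorem exists_root [CompleteSpace F] (hX : IsClosed X) (hΓ : IsTopSet X Γ) {s : ℕ → Bool} {z : E} (hz : z ∈ 𝒯.Z s) :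
    ∃ x ∈ X, ∀ l, ∃ w, (𝒯.IsNode w ∧ w.length = l ∧ ((x.1, 𝒮.c s), x.2) ∈ 𝒮.B w) ∧ z ∈ 𝒯.T w := by
  choose w hw hzw using Tower.mem_Z.mp hz
  have hwl : ∀ l, (w l).length = l := fun l => (hw l).2
  have hmem : ∀ l m, l ≤ m → (𝒮.σ m).p (w m) ∈ 𝒮.B (w l) := fun l m hlm => by
    have h1 : (𝒮.σ m).p (w m) ∈ 𝒮.B (w m) := by
      rw [B, hwl]
      exact mem_closedBall_self (𝒮.σ m).pos.le
    have h := List.take_append_drop ((w m).length - l) (w m)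
    have hv : 𝒯.IsNode ((w m).take ((w m).length - l) ++ (w m).drop ((w m).length - l)) := by rw [h]; exact (hw m).1.1
    have hz' : z ∈ 𝒯.T ((w m).drop ((w m).length - l)) := hv.T_append_subset (by rw [h]; exact hzw m)
    have he := hv.of_append.eq_of_mem (hw l).1.1 (by rw [List.length_drop, hwl, hwl]; omega) hz' (hzw l)
    rw [← he]
    exact B_append hv (by rw [h]; exact h1)
  have hB : ∀ l, 𝒮.B (w l) = closedBall ((𝒮.σ l).p (w l)) (𝒮.σ l).ε := fun l => by rw [B, hwl]
  have hcs : CauchySeq fun l => (𝒮.σ l).p (w l) := by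
    refine cauchySeq_of_le_tendsto_0 (fun l => 2 * (𝒮.σ l).ε) (fun n m N hn hm => ?_) (by simpa using tendsto_eps.const_mul 2)
    have h1 := hmem N n hn
    have h2 := hmem N m hm
    rw [hB, mem_closedBall] at h1 h2
    linarith [dist_triangle_right ((𝒮.σ n).p (w n)) ((𝒮.σ m).p (w m)) ((𝒮.σ N).p (w N))]
  obtain ⟨x, hx⟩ := cauchySeq_tendsto_of_complete hcs
  have hxc : x.1.2 = 𝒮.c s := by
    have h1 : Filter.Tendsto (fun l => ((𝒮.σ l).p (w l)).1.2) Filter.atTop (𝓝 x.1.2) :=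
      ((continuous_snd.comp continuous_fst).tendsto x).comp hx
    refine tendsto_nhds_unique h1 ?_
    refine ((summable_code rho_pos rho_succ_le s).hasSum.tendsto_sum_nat.const_add ((𝒮.σ 0).p []).1.2).congr fun l => ?_
    have := coord_of_onBranch (𝒮 := 𝒮) (hw l).1
    rw [hwl] at this
    exact this.symm
  refine ⟨(x.1.1, x.2), ?_, fun l => ⟨w l, ⟨(hw l).1.1, hwl l, ?_⟩, hzw l⟩⟩
  · have h1 : Filter.Tendsto (fun l => (((𝒮.σ l).p (w l)).1.1, ((𝒮.σ l).p (w l)).2)) Filter.atTop (𝓝 (x.1.1, x.2)) :=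
      ((continuous_fst.comp continuous_fst).prodMk continuous_snd).tendsto x |>.comp hx
    refine hX.mem_of_tendsto h1 (Filter.Eventually.of_forall fun l => hΓ.subset ((𝒮.σ l).mem (w l) ?_))
    have := node_mem (hw l).1.1
    rwa [hwl] at this
  · rw [← hxc]
    exact (isClosed_closedBall : IsClosed (𝒮.B (w l))).mem_of_tendsto hx (by
      filter_upwards [Filter.eventually_ge_atTop l] with m hm
      exact hmem l m hm)

end Stages

/-- The family of embeddings whose wild points form the Cantor sets of the branches of a tower. -/
theorem Tower.exists_family [NormedSpace ℝ F] [NormedSpace ℝ E] [CompleteSpace F] [CompleteSpace E]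
    (hF : 1 < Module.rank ℝ (F × ℝ)) (hX : IsCompact X) (hΓ : IsTopSet X Γ) (R₀ : (F × ℝ) × ℝ ≃ₜ E) (𝒯 : Tower d E) :
    ∃ Φ : (F × ℝ) × (ℕ → Bool) → E, ContinuousOn Φ (X ×ˢ univ) ∧ InjOn Φ (X ×ˢ univ) ∧
      ∀ s, 𝒯.Z s ⊆ (fun x => Φ (x, s)) '' X ∧ ∀ y ∈ (fun x => Φ (x, s)) '' X, y ∉ 𝒯.Z s →
        ∃ U ∈ 𝓝 y, ∃ (R : (F × ℝ) × ℝ ≃ₜ E) (c : ℝ), ∀ x, R x ∈ U → R x ∈ (fun x => Φ (x, s)) '' X → x.1.2 = c := by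
  obtain ⟨σ₀⟩ := Stage.exists_zero (𝒯 := 𝒯) hX hΓ R₀
  obtain ⟨𝒮, -⟩ := Stage.exists_stages hF hX hΓ σ₀
  obtain ⟨f, hfc, hfi, hfs, hfu⟩ := Stages.exists_limit (𝒮 := 𝒮) Stages.tendsto_eps
  have hc : Continuous 𝒮.c := continuous_const.add (continuous_codeSum Stages.rho_pos Stages.rho_succ_le)
  have hci : Function.Injective 𝒮.c := fun s t h =>
    codeSum_injective Stages.rho_pos Stages.rho_succ_le (add_left_cancel h)
  have hmem : ∀ x ∈ X, ∀ c : ℝ, ((x.1, c), x.2) ∈ below X := fun x hx c => ⟨x.2, le_rfl, hx⟩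
  have hcont : Continuous fun q : (F × ℝ) × (ℕ → Bool) => ((q.1.1, 𝒮.c q.2), q.1.2) := by fun_prop
  refine ⟨fun q => f ((q.1.1, 𝒮.c q.2), q.1.2), hfc.comp hcont.continuousOn fun q hq => hmem q.1 hq.1 _, ?_, fun s => ⟨?_, ?_⟩⟩
  · rintro ⟨x, s⟩ hx ⟨x', s'⟩ hx' h
    have h1 := hfi (hmem x hx.1 _) (hmem x' hx'.1 _) h
    simp only [Prod.mk.injEq] at h1
    exact Prod.ext (Prod.ext h1.1.1 h1.2) (hci h1.1.2)
  · intro z hz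
    obtain ⟨x, hx, h⟩ := Stages.exists_root (𝒮 := 𝒮) hX.isClosed hΓ hz
    refine ⟨x, hx, ?_⟩
    refine dist_le_zero.mp (le_of_forall_pos_lt_add fun ε hε => ?_)
    obtain ⟨l, hl⟩ := 𝒯.exists_small hε
    obtain ⟨w, ⟨hw, hwl, hxw⟩, hzw⟩ := h l
    rw [zero_add]
    exact hl w hw hwl.ge _ (hfu _ (hmem x hx _) (fun l => (h l).imp fun w hw => hw.1) w hw hxw) _ hzw
  · rintro _ ⟨x, hx, rfl⟩ hxZ
    have hst : ∃ l, ¬ ∃ w, 𝒯.IsNode w ∧ w.length = l ∧ ((x.1, 𝒮.c s), x.2) ∈ 𝒮.B w := by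
      by_contra! h
      refine hxZ (Tower.mem_Z.mpr fun l => ?_)
      obtain ⟨w, hw, hwl, hxw⟩ := h l
      exact ⟨w, ⟨Stages.onBranch_of_mem hw hxw rfl, hwl⟩, hfu _ (hmem x hx _) h w hw hxw⟩
    obtain ⟨l, hl⟩ := hst
    let D : Set ((F × ℝ) × ℝ) := (fun x => ((x.1, 𝒮.c s), x.2)) '' X
    have hD : IsCompact D := hX.image (by fun_prop)
    have hDb : D ⊆ below X := by
      rintro _ ⟨x, hx, rfl⟩
      exact hmem x hx _
    have hK : IsClosed (⋃ w ∈ 𝒯.nodes l, 𝒮.B w) :=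
      (𝒯.nodes l).finite_toSet.isClosed_biUnion fun w _ => isClosed_closedBall
    have hKc : IsClosed (f '' (D ∩ ⋃ w ∈ 𝒯.nodes l, 𝒮.B w)) :=
      ((hD.inter_right hK).image_of_continuousOn (hfc.mono (inter_subset_left.trans hDb))).isClosed
    refine ⟨_, hKc.isOpen_compl.mem_nhds ?_, (𝒮.σ l).R, 𝒮.c s, ?_⟩
    · rintro ⟨x', ⟨hx'D, hx'⟩, he⟩
      have h1 := hfi (hDb hx'D) (hmem x hx _) he
      rw [h1] at hx'
      simp only [mem_iUnion] at hx'
      obtain ⟨w, hw, hxw⟩ := hx'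
      obtain ⟨h2, h3⟩ := Tower.mem_nodes.mp hw
      exact hl ⟨w, h2, h3, hxw⟩
    · rintro x' hx' ⟨y, hy, he⟩
      have h1 : ¬ ∃ w, 𝒯.IsNode w ∧ w.length = l ∧ ((y.1, 𝒮.c s), y.2) ∈ 𝒮.B w := by
        rintro ⟨w, h2, h3, h4⟩
        refine hx' ⟨((y.1, 𝒮.c s), y.2), ⟨⟨y, hy, rfl⟩, ?_⟩, he⟩
        simp only [mem_iUnion]
        exact ⟨w, Tower.mem_nodes.mpr ⟨h2, h3⟩, h4⟩
      have h2 : (𝒮.σ l).R ((y.1, 𝒮.c s), y.2) = (𝒮.σ l).R x' := (hfs _ (hmem y hy _) l h1).symm.trans he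
      rw [← (𝒮.σ l).R.injective h2]

end Family

section TopSets

theorem exists_isTopSet {F : Type*} [NormedAddCommGroup F] [SecondCountableTopology F] {X : Set (F × ℝ)}
    (hX : IsCompact X) (h : ¬ (Prod.fst '' X).Countable) : ∃ Γ, IsTopSet X Γ := by
  let A : Set (F × ℝ) := {g | g ∈ X ∧ ∀ t, (g.1, t) ∈ X → t ≤ g.2}
  have hA : ¬ A.Countable := fun hA => h <| (hA.image Prod.fst).mono <| by
    rintro _ ⟨x, hx, rfl⟩
    obtain ⟨y, hy, hm⟩ := (hX.inter_right (isClosed_singleton.preimage continuous_fst : IsClosed (Prod.fst ⁻¹' {x.1}))).exists_isMaxOn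
      ⟨x, hx, rfl⟩ continuous_snd.continuousOn
    have hyx : y.1 = x.1 := hy.2
    exact ⟨y, ⟨hy.1, fun t ht => hm ⟨ht, hyx⟩⟩, hyx⟩
  let Γ : Set (F × ℝ) := {g | g ∈ A ∧ ∀ U ∈ 𝓝 g, ¬ (U ∩ A).Countable}
  have hd : (A \ Γ).Countable := by
    have h1 : ∀ g ∈ A \ Γ, ∃ U ∈ 𝓝 g, (U ∩ A).Countable := fun g hg => by
      by_contra! hc
      exact hg.2 ⟨hg.1, hc⟩
    choose! U hU hUA using h1
    obtain ⟨t, ht, htc, hc⟩ := TopologicalSpace.countable_cover_nhdsWithin fun g hg => mem_nhdsWithin_of_mem_nhds (hU g hg)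
    refine (htc.biUnion fun g hg => hUA g (ht hg)).mono fun x hx => ?_
    obtain ⟨g, hg, hxg⟩ := mem_iUnion₂.mp (hc hx)
    exact mem_iUnion₂.mpr ⟨g, hg, hxg, hx.1⟩
  have hΓ : ∀ U : Set (F × ℝ), ¬ (U ∩ A).Countable → (U ∩ Γ).Infinite := fun U hU hf =>
    hU <| (hf.countable.union hd).mono fun x hx => by
      by_cases hxΓ : x ∈ Γ
      exacts [Or.inl ⟨hx.1, hxΓ⟩, Or.inr ⟨hx.2, hxΓ⟩]
  refine ⟨Γ, fun g hg => hg.1.1, ?_, fun g hg => hg.1.2, fun g hg U hU => hΓ U (hg.2 U hU)⟩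
  exact (hΓ univ (by rwa [univ_inter])).nonempty.mono inter_subset_right

theorem exists_range_isTopSet {d : ℕ} {X : Type*} [TopologicalSpace X] [CompactSpace X] [Uncountable X]
    {f : X → EuclideanSpace ℝ (Fin (d + 2))} (hf : Continuous f) (hi : Function.Injective f) :
    ∃ g : X → (Fin (d + 1) → ℝ) × ℝ, Continuous g ∧ Function.Injective g ∧ ∃ Γ, IsTopSet (range g) Γ := by
  let g : Fin (d + 2) → X → (Fin (d + 1) → ℝ) × ℝ := fun i x => (fun j => f x (i.succAbove j), f x i)
  have hg : ∀ i, Continuous (g i) := fun i => by fun_prop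
  have hgi : ∀ i, Function.Injective (g i) := fun i x y h => hi <| by
    ext j
    rcases Fin.eq_self_or_eq_succAbove i j with rfl | ⟨k, rfl⟩
    exacts [congrArg Prod.snd h, congrFun (congrArg Prod.fst h) k]
  obtain ⟨i, h⟩ : ∃ i, ¬ (Prod.fst '' range (g i)).Countable := by
    by_contra! hc
    have hr : ∀ i x, (g i x).1 ∈ Prod.fst '' range (g i) := fun i x => mem_image_of_mem _ (mem_range_self x)
    have h0 := (hc 0).to_subtype
    have h1 := (hc 1).to_subtype
    refine not_countable (α := X) (Function.Injective.countable (f := fun x =>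
      ((⟨_, hr 0 x⟩, ⟨_, hr 1 x⟩) : (Prod.fst '' range (g 0)) × (Prod.fst '' range (g 1)))) fun x y h => hi ?_)
    simp only [Prod.mk.injEq, Subtype.mk.injEq] at h
    ext j
    rcases Fin.eq_self_or_eq_succAbove 0 j with rfl | ⟨k, rfl⟩
    exacts [congrFun h.2 0, congrFun h.1 k]
  exact ⟨g i, hg i, hgi i, exists_isTopSet (isCompact_range (hg i)) h⟩

/-- The coordinates of Euclidean space, the last one in the middle factor. -/
noncomputable def splitEuclidean (d : ℕ) : ((Fin (d + 1) → ℝ) × ℝ) × ℝ ≃ₜ EuclideanSpace ℝ (Fin (d + 3)) where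
  toFun x := WithLp.toLp 2 (Fin.snoc (Fin.snoc x.1.1 x.2) x.1.2)
  invFun y := ((fun j => y j.castSucc.castSucc, y (Fin.last _)), y (Fin.last _).castSucc)
  left_inv x := by simp
  right_inv y := by
    ext i
    induction i using Fin.lastCases with
    | last => simp
    | cast i => induction i using Fin.lastCases <;> simp
  continuous_toFun := (PiLp.continuous_toLp 2 _).comp <| continuous_pi fun i => by
    induction i using Fin.lastCases with
    | last => simpa using by fun_prop
    | cast i => induction i using Fin.lastCases <;> simpa using by fun_prop
  continuous_invFun := by fun_prop

theorem splitEuclidean_last {d : ℕ} (x : ((Fin (d + 1) → ℝ) × ℝ) × ℝ) {i : Fin (d + 3)} (hi : (i : ℕ) = d + 2) :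
    splitEuclidean d x i = x.1.2 := by
  obtain rfl : i = Fin.last _ := Fin.ext hi
  simp [splitEuclidean]

end TopSets

section Fence

variable {d : ℕ}

namespace Tower

variable {E : Type*} [MetricSpace E] {𝒯 : Tower d E} {s t : ℕ → Bool}

theorem nonempty_Z (𝒯 : Tower d E) (s : ℕ → Bool) : (𝒯.Z s).Nonempty := by
  let w : ℕ → List Code := fun l => (initBits s l).map fun b => (b, false, 0)
  have hw : ∀ l, (w l).length = l ∧ 𝒯.OnBranch s (w l) := fun l => by
    induction l with
    | zero => exact ⟨rfl, onBranch_nil⟩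
    | succ l ih =>
      have h : w (l + 1) = (s l, false, 0) :: w l := rfl
      exact ⟨by rw [h, List.length_cons, ih.1], by
        rw [h, onBranch_cons, ih.1]
        exact ⟨⟨ih.2.1, Nat.pos_of_ne_zero (patK_ne_zero _ _)⟩, ih.2, rfl⟩⟩
  obtain ⟨x, hx⟩ := IsCompact.nonempty_iInter_of_sequence_nonempty_isCompact_isClosed (fun l => 𝒯.T (w l))
    (fun l => ((hw (l + 1)).2.1.T_cons_subset_I).trans (I_subset_T _))
    (fun l => ⟨_, mem_image_of_mem _ (show ((0, 1) : TT d) ∈ MM d from by simp [MM])⟩) (hw 0).2.1.isCompact_T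
    fun l => (hw l).2.1.isCompact_T.isClosed
  exact ⟨x, mem_Z.mpr fun l => ⟨w l, ⟨(hw l).2, (hw l).1⟩, mem_iInter.mp hx l⟩⟩

theorem not_tame_Z {G : Type*} [Group G] (𝒯 : Tower d E) (s : ℕ → Bool) {S : Set G} (hS : S.Nonempty) (h1 : 1 ∉ S)
    (hroot : ∀ l, ∀ m ∈ S, ∃ x ∈ S, x ^ 𝒯.N (initBits s l) = m)
    (hcomm : ∀ x ∈ S, ∃ a ∈ S, ∃ c ∈ S, c * a * c⁻¹ * a⁻¹ = x) {p : E} (hp : p ∈ 𝒯.Z s) : ¬ Tame G (𝒯.Z s) p := by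
  intro h
  obtain ⟨τ, hτ, hτp⟩ := 𝒯.exists_wild_cocycle s hS h1 hroot hcomm
  obtain ⟨V, hV, f, hf⟩ := h _ ((IsNode.isOpen_I (𝒯 := 𝒯) (w := []) trivial).mem_nhds (Z_subset hp)) τ hτ
  exact hτp p hp V hV f hf

end Tower

theorem LocallyHyperplanarAt.of_image_subset {n : ℕ} {K L : Set (EuclideanSpace ℝ (Fin n))} {p : EuclideanSpace ℝ (Fin n)}
    (h : EuclideanSpace ℝ (Fin n) ≃ₜ EuclideanSpace ℝ (Fin n)) (hKL : h '' K ⊆ L) (hp : LocallyHyperplanarAt L (h p)) :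
    LocallyHyperplanarAt K p := by
  obtain ⟨U, hU, g, hg, hgL⟩ := hp
  exact ⟨h ⁻¹' U, h.continuous.continuousAt hU, fun y => g ⟨h y, y.2⟩,
    hg.comp ((h.isEmbedding.comp IsEmbedding.subtypeVal).codRestrict U fun y => y.2),
    fun y hy => hgL ⟨h y, y.2⟩ (hKL (mem_image_of_mem h hy))⟩

theorem locallyHyperplanarAt_of_height {K : Set (EuclideanSpace ℝ (Fin (d + 3)))} {p : EuclideanSpace ℝ (Fin (d + 3))}
    {U : Set (EuclideanSpace ℝ (Fin (d + 3)))} (hU : U ∈ 𝓝 p)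
    (R : ((Fin (d + 1) → ℝ) × ℝ) × ℝ ≃ₜ EuclideanSpace ℝ (Fin (d + 3))) {c : ℝ} (hR : ∀ x, R x ∈ U → R x ∈ K → x.1.2 = c) :
    LocallyHyperplanarAt K p := by
  let h := (R.symm.trans (Homeomorph.addRight ((0, -c), 0))).trans (splitEuclidean d)
  refine ⟨U, hU, fun y => h y, h.isEmbedding.comp IsEmbedding.subtypeVal, fun y hy i hi => ?_⟩
  have h1 := hR (R.symm y) (by simp) (by simpa using hy)
  have h2 := splitEuclidean_last (R.symm y + ((0, -c), 0)) (i := i) (by omega)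
  exact h2.trans (by simp [h1])

theorem exists_wild_towers (d : ℕ) : ∃ 𝒯 : Tower d (EuclideanSpace ℝ (Fin (d + 3))),
    (∀ s, ∀ p ∈ 𝒯.Z s, ¬ LocallyHyperplanarAt (𝒯.Z s) p) ∧ ∀ s t, s ≠ t → ¬ AmbientlyEmbeds (𝒯.Z s) (𝒯.Z t) := by
  obtain ⟨N, G, _, S, hN, hS, hNG⟩ := exists_groups
  let 𝒯 := euclideanTower d N fun v => (hN v).1
  have hwild : ∀ s k, ∀ p ∈ 𝒯.Z s, ¬ Tame (G (2 * k + (s k).toNat)) (𝒯.Z s) p := fun s k p hp =>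
    𝒯.not_tame_Z s (hS _).1 (hS _).2.1 (hNG s k).1 (hS _).2.2 hp
  refine ⟨𝒯, fun s p hp hl => ?_, fun s t hst ⟨h, hh⟩ => ?_⟩
  · refine hwild s 0 p hp (Tame.of_locallyHyperplanarAt (by omega) Tower.isClosed_Z hp hl fun U hU τ hτ =>
      Tower.exists_isPot_near (𝒯 := 𝒯) (l₀ := 0) (fun l _ g => ?_) Tower.isClosed_Z subset_rfl hU hτ)
    have h2 : g ^ 2 = 1 := by
      rw [pow_two]
      exact funext fun x => CharTwo.add_self_eq_zero (Multiplicative.toAdd g x)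
    obtain ⟨m, hm⟩ := (hN (initBits s l)).2
    exact (congrArg (g ^ ·) hm).trans (by simp only [pow_mul, h2, one_pow])
  · obtain ⟨k, hk⟩ := Function.ne_iff.mp hst
    have hk' : s k = !t k := by
      revert hk
      cases s k <;> cases t k <;> simp
    obtain ⟨p, hp⟩ := 𝒯.nonempty_Z s
    refine hwild s k p hp (Tame.of_openPartialHomeomorph h.toOpenPartialHomeomorph (K' := h '' 𝒯.Z s) trivial
      (fun x _ => h.injective.mem_set_image.symm) fun U hU τ hτ =>
      Tower.exists_isPot_near (𝒯 := 𝒯) (l₀ := k + 1) (fun l hl g => ?_) (h.isClosedMap _ Tower.isClosed_Z) hh hU hτ)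
    revert g
    rw [hk']
    exact (hNG t k).2 l hl

end Fence

/-- **Theorem 1 (Frolkina).** For each `n ≥ 3` and any non-empty perfect compact metric space
`X` embeddable in `ℝ^{n-1}`, there is an embedding `𝔸 : X × 𝒞 → ℝⁿ` whose slice images
`𝔸(X × {s})` each fail to be locally hyperplanar at some of their points and are pairwise
ambiently incomparable. -/
theorem wild_cantor_fence (n : ℕ) (hn : 3 ≤ n)
    (X : Type) [MetricSpace X] [CompactSpace X] [Nonempty X]
    (hperf : Perfect (Set.univ : Set X))
    (hemb : ∃ f : X → EuclideanSpace ℝ (Fin (n - 1)), Topology.IsEmbedding f) :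
    ∃ 𝔸 : X × ↥cantorSet → EuclideanSpace ℝ (Fin n), Topology.IsEmbedding 𝔸 ∧
      (∀ s : ↥cantorSet, ∃ y ∈ Set.range (fun x : X => 𝔸 (x, s)),
        ¬ LocallyHyperplanarAt (Set.range (fun x : X => 𝔸 (x, s))) y) ∧
      (∀ s t : ↥cantorSet, s ≠ t →
        AmbientlyIncomparable (Set.range (fun x : X => 𝔸 (x, s)))
          (Set.range (fun x : X => 𝔸 (x, t)))) := by
  obtain ⟨d, rfl⟩ := Nat.exists_eq_add_of_le' hn
  obtain ⟨f, hf⟩ := hemb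
  have : Uncountable X := by
    obtain ⟨b, -, -, hb⟩ := hperf.exists_nat_bool_injection univ_nonempty
    have h : Uncountable (ℕ → Bool) := by
      rw [← Cardinal.aleph0_lt_mk_iff]
      simpa using Cardinal.aleph0_lt_continuum
    exact hb.uncountable
  obtain ⟨g, hg, hgi, Γ, hΓ⟩ := exists_range_isTopSet (d := d) hf.continuous hf.injective
  obtain ⟨𝒯, hZ, hZZ⟩ := exists_wild_towers d
  have hF : 1 < Module.rank ℝ ((Fin (d + 1) → ℝ) × ℝ) := by
    rw [← Module.finrank_eq_rank, Module.finrank_prod, Module.finrank_fin_fun, Module.finrank_self]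
    exact_mod_cast (by omega : 1 < d + 1 + 1)
  obtain ⟨Φ, hΦ, hΦi, hΦZ⟩ := 𝒯.exists_family hF (isCompact_range hg) hΓ (splitEuclidean d)
  let e := cantorSetHomeomorphNatToBool
  have hm : ∀ q : X × ↥cantorSet, (g q.1, e q.2) ∈ range g ×ˢ (univ : Set (ℕ → Bool)) := fun q => ⟨mem_range_self _, trivial⟩
  have hr : ∀ s, range (fun x => Φ (g x, e s)) = (fun x => Φ (x, e s)) '' range g := fun s =>
    range_comp (fun x => Φ (x, e s)) g
  have hlh : ∀ s, ∀ p ∈ 𝒯.Z (e s), ¬ LocallyHyperplanarAt (range fun x => Φ (g x, e s)) p := fun s p hp h =>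
    hZ _ p hp (h.of_image_subset (Homeomorph.refl _) (by rw [hr]; simpa using (hΦZ (e s)).1))
  have hinc : ∀ s t, s ≠ t → ¬ AmbientlyEmbeds (range fun x => Φ (g x, e s)) (range fun x => Φ (g x, e t)) := by
    rintro s t hst ⟨h, hh⟩
    refine hZZ _ _ (e.injective.ne hst) ⟨h, ?_⟩
    rintro _ ⟨p, hp, rfl⟩
    by_contra hpt
    have hps := (hΦZ (e s)).1 hp
    rw [← hr] at hps
    have hpY := hh (mem_image_of_mem h hps)
    rw [hr] at hpY
    obtain ⟨U, hU, R, c, hR⟩ := (hΦZ (e t)).2 _ hpY hpt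
    rw [← hr] at hR
    exact hlh s p hp ((locallyHyperplanarAt_of_height hU R hR).of_image_subset h hh)
  have : CompactSpace ↥cantorSet := e.symm.compactSpace
  refine ⟨fun q => Φ (g q.1, e q.2), ?_, fun s => ?_, fun s t hst => ⟨hinc s t hst, hinc t s hst.symm⟩⟩
  · refine (Continuous.isClosedEmbedding (hΦ.comp_continuous (by fun_prop) hm) fun q q' h => ?_).isEmbedding
    have h := hΦi (hm q) (hm q') h
    exact Prod.ext (hgi (congrArg Prod.fst h)) (e.injective (congrArg Prod.snd h))
  · obtain ⟨p, hp⟩ := 𝒯.nonempty_Z (e s)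
    exact ⟨p, by rw [hr]; exact (hΦZ (e s)).1 hp, hlh s p hp⟩

end
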